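/- Assume GRH. Let Φ: ℝ → ℝ be a fixed smooth compactly supported function with support contained in (0,∞), and fix δ > 0 and ε > 0. Then there exist constants C > 0 and x₀ such that for all x ≥ x₀, all y with (log x)^{2+δ} ≤ y ≤ exp((log x)^{1/2−δ}), and all real α ∈ [0,1] of the form α = a/q + γ with integers a, q satisfying gcd(a,q)=1, 1 ≤ q ≤ √x, |γ| ≤ 1/(q√x) and |γ| ≤ x^{δ−1}, the following holds. Write q = q₀q₁ where every prime factor of q₀ is ≤ y and every prime factor of q₁ is > y, set κ = log y / log log x and c₀ = 1 − 1/κ. Then |E(x,y;α) − (μ(q₁)/φ(q₁))·(c₀/q₀^{c₀})·∏_{p | q₀}(1 − (p^{c₀}−1)/(p−1))·(∫₀^∞ Φ(w) e(γxw) w^{c₀−1} dw)·Ψ(x,y)| ≤ C·(x^{3/4+ε} + Ψ(x,y)·q₀^{−c₀+ε}·q₁^{−1+ε}·(1+|γ|x)^{−2}·(log log y)/(log y)). -/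

import Mathlib

noncomputable section

/-- The Generalized Riemann Hypothesis. -/
def GRH : Prop :=
  (∀ s : ℂ, 0 < s.re → s.re < 1 → riemannZeta s = 0 → s.re = 1 / 2) ∧
  (∀ (N : ℕ) [NeZero N] (χ : DirichletCharacter ℂ N) (s : ℂ),
    0 < s.re → s.re < 1 → DirichletCharacter.LFunction χ s = 0 → s.re = 1 / 2)

/-- `Ψ(x,y)`: the number of positive integers `n ≤ x` all of whose prime factors are `≤ y`. -/
def Psi (x y : ℝ) : ℕ :=
  Nat.card {n : ℕ | 0 < n ∧ (n : ℝ) ≤ x ∧ ∀ p : ℕ, p.Prime → p ∣ n → (p : ℝ) ≤ y}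

/-- The weighted exponential sum `E(x,y;α)` over `y`-smooth positive integers. -/
def Esum (x y : ℝ) (Φ : ℝ → ℝ) (α : ℝ) : ℂ :=
  ∑' n : {n : ℕ // 0 < n ∧ ∀ p : ℕ, p.Prime → p ∣ n → (p : ℝ) ≤ y},
    Complex.exp (2 * (Real.pi : ℂ) * Complex.I * ((n : ℕ) : ℂ) * (α : ℂ)) *
      ((Φ (((n : ℕ) : ℝ) / x) : ℝ) : ℂ)

namespace SmoothSum

open Complex Set Filter Topology MeasureTheory Metric

/-- A zero-free holomorphic function bounded by `exp M` times its central value has logarithmic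
derivative `O(M)` on smaller discs. -/
theorem norm_logDeriv_le_of_norm_le {f : ℂ → ℂ} {c : ℂ} {R r M : ℝ} (hM : 0 < M) (hr : 0 < r)
    (hrR : r < R) (hf : DifferentiableOn ℂ f (ball c R)) (h0 : ∀ z ∈ ball c R, f z ≠ 0)
    (hb : ∀ z ∈ ball c R, ‖f z‖ ≤ Real.exp M * ‖f c‖) {z : ℂ} (hz : z ∈ closedBall c r) :
    ‖deriv f z / f z‖ ≤ 16 * R * M / (R - r) ^ 2 := by
  have hR : 0 < R := hr.trans hrR
  have hc : c ∈ ball c R := mem_ball_self hR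
  have hd : DifferentiableOn ℂ (fun z => deriv f z / f z) (ball c R) :=
    (hf.deriv isOpen_ball).div hf h0
  obtain ⟨g, hgc, hg⟩ := (hd.isExactOn_ball).with_val_at c 0
  have hgd : DifferentiableOn ℂ g (ball c R) := fun w hw =>
    (hg w hw).differentiableAt.differentiableWithinAt
  -- f = f c * exp g
  have hexp : ∀ w ∈ ball c R, f w = f c * exp (g w) := by
    have hconst : ∀ w ∈ ball c R, f w * exp (-g w) = f c * exp (-g c) := by
      intro w hw
      refine (convex_ball c R).is_const_of_fderivWithin_eq_zero (𝕜 := ℂ)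
        (f := fun w => f w * exp (-g w)) (fun u hu => ?_) (fun u hu => ?_) hw hc
      · exact ((hf u hu).mul ((hgd u hu).neg.cexp))
      · have h1 : HasDerivAt (fun w => f w * exp (-g w))
            (deriv f u * exp (-g u) + f u * (exp (-g u) * -(deriv f u / f u))) u :=
          ((hf.differentiableAt (isOpen_ball.mem_nhds hu)).hasDerivAt).mul ((hg u hu).neg.cexp)
        have h2 : deriv f u * exp (-g u) + f u * (exp (-g u) * -(deriv f u / f u)) = 0 := by
          have := h0 u hu
          field_simp
          ring
        rw [h2] at h1
        rw [fderivWithin_of_isOpen isOpen_ball hu]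
        have := h1.hasFDerivAt.fderiv
        rw [this]
        ext
        simp
    intro w hw
    have := hconst w hw
    rw [hgc, neg_zero, exp_zero, mul_one] at this
    rw [← this, mul_assoc, ← exp_add]
    simp
  have hre : ∀ w ∈ ball c R, (g w).re ≤ M := by
    intro w hw
    have h1 := hb w hw
    rw [hexp w hw, norm_mul, norm_exp, mul_comm] at h1
    have h2 := le_of_mul_le_mul_right h1 (norm_pos_iff.mpr (h0 c hc))
    exact Real.exp_le_exp.mp h2
  -- Borel-Caratheodory on the shifted function
  have hBC : ∀ w ∈ ball c R, ‖g w‖ ≤ 2 * M * ‖w - c‖ / (R - ‖w - c‖) := by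
    intro w hw
    have hmaps : ∀ u ∈ ball (0 : ℂ) R, c + u ∈ ball c R := by
      intro u hu
      simpa [mem_ball, dist_eq_norm] using hu
    have := borelCaratheodory_zero (f := fun u => g (c + u)) (R := R) (z := w - c) hM
      (hgd.comp (by fun_prop) hmaps) (fun u hu => hre _ (hmaps u hu)) hR
      (by simpa [mem_ball, dist_eq_norm] using hw) (by simpa using hgc)
    simpa using this
  have hzR : z ∈ ball c R := closedBall_subset_ball hrR hz
  have hzr : ‖z - c‖ ≤ r := by simpa [mem_closedBall, dist_eq_norm] using hz
  set ρ := (R - r) / 2 with hρ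
  have hρ0 : 0 < ρ := by rw [hρ]; linarith
  have hsub : ∀ w ∈ closedBall z ρ, ‖w - c‖ ≤ R - ρ := by
    intro w hw
    have h1 : ‖w - z‖ ≤ ρ := by simpa [mem_closedBall, dist_eq_norm] using hw
    calc ‖w - c‖ = ‖(w - z) + (z - c)‖ := by ring_nf
      _ ≤ ‖w - z‖ + ‖z - c‖ := norm_add_le _ _
      _ ≤ R - ρ := by rw [hρ] at *; linarith
  have hball : ∀ w ∈ closedBall z ρ, w ∈ ball c R := by
    intro w hw
    have := hsub w hw
    simp only [mem_ball, dist_eq_norm]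
    linarith
  have hgb : ∀ w ∈ sphere z ρ, ‖g w‖ ≤ 2 * M * R / ρ := by
    intro w hw
    have hw' := sphere_subset_closedBall hw
    have h1 := hsub w hw'
    refine (hBC w (hball w hw')).trans ?_
    gcongr
    · linarith
    · linarith
  have hcau := norm_deriv_le_of_forall_mem_sphere_norm_le hρ0
    (DifferentiableOn.diffContOnCl (f := g) (s := ball z ρ) (by
      rw [closure_ball z hρ0.ne']
      exact hgd.mono hball)) hgb
  rw [(hg z hzR).deriv] at hcau
  refine hcau.trans ?_
  have hne : R - r ≠ 0 := by linarith
  rw [hρ]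
  apply le_of_eq_of_le (b := 8 * R * M / (R - r) ^ 2)
  · field_simp
    ring
  · have : 0 < R * M := mul_pos hR hM
    gcongr
    linarith

/-- Vertical line integrals of a holomorphic function decaying in a strip agree. -/
theorem integral_vertical_eq_of_decay {f : ℂ → ℂ} {a b B η : ℝ} (hab : a ≤ b) (hη : 0 < η)
    (hf : DifferentiableOn ℂ f {s | a ≤ s.re ∧ s.re ≤ b})
    (hB : ∀ σ τ : ℝ, a ≤ σ → σ ≤ b → ‖f (σ + τ * I)‖ ≤ B * (1 + |τ|) ^ (-(1 + η))) :
    ∫ τ : ℝ, f (a + τ * I) = ∫ τ : ℝ, f (b + τ * I) := by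
  have hcont : ∀ σ : ℝ, a ≤ σ → σ ≤ b → Continuous fun τ : ℝ => f (σ + τ * I) := by
    intro σ h1 h2
    refine hf.continuousOn.comp_continuous (by fun_prop) ?_
    intro τ
    simp [h1, h2]
  have hdom : Integrable fun τ : ℝ => B * (1 + |τ|) ^ (-(1 + η)) := by
    refine Integrable.const_mul ?_ _
    have := integrable_one_add_norm (E := ℝ) (μ := volume) (r := 1 + η) (by simp; exact hη)
    simpa using this
  have hintg : ∀ σ : ℝ, a ≤ σ → σ ≤ b → Integrable fun τ : ℝ => f (σ + τ * I) := by
    intro σ h1 h2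
    exact hdom.mono' (hcont σ h1 h2).aestronglyMeasurable (Eventually.of_forall fun τ => hB σ τ h1 h2)
  have hlimv : ∀ σ : ℝ, a ≤ σ → σ ≤ b → Tendsto (fun R : ℝ => ∫ τ in (-R)..R, f (σ + τ * I)) atTop
      (𝓝 (∫ τ : ℝ, f (σ + τ * I))) := fun σ h1 h2 =>
    intervalIntegral_tendsto_integral (hintg σ h1 h2) tendsto_neg_atTop_atBot tendsto_id
  have hdecay : Tendsto (fun R : ℝ => B * (1 + |R|) ^ (-(1 + η)) * |b - a|) atTop (𝓝 0) := by
    have h1 : Tendsto (fun R : ℝ => (1 + |R|) ^ (-(1 + η))) atTop (𝓝 0) := by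
      refine (tendsto_rpow_neg_atTop (by linarith)).comp ?_
      exact tendsto_atTop_add_const_left _ _ tendsto_abs_atTop_atTop
    simpa using (h1.const_mul B).mul_const |b - a|
  have hhor : ∀ ε : ℝ, |ε| = 1 → Tendsto (fun R : ℝ => ∫ σ in a..b, f (σ + (ε * R : ℝ) * I)) atTop
      (𝓝 0) := by
    intro ε hε
    refine squeeze_zero_norm (fun R => ?_) hdecay
    have := intervalIntegral.norm_integral_le_of_norm_le_const (a := a) (b := b)
      (f := fun σ : ℝ => f (σ + (ε * R : ℝ) * I)) (C := B * (1 + |R|) ^ (-(1 + η))) ?_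
    · exact this
    · intro σ hσ
      rw [uIoc_of_le hab] at hσ
      have := hB σ (ε * R) hσ.1.le hσ.2
      rwa [abs_mul, hε, one_mul] at this
  have hrect : ∀ R : ℝ, 0 ≤ R → (∫ σ in a..b, f (σ + (-1 * R : ℝ) * I))
      - (∫ σ in a..b, f (σ + (1 * R : ℝ) * I)) + I * (∫ τ in (-R)..R, f (b + τ * I))
      - I * (∫ τ in (-R)..R, f (a + τ * I)) = 0 := by
    intro R hR
    have := integral_boundary_rect_eq_zero_of_differentiableOn f (⟨a, -R⟩ : ℂ) (⟨b, R⟩ : ℂ)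
      (hf.mono ?_)
    · simpa using this
    · intro s hs
      rw [mem_reProdIm] at hs
      simp only [uIcc_of_le hab] at hs
      exact hs.1
  have hlim := ((((hhor (-1) (by simp)).sub (hhor 1 (by simp))).add
    ((hlimv b hab le_rfl).const_mul I)).sub ((hlimv a le_rfl hab).const_mul I))
  have hzero := tendsto_nhds_unique (hlim.congr' (by
    filter_upwards [eventually_ge_atTop 0] with R hR using hrect R hR)) tendsto_const_nhds
  have : I * (∫ τ : ℝ, f (b + τ * I)) = I * ∫ τ : ℝ, f (a + τ * I) := by
    linear_combination hzero
  exact (mul_left_cancel₀ I_ne_zero this).symm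

end SmoothSum

namespace SmoothSum

open Complex Set Filter Topology MeasureTheory Metric

theorem differentiableAt_integral_Ioi_mul_cpow {g : ℝ → ℂ} {B : ℝ} (hg : Measurable g)
    (hB : ∀ t, ‖g t‖ ≤ B) {s : ℂ} (hs : 0 < s.re) :
    DifferentiableAt ℂ (fun s : ℂ ↦ ∫ t : ℝ in Ioi (1 : ℝ), g t * (t : ℂ) ^ (-(s + 1))) s := by
  have hintg : IntegrableOn (fun _ : ℝ ↦ (1 : ℝ)) (Icc 0 1) := by simp
  have h1 : DifferentiableAt ℂ (mellin ((Ioi (1 : ℝ)).indicator g)) (-s) := by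
    refine mellin_differentiableAt_of_isBigO_rpow (a := 0) (b := (-s).re - 1) ?_ ?_ ?_ ?_ ?_
    · have : LocallyIntegrable ((Ioi (1 : ℝ)).indicator g) volume := by
        refine LocallyIntegrable.mono (g := (Ioi (1 : ℝ)).indicator g) (f := fun _ ↦ B)
          (locallyIntegrable_const B)
          (hg.indicator measurableSet_Ioi).aestronglyMeasurable (ae_of_all _ fun t ↦ ?_)
        have hB0 : 0 ≤ B := (norm_nonneg _).trans (hB 0)
        rw [Real.norm_of_nonneg hB0]
        exact (norm_indicator_le_norm_self _ _).trans (hB t)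
      exact this.locallyIntegrableOn _
    · refine Asymptotics.IsBigO.of_bound B (Eventually.of_forall fun t ↦ ?_)
      simpa using (norm_indicator_le_norm_self _ _).trans (hB t)
    · simpa using hs
    · refine Asymptotics.IsBigO.of_bound 1 ?_
      have : Ioo (0 : ℝ) 1 ∈ 𝓝[>] (0 : ℝ) := Ioo_mem_nhdsGT one_pos
      filter_upwards [this] with t ht
      rw [indicator_of_notMem (by simpa using ht.2.le)]
      simp
    · linarith
  have h2 : DifferentiableAt ℂ (fun s : ℂ ↦ mellin ((Ioi (1 : ℝ)).indicator g) (-s)) s :=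
    DifferentiableAt.comp (𝕜 := ℂ) (g := mellin ((Ioi (1 : ℝ)).indicator g)) s h1
      differentiableAt_id.neg
  convert h2 using 2 with w
  rw [mellin, ← integral_indicator measurableSet_Ioi, ← integral_indicator measurableSet_Ioi]
  congr 1
  ext t
  by_cases ht : 1 < t
  · have ht' : t ∈ Ioi (1 : ℝ) := ht
    have ht0 : t ∈ Ioi (0 : ℝ) := by simp only [mem_Ioi]; linarith
    simp only [indicator_of_mem ht', indicator_of_mem ht0, smul_eq_mul]
    rw [mul_comm, show -(w + 1) = -w - 1 by ring]
  · have ht' : t ∉ Ioi (1 : ℝ) := ht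
    rw [indicator_of_notMem ht']
    by_cases h0 : t ∈ Ioi (0 : ℝ)
    · simp [indicator_of_mem h0, indicator_of_notMem ht']
    · rw [indicator_of_notMem h0]

theorem norm_integral_Ioi_mul_cpow_le {g : ℝ → ℂ} {B : ℝ}
    (hB : ∀ t, ‖g t‖ ≤ B) {s : ℂ} (hs : 0 < s.re) :
    ‖∫ t : ℝ in Ioi (1 : ℝ), g t * (t : ℂ) ^ (-(s + 1))‖ ≤ B / s.re := by
  have h1 : IntegrableOn (fun t : ℝ ↦ B * t ^ (-(s.re + 1))) (Ioi 1) :=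
    (integrableOn_Ioi_rpow_of_lt (by linarith) one_pos).const_mul B
  have h2 : ∫ t : ℝ in Ioi (1 : ℝ), B * t ^ (-(s.re + 1)) = B / s.re := by
    rw [integral_const_mul, integral_Ioi_rpow_of_lt (by linarith) one_pos]
    simp only [Real.one_rpow]
    rw [show -(s.re + 1) + 1 = -s.re by ring]
    field_simp
  rw [← h2]
  refine norm_integral_le_of_norm_le h1 ?_
  refine (ae_restrict_iff' measurableSet_Ioi).2 (ae_of_all _ fun t ht ↦ ?_)
  have ht0 : (0 : ℝ) < t := lt_trans one_pos ht
  rw [norm_mul, norm_cpow_eq_rpow_re_of_pos ht0]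
  rw [show (-(s + 1)).re = -(s.re + 1) by simp]
  gcongr
  exact hB t

theorem norm_sum_range_dirichletCharacter_le {q : ℕ} [NeZero q] {χ : DirichletCharacter ℂ q}
    (hχ : χ ≠ 1) (n : ℕ) : ‖∑ k ∈ Finset.range n, χ (k : ZMod q)‖ ≤ q := by
  have hper : ∑ k ∈ Finset.range q, χ (k : ZMod q) = 0 := by
    rw [← MulChar.sum_eq_zero_of_ne_one hχ]
    refine Finset.sum_bij (fun k _ ↦ (k : ZMod q)) (by simp) ?_ ?_ (by simp)
    · intro a ha b hb hab
      simp only [Finset.mem_range] at ha hb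
      have := congrArg ZMod.val hab
      rwa [ZMod.val_natCast_of_lt ha, ZMod.val_natCast_of_lt hb] at this
    · intro b _
      exact ⟨b.val, by simpa using ZMod.val_lt b, by simp⟩
  induction n using Nat.strong_induction_on with
  | _ n ih =>
    rcases lt_or_ge n q with h | h
    · refine (norm_sum_le_of_le _ fun k _ ↦ χ.norm_le_one _).trans ?_
      simpa using h.le
    · obtain ⟨m, rfl⟩ := Nat.exists_eq_add_of_le h
      rw [Finset.sum_range_add, hper, zero_add]
      have := ih m (by have := NeZero.pos q; omega)
      simpa using this

theorem LSeries_eq_mul_integral_add {f : ℕ → ℂ} {b : ℂ} {s : ℂ} {B : ℝ} (hs : 1 < s.re)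
    (hsum : LSeriesSummable f s) (hB : ∀ t : ℝ, 1 < t → ‖∑ k ∈ Finset.Icc 1 ⌊t⌋₊, f k - b * t‖ ≤ B) :
    LSeries f s = s * (∫ t : ℝ in Ioi (1 : ℝ),
      (Ioi (1 : ℝ)).indicator (fun t : ℝ ↦ ∑ k ∈ Finset.Icc 1 ⌊t⌋₊, f k - b * t) t
        * (t : ℂ) ^ (-(s + 1))) + b * s / (s - 1) := by
  have hs1 : s - 1 ≠ 0 := by
    intro h
    have := congrArg re h
    simp at this; linarith
  have hO : (fun n : ℕ ↦ ∑ k ∈ Finset.Icc 1 n, f k) =O[atTop] fun n ↦ (n : ℝ) ^ (1 : ℝ) := by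
    refine Asymptotics.IsBigO.of_bound (B + ‖b‖) ?_
    filter_upwards [eventually_gt_atTop 1] with n hn
    have hn1 : (1 : ℝ) < n := by exact_mod_cast hn
    have h := hB n hn1
    rw [Nat.floor_natCast] at h
    have hB0 : 0 ≤ B := (norm_nonneg _).trans h
    have := norm_le_norm_sub_add (∑ k ∈ Finset.Icc 1 n, f k) (b * ((n : ℝ) : ℂ))
    have h2 : ‖b * ((n : ℝ) : ℂ)‖ = ‖b‖ * n := by simp
    rw [Real.rpow_one, Real.norm_of_nonneg (by positivity)]
    nlinarith
  rw [LSeries_eq_mul_integral f zero_le_one hs hsum hO]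
  have hI : ∫ t : ℝ in Ioi (1 : ℝ), b * (t : ℂ) ^ (-s) = b / (s - 1) := by
    rw [integral_const_mul, integral_Ioi_cpow_of_lt (by simpa using hs) one_pos]
    have : -s + 1 ≠ 0 := fun h ↦ hs1 (by linear_combination -h)
    simp only [ofReal_one, one_cpow]
    field_simp
    ring
  have hint1 : IntegrableOn (fun t : ℝ ↦ b * (t : ℂ) ^ (-s)) (Ioi 1) :=
    (integrableOn_Ioi_cpow_of_lt (by simpa using hs) one_pos).const_mul b
  have hint2 : IntegrableOn (fun t : ℝ ↦ (Ioi (1 : ℝ)).indicator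
      (fun t : ℝ ↦ ∑ k ∈ Finset.Icc 1 ⌊t⌋₊, f k - b * t) t * (t : ℂ) ^ (-(s + 1))) (Ioi 1) := by
    have hd : IntegrableOn (fun t : ℝ ↦ B * t ^ (-(s.re + 1))) (Ioi 1) :=
      (integrableOn_Ioi_rpow_of_lt (by linarith) one_pos).const_mul B
    refine Integrable.mono' hd ?_ ?_
    · refine AEStronglyMeasurable.mul ?_ ?_
      · refine (Measurable.indicator ?_ measurableSet_Ioi).aestronglyMeasurable
        refine Measurable.sub ?_ (by fun_prop)
        exact (measurable_from_nat (f := fun n ↦ ∑ k ∈ Finset.Icc 1 n, f k)).comp Nat.measurable_floor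
      · exact (integrableOn_Ioi_cpow_of_lt (by simp; linarith) one_pos).aestronglyMeasurable
    · refine (ae_restrict_iff' measurableSet_Ioi).2 (ae_of_all _ fun t ht ↦ ?_)
      have ht0 : (0 : ℝ) < t := lt_trans one_pos ht
      rw [norm_mul, norm_cpow_eq_rpow_re_of_pos ht0, indicator_of_mem ht]
      rw [show (-(s + 1)).re = -(s.re + 1) by simp]
      gcongr
      exact hB t ht
  rw [show b * s / (s - 1) = s * (b / (s - 1)) by ring, ← hI, ← mul_add, ← integral_add hint2 hint1]
  congr 1
  refine setIntegral_congr_fun measurableSet_Ioi fun t ht ↦ ?_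
  have ht0 : (t : ℂ) ≠ 0 := by
    have : (0 : ℝ) < t := lt_trans one_pos ht
    exact_mod_cast this.ne'
  simp only [indicator_of_mem ht]
  rw [show (-s) = 1 + (-(s + 1)) by ring, cpow_add _ _ ht0, cpow_one]
  ring

/-- A function analytic in `Re s > 0` which equals a Dirichlet series with bounded partial sums
in `Re s > 1` grows at most linearly. -/
theorem norm_le_of_eq_LSeries {f : ℕ → ℂ} {b : ℂ} {B : ℝ} {F : ℂ → ℂ}
    (hsum : ∀ s : ℂ, 1 < s.re → LSeriesSummable f s)
    (hB : ∀ t : ℝ, 1 < t → ‖∑ k ∈ Finset.Icc 1 ⌊t⌋₊, f k - b * t‖ ≤ B)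
    (hF : Differentiable ℂ F) {G : ℂ → ℂ} (hG : Differentiable ℂ G)
    (hFG : ∀ s : ℂ, 1 < s.re → F s = G s * LSeries f s - (G s * b * s / (s - 1) - b * s))
    {s : ℂ} (hs : 0 < s.re) : ‖F s‖ ≤ ‖G s‖ * ‖s‖ * (B / s.re) + ‖b‖ * ‖s‖ := by
  set g : ℝ → ℂ := (Ioi (1 : ℝ)).indicator (fun t : ℝ ↦ ∑ k ∈ Finset.Icc 1 ⌊t⌋₊, f k - b * t)
    with hg
  have hgm : Measurable g := by
    refine (Measurable.indicator ?_ measurableSet_Ioi)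
    refine Measurable.sub ?_ (by fun_prop)
    exact (measurable_from_nat (f := fun n ↦ ∑ k ∈ Finset.Icc 1 n, f k)).comp Nat.measurable_floor
  have hB0 : 0 ≤ B := (norm_nonneg _).trans (hB 2 (by norm_num))
  have hgB : ∀ t, ‖g t‖ ≤ B := by
    intro t
    by_cases ht : t ∈ Ioi (1 : ℝ)
    · rw [hg, indicator_of_mem ht]; exact hB t ht
    · rw [hg, indicator_of_notMem ht]; simpa using hB0
  set H : ℂ → ℂ := fun s ↦ ∫ t : ℝ in Ioi (1 : ℝ), g t * (t : ℂ) ^ (-(s + 1)) with hH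
  have hopen : IsOpen {s : ℂ | 0 < s.re} := isOpen_lt continuous_const continuous_re
  have key : EqOn F (fun s ↦ G s * s * H s + b * s) {s : ℂ | 0 < s.re} := by
    refine AnalyticOnNhd.eqOn_of_preconnected_of_eventuallyEq (𝕜 := ℂ) (z₀ := 2) ?_ ?_ ?_ ?_ ?_
    · exact hF.differentiableOn.analyticOnNhd hopen
    · refine DifferentiableOn.analyticOnNhd (fun w hw ↦ ?_) hopen
      refine DifferentiableAt.differentiableWithinAt ?_
      have := differentiableAt_integral_Ioi_mul_cpow hgm hgB hw
      exact ((hG w).mul differentiableAt_id).mul this |>.add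
        ((differentiableAt_const b).mul differentiableAt_id)
    · exact (convex_halfSpace_re_gt 0).isPreconnected
    · simp
    · have : {s : ℂ | 1 < s.re} ∈ 𝓝 (2 : ℂ) :=
        (isOpen_lt continuous_const continuous_re).mem_nhds (by simp)
      filter_upwards [this] with w hw
      rw [hFG w hw, LSeries_eq_mul_integral_add hw (hsum w hw) hB]
      ring
  rw [key hs]
  refine (norm_add_le _ _).trans ?_
  rw [norm_mul, norm_mul, norm_mul]
  gcongr
  exact norm_integral_Ioi_mul_cpow_le hgB hs

end SmoothSum

namespace SmoothSum

open Complex Set Filter Topology MeasureTheory Metric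

theorem exists_norm_logDeriv_le_log {A c θ : ℝ} (hA : 0 < A) (hc : 0 < c) (hθ : 1 / 2 < θ)
    (hθ2 : θ < 2) :
    ∃ C > 0, ∀ (f : ℂ → ℂ) (K : ℝ), 1 ≤ K → Differentiable ℂ f → (∀ s : ℂ, 1 / 2 < s.re → f s ≠ 0) →
      (∀ s : ℂ, 1 / 2 < s.re → ‖f s‖ ≤ A * K * (1 + ‖s‖) ^ 2) →
      (∀ s : ℂ, s.re = 2 → c ≤ ‖f s‖) →
      ∀ s : ℂ, θ ≤ s.re → s.re ≤ 2 → ‖deriv f s / f s‖ ≤ C * Real.log (K * (|s.im| + 2)) := by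
  set C1 : ℝ := 2 + |Real.log (9 * A / c)| / Real.log 2 with hC1
  have hl2 : 0 < Real.log 2 := Real.log_pos one_lt_two
  have hC1pos : 0 < C1 := by positivity
  refine ⟨16 * (3 / 2) * C1 / (θ - 1 / 2) ^ 2, by
    have : 0 < θ - 1 / 2 := by linarith
    positivity, ?_⟩
  intro f K hK hf h0 hb hlow s hs1 hs2
  set T : ℝ := |s.im| + 2 with hT
  have hT2 : 2 ≤ T := by have := abs_nonneg s.im; linarith
  have hKT : 2 ≤ K * T := by nlinarith
  have hlog : Real.log 2 ≤ Real.log (K * T) := Real.log_le_log (by norm_num) hKT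
  set M : ℝ := C1 * Real.log (K * T) with hM
  have hMpos : 0 < M := mul_pos hC1pos (by linarith)
  have hMb : A * K * (3 * T) ^ 2 ≤ Real.exp M * c := by
    rw [← div_le_iff₀ hc, ← Real.log_le_iff_le_exp (by positivity)]
    have h1 : A * K * (3 * T) ^ 2 / c = (9 * A / c) * (K * T ^ 2) := by ring
    rw [h1, Real.log_mul (by positivity) (by positivity)]
    have h2 : Real.log (K * T ^ 2) ≤ 2 * Real.log (K * T) := by
      rw [← Real.log_rpow (by positivity)]
      apply Real.log_le_log (by positivity)
      rw [Real.rpow_two]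
      nlinarith [sq_nonneg T]
    have h3 : Real.log (9 * A / c) ≤ |Real.log (9 * A / c)| / Real.log 2 * Real.log (K * T) := by
      rw [div_mul_eq_mul_div, le_div_iff₀ hl2]
      exact mul_le_mul (le_abs_self _) hlog hl2.le (abs_nonneg _)
    rw [hM, hC1, add_mul]
    linarith
  set c0 : ℂ := 2 + s.im * I with hc0
  have hc0re : c0.re = 2 := by simp [hc0]
  have hre : ∀ z ∈ ball c0 (3 / 2), 1 / 2 < z.re := by
    intro z hz
    rw [mem_ball, dist_eq] at hz
    have := (abs_re_le_norm (z - c0)).trans_lt hz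
    rw [sub_re, hc0re, abs_lt] at this
    linarith
  have key := norm_logDeriv_le_of_norm_le (f := f) (c := c0) (R := 3 / 2) (r := 2 - θ) (M := M)
    hMpos (by linarith) (by linarith) hf.differentiableOn (fun z hz ↦ h0 z (hre z hz)) ?_ (z := s) ?_
  · refine key.trans (le_of_eq ?_)
    rw [show (3 / 2 - (2 - θ)) = θ - 1 / 2 by ring, hM]
    ring
  · intro z hz
    refine (hb z (hre z hz)).trans ?_
    have h1 : ‖z‖ ≤ |s.im| + 7 / 2 := by
      rw [mem_ball, dist_eq] at hz
      have h2 := norm_le_norm_add_norm_sub' z c0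
      have h3 : ‖c0‖ ≤ 2 + |s.im| := by
        refine (norm_add_le _ _).trans ?_
        simp
      linarith
    have h4 : A * K * (1 + ‖z‖) ^ 2 ≤ A * K * (3 * T) ^ 2 := by
      gcongr
      have := abs_nonneg s.im
      linarith
    exact h4.trans (hMb.trans (by gcongr; exact hlow c0 hc0re))
  · rw [mem_closedBall, dist_eq]
    have : s - c0 = ((s.re - 2 : ℝ) : ℂ) := by
      apply Complex.ext <;> simp [hc0]
    rw [this, norm_real, Real.norm_eq_abs, abs_le]
    constructor <;> linarith

theorem norm_LSeries_ge {f : ℕ → ℂ} (h1 : f 1 = 1) (hf : ∀ n, ‖f n‖ ≤ 1) {s : ℂ} (hs : s.re = 2) :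
    1 / 3 ≤ ‖LSeries f s‖ := by
  have hz := hasSum_zeta_two
  have hterm : ∀ n, ‖LSeries.term f s n‖ ≤ 1 / (n : ℝ) ^ 2 := by
    intro n
    rw [LSeries.norm_term_eq]
    split_ifs with h
    · simp [h]
    · rw [hs]
      have := hf n
      rw [Real.rpow_two]
      gcongr
  have hsum : Summable fun n ↦ ‖LSeries.term f s n‖ :=
    Summable.of_nonneg_of_le (fun _ ↦ norm_nonneg _) hterm hz.summable
  have hle : ∑' n, ‖LSeries.term f s n‖ ≤ Real.pi ^ 2 / 6 := by
    rw [← hz.tsum_eq]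
    exact hsum.tsum_le_tsum hterm hz.summable
  have h3 : LSeries.term f s 1 = 1 := by simp [h1]
  have e1 : LSeries f s = 1 + ∑' n, (if n = 1 then 0 else LSeries.term f s n) := by
    rw [LSeries, hsum.of_norm.tsum_eq_add_tsum_ite 1, h3]
  have e2 : ∑' n, ‖LSeries.term f s n‖ = 1 + ∑' n, (if n = 1 then 0 else ‖LSeries.term f s n‖) := by
    rw [hsum.tsum_eq_add_tsum_ite 1, h3]; simp
  have hs2 : Summable fun n ↦ ‖(if n = 1 then 0 else LSeries.term f s n)‖ := by
    refine Summable.of_nonneg_of_le (fun _ ↦ norm_nonneg _) (fun n ↦ ?_) hsum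
    split_ifs <;> simp
  have e3 : ‖∑' n, (if n = 1 then 0 else LSeries.term f s n)‖ ≤
      ∑' n, (if n = 1 then 0 else ‖LSeries.term f s n‖) := by
    refine (norm_tsum_le_tsum_norm hs2).trans (le_of_eq ?_)
    congr 1; ext n; split_ifs <;> simp
  have hpi : Real.pi ^ 2 / 6 ≤ 5 / 3 := by
    have := Real.pi_lt_d2
    have := Real.pi_pos
    nlinarith
  have h5 : ‖(1 : ℂ)‖ ≤ ‖LSeries f s‖ + ‖∑' n, (if n = 1 then 0 else LSeries.term f s n)‖ := by
    have := norm_sub_le (LSeries f s) (∑' n, (if n = 1 then 0 else LSeries.term f s n))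
    rwa [e1, add_sub_cancel_right, ← e1] at this
  rw [norm_one] at h5
  linarith

theorem LFunction_ne_zero_of_GRH (hGRH : GRH) {q : ℕ} [NeZero q] {χ : DirichletCharacter ℂ q}
    (hχ : χ ≠ 1) {s : ℂ} (hs : 1 / 2 < s.re) : χ.LFunction s ≠ 0 := by
  rcases lt_or_ge s.re 1 with h | h
  · intro h0
    have := hGRH.2 q χ s (by linarith) h h0
    linarith
  · exact χ.LFunction_ne_zero_of_one_le_re (Or.inl hχ) h

theorem exists_norm_logDeriv_LFunction_le (hGRH : GRH) {θ : ℝ} (hθ : 1 / 2 < θ) (hθ2 : θ < 2) :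
    ∃ C > 0, ∀ (q : ℕ) [NeZero q] (χ : DirichletCharacter ℂ q), χ ≠ 1 → ∀ s : ℂ, θ ≤ s.re →
      s.re ≤ 2 → ‖deriv χ.LFunction s / χ.LFunction s‖ ≤ C * Real.log (q * (|s.im| + 2)) := by
  obtain ⟨C, hC, h⟩ := exists_norm_logDeriv_le_log (A := 4) (c := 1 / 3) (θ := θ) (by norm_num)
    (by norm_num) hθ hθ2
  refine ⟨C, hC, fun q _ χ hχ ↦ h χ.LFunction q ?_ (DirichletCharacter.differentiable_LFunction hχ)
    (fun s hs ↦ LFunction_ne_zero_of_GRH hGRH hχ hs) (fun s hs ↦ ?_) (fun s hs ↦ ?_)⟩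
  · exact_mod_cast NeZero.one_le
  · have key := norm_le_of_eq_LSeries (f := fun n ↦ χ n) (b := 0) (B := 2 * q)
      (F := χ.LFunction) (G := 1) (fun s hs ↦ χ.LSeriesSummable_of_one_lt_re hs) ?_
      (DirichletCharacter.differentiable_LFunction hχ) (differentiable_const (1 : ℂ)) ?_
      (s := s) (by linarith)
    · refine key.trans ?_
      simp only [Pi.one_apply, norm_one, one_mul, norm_zero, zero_mul, add_zero]
      have h1 : (2 * q : ℝ) / s.re ≤ 4 * q := by
        rw [div_le_iff₀ (by linarith)]
        have : (0 : ℝ) ≤ q := by positivity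
        nlinarith
      have h2 : ‖s‖ ≤ (1 + ‖s‖) ^ 2 := by nlinarith [norm_nonneg s]
      calc ‖s‖ * (2 * q / s.re) ≤ (1 + ‖s‖) ^ 2 * (4 * q) := by gcongr
        _ = _ := by ring
    · intro t _
      simp only [zero_mul, sub_zero]
      have h1 : ∑ k ∈ Finset.Icc 1 ⌊t⌋₊, χ (k : ZMod q) =
          ∑ k ∈ Finset.range (⌊t⌋₊ + 1), χ (k : ZMod q) - χ ((0 : ℕ) : ZMod q) := by
        rw [show Finset.range (⌊t⌋₊ + 1) = insert 0 (Finset.Icc 1 ⌊t⌋₊) by ext k; simp; omega,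
          Finset.sum_insert (by simp), add_sub_cancel_left]
      rw [h1]
      refine (norm_sub_le _ _).trans ?_
      have h2 := norm_sum_range_dirichletCharacter_le hχ (⌊t⌋₊ + 1)
      have h3 := χ.norm_le_one ((0 : ℕ) : ZMod q)
      have h4 : (1 : ℝ) ≤ q := by exact_mod_cast NeZero.one_le
      linarith
    · intro w hw
      rw [χ.LFunction_eq_LSeries hw]
      simp
  · rw [χ.LFunction_eq_LSeries (by linarith)]
    exact norm_LSeries_ge (by simp) (fun n ↦ χ.norm_le_one _) hs

/-- The entire function `(s - 1) ζ(s)`. -/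
def zetaAux : ℂ → ℂ := DirichletCharacter.LFunctionTrivChar₁ 1

theorem differentiable_zetaAux : Differentiable ℂ zetaAux :=
  DirichletCharacter.differentiable_LFunctionTrivChar₁ 1

theorem zetaAux_one : zetaAux 1 = 1 := by simp [zetaAux]

theorem zetaAux_of_ne_one {s : ℂ} (hs : s ≠ 1) : zetaAux s = (s - 1) * riemannZeta s := by
  simp [zetaAux, hs]

theorem zetaAux_ne_zero_of_GRH (hGRH : GRH) {s : ℂ} (hs : 1 / 2 < s.re) : zetaAux s ≠ 0 := by
  by_cases h1 : s = 1
  · rw [h1, zetaAux_one]; exact one_ne_zero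
  rw [zetaAux_of_ne_one h1]
  refine mul_ne_zero (sub_ne_zero.2 h1) ?_
  rcases lt_or_ge s.re 1 with h | h
  · intro h0
    have := hGRH.1 s (by linarith) h h0
    linarith
  · exact riemannZeta_ne_zero_of_one_le_re h

theorem exists_norm_logDeriv_zetaAux_le (hGRH : GRH) {θ : ℝ} (hθ : 1 / 2 < θ) (hθ2 : θ < 2) :
    ∃ C > 0, ∀ s : ℂ, θ ≤ s.re →
      s.re ≤ 2 → ‖deriv zetaAux s / zetaAux s‖ ≤ C * Real.log (|s.im| + 2) := by
  obtain ⟨C, hC, h⟩ := exists_norm_logDeriv_le_log (A := 4) (c := 1 / 3) (θ := θ) (by norm_num)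
    (by norm_num) hθ hθ2
  refine ⟨C, hC, ?_⟩
  have := h zetaAux 1 le_rfl differentiable_zetaAux (fun s hs ↦ zetaAux_ne_zero_of_GRH hGRH hs)
    (fun s hs ↦ ?_) (fun s hs ↦ ?_)
  · simpa using this
  · have hne : ∀ w : ℂ, 1 < w.re → w ≠ 1 := fun w hw h ↦ by simp [h] at hw
    have key := norm_le_of_eq_LSeries (f := 1) (b := 1) (B := 1)
      (F := zetaAux) (G := fun s ↦ s - 1) (fun s hs ↦ LSeriesSummable_one_iff.2 hs) ?_
      differentiable_zetaAux (by fun_prop) ?_ (s := s) (by linarith)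
    · refine key.trans ?_
      rw [norm_one, one_mul]
      have h1 : 1 / s.re ≤ 2 := by
        rw [div_le_iff₀ (by linarith)]
        linarith
      have h2 : ‖s - 1‖ ≤ 1 + ‖s‖ := by simpa [add_comm] using norm_sub_le s 1
      have h0 := norm_nonneg s
      calc ‖s - 1‖ * ‖s‖ * (1 / s.re) + ‖s‖ ≤ (1 + ‖s‖) * ‖s‖ * 2 + ‖s‖ := by gcongr
        _ ≤ _ := by nlinarith
    · intro t ht
      have h1 := Nat.floor_le (show 0 ≤ t by linarith)
      have h2 := Nat.lt_floor_add_one t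
      have : ∑ k ∈ Finset.Icc 1 ⌊t⌋₊, (1 : ℕ → ℂ) k - 1 * t = ((⌊t⌋₊ - t : ℝ) : ℂ) := by simp
      rw [this, norm_real, Real.norm_eq_abs, abs_le]
      constructor <;> linarith
    · intro w hw
      have hw1 : w - 1 ≠ 0 := sub_ne_zero.2 (hne w hw)
      rw [zetaAux_of_ne_one (hne w hw), LSeries_one_eq_riemannZeta hw]
      field_simp
      ring
  · have hne : s ≠ 1 := fun h ↦ by simp [h] at hs
    rw [zetaAux_of_ne_one hne, ← LSeries_one_eq_riemannZeta (by linarith), norm_mul]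
    have h1 := norm_LSeries_ge (f := 1) (by simp) (by simp) hs
    have h2 : 1 ≤ ‖s - 1‖ := by
      have := abs_re_le_norm (s - 1)
      rw [sub_re, hs, one_re] at this
      norm_num at this
      exact this
    nlinarith

theorem LSeries_vonMangoldt_eq_zetaAux {s : ℂ} (hs : 1 < s.re) :
    -(deriv zetaAux s / zetaAux s) =
      LSeries (fun n ↦ (ArithmeticFunction.vonMangoldt n : ℂ)) s - 1 / (s - 1) := by
  have hne : s ≠ 1 := fun h ↦ by simp [h] at hs
  have hs1 : s - 1 ≠ 0 := sub_ne_zero.2 hne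
  have hz : riemannZeta s ≠ 0 := riemannZeta_ne_zero_of_one_le_re hs.le
  have hev : zetaAux =ᶠ[𝓝 s] fun s ↦ (s - 1) * riemannZeta s := by
    filter_upwards [isOpen_ne.mem_nhds hne] with w hw using zetaAux_of_ne_one hw
  have hd : HasDerivAt (fun s ↦ (s - 1) * riemannZeta s)
      (1 * riemannZeta s + (s - 1) * deriv riemannZeta s) s :=
    ((hasDerivAt_id s).sub_const 1).mul (differentiableAt_riemannZeta hne).hasDerivAt
  have h := ArithmeticFunction.LSeries_vonMangoldt_eq_deriv_riemannZeta_div hs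
  rw [h, hev.deriv_eq, hd.deriv, zetaAux_of_ne_one hne]
  field_simp
  ring

end SmoothSum

namespace SmoothSum

open Complex Set Filter Topology MeasureTheory Metric

theorem integral_mul_comp_div_eq_mellin {ι : Type*} [MeasurableSpace ι] {ν : Measure ι} [SFinite ν]
    {v : ι → ℝ} (hv : Measurable v) {w : ι → ℂ} (hw : ∀ i, w i ≠ 0 → 0 < v i) {σ : ℝ}
    (hintg : Integrable (fun i ↦ w i * (v i : ℂ) ^ (-(σ : ℂ))) ν) {f : ℝ → ℂ}
    (hf : MellinConvergent f σ) (hF : VerticalIntegrable (mellin f) σ)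
    (hc : ∀ t : ℝ, 0 < t → ContinuousAt f t) {z : ℝ} (hz : 0 < z) :
    Integrable (fun τ : ℝ ↦ (z : ℂ) ^ (σ + τ * I) *
      mellin f (σ + τ * I) * ∫ i, w i * (v i : ℂ) ^ (-(σ + τ * I)) ∂ν) ∧
    ∫ i, w i * f (v i / z) ∂ν = (1 / (2 * Real.pi) : ℝ) * ∫ τ : ℝ, (z : ℂ) ^ (σ + τ * I) *
      mellin f (σ + τ * I) * ∫ i, w i * (v i : ℂ) ^ (-(σ + τ * I)) ∂ν := by
  have hz' : (z : ℂ) ≠ 0 := by exact_mod_cast hz.ne'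
  have hpt : ∀ i, w i * f (v i / z) = (1 / (2 * Real.pi) : ℝ) * ∫ τ : ℝ,
      (w i * (v i : ℂ) ^ (-(σ + τ * I))) * ((z : ℂ) ^ (σ + τ * I) * mellin f (σ + τ * I)) := by
    intro i
    by_cases h0 : w i = 0
    · simp [h0]
    have hvi := hw i h0
    have hvz : 0 < v i / z := div_pos hvi hz
    rw [← mellinInv_mellin_eq σ f hvz hf hF (hc _ hvz), mellinInv, real_smul, mul_left_comm,
      ← integral_const_mul]
    congr 2
    ext τ
    rw [ofReal_div, div_cpow_ofReal_nonneg hvi.le hz.le, cpow_neg (z : ℂ), div_inv_eq_mul, smul_eq_mul]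
    ring
  have hprod : Integrable (Function.uncurry fun (i : ι) (τ : ℝ) ↦
      (w i * (v i : ℂ) ^ (-(σ + τ * I))) * ((z : ℂ) ^ (σ + τ * I) * mellin f (σ + τ * I)))
      (ν.prod volume) := by
    have h1 := hintg.mul_prod (f := fun i ↦ w i * (v i : ℂ) ^ (-(σ : ℂ)))
      (g := fun τ : ℝ ↦ (z : ℂ) ^ (σ : ℂ) * mellin f (σ + τ * I)) (hF.const_mul _)
    have h2 : Integrable (fun p : ι × ℝ ↦ cexp (-(p.2 * (Real.log (v p.1) - Real.log z) : ℝ) * I) *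
        ((w p.1 * (v p.1 : ℂ) ^ (-(σ : ℂ))) * ((z : ℂ) ^ (σ : ℂ) * mellin f (σ + p.2 * I))))
        (ν.prod volume) := by
      refine h1.bdd_mul (c := 1) ?_ (ae_of_all _ fun p ↦ ?_)
      · refine Measurable.aestronglyMeasurable ?_
        fun_prop
      · rw [← ofReal_neg, norm_exp_ofReal_mul_I]
    refine h2.congr (ae_of_all _ fun p ↦ ?_)
    simp only [Function.uncurry]
    by_cases h0 : w p.1 = 0
    · simp [h0]
    have hvi := hw _ h0
    have hvi' : (v p.1 : ℂ) ≠ 0 := by exact_mod_cast hvi.ne'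
    rw [neg_add, cpow_add _ _ hvi', cpow_add _ _ hz', cpow_def_of_ne_zero hvi' (-(p.2 * I)),
      cpow_def_of_ne_zero hz' (p.2 * I), ← ofReal_log hvi.le, ← ofReal_log hz.le,
      show (-((p.2 * (Real.log (v p.1) - Real.log z) : ℝ) : ℂ) * I) =
        (Real.log (v p.1) * -(p.2 * I) : ℂ) + (Real.log z * (p.2 * I) : ℂ) by push_cast; ring,
      Complex.exp_add]
    ring
  have heq : ∀ τ : ℝ, (z : ℂ) ^ (σ + τ * I) *
      mellin f (σ + τ * I) * ∫ i, w i * (v i : ℂ) ^ (-(σ + τ * I)) ∂ν = ∫ i,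
      (w i * (v i : ℂ) ^ (-(σ + τ * I))) * ((z : ℂ) ^ (σ + τ * I) * mellin f (σ + τ * I)) ∂ν := by
    intro τ
    rw [integral_mul_const, mul_comm]
  simp_rw [hpt, heq]
  refine ⟨hprod.integral_prod_right, ?_⟩
  rw [integral_const_mul, integral_integral_swap hprod]

theorem sum_mul_comp_div_eq_mellin {a : ℕ → ℂ} (ha : a 0 = 0) {σ : ℝ}
    (hsum : LSeriesSummable a σ) {f : ℝ → ℂ}
    (hf : MellinConvergent f σ) (hF : VerticalIntegrable (mellin f) σ)
    (hc : ∀ t : ℝ, 0 < t → ContinuousAt f t) {z : ℝ} (hz : 0 < z) {N : ℕ}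
    (hN : ∀ n, N < n → a n * f (n / z) = 0) :
    Integrable (fun τ : ℝ ↦
      (z : ℂ) ^ (σ + τ * I) * mellin f (σ + τ * I) * LSeries a (σ + τ * I)) ∧
    ∑ n ∈ Finset.Icc 1 N, a n * f (n / z) = (1 / (2 * Real.pi) : ℝ) * ∫ τ : ℝ,
      (z : ℂ) ^ (σ + τ * I) * mellin f (σ + τ * I) * LSeries a (σ + τ * I) := by
  have hterm : ∀ (s : ℂ) (n : ℕ), a n * ((n : ℝ) : ℂ) ^ (-s) = LSeries.term a s n := by
    intro s n
    rcases eq_or_ne n 0 with rfl | hn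
    · simp [ha]
    · rw [LSeries.term_of_ne_zero hn, cpow_neg, ofReal_natCast]; rfl
  have hterm' : ∀ (τ : ℝ), Summable (fun n ↦ ‖LSeries.term a (σ + τ * I) n‖) := by
    intro τ
    refine hsum.norm.congr fun n ↦ ?_
    rw [LSeries.norm_term_eq, LSeries.norm_term_eq]
    simp
  have h0 : ∀ n, n ∉ Finset.Icc 1 N → a n * f (n / z) = 0 := by
    intro n hn
    rw [Finset.mem_Icc, not_and_or, not_le, not_le] at hn
    rcases hn with h | h
    · obtain rfl : n = 0 := by omega
      simp [ha]
    · exact hN n h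
  have hL : ∀ τ : ℝ, ∫ n : ℕ, a n * ((n : ℝ) : ℂ) ^ (-(σ + τ * I)) ∂Measure.count =
      LSeries a (σ + τ * I) := by
    intro τ
    rw [integral_countable]
    · simp only [measureReal_def, Measure.count_singleton, ENNReal.toReal_one, one_smul, hterm]
      rfl
    · rw [integrable_count_iff]
      exact (hterm' τ).congr fun n ↦ by rw [hterm]
  have h := integral_mul_comp_div_eq_mellin (ν := (Measure.count : Measure ℕ)) (v := fun n : ℕ ↦ (n : ℝ))
    (w := a) (by fun_prop) (fun n hn ↦ ?_) (σ := σ) ?_ hf hF hc hz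
  · simp only [hL] at h
    refine ⟨h.1, ?_⟩
    replace h := h.2
    rw [integral_countable] at h
    · simp only [measureReal_def, Measure.count_singleton, ENNReal.toReal_one, one_smul] at h
      rw [tsum_eq_sum h0] at h
      exact h
    · rw [integrable_count_iff]
      refine summable_of_ne_finset_zero (s := Finset.Icc 1 N) fun n hn ↦ ?_
      rw [h0 n hn, norm_zero]
  · have : n ≠ 0 := fun h ↦ hn (h ▸ ha)
    exact_mod_cast Nat.pos_of_ne_zero this
  · rw [integrable_count_iff]
    exact hsum.norm.congr fun n ↦ by rw [hterm]

/-- The continuous function equal to `1` on `u ≤ 1`, to `0` on `u ≥ 1 + h` and affine in between. -/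
noncomputable def ramp (h u : ℝ) : ℂ := ((max 0 (min 1 ((1 + h - u) / h)) : ℝ) : ℂ)

theorem ramp_of_le_one {h u : ℝ} (hh : 0 < h) (hu : u ≤ 1) : ramp h u = 1 := by
  have : 1 ≤ (1 + h - u) / h := by rw [le_div_iff₀ hh]; linarith
  simp [ramp, min_eq_left this]

theorem ramp_of_ge {h u : ℝ} (hh : 0 < h) (hu : 1 + h ≤ u) : ramp h u = 0 := by
  have : (1 + h - u) / h ≤ 0 := div_nonpos_of_nonpos_of_nonneg (by linarith) hh.le
  rw [ramp, max_eq_left ((min_le_right _ _).trans this), ofReal_zero]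

theorem ramp_of_mem {h u : ℝ} (hh : 0 < h) (hu : 1 ≤ u) (hu2 : u ≤ 1 + h) :
    ramp h u = (1 + h - u) / h := by
  have h1 : (1 + h - u) / h ≤ 1 := by rw [div_le_iff₀ hh]; linarith
  have h2 : 0 ≤ (1 + h - u) / h := div_nonneg (by linarith) hh.le
  rw [ramp, min_eq_right h1, max_eq_right h2]
  push_cast
  rfl

theorem norm_ramp_le (h u : ℝ) : ‖ramp h u‖ ≤ 1 := by
  rw [ramp, norm_real, Real.norm_of_nonneg (le_max_left _ _)]
  simp

theorem continuous_ramp (h : ℝ) : Continuous (ramp h) := by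
  unfold ramp
  fun_prop

theorem mellinConvergent_ramp {h : ℝ} (hh : 0 < h) {s : ℂ} (hs : 0 < s.re) :
    MellinConvergent (ramp h) s := by
  refine mellinConvergent_of_isBigO_rpow (a := s.re + 1) (b := 0)
    ((continuous_ramp h).locallyIntegrable.locallyIntegrableOn _) ?_ (by linarith) ?_ hs
  · refine Asymptotics.IsBigO.of_bound 1 ?_
    filter_upwards [eventually_ge_atTop (1 + h)] with u hu
    rw [ramp_of_ge hh hu]
    simp
  · refine Asymptotics.IsBigO.of_bound 1 (Eventually.of_forall fun u ↦ ?_)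
    simpa using norm_ramp_le h u

theorem mellin_ramp {h : ℝ} (hh : 0 < h) {s : ℂ} (hs : 0 < s.re) :
    mellin (ramp h) s = ((1 + h : ℂ) ^ (s + 1) - 1) / (h * s * (s + 1)) := by
  have hs0 : s ≠ 0 := fun h ↦ by simp [h] at hs
  have hs1 : s + 1 ≠ 0 := fun h ↦ by
    have := congrArg re h
    simp at this; linarith
  have hhc : (h : ℂ) ≠ 0 := by exact_mod_cast hh.ne'
  have hconv := mellinConvergent_ramp hh hs
  rw [mellin, ← Ioc_union_Ioi_eq_Ioi (show (0 : ℝ) ≤ 1 + h by linarith),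
    setIntegral_union Ioc_disjoint_Ioi_same measurableSet_Ioi]
  · have h2 : ∫ t in Ioi (1 + h), (t : ℂ) ^ (s - 1) • ramp h t = 0 := by
      refine setIntegral_eq_zero_of_forall_eq_zero fun t ht ↦ ?_
      rw [ramp_of_ge hh (le_of_lt ht), smul_zero]
    have hii : IntervalIntegrable (fun t : ℝ ↦ (t : ℂ) ^ (s - 1) • ramp h t) volume 0 (1 + h) := by
      rw [intervalIntegrable_iff_integrableOn_Ioc_of_le (by linarith)]
      exact hconv.mono_set Ioc_subset_Ioi_self
    rw [h2, add_zero, ← intervalIntegral.integral_of_le (by linarith),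
      ← intervalIntegral.integral_add_adjacent_intervals (b := 1)]
    · have i1 : ∫ t in (0 : ℝ)..1, (t : ℂ) ^ (s - 1) • ramp h t = 1 / s := by
        rw [intervalIntegral.integral_congr (g := fun t : ℝ ↦ (t : ℂ) ^ (s - 1)),
          integral_cpow (Or.inl (by simpa using hs))]
        · simp [hs0]
        · intro t ht
          rw [uIcc_of_le zero_le_one] at ht
          simp only [ramp_of_le_one hh ht.2, smul_eq_mul, mul_one]
      have i2 : ∫ t in (1 : ℝ)..(1 + h), (t : ℂ) ^ (s - 1) • ramp h t =
          ((1 + h) / h) * (((1 + h : ℂ) ^ s - 1) / s) -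
            (1 / h) * (((1 + h : ℂ) ^ (s + 1) - 1) / (s + 1)) := by
        rw [intervalIntegral.integral_congr (g := fun t : ℝ ↦
          ((1 + h) / h : ℂ) * (t : ℂ) ^ (s - 1) - (1 / h : ℂ) * (t : ℂ) ^ s)]
        · rw [intervalIntegral.integral_sub, intervalIntegral.integral_const_mul,
            intervalIntegral.integral_const_mul, integral_cpow (Or.inl (by simpa using hs)),
            integral_cpow (Or.inl (by linarith))]
          · simp
          · exact (intervalIntegral.intervalIntegrable_cpow' (by simpa using hs)).const_mul _
          · exact (intervalIntegral.intervalIntegrable_cpow' (by linarith)).const_mul _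
        · intro t ht
          rw [uIcc_of_le (by linarith)] at ht
          have ht0 : (t : ℂ) ≠ 0 := by
            have : 0 < t := by linarith [ht.1]
            exact_mod_cast this.ne'
          simp only [ramp_of_mem hh ht.1 ht.2, smul_eq_mul]
          rw [cpow_sub _ _ ht0, cpow_one]
          field_simp
      rw [i1, i2]
      have h1h : (1 + h : ℂ) ≠ 0 := by
        have : (0 : ℝ) < 1 + h := by linarith
        exact_mod_cast this.ne'
      rw [cpow_add _ _ h1h, cpow_one]
      field_simp
      ring
    · exact hii.mono_set (by rw [uIcc_of_le zero_le_one, uIcc_of_le (by linarith)]; exact Icc_subset_Icc_right (by linarith))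
    · exact hii.mono_set (by rw [uIcc_of_le (by linarith), uIcc_of_le (by linarith)]; exact Icc_subset_Icc_left (by linarith))
  · exact hconv.mono_set Ioc_subset_Ioi_self
  · exact hconv.mono_set (Ioi_subset_Ioi (by linarith))

theorem norm_mellin_ramp_le {h η : ℝ} (hh : 0 < h) (hh1 : h ≤ 1) (hη : 0 ≤ η) (hη1 : η ≤ 1) {s : ℂ}
    (hs : 0 < s.re) (hs2 : s.re ≤ 2) :
    ‖((1 + h : ℂ) ^ (s + 1) - 1) / (h * s * (s + 1))‖ ≤ 9 * h ^ (-η) * ‖s‖ ^ (-(1 + η)) := by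
  have hs0 : s ≠ 0 := fun h ↦ by simp [h] at hs
  have hn : 0 < ‖s‖ := norm_pos_iff.2 hs0
  have hle : ‖s‖ ≤ ‖s + 1‖ := by
    rw [← sq_le_sq₀ (norm_nonneg _) (norm_nonneg _), Complex.sq_norm, Complex.sq_norm, normSq_apply,
      normSq_apply]
    simp
    nlinarith
  have hn1 : 0 < ‖s + 1‖ := hn.trans_le hle
  have hs1 : s + 1 ≠ 0 := norm_pos_iff.1 hn1
  have h8 : ∀ t : ℝ, 1 ≤ t → t ≤ 2 → ∀ w : ℂ, 0 ≤ w.re → w.re ≤ 3 → ‖(t : ℂ) ^ w‖ ≤ 2 ^ w.re := by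
    intro t h1 h2 w hw _
    rw [norm_cpow_eq_rpow_re_of_pos (by linarith)]
    exact Real.rpow_le_rpow (by linarith) h2 hw
  have hA : ‖(1 + h : ℂ) ^ (s + 1) - 1‖ ≤ 9 := by
    refine (norm_sub_le _ _).trans ?_
    have := h8 (1 + h) (by linarith) (by linarith) (s + 1) (by simp; linarith) (by simp; linarith)
    have h3 : (2 : ℝ) ^ (s + 1).re ≤ 2 ^ (3 : ℝ) :=
      Real.rpow_le_rpow_of_exponent_le one_le_two (by simp; linarith)
    norm_num at h3 this ⊢
    linarith
  have hB : ‖(1 + h : ℂ) ^ (s + 1) - 1‖ ≤ 9 * h * ‖s + 1‖ := by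
    have h1 : ∫ t in (1 : ℝ)..(1 + h), (t : ℂ) ^ s = ((1 + h : ℂ) ^ (s + 1) - 1) / (s + 1) := by
      rw [integral_cpow (Or.inl (by linarith))]
      simp
    have h2 : ‖∫ t in (1 : ℝ)..(1 + h), (t : ℂ) ^ s‖ ≤ 4 * |1 + h - 1| := by
      refine intervalIntegral.norm_integral_le_of_norm_le_const fun t ht ↦ ?_
      rw [uIoc_of_le (by linarith)] at ht
      refine (h8 t ht.1.le (by linarith [ht.2]) s hs.le (by linarith)).trans ?_
      have h3 : (2 : ℝ) ^ s.re ≤ 2 ^ (2 : ℝ) := Real.rpow_le_rpow_of_exponent_le one_le_two hs2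
      norm_num at h3
      exact h3
    rw [h1, norm_div, div_le_iff₀ hn1, add_sub_cancel_left, abs_of_pos hh] at h2
    refine h2.trans ?_
    gcongr
    norm_num
  have hden : ‖(h * s * (s + 1) : ℂ)‖ = h * ‖s‖ * ‖s + 1‖ := by
    rw [norm_mul, norm_mul, norm_real, Real.norm_of_nonneg hh.le]
  rw [norm_div, hden]
  set A := ‖(1 + h : ℂ) ^ (s + 1) - 1‖ with hAdef
  have b1 : A / (h * ‖s‖ * ‖s + 1‖) ≤ 9 * ‖s‖⁻¹ := by
    rw [div_le_iff₀ (by positivity)]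
    calc A ≤ 9 * h * ‖s + 1‖ := hB
      _ = 9 * ‖s‖⁻¹ * (h * ‖s‖ * ‖s + 1‖) := by field_simp
  have b2 : A / (h * ‖s‖ * ‖s + 1‖) ≤ 9 * (h⁻¹ * ‖s‖⁻¹ * ‖s‖⁻¹) := by
    rw [div_le_iff₀ (by positivity)]
    calc A ≤ 9 * (h⁻¹ * ‖s‖⁻¹ * ‖s‖⁻¹) * (h * ‖s‖ * ‖s‖) := by field_simp; linarith
      _ ≤ _ := by gcongr
  have hX : 0 ≤ A / (h * ‖s‖ * ‖s + 1‖) := by positivity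
  set X := A / (h * ‖s‖ * ‖s + 1‖)
  have h9 : X = X ^ (1 - η) * X ^ η := by
    rw [← Real.rpow_add_of_nonneg hX (by linarith) hη]
    simp
  rw [h9]
  calc X ^ (1 - η) * X ^ η ≤ (9 * ‖s‖⁻¹) ^ (1 - η) * (9 * (h⁻¹ * ‖s‖⁻¹ * ‖s‖⁻¹)) ^ η := by
        gcongr
    _ = 9 * h ^ (-η) * ‖s‖ ^ (-(1 + η)) := by
        have huv : ∀ u v : ℝ, 0 < u → 0 < v → u ^ (1 - η) * (u * v) ^ η = u * v ^ η := by
          intro u v hu hv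
          rw [Real.mul_rpow hu.le hv.le, ← mul_assoc, ← Real.rpow_add hu, sub_add_cancel,
            Real.rpow_one]
        rw [show (9 * (h⁻¹ * ‖s‖⁻¹ * ‖s‖⁻¹)) = (9 * ‖s‖⁻¹) * (h⁻¹ * ‖s‖⁻¹) by ring,
          huv _ _ (by positivity) (by positivity), Real.mul_rpow (by positivity) (by positivity)]
        rw [Real.inv_rpow hh.le, Real.inv_rpow hn.le,
          Real.rpow_neg hh.le, Real.rpow_neg hn.le, Real.rpow_add hn, Real.rpow_one]
        field_simp

theorem one_add_abs_im_le {s : ℂ} (hs : 1 / 2 ≤ s.re) : 1 + |s.im| ≤ 3 * ‖s‖ := by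
  have h1 := abs_re_le_norm s
  have h2 := abs_im_le_norm s
  have := le_abs_self s.re
  linarith

theorem norm_rampMellin_le {h η : ℝ} (hh : 0 < h) (hh1 : h ≤ 1) (hη : 0 ≤ η) (hη1 : η ≤ 1)
    {s : ℂ} (hs : 1 / 2 ≤ s.re) (hs2 : s.re ≤ 2) :
    ‖((1 + h : ℂ) ^ (s + 1) - 1) / (h * s * (s + 1))‖ ≤
      81 * h ^ (-η) * (1 + |s.im|) ^ (-(1 + η)) := by
  refine (norm_mellin_ramp_le hh hh1 hη hη1 (by linarith) hs2).trans ?_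
  have h1 := one_add_abs_im_le hs
  have h2 : 0 < 1 + |s.im| := by positivity
  have h3 : 0 < ‖s‖ := by linarith
  have h4 : (3 * ‖s‖) ^ (-(1 + η)) ≤ (1 + |s.im|) ^ (-(1 + η)) :=
    Real.rpow_le_rpow_of_nonpos h2 h1 (by linarith)
  rw [Real.mul_rpow (by norm_num) h3.le] at h4
  have h5 : (1 / 9 : ℝ) ≤ 3 ^ (-(1 + η)) := by
    have : (3 : ℝ) ^ (-2 : ℝ) ≤ 3 ^ (-(1 + η)) :=
      Real.rpow_le_rpow_of_exponent_le (by norm_num) (by linarith)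
    rw [show (3 : ℝ) ^ (-2 : ℝ) = 1 / 9 by
      rw [Real.rpow_neg (by norm_num)]; norm_num] at this
    exact this
  have h6 : ‖s‖ ^ (-(1 + η)) ≤ 9 * (1 + |s.im|) ^ (-(1 + η)) := by
    have h7 : 0 ≤ ‖s‖ ^ (-(1 + η)) := by positivity
    nlinarith
  calc 9 * h ^ (-η) * ‖s‖ ^ (-(1 + η)) ≤ 9 * h ^ (-η) * (9 * (1 + |s.im|) ^ (-(1 + η))) := by gcongr
    _ = _ := by ring

theorem integrable_one_add_abs_rpow {η : ℝ} (hη : 0 < η) :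
    Integrable fun τ : ℝ ↦ (1 + |τ|) ^ (-(1 + η)) := by
  have := integrable_one_add_norm (E := ℝ) (μ := volume) (r := 1 + η) (by simpa using hη)
  simpa using this

theorem differentiableOn_rampMellin {h : ℝ} (hh : 0 < h) :
    DifferentiableOn ℂ (fun s : ℂ ↦ ((1 + h : ℂ) ^ (s + 1) - 1) / (h * s * (s + 1)))
      {s | 0 < s.re} := by
  intro s hs
  have hs' : 0 < s.re := hs
  have hs0 : s ≠ 0 := fun h ↦ by simp [h] at hs'
  have hs1 : s + 1 ≠ 0 := fun h ↦ by
    have := congrArg re h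
    simp at this; linarith
  have hhc : (h : ℂ) ≠ 0 := by exact_mod_cast hh.ne'
  have h1h : (1 + h : ℂ) ≠ 0 := by
    have : (0 : ℝ) < 1 + h := by linarith
    exact_mod_cast this.ne'
  refine DifferentiableAt.differentiableWithinAt (DifferentiableAt.div ?_ (by fun_prop)
    (by simp [hs0, hs1, hhc]))
  refine DifferentiableAt.sub_const ?_ _
  exact DifferentiableAt.const_cpow (by fun_prop) (Or.inl h1h)

theorem verticalIntegrable_mellin_ramp {h σ : ℝ} (hh : 0 < h) (hh1 : h ≤ 1) (hσ : 1 / 2 ≤ σ)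
    (hσ2 : σ ≤ 2) : VerticalIntegrable (mellin (ramp h)) σ := by
  have heq : (fun τ : ℝ ↦ mellin (ramp h) (σ + τ * I)) = fun τ : ℝ ↦
      ((1 + h : ℂ) ^ ((σ + τ * I : ℂ) + 1) - 1) / (h * (σ + τ * I) * ((σ + τ * I) + 1)) := by
    ext τ
    rw [mellin_ramp hh (by simp; linarith)]
  rw [VerticalIntegrable, heq]
  refine Integrable.mono' ((integrable_one_add_abs_rpow one_pos).const_mul (81 * h ^ (-1 : ℝ))) ?_
    (ae_of_all _ fun τ ↦ ?_)
  · refine Continuous.aestronglyMeasurable ?_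
    refine (differentiableOn_rampMellin hh).continuousOn.comp_continuous (by fun_prop) fun τ ↦ ?_
    simp; linarith
  · have := norm_rampMellin_le hh hh1 zero_le_one le_rfl (s := σ + τ * I) (by simpa using hσ)
      (by simpa using hσ2)
    simpa using this

end SmoothSum

namespace SmoothSum

open Complex Set Filter Topology MeasureTheory Metric ArithmeticFunction

theorem norm_smoothed_sum_sub_integral_le {θ η : ℝ} (hθ : 1 / 2 < θ) (hθ1 : θ ≤ 1) (hη : 0 < η)
    (hη1 : η ≤ 1 / 2) :
    ∃ C > 0, ∀ (a : ℕ → ℂ) (b : ℂ) (t : ℝ) (D : ℂ → ℂ) (K : ℝ), 1 ≤ K →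
      (∀ n, ‖a n‖ ≤ vonMangoldt n) →
      DifferentiableOn ℂ D {s | θ ≤ s.re ∧ s.re ≤ 2} →
      (∀ τ : ℝ, D ((2 : ℝ) + τ * I) =
        LSeries a ((2 : ℝ) + τ * I) - b / ((2 : ℝ) + τ * I + t * I - 1)) →
      (∀ σ τ : ℝ, θ ≤ σ → σ ≤ 2 → ‖D (σ + τ * I)‖ ≤ K * (1 + |τ|) ^ η) →
      ∀ z h : ℝ, 1 ≤ z → 0 < h → h ≤ 1 → ∀ N : ℕ, 2 * z ≤ N + 1 →
        ‖∑ n ∈ Finset.Icc 1 N, a n * ramp h (n / z) -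
          b * ∫ v : ℝ in Ioi (1 : ℝ), (v : ℂ) ^ (-(t * I)) * ramp h (v / z)‖
          ≤ C * K * z ^ θ * h ^ (-(2 * η)) := by
  refine ⟨1 / (2 * Real.pi) * (81 * ∫ τ : ℝ, (1 + |τ|) ^ (-(1 + η))) + 1, ?_, ?_⟩
  · have : 0 ≤ ∫ τ : ℝ, (1 + |τ|) ^ (-(1 + η)) := integral_nonneg fun τ ↦ by positivity
    have := Real.pi_pos
    positivity
  intro a b t D K hK ha hD hD2 hDb z h hz hh hh1 N hN
  have hz0 : 0 < z := by linarith
  have hz' : (z : ℂ) ≠ 0 := by exact_mod_cast hz0.ne'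
  have ha0 : a 0 = 0 := by simpa using ha 0
  have hsum : LSeriesSummable a (2 : ℝ) := by
    have h1 := LSeriesSummable_vonMangoldt (s := ((2 : ℝ) : ℂ)) (by simp)
    refine Summable.of_norm_bounded h1.norm fun n ↦ ?_
    rw [LSeries.norm_term_eq, LSeries.norm_term_eq]
    split_ifs
    · rfl
    · gcongr
      refine (ha n).trans ?_
      rw [norm_real]
      exact le_abs_self _
  obtain ⟨hi1, he1⟩ := sum_mul_comp_div_eq_mellin ha0 hsum (f := ramp h)
    (mellinConvergent_ramp hh (by simp))
    (verticalIntegrable_mellin_ramp hh hh1 (by norm_num) le_rfl)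
    (fun u _ ↦ (continuous_ramp h).continuousAt) hz0 (N := N) (fun n hn ↦ by
      rw [ramp_of_ge hh, mul_zero]
      rw [le_div_iff₀ hz0]
      have : (N : ℝ) + 1 ≤ n := by exact_mod_cast hn
      nlinarith)
  obtain ⟨hi2, he2⟩ := integral_mul_comp_div_eq_mellin (ν := (volume : Measure ℝ)) (v := id)
    measurable_id (w := (Ioi (1 : ℝ)).indicator fun v ↦ (v : ℂ) ^ (-(t * I))) (fun v hv ↦ by
      have : v ∈ Ioi (1 : ℝ) := by
        by_contra h
        exact hv (indicator_of_notMem h _)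
      simp only [mem_Ioi] at this
      simp only [id]; linarith) (σ := 2) (by
      have : IntegrableOn (fun v : ℝ ↦ (v : ℂ) ^ (-(t * I) + -2)) (Ioi 1) :=
        integrableOn_Ioi_cpow_of_lt (by simp) one_pos
      rw [← integrable_indicator_iff measurableSet_Ioi] at this
      refine this.congr (ae_of_all _ fun v ↦ ?_)
      by_cases hv : v ∈ Ioi (1 : ℝ)
      · have : (v : ℂ) ≠ 0 := by
          have : (0 : ℝ) < v := lt_trans one_pos hv
          exact_mod_cast this.ne'
        simp only [indicator_of_mem hv, id]
        rw [cpow_add _ _ this]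
        norm_num
      · simp [indicator_of_notMem hv]) (f := ramp h)
    (mellinConvergent_ramp hh (by simp))
    (verticalIntegrable_mellin_ramp hh hh1 (by norm_num) le_rfl)
    (fun u _ ↦ (continuous_ramp h).continuousAt) hz0
  have hL2 : ∀ τ : ℝ, ∫ v : ℝ, (Ioi (1 : ℝ)).indicator (fun v : ℝ ↦ (v : ℂ) ^ (-(t * I))) v *
      ((id v : ℝ) : ℂ) ^ (-(((2 : ℝ) : ℂ) + τ * I)) = 1 / ((2 : ℝ) + τ * I + t * I - 1) := by
    intro τ
    have h1 : ∀ v : ℝ, (Ioi (1 : ℝ)).indicator (fun v : ℝ ↦ (v : ℂ) ^ (-(t * I))) v *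
      ((id v : ℝ) : ℂ) ^ (-(((2 : ℝ) : ℂ) + τ * I)) = (Ioi (1 : ℝ)).indicator (fun v : ℝ ↦
        (v : ℂ) ^ (-(t * I) + -((2 : ℝ) + τ * I) : ℂ)) v := by
      intro v
      by_cases hv : v ∈ Ioi (1 : ℝ)
      · have : (v : ℂ) ≠ 0 := by
          have : (0 : ℝ) < v := lt_trans one_pos hv
          exact_mod_cast this.ne'
        simp only [indicator_of_mem hv, id]
        rw [cpow_add _ _ this]
      · simp [indicator_of_notMem hv]
    simp_rw [h1]
    rw [integral_indicator measurableSet_Ioi, integral_Ioi_cpow_of_lt (by simp) one_pos]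
    simp only [ofReal_one, one_cpow]
    rw [neg_div, ← div_neg]
    congr 1
    ring
  simp only [hL2] at hi2 he2
  have hlhs : ∫ v : ℝ, (Ioi (1 : ℝ)).indicator (fun v : ℝ ↦ (v : ℂ) ^ (-(t * I))) v *
      ramp h (id v / z) = ∫ v : ℝ in Ioi (1 : ℝ), (v : ℂ) ^ (-(t * I)) * ramp h (v / z) := by
    rw [← integral_indicator measurableSet_Ioi]
    congr 1
    ext v
    by_cases hv : v ∈ Ioi (1 : ℝ)
    · simp [indicator_of_mem hv]
    · simp [indicator_of_notMem hv]
  rw [hlhs] at he2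
  set G : ℂ → ℂ := fun s ↦ (z : ℂ) ^ s * (((1 + h : ℂ) ^ (s + 1) - 1) / (h * s * (s + 1))) * D s
    with hG
  have hdiff : ∑ n ∈ Finset.Icc 1 N, a n * ramp h (n / z) -
      b * ∫ v : ℝ in Ioi (1 : ℝ), (v : ℂ) ^ (-(t * I)) * ramp h (v / z) =
      (1 / (2 * Real.pi) : ℝ) * ∫ τ : ℝ, G ((2 : ℝ) + τ * I) := by
    rw [he1, he2, mul_left_comm b, ← mul_sub, ← integral_const_mul, ← integral_sub hi1 (hi2.const_mul b)]
    congr 2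
    ext τ
    rw [hG]
    simp only
    rw [hD2, mellin_ramp hh (by simp)]
    ring
  have hGb : ∀ σ τ : ℝ, θ ≤ σ → σ ≤ 2 → ‖G (σ + τ * I)‖ ≤
      z ^ σ * (81 * h ^ (-(2 * η)) * K) * (1 + |τ|) ^ (-(1 + η)) := by
    intro σ τ h1 h2
    have hm := norm_rampMellin_le hh hh1 (η := 2 * η) (by linarith) (by linarith) (s := σ + τ * I)
      (by simp; linarith) (by simpa using h2)
    have hd := hDb σ τ h1 h2
    have hT : 0 < 1 + |τ| := by positivity
    rw [hG]
    simp only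
    rw [norm_mul, norm_mul, norm_cpow_eq_rpow_re_of_pos hz0]
    have e1 : (σ + τ * I : ℂ).re = σ := by simp
    have e2 : (σ + τ * I : ℂ).im = τ := by simp
    rw [e2] at hm
    rw [e1]
    calc _ ≤ z ^ σ * (81 * h ^ (-(2 * η)) * (1 + |τ|) ^ (-(1 + 2 * η))) * (K * (1 + |τ|) ^ η) := by
          gcongr
      _ = z ^ σ * (81 * h ^ (-(2 * η)) * K) * ((1 + |τ|) ^ (-(1 + 2 * η)) * (1 + |τ|) ^ η) := by ring
      _ = _ := by rw [← Real.rpow_add hT]; congr 2; ring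
  have hshift := integral_vertical_eq_of_decay (f := G) (a := θ) (b := 2)
    (B := z ^ (2 : ℝ) * (81 * h ^ (-(2 * η)) * K)) (η := η) (by linarith) hη ?_ ?_
  · rw [hdiff, ← hshift, norm_mul, norm_real, Real.norm_of_nonneg (by positivity)]
    have hn : ‖∫ τ : ℝ, G (θ + τ * I)‖ ≤ ∫ τ : ℝ,
        z ^ θ * (81 * h ^ (-(2 * η)) * K) * (1 + |τ|) ^ (-(1 + η)) :=
      norm_integral_le_of_norm_le ((integrable_one_add_abs_rpow hη).const_mul _)
        (ae_of_all _ fun τ ↦ hGb θ τ le_rfl (by linarith))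
    rw [integral_const_mul] at hn
    set J := ∫ τ : ℝ, (1 + |τ|) ^ (-(1 + η))
    calc 1 / (2 * Real.pi) * ‖∫ τ : ℝ, G (θ + τ * I)‖ ≤
        1 / (2 * Real.pi) * (z ^ θ * (81 * h ^ (-(2 * η)) * K) * J) := by gcongr
      _ = (1 / (2 * Real.pi) * (81 * J)) * K * z ^ θ * h ^ (-(2 * η)) := by ring
      _ ≤ _ := by gcongr; linarith
  · refine DifferentiableOn.mul (DifferentiableOn.mul ?_ ?_) hD
    · intro s _
      exact (differentiableAt_id.const_cpow (Or.inl hz')).differentiableWithinAt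
    · refine (differentiableOn_rampMellin hh).mono fun s hs ↦ ?_
      have : θ ≤ s.re := hs.1
      simp only [mem_ofPred_eq]; linarith
  · intro σ τ h1 h2
    refine (hGb σ τ h1 h2).trans ?_
    gcongr

/-- The primes not exceeding `z`. -/
noncomputable def primesUpTo (z : ℝ) : Finset ℕ := (Finset.Ioc 0 ⌊z⌋₊).filter Nat.Prime

theorem mem_primesUpTo {z : ℝ} {p : ℕ} : p ∈ primesUpTo z ↔ p.Prime ∧ (p : ℝ) ≤ z := by
  rw [primesUpTo, Finset.mem_filter, Finset.mem_Ioc]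
  constructor
  · rintro ⟨⟨h0, h1⟩, h2⟩
    exact ⟨h2, (Nat.le_floor_iff' h0.ne').1 h1⟩
  · rintro ⟨h2, h1⟩
    exact ⟨⟨h2.pos, (Nat.le_floor_iff' h2.ne_zero).2 h1⟩, h2⟩

theorem exists_norm_sum_vonMangoldt_sub_sum_primes_le :
    ∃ C > 0, ∀ c : ℕ → ℂ, (∀ n, ‖c n‖ ≤ 1) → ∀ z : ℝ, 1 ≤ z →
      ‖∑ n ∈ Finset.Icc 1 ⌊z⌋₊, c n * vonMangoldt n - ∑ p ∈ primesUpTo z, c p * Real.log p‖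
        ≤ C * √z := by
  obtain ⟨C, hC⟩ := Chebyshev.psi_sub_theta_le_mul_sqrt
  refine ⟨|C| + 1, by positivity, fun c hc z hz ↦ ?_⟩
  have h1 : ∑ n ∈ Finset.Icc 1 ⌊z⌋₊, c n * vonMangoldt n - ∑ p ∈ primesUpTo z, c p * Real.log p =
      ∑ n ∈ Finset.Ioc 0 ⌊z⌋₊, c n * (vonMangoldt n - if n.Prime then Real.log n else 0 : ℝ) := by
    rw [primesUpTo, Finset.sum_filter, show Finset.Icc 1 ⌊z⌋₊ = Finset.Ioc 0 ⌊z⌋₊ from rfl,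
      ← Finset.sum_sub_distrib]
    refine Finset.sum_congr rfl fun n _ ↦ ?_
    split_ifs <;> push_cast <;> ring
  have h2 : Chebyshev.psi z - Chebyshev.theta z =
      ∑ n ∈ Finset.Ioc 0 ⌊z⌋₊, (vonMangoldt n - if n.Prime then Real.log n else 0 : ℝ) := by
    rw [Chebyshev.psi, Chebyshev.theta, Finset.sum_filter, ← Finset.sum_sub_distrib]
  have h3 : ∀ n, 0 ≤ (vonMangoldt n - if n.Prime then Real.log n else 0 : ℝ) := by
    intro n
    split_ifs with h
    · rw [vonMangoldt_apply_prime h, sub_self]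
    · simp
  rw [h1]
  calc _ ≤ ∑ n ∈ Finset.Ioc 0 ⌊z⌋₊, (vonMangoldt n - if n.Prime then Real.log n else 0 : ℝ) := by
        refine norm_sum_le_of_le _ fun n _ ↦ ?_
        rw [norm_mul, norm_real, Real.norm_of_nonneg (h3 n)]
        exact mul_le_of_le_one_left (h3 n) (hc n)
    _ ≤ C * √z := h2 ▸ hC z
    _ ≤ _ := by
        gcongr
        linarith [le_abs_self C]

theorem exists_norm_sum_primes_sub_integral_le {θ η : ℝ} (hθ : 1 / 2 < θ) (hθ1 : θ ≤ 1)
    (hη : 0 < η) (hη1 : η ≤ 1 / 2) :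
    ∃ C > 0, ∀ (c : ℕ → ℂ) (b : ℂ) (t : ℝ) (D : ℂ → ℂ) (K : ℝ), 1 ≤ K →
      (∀ n, ‖c n‖ ≤ 1) → ‖b‖ ≤ 1 →
      DifferentiableOn ℂ D {s | θ ≤ s.re ∧ s.re ≤ 2} →
      (∀ τ : ℝ, D ((2 : ℝ) + τ * I) = LSeries (fun n ↦ c n * vonMangoldt n) ((2 : ℝ) + τ * I)
        - b / ((2 : ℝ) + τ * I + t * I - 1)) →
      (∀ σ τ : ℝ, θ ≤ σ → σ ≤ 2 → ‖D (σ + τ * I)‖ ≤ K * (1 + |τ|) ^ η) →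
      ∀ z : ℝ, 1 ≤ z →
        ‖∑ p ∈ primesUpTo z, c p * Real.log p - b * ∫ v : ℝ in 1..z, (v : ℂ) ^ (-(t * I))‖
          ≤ C * K * z ^ (θ + η) := by
  obtain ⟨C1, hC1, h1⟩ := norm_smoothed_sum_sub_integral_le hθ hθ1 hη hη1
  obtain ⟨C2, hC2, h2⟩ := exists_norm_sum_vonMangoldt_sub_sum_primes_le
  have hk : 0 < θ - 1 / 2 := by linarith
  refine ⟨C1 + C2 + 4 / (θ - 1 / 2) + 1, by positivity, ?_⟩
  intro c b t D K hK hc hb hD hD2 hDb z hz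
  have hz0 : 0 < z := by linarith
  have hsq1 : 1 ≤ √z := Real.one_le_sqrt.2 hz
  have hsq : 0 < √z := by linarith
  set h : ℝ := (√z)⁻¹ with hh
  have hh0 : 0 < h := inv_pos.2 hsq
  have hh1 : h ≤ 1 := inv_le_one_of_one_le₀ hsq1
  have hzh : z * h = √z := by
    rw [hh, ← div_eq_mul_inv, Real.div_sqrt]
  have hhη : h ^ (-(2 * η)) = z ^ η := by
    rw [hh, Real.sqrt_eq_rpow, ← Real.rpow_neg hz0.le, ← Real.rpow_mul hz0.le]
    congr 1; ring
  set N : ℕ := ⌊2 * z⌋₊ with hN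
  have hN1 : 2 * z ≤ N + 1 := (Nat.lt_floor_add_one _).le
  have hmain := h1 (fun n ↦ c n * vonMangoldt n) b t D K hK (fun n ↦ by
    rw [norm_mul, norm_real, Real.norm_of_nonneg vonMangoldt_nonneg]
    exact mul_le_of_le_one_left vonMangoldt_nonneg (hc n)) hD hD2 hDb z h hz hh0 hh1 N hN1
  rw [hhη, mul_assoc, ← Real.rpow_add hz0] at hmain
  have hp := h2 c hc z hz
  set SP := ∑ p ∈ primesUpTo z, c p * Real.log p
  set SL := ∑ n ∈ Finset.Icc 1 ⌊z⌋₊, c n * vonMangoldt n with hSL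
  set SR := ∑ n ∈ Finset.Icc 1 N, c n * vonMangoldt n * ramp h (n / z) with hSR
  set JR := ∫ v : ℝ in Ioi (1 : ℝ), (v : ℂ) ^ (-(t * I)) * ramp h (v / z) with hJR
  set JZ := ∫ v : ℝ in 1..z, (v : ℂ) ^ (-(t * I)) with hJZ
  have hle1 : ∀ u : ℝ, u ≤ z → ramp h (u / z) = 1 := fun u hu ↦
    ramp_of_le_one hh0 ((div_le_one hz0).2 hu)
  have hge1 : ∀ u : ℝ, z + √z ≤ u → ramp h (u / z) = 0 := fun u hu ↦
    ramp_of_ge hh0 (by rw [le_div_iff₀ hz0, ← hzh] at *; linarith)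
  have hlog2z : 0 ≤ Real.log (2 * z) := Real.log_nonneg (by linarith)
  have hA : ‖SR - SL‖ ≤ Real.log (2 * z) * (√z + 1) := by
    have hsub : Finset.Icc 1 ⌊z⌋₊ ⊆ Finset.Icc 1 N :=
      Finset.Icc_subset_Icc_right (Nat.floor_mono (by linarith))
    have e1 : SR = ∑ n ∈ Finset.Icc 1 N \ Finset.Icc 1 ⌊z⌋₊,
        c n * vonMangoldt n * ramp h (n / z) + SL := by
      rw [hSR, ← Finset.sum_sdiff hsub, hSL]
      congr 1
      refine Finset.sum_congr rfl fun n hn ↦ ?_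
      rw [Finset.mem_Icc] at hn
      rw [hle1 n ((Nat.le_floor_iff hz0.le).1 hn.2), mul_one]
    rw [e1, add_sub_cancel_right]
    have e2 : ∑ n ∈ Finset.Icc 1 N \ Finset.Icc 1 ⌊z⌋₊, c n * vonMangoldt n * ramp h (n / z) =
        ∑ n ∈ (Finset.Icc 1 N \ Finset.Icc 1 ⌊z⌋₊).filter (fun n : ℕ ↦ (n : ℝ) < z + √z),
          c n * vonMangoldt n * ramp h (n / z) := by
      rw [Finset.sum_filter]
      refine Finset.sum_congr rfl fun n _ ↦ ?_
      split_ifs with h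
      · rfl
      · rw [hge1 n (not_lt.1 h), mul_zero]
    rw [e2]
    have e3 : ((Finset.Icc 1 N \ Finset.Icc 1 ⌊z⌋₊).filter (fun n : ℕ ↦ (n : ℝ) < z + √z)) ⊆
        Finset.Ioc ⌊z⌋₊ ⌊z + √z⌋₊ := by
      intro n hn
      simp only [Finset.mem_filter, Finset.mem_sdiff, Finset.mem_Icc] at hn
      rw [Finset.mem_Ioc]
      refine ⟨by omega, Nat.le_floor hn.2.le⟩
    have e4 : (((Finset.Icc 1 N \ Finset.Icc 1 ⌊z⌋₊).filter
        (fun n : ℕ ↦ (n : ℝ) < z + √z)).card : ℝ) ≤ √z + 1 := by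
      have h5 := Finset.card_le_card e3
      rw [Nat.card_Ioc] at h5
      have h6 : ⌊z⌋₊ ≤ ⌊z + √z⌋₊ := Nat.floor_mono (by linarith)
      have h7 : (((Finset.Icc 1 N \ Finset.Icc 1 ⌊z⌋₊).filter
        (fun n : ℕ ↦ (n : ℝ) < z + √z)).card : ℝ) ≤ (⌊z + √z⌋₊ : ℝ) - ⌊z⌋₊ := by
        rw [← Nat.cast_sub h6]
        exact_mod_cast h5
      have h8 := Nat.floor_le (show 0 ≤ z + √z by positivity)
      have h9 := Nat.lt_floor_add_one z
      linarith
    refine (norm_sum_le_of_le (f := fun n ↦ c n * vonMangoldt n * ramp h (n / z)) _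
      (n := fun _ ↦ Real.log (2 * z)) fun n hn ↦ ?_).trans ?_
    · simp only [Finset.mem_filter, Finset.mem_sdiff, Finset.mem_Icc] at hn
      rw [norm_mul, norm_mul, norm_real, Real.norm_of_nonneg vonMangoldt_nonneg]
      have h5 : (vonMangoldt n : ℝ) ≤ Real.log (2 * z) := by
        refine vonMangoldt_le_log.trans (Real.log_le_log ?_ ?_)
        · exact_mod_cast hn.1.1.1
        · exact (Nat.le_floor_iff (by linarith)).1 hn.1.1.2
      calc ‖c n‖ * vonMangoldt n * ‖ramp h (n / z)‖ ≤ 1 * Real.log (2 * z) * 1 := by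
            gcongr
            · exact hc n
            · exact norm_ramp_le _ _
        _ = _ := by ring
    · rw [Finset.sum_const, nsmul_eq_mul, mul_comm]
      gcongr
  have hB : ‖JR - JZ‖ ≤ √z := by
    have hci : ∀ u w : ℝ, 1 ≤ u → u ≤ w → IntervalIntegrable
        (fun v : ℝ ↦ (v : ℂ) ^ (-(t * I)) * ramp h (v / z)) volume u w := by
      intro u w hu huw
      refine ContinuousOn.intervalIntegrable fun v hv ↦ ?_
      rw [uIcc_of_le huw] at hv
      refine ContinuousAt.continuousWithinAt (ContinuousAt.mul ?_ ?_)
      · exact continuousAt_ofReal_cpow_const _ _ (Or.inr (by linarith [hv.1]))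
      · exact ((continuous_ramp h).comp (continuous_id.div_const z)).continuousAt
    have e1 : JR = ∫ v in 1..(z + √z), (v : ℂ) ^ (-(t * I)) * ramp h (v / z) := by
      rw [intervalIntegral.integral_of_le (by linarith), hJR]
      refine (setIntegral_eq_of_subset_of_forall_sdiff_eq_zero measurableSet_Ioi
        Ioc_subset_Ioi_self fun v hv ↦ ?_)
      rw [hge1 v, mul_zero]
      by_contra hlt
      exact hv.2 ⟨hv.1, (not_le.1 hlt).le⟩
    have e2 : JZ = ∫ v in 1..z, (v : ℂ) ^ (-(t * I)) * ramp h (v / z) := by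
      refine intervalIntegral.integral_congr fun v hv ↦ ?_
      rw [uIcc_of_le hz] at hv
      simp only [hle1 v hv.2, mul_one]
    rw [e1, e2, ← intervalIntegral.integral_add_adjacent_intervals (hci 1 z le_rfl hz)
      (hci z (z + √z) hz (by linarith)), add_sub_cancel_left]
    refine (intervalIntegral.norm_integral_le_of_norm_le_const (C := 1) fun v hv ↦ ?_).trans ?_
    · rw [uIoc_of_le (by linarith)] at hv
      rw [norm_mul, norm_cpow_eq_rpow_re_of_pos (by linarith [hv.1])]
      simpa using norm_ramp_le _ _
    · rw [add_sub_cancel_left, abs_of_pos hsq, one_mul]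
  have hsqle : √z ≤ z ^ (θ + η) := by
    rw [Real.sqrt_eq_rpow]
    exact Real.rpow_le_rpow_of_exponent_le hz (by linarith)
  have hlogle : Real.log (2 * z) * (√z + 1) ≤ 4 / (θ - 1 / 2) * z ^ (θ + η) := by
    have h5 := Real.log_le_rpow_div (show 0 ≤ 2 * z by positivity) hk
    have h6 : (2 * z) ^ (θ - 1 / 2) ≤ 2 * z ^ (θ - 1 / 2) := by
      rw [Real.mul_rpow (by norm_num) hz0.le]
      gcongr
      calc (2 : ℝ) ^ (θ - 1 / 2) ≤ 2 ^ (1 : ℝ) :=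
            Real.rpow_le_rpow_of_exponent_le one_le_two (by linarith)
        _ = 2 := Real.rpow_one _
    have h7 : z ^ (θ - 1 / 2) * √z ≤ z ^ (θ + η) := by
      rw [Real.sqrt_eq_rpow, ← Real.rpow_add hz0]
      exact Real.rpow_le_rpow_of_exponent_le hz (by linarith)
    calc Real.log (2 * z) * (√z + 1) ≤ (2 * z ^ (θ - 1 / 2) / (θ - 1 / 2)) * (2 * √z) := by
          gcongr
          · exact h5.trans (by gcongr)
          · linarith
      _ = 4 / (θ - 1 / 2) * (z ^ (θ - 1 / 2) * √z) := by ring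
      _ ≤ _ := by gcongr
  have e : SP - b * JZ = (SR - b * JR) - (SR - SL) - (SL - SP) + b * (JR - JZ) := by ring
  rw [e]
  have hbJ : ‖b * (JR - JZ)‖ ≤ √z := by
    rw [norm_mul]
    exact (mul_le_of_le_one_left (norm_nonneg _) hb).trans hB
  have hzp : 0 ≤ z ^ (θ + η) := by positivity
  calc _ ≤ ‖SR - b * JR‖ + ‖SR - SL‖ + ‖SL - SP‖ + ‖b * (JR - JZ)‖ := by
        refine (norm_add_le _ _).trans ?_
        gcongr
        refine (norm_sub_le _ _).trans ?_
        gcongr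
        exact norm_sub_le _ _
    _ ≤ C1 * K * z ^ (θ + η) + 4 / (θ - 1 / 2) * z ^ (θ + η) + C2 * z ^ (θ + η) + z ^ (θ + η) := by
        gcongr
        · exact hA.trans hlogle
        · exact hp.trans (mul_le_mul_of_nonneg_left hsqle hC2.le)
        · exact hbJ.trans hsqle
    _ = (C1 * K + (4 / (θ - 1 / 2) + C2 + 1)) * z ^ (θ + η) := by ring
    _ ≤ (C1 * K + (4 / (θ - 1 / 2) + C2 + 1) * K) * z ^ (θ + η) := by
        gcongr
        exact le_mul_of_one_le_right (by positivity) hK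
    _ = _ := by ring

theorem log_mul_add_two_le {q t τ η : ℝ} (hq : 1 ≤ q) (hη : 0 < η) :
    Real.log (q * (|τ + t| + 2)) ≤ (1 + 2 / η) * Real.log (q * (|t| + 2)) * (1 + |τ|) ^ η := by
  have ht := abs_nonneg t
  have hτ := abs_nonneg τ
  have h2 : 2 ≤ q * (|t| + 2) := by nlinarith
  have hlog : 1 / 2 ≤ Real.log (q * (|t| + 2)) := by
    have h1 := Real.log_le_log (by norm_num) h2
    have := Real.log_two_gt_d9
    linarith
  have h3 : q * (|τ + t| + 2) ≤ q * (|t| + 2) * (1 + |τ|) := by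
    have := abs_add_le τ t
    have : q * (|τ + t| + 2) ≤ q * ((|t| + 2) * (1 + |τ|)) := by
      gcongr
      nlinarith
    linarith
  have h4 : 1 ≤ (1 + |τ|) ^ η := Real.one_le_rpow (by linarith) hη.le
  have h5 := Real.log_le_rpow_div (show 0 ≤ 1 + |τ| by positivity) hη
  calc Real.log (q * (|τ + t| + 2)) ≤ Real.log (q * (|t| + 2) * (1 + |τ|)) :=
        Real.log_le_log (by positivity) h3
    _ = Real.log (q * (|t| + 2)) + Real.log (1 + |τ|) :=
        Real.log_mul (by positivity) (by positivity)
    _ ≤ Real.log (q * (|t| + 2)) * (1 + |τ|) ^ η +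
        (2 * Real.log (q * (|t| + 2))) * ((1 + |τ|) ^ η / η) := by
        gcongr
        · exact le_mul_of_one_le_right (by linarith) h4
        · exact h5.trans (le_mul_of_one_le_left (by positivity) (by linarith))
    _ = _ := by ring

theorem mul_cpow_neg_term {c : ℕ → ℂ} {u s : ℂ} (n : ℕ) :
    LSeries.term (fun n ↦ c n * (n : ℂ) ^ (-u) * vonMangoldt n) s n =
      LSeries.term (fun n ↦ c n * vonMangoldt n) (s + u) n := by
  rcases eq_or_ne n 0 with rfl | hn
  · simp
  · have hn' : (n : ℂ) ≠ 0 := by exact_mod_cast hn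
    rw [LSeries.term_of_ne_zero hn, LSeries.term_of_ne_zero hn, cpow_add _ _ hn', cpow_neg]
    field_simp

theorem norm_mul_cpow_neg_mul_I_le {c : ℕ → ℂ} (hc : ∀ n, ‖c n‖ ≤ 1) (t : ℝ) (n : ℕ) :
    ‖c n * (n : ℂ) ^ (-(t * I))‖ ≤ 1 := by
  rcases eq_or_ne n 0 with rfl | hn
  · rw [norm_mul]
    refine mul_le_one₀ (hc 0) (norm_nonneg _) ?_
    by_cases ht : t = 0
    · simp [ht]
    · rw [Nat.cast_zero, zero_cpow (by simp [ht])]; simp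
  · rw [norm_mul, norm_natCast_cpow_of_pos (Nat.pos_of_ne_zero hn)]
    simpa using hc n

theorem exists_norm_sum_char_primes_le (hGRH : GRH) {θ : ℝ} (hθ : 1 / 2 < θ) (hθ1 : θ ≤ 1) :
    ∃ C > 0, ∀ (q : ℕ) [NeZero q] (χ : DirichletCharacter ℂ q), χ ≠ 1 → ∀ t z : ℝ, 1 ≤ z →
      ‖∑ p ∈ primesUpTo z, χ p * (p : ℂ) ^ (-(t * I)) * Real.log p‖
        ≤ C * Real.log (q * (|t| + 2)) * z ^ θ := by
  set θ' := (θ + 1 / 2) / 2 with hθ'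
  set η := θ - θ' with hη
  have hηpos : 0 < η := by linarith
  obtain ⟨C1, hC1, h1⟩ := exists_norm_logDeriv_LFunction_le hGRH (θ := θ') (by linarith) (by linarith)
  obtain ⟨C2, hC2, h2⟩ := exists_norm_sum_primes_sub_integral_le (θ := θ') (η := η) (by linarith)
    (by linarith) hηpos (by linarith)
  refine ⟨C2 * (2 + C1 * (1 + 2 / η)), by positivity, fun q _ χ hχ t z hz ↦ ?_⟩
  have hq : (1 : ℝ) ≤ q := by exact_mod_cast NeZero.one_le
  have hl : 1 / 2 ≤ Real.log (q * (|t| + 2)) := by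
    have h2 : 2 ≤ q * (|t| + 2) := by nlinarith [abs_nonneg t]
    have h1 := Real.log_le_log (by norm_num) h2
    have := Real.log_two_gt_d9
    linarith
  have key := h2 (fun n ↦ χ n * (n : ℂ) ^ (-(t * I))) 0 t
    (fun s ↦ -(deriv χ.LFunction (s + t * I) / χ.LFunction (s + t * I)))
    ((2 + C1 * (1 + 2 / η)) * Real.log (q * (|t| + 2))) ?_
    (norm_mul_cpow_neg_mul_I_le (fun n ↦ χ.norm_le_one _) t) (by simp) ?_ ?_ ?_ z hz
  · rw [zero_mul, sub_zero, show θ' + η = θ by ring] at key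
    exact key.trans (le_of_eq (by ring))
  · have : 0 ≤ C1 * (1 + 2 / η) := by positivity
    nlinarith
  · have hd : Differentiable ℂ χ.LFunction := DirichletCharacter.differentiable_LFunction hχ
    have hd' : Differentiable ℂ (deriv χ.LFunction) := hd.deriv
    intro s hs
    have : θ' ≤ s.re := hs.1
    refine DifferentiableAt.differentiableWithinAt (DifferentiableAt.neg (DifferentiableAt.div ?_ ?_ ?_))
    · exact DifferentiableAt.comp s (hd' _) (by fun_prop)
    · exact DifferentiableAt.comp s (hd _) (by fun_prop)
    · exact LFunction_ne_zero_of_GRH hGRH hχ (by simp; linarith)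
  · intro τ
    have h2re : 1 < ((2 : ℝ) + τ * I + t * I : ℂ).re := by simp
    have e1 := χ.LSeries_twist_vonMangoldt_eq h2re
    have hev : χ.LFunction =ᶠ[𝓝 ((2 : ℝ) + τ * I + t * I : ℂ)] LSeries (fun n ↦ χ n) := by
      filter_upwards [(isOpen_lt continuous_const continuous_re).mem_nhds h2re] with w hw
      exact χ.LFunction_eq_LSeries hw
    rw [hev.deriv_eq, hev.eq_of_nhds, zero_div, sub_zero, ← neg_div, ← e1]
    exact tsum_congr fun n ↦ (mul_cpow_neg_term n).symm
  · intro σ τ hσ1 hσ2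
    rw [norm_neg]
    refine (h1 q χ hχ _ (by simpa using hσ1) (by simpa using hσ2)).trans ?_
    have e1 : (σ + τ * I + t * I : ℂ).im = τ + t := by simp
    rw [e1]
    have h3 := log_mul_add_two_le (t := t) (τ := τ) hq hηpos
    have h4 : 0 ≤ (1 + |τ|) ^ η := by positivity
    calc _ ≤ C1 * ((1 + 2 / η) * Real.log (q * (|t| + 2)) * (1 + |τ|) ^ η) := by gcongr
      _ = (C1 * (1 + 2 / η)) * Real.log (q * (|t| + 2)) * (1 + |τ|) ^ η := by ring
      _ ≤ _ := by gcongr; linarith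

theorem exists_norm_sum_primes_cpow_sub_integral_le (hGRH : GRH) {θ : ℝ} (hθ : 1 / 2 < θ)
    (hθ1 : θ ≤ 1) :
    ∃ C > 0, ∀ t z : ℝ, 1 ≤ z →
      ‖∑ p ∈ primesUpTo z, (p : ℂ) ^ (-(t * I)) * Real.log p - ∫ v : ℝ in 1..z, (v : ℂ) ^ (-(t * I))‖
        ≤ C * Real.log (|t| + 2) * z ^ θ := by
  set θ' := (θ + 1 / 2) / 2 with hθ'
  set η := θ - θ' with hη
  have hηpos : 0 < η := by linarith
  obtain ⟨C1, hC1, h1⟩ := exists_norm_logDeriv_zetaAux_le hGRH (θ := θ') (by linarith) (by linarith)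
  obtain ⟨C2, hC2, h2⟩ := exists_norm_sum_primes_sub_integral_le (θ := θ') (η := η) (by linarith)
    (by linarith) hηpos (by linarith)
  refine ⟨C2 * (2 + C1 * (1 + 2 / η)), by positivity, fun t z hz ↦ ?_⟩
  have hl : 1 / 2 ≤ Real.log (|t| + 2) := by
    have h2 : 2 ≤ |t| + 2 := by linarith [abs_nonneg t]
    have h1 := Real.log_le_log (by norm_num) h2
    have := Real.log_two_gt_d9
    linarith
  have key := h2 (fun n ↦ 1 * (n : ℂ) ^ (-(t * I))) 1 t
    (fun s ↦ -(deriv zetaAux (s + t * I) / zetaAux (s + t * I)))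
    ((2 + C1 * (1 + 2 / η)) * Real.log (|t| + 2)) ?_
    (norm_mul_cpow_neg_mul_I_le (c := fun _ ↦ 1) (by simp) t) (by simp) ?_ ?_ ?_ z hz
  · simp only [one_mul] at key
    rw [show θ' + η = θ by ring] at key
    exact key.trans (le_of_eq (by ring))
  · have : 0 ≤ C1 * (1 + 2 / η) := by positivity
    nlinarith
  · have hd : Differentiable ℂ zetaAux := differentiable_zetaAux
    have hd' : Differentiable ℂ (deriv zetaAux) := hd.deriv
    intro s hs
    have : θ' ≤ s.re := hs.1
    refine DifferentiableAt.differentiableWithinAt (DifferentiableAt.neg (DifferentiableAt.div ?_ ?_ ?_))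
    · exact DifferentiableAt.comp s (hd' _) (by fun_prop)
    · exact DifferentiableAt.comp s (hd _) (by fun_prop)
    · exact zetaAux_ne_zero_of_GRH hGRH (by simp; linarith)
  · intro τ
    have h2re : 1 < ((2 : ℝ) + τ * I + t * I : ℂ).re := by simp
    rw [LSeries_vonMangoldt_eq_zetaAux h2re]
    congr 1
    refine tsum_congr fun n ↦ ?_
    rw [mul_cpow_neg_term (c := fun _ ↦ 1)]
    simp
  · intro σ τ hσ1 hσ2
    rw [norm_neg]
    refine (h1 _ (by simpa using hσ1) (by simpa using hσ2)).trans ?_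
    have e1 : (σ + τ * I + t * I : ℂ).im = τ + t := by simp
    rw [e1]
    have h3 := log_mul_add_two_le (q := 1) (t := t) (τ := τ) le_rfl hηpos
    rw [one_mul, one_mul] at h3
    have h4 : 0 ≤ (1 + |τ|) ^ η := by positivity
    calc _ ≤ C1 * ((1 + 2 / η) * Real.log (|t| + 2) * (1 + |τ|) ^ η) := by gcongr
      _ = (C1 * (1 + 2 / η)) * Real.log (|t| + 2) * (1 + |τ|) ^ η := by ring
      _ ≤ _ := by gcongr; linarith

end SmoothSum

namespace SmoothSum

open Complex Set Filter Topology MeasureTheory Metric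

theorem norm_sum_mul_sub_integral_mul_le {c : ℕ → ℂ} {G g : ℝ → ℂ} {f f' : ℝ → ℝ}
    {a b K D σ θ : ℝ} (ha : 1 ≤ a) (hab : a ≤ b) (hθ : θ < σ) (hK : 0 ≤ K) (hD : 0 ≤ D)
    (hG : ∀ u ∈ Icc a b, HasDerivAt G (g u) u) (hg : ContinuousOn g (Icc a b))
    (hf : ∀ u ∈ Icc a b, HasDerivAt f (f' u) u) (hf' : ContinuousOn f' (Icc a b))
    (hE : ∀ u ∈ Icc a b, ‖∑ k ∈ Finset.Icc 0 ⌊u⌋₊, c k - G u‖ ≤ K * u ^ θ)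
    (hfD : ∀ u ∈ Icc a b, |f u| ≤ D * u ^ (-σ))
    (hfD' : ∀ u ∈ Icc a b, |f' u| ≤ D * u ^ (-σ - 1)) :
    ‖∑ k ∈ Finset.Ioc ⌊a⌋₊ ⌊b⌋₊, (f k : ℂ) * c k - ∫ u in a..b, (f u : ℂ) * g u‖ ≤
      K * D * a ^ (θ - σ) * (2 + 1 / (σ - θ)) := by
  have hfc : ∀ u ∈ Icc a b, HasDerivAt (fun u : ℝ ↦ (f u : ℂ)) (f' u : ℂ) u :=
    fun u hu ↦ (hf u hu).ofReal_comp
  have hfcc : ContinuousOn (fun u : ℝ ↦ (f' u : ℂ)) (Icc a b) :=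
    continuous_ofReal.comp_continuousOn hf'
  have hdint : IntegrableOn (deriv fun u : ℝ ↦ (f u : ℂ)) (Icc a b) :=
    (hfcc.integrableOn_Icc).congr_fun (fun u hu ↦ ((hfc u hu).deriv).symm) measurableSet_Icc
  have h1 := sum_mul_eq_sub_sub_integral_mul (f := fun u : ℝ ↦ (f u : ℂ)) c (by linarith) hab
    (fun u hu ↦ (hfc u hu).differentiableAt) hdint
  have huIcc : uIcc a b = Icc a b := uIcc_of_le hab
  have h2 := intervalIntegral.integral_mul_deriv_eq_deriv_mul (u := fun u : ℝ ↦ (f u : ℂ))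
    (v := G) (u' := fun u ↦ (f' u : ℂ)) (v' := g) (a := a) (b := b) (by rwa [huIcc])
    (by rwa [huIcc]) (ContinuousOn.intervalIntegrable (by rwa [huIcc]))
    (ContinuousOn.intervalIntegrable (by rwa [huIcc]))
  have hGc : ContinuousOn G (Icc a b) := fun u hu ↦ (hG u hu).continuousAt.continuousWithinAt
  have h3 : IntegrableOn (fun u ↦ deriv (fun u : ℝ ↦ (f u : ℂ)) u *
      ∑ k ∈ Finset.Icc 0 ⌊u⌋₊, c k) (Ioc a b) :=
    (integrableOn_mul_sum_Icc (m := 0) c (by linarith) hdint).mono_set Ioc_subset_Icc_self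
  have h4 : IntegrableOn (fun u ↦ (f' u : ℂ) * G u) (Ioc a b) :=
    ((hfcc.mul hGc).integrableOn_Icc).mono_set Ioc_subset_Icc_self
  have h5 : (∫ u in Ioc a b, deriv (fun u : ℝ ↦ (f u : ℂ)) u * ∑ k ∈ Finset.Icc 0 ⌊u⌋₊, c k) -
      ∫ u in a..b, (f' u : ℂ) * G u =
      ∫ u in Ioc a b, (f' u : ℂ) * (∑ k ∈ Finset.Icc 0 ⌊u⌋₊, c k - G u) := by
    rw [intervalIntegral.integral_of_le hab, ← integral_sub h3 h4]
    refine setIntegral_congr_fun measurableSet_Ioc fun u hu ↦ ?_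
    rw [(hfc u (Ioc_subset_Icc_self hu)).deriv]
    ring
  have h6 : ∑ k ∈ Finset.Ioc ⌊a⌋₊ ⌊b⌋₊, (f k : ℂ) * c k - ∫ u in a..b, (f u : ℂ) * g u =
      (f b : ℂ) * (∑ k ∈ Finset.Icc 0 ⌊b⌋₊, c k - G b) -
      (f a : ℂ) * (∑ k ∈ Finset.Icc 0 ⌊a⌋₊, c k - G a) -
      ∫ u in Ioc a b, (f' u : ℂ) * (∑ k ∈ Finset.Icc 0 ⌊u⌋₊, c k - G u) := by
    rw [h1, h2, ← h5]; ring
  have ha0 : 0 < a := by linarith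
  have hmem : ∀ u ∈ Icc a b, ‖(f u : ℂ) * (∑ k ∈ Finset.Icc 0 ⌊u⌋₊, c k - G u)‖ ≤
      K * D * a ^ (θ - σ) := by
    intro u hu
    have hu0 : 0 < u := ha0.trans_le hu.1
    rw [norm_mul, norm_real, Real.norm_eq_abs]
    calc _ ≤ (D * u ^ (-σ)) * (K * u ^ θ) := by
          gcongr
          · exact hfD u hu
          · exact hE u hu
      _ = K * D * (u ^ (-σ) * u ^ θ) := by ring
      _ = K * D * u ^ (θ - σ) := by rw [← Real.rpow_add hu0]; congr 2; ring
      _ ≤ _ := by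
          refine mul_le_mul_of_nonneg_left ?_ (by positivity)
          exact Real.rpow_le_rpow_of_nonpos ha0 hu.1 (by linarith)
  have hintg : ‖∫ u in Ioc a b, (f' u : ℂ) * (∑ k ∈ Finset.Icc 0 ⌊u⌋₊, c k - G u)‖ ≤
      K * D * (a ^ (θ - σ) / (σ - θ)) := by
    have hI : IntegrableOn (fun u : ℝ ↦ u ^ (θ - σ - 1)) (Ioi a) :=
      integrableOn_Ioi_rpow_of_lt (by linarith) ha0
    have hval := integral_Ioi_rpow_of_lt (a := θ - σ - 1) (by linarith) ha0
    calc _ ≤ ∫ u in Ioc a b, K * D * u ^ (θ - σ - 1) := by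
          refine norm_integral_le_of_norm_le ((hI.mono_set Ioc_subset_Ioi_self).const_mul _) ?_
          refine (ae_restrict_iff' measurableSet_Ioc).2 (ae_of_all _ fun u hu ↦ ?_)
          have hu' := Ioc_subset_Icc_self hu
          have hu0 : 0 < u := ha0.trans_le hu'.1
          rw [norm_mul, norm_real, Real.norm_eq_abs]
          calc _ ≤ (D * u ^ (-σ - 1)) * (K * u ^ θ) := by
                gcongr
                · exact hfD' u hu'
                · exact hE u hu'
            _ = K * D * (u ^ (-σ - 1) * u ^ θ) := by ring
            _ = _ := by rw [← Real.rpow_add hu0]; congr 2; ring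
      _ ≤ ∫ u in Ioi a, K * D * u ^ (θ - σ - 1) := by
          refine setIntegral_mono_set (hI.const_mul _) ?_ Ioc_subset_Ioi_self.eventuallyLE
          refine (ae_restrict_iff' measurableSet_Ioi).2 (ae_of_all _ fun u hu ↦ ?_)
          have : 0 < u := ha0.trans hu
          simp only [Pi.zero_apply]; positivity
      _ = _ := by
          rw [integral_const_mul, hval]
          have : σ - θ ≠ 0 := by linarith
          have h' : θ - σ - 1 + 1 = -(σ - θ) := by ring
          have h'' : θ - σ = -(σ - θ) := by ring
          rw [h', h'', neg_div_neg_eq]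
  rw [h6]
  calc _ ≤ K * D * a ^ (θ - σ) + K * D * a ^ (θ - σ) + K * D * (a ^ (θ - σ) / (σ - θ)) :=
        (norm_sub_le _ _).trans (add_le_add ((norm_sub_le _ _).trans (add_le_add
          (hmem b ⟨hab, le_rfl⟩) (hmem a ⟨le_rfl, hab⟩))) hintg)
    _ = _ := by ring

theorem sum_Icc_ite_prime (u : ℕ → ℂ) (z : ℝ) :
    ∑ k ∈ Finset.Icc 0 ⌊z⌋₊, (if k.Prime then u k else 0) = ∑ p ∈ primesUpTo z, u p := by
  rw [primesUpTo, Finset.sum_filter]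
  refine (Finset.sum_subset (fun k hk ↦ ?_) fun k _ hk ↦ ?_).symm
  · simp only [Finset.mem_Ioc, Finset.mem_Icc] at *; omega
  · have : k = 0 := by
      simp only [Finset.mem_Ioc, Finset.mem_Icc] at *; omega
    simp [this, Nat.not_prime_zero]

theorem exists_norm_sum_primes_cpow_mul_log_sub_integral_le (hGRH : GRH) {σ₀ : ℝ}
    (h0 : 1 / 2 < σ₀) (h1 : σ₀ ≤ 1) :
    ∃ C > 0, ∀ σ t y : ℝ, σ₀ ≤ σ → σ ≤ 1 → 1 ≤ y →
      ‖∑ p ∈ primesUpTo y, (p : ℂ) ^ (-(σ + t * I)) * Real.log p -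
        ∫ v : ℝ in 1..y, (v : ℂ) ^ (-(σ + t * I))‖ ≤ C * Real.log (|t| + 2) := by
  set θ := (1 / 2 + σ₀) / 2 with hθ
  obtain ⟨C, hC, H⟩ := exists_norm_sum_primes_cpow_sub_integral_le hGRH (θ := θ)
    (by linarith) (by linarith)
  refine ⟨C * (2 + 1 / (σ₀ - θ)), ?_, ?_⟩
  · have : 0 < σ₀ - θ := by linarith
    positivity
  intro σ t y hσ hσ1 hy
  have hlog : 0 < Real.log (|t| + 2) := Real.log_pos (by linarith [abs_nonneg t])
  have hcont : ∀ w : ℂ, ContinuousOn (fun v : ℝ ↦ (v : ℂ) ^ w) (Ioi 0) := fun w v hv ↦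
    ((continuousAt_cpow_const (a := (v : ℂ)) (b := w) (Or.inl (by simpa using hv))).comp continuous_ofReal.continuousAt).continuousWithinAt
  have key := norm_sum_mul_sub_integral_mul_le (a := 1) (b := y) (σ := σ) (θ := θ)
    (K := C * Real.log (|t| + 2)) (D := 1)
    (c := fun k ↦ if k.Prime then (k : ℂ) ^ (-(t * I)) * Real.log k else 0)
    (G := fun u ↦ ∫ v : ℝ in 1..u, (v : ℂ) ^ (-(t * I))) (g := fun v ↦ (v : ℂ) ^ (-(t * I)))
    (f := fun u ↦ u ^ (-σ)) (f' := fun u ↦ -σ * u ^ (-σ - 1)) le_rfl hy (by linarith)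
    (by positivity) zero_le_one ?_ ?_ ?_ ?_ ?_ ?_ ?_
  · have e1 : ∑ k ∈ Finset.Ioc ⌊(1 : ℝ)⌋₊ ⌊y⌋₊, (((k : ℝ) ^ (-σ) : ℝ) : ℂ) *
        (if k.Prime then (k : ℂ) ^ (-(t * I)) * Real.log k else 0) =
        ∑ p ∈ primesUpTo y, (p : ℂ) ^ (-(σ + t * I)) * Real.log p := by
      rw [primesUpTo, Finset.sum_filter]
      refine Finset.sum_subset_zero_on_sdiff (fun k hk ↦ ?_) (fun k hk ↦ ?_) fun k hk ↦ ?_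
      · simp only [Nat.floor_one, Finset.mem_Ioc] at *; omega
      · have : k = 1 := by
          simp only [Nat.floor_one, Finset.mem_Ioc, Finset.mem_sdiff] at *; omega
        simp [this, Nat.not_prime_one]
      · split_ifs with hk
        · have : (k : ℂ) ≠ 0 := by exact_mod_cast hk.ne_zero
          rw [neg_add, cpow_add _ _ this, ofReal_cpow (by positivity)]
          push_cast
          ring
        · simp
    have e2 : ∫ u : ℝ in 1..y, ((u ^ (-σ) : ℝ) : ℂ) * (u : ℂ) ^ (-(t * I)) =
        ∫ v : ℝ in 1..y, (v : ℂ) ^ (-(σ + t * I)) := by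
      refine intervalIntegral.integral_congr fun u hu ↦ ?_
      rw [uIcc_of_le hy] at hu
      have hu0 : 0 < u := by linarith [hu.1]
      have : (u : ℂ) ≠ 0 := by exact_mod_cast hu0.ne'
      rw [neg_add, cpow_add _ _ this, ofReal_cpow hu0.le]
      push_cast
      ring
    rw [e1, e2, Real.one_rpow] at key
    refine key.trans ?_
    have h2 : 0 < σ₀ - θ := by linarith
    have : 1 / (σ - θ) ≤ 1 / (σ₀ - θ) := by gcongr
    calc _ = C * Real.log (|t| + 2) * (2 + 1 / (σ - θ)) := by ring
      _ ≤ C * Real.log (|t| + 2) * (2 + 1 / (σ₀ - θ)) := by gcongr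
      _ = _ := by ring
  · intro u hu
    have hu0 : 0 < u := by linarith [hu.1]
    refine intervalIntegral.integral_hasDerivAt_right
      (ContinuousOn.intervalIntegrable ((hcont _).mono ?_))
      ((hcont _).stronglyMeasurableAtFilter isOpen_Ioi _ hu0)
      ((hcont _).continuousAt (Ioi_mem_nhds hu0))
    rw [uIcc_of_le hu.1]
    exact fun v hv ↦ lt_of_lt_of_le one_pos hv.1
  · exact (hcont _).mono fun v hv ↦ lt_of_lt_of_le one_pos hv.1
  · intro u hu
    have hu0 : 0 < u := by linarith [hu.1]
    exact Real.hasDerivAt_rpow_const (Or.inl hu0.ne')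
  · refine continuousOn_const.mul (ContinuousOn.rpow_const continuousOn_id fun u hu ↦ Or.inl ?_)
    exact (lt_of_lt_of_le one_pos hu.1).ne'
  · intro u hu
    rw [sum_Icc_ite_prime (fun k ↦ (k : ℂ) ^ (-(t * I)) * Real.log k)]
    exact H t u hu.1
  · intro u hu
    have hu0 : 0 < u := by linarith [hu.1]
    rw [one_mul, abs_of_nonneg (by positivity)]
  · intro u hu
    have hu0 : 0 < u := by linarith [hu.1]
    rw [abs_mul, abs_neg, abs_of_nonneg (by linarith : 0 ≤ σ), abs_of_nonneg (by positivity)]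
    gcongr

end SmoothSum

namespace SmoothSum

open Complex Set Filter Topology MeasureTheory Metric

theorem exists_mul_rpow_le {A r ε : ℝ} (hA : 0 < A) (hr : 0 ≤ r) (hr1 : r < 1) (hε : 0 < ε) :
    ∃ C > 0, ∀ L : ℝ, 0 < L → A * L ^ r ≤ ε * L + C := by
  set B := (A / ε) ^ (1 / (1 - r)) with hB
  have hB0 : 0 < B := by positivity
  refine ⟨A * B ^ r, by positivity, fun L hL ↦ ?_⟩
  have hr' : 0 < 1 - r := by linarith
  rcases le_total L B with h | h
  · have : A * L ^ r ≤ A * B ^ r := by gcongr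
    nlinarith
  · have h1 : A / ε ≤ L ^ (1 - r) := by
      calc A / ε = B ^ (1 - r) := by
            rw [hB, ← Real.rpow_mul (by positivity), one_div_mul_cancel hr'.ne', Real.rpow_one]
        _ ≤ _ := by gcongr
    have h2 : L = L ^ (1 - r) * L ^ r := by rw [← Real.rpow_add hL]; simp
    have h3 : A * L ^ r ≤ ε * L := by
      rw [div_le_iff₀ hε] at h1
      have : 0 < L ^ r := by positivity
      calc A * L ^ r ≤ (L ^ (1 - r) * ε) * L ^ r := by gcongr
        _ = ε * (L ^ (1 - r) * L ^ r) := by ring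
        _ = _ := by rw [← h2]
    have : 0 < A * B ^ r := by positivity
    linarith

theorem sum_primesUpTo_rpow_neg_le {σ z : ℝ} (h0 : 0 < σ) (h1 : σ < 1) (hz : 1 ≤ z) :
    ∑ p ∈ primesUpTo z, (p : ℝ) ^ (-σ) ≤ z ^ (1 - σ) / (1 - σ) := by
  have hN : 1 ≤ ⌊z⌋₊ := Nat.one_le_floor_iff _ |>.2 hz
  have h2 : ∑ p ∈ primesUpTo z, (p : ℝ) ^ (-σ) ≤
      ∑ i ∈ Finset.Ico 1 ⌊z⌋₊, ((i + 1 : ℕ) : ℝ) ^ (-σ) := by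
    rw [Finset.sum_Ico_add' (fun i : ℕ ↦ (i : ℝ) ^ (-σ))]
    refine Finset.sum_le_sum_of_subset_of_nonneg (fun p hp ↦ ?_) fun _ _ _ ↦ by positivity
    rw [primesUpTo, Finset.mem_filter, Finset.mem_Ioc] at hp
    have := hp.2.two_le
    simp only [Finset.mem_Ico]; omega
  refine h2.trans ?_
  have h3 : AntitoneOn (fun u : ℝ ↦ u ^ (-σ)) (Icc ((1 : ℕ) : ℝ) ⌊z⌋₊) := by
    intro u hu v _ huv
    have : (1 : ℝ) ≤ u := by simpa using hu.1
    exact Real.rpow_le_rpow_of_nonpos (by linarith) huv (by linarith)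
  refine (h3.sum_le_integral_Ico hN).trans ?_
  rw [integral_rpow (Or.inl (by linarith))]
  have : ((⌊z⌋₊ : ℝ)) ≤ z := Nat.floor_le (by linarith)
  have h5 : (⌊z⌋₊ : ℝ) ^ (1 - σ) ≤ z ^ (1 - σ) := by gcongr
  have h4 : -σ + 1 = 1 - σ := by ring
  rw [h4, Nat.cast_one, Real.one_rpow]
  have h6 : 0 < 1 - σ := by linarith
  gcongr
  linarith

theorem norm_one_sub_inv_le_exp {w : ℂ} (hw : ‖w‖ ≤ 3 / 4) :
    ‖(1 - w)⁻¹‖ ≤ Real.exp (w.re + 2 * ‖w‖ ^ 2) := by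
  have h0 : (1 : ℂ) + -w ≠ 0 := by
    intro h
    have : w = 1 := by linear_combination -h
    rw [this] at hw; norm_num at hw
  have h1 := norm_log_one_add_sub_self_le (z := -w) (by rw [norm_neg]; linarith)
  rw [norm_neg] at h1
  have h2 : ‖w‖ ^ 2 * (1 - ‖w‖)⁻¹ / 2 ≤ 2 * ‖w‖ ^ 2 := by
    have : (1 - ‖w‖)⁻¹ ≤ 4 := by
      rw [inv_le_comm₀ (by linarith) (by norm_num)]; linarith
    nlinarith [sq_nonneg ‖w‖]
  have h3 := (abs_le.1 ((abs_re_le_norm _).trans (h1.trans h2))).1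
  rw [sub_re, neg_re, log_re] at h3
  rw [norm_inv, ← sub_eq_add_neg] at *
  rw [← Real.exp_log (norm_pos_iff.2 h0), ← Real.exp_neg]
  exact Real.exp_le_exp.2 (by linarith)

theorem exists_norm_prod_primes_le {θ σ K ε : ℝ} (hθ : 1 / 2 < θ) (hθσ : θ < σ) (hσ : σ < 1)
    (hK : 0 < K) (hε : 0 < ε) :
    ∃ C > 0, ∀ (u : ℕ → ℂ) (L y σ' : ℝ), 2 ≤ L → 1 ≤ y → σ ≤ σ' → σ' ≤ 1 → (∀ n, ‖u n‖ ≤ 1) →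
      (∀ z, 1 ≤ z → z ≤ y → ‖∑ p ∈ primesUpTo z, u p * Real.log p‖ ≤ K * L * z ^ θ) →
      ‖∏ p ∈ primesUpTo y, (1 - u p * ((p : ℝ) ^ (-σ') : ℝ))⁻¹‖ ≤ C * Real.exp (ε * L) := by
  obtain ⟨C₁, hC₁, H₁⟩ := exists_mul_rpow_le (A := 1 / (1 - σ)) (r := 2 * (1 - σ)) (ε := ε / 2)
    (by have : 0 < 1 - σ := by linarith
        positivity) (by linarith) (by linarith) (by linarith)
  have hσθ : 0 < σ - θ := by linarith
  obtain ⟨C₂, hC₂, H₂⟩ := exists_mul_rpow_le (A := K * 2 * (2 + 1 / (σ - θ)))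
    (r := 1 + 2 * (θ - σ)) (ε := ε / 2)
    (by positivity) (by linarith) (by linarith) (by linarith)
  have hsumm : Summable fun n : ℕ ↦ (n : ℝ) ^ (-(2 * σ)) :=
    Real.summable_nat_rpow.2 (by linarith)
  refine ⟨Real.exp (C₁ + C₂ + 2 * ∑' n : ℕ, (n : ℝ) ^ (-(2 * σ))), Real.exp_pos _, ?_⟩
  intro u L y σ' hL hy hσσ' hσ' hu H
  have hnorm : ∀ p : ℕ, 1 ≤ p → ‖u p * ((p : ℝ) ^ (-σ') : ℝ)‖ ≤ (p : ℝ) ^ (-σ) := by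
    intro p hp
    rw [norm_mul, norm_real, Real.norm_of_nonneg (by positivity)]
    refine (mul_le_of_le_one_left (by positivity) (hu p)).trans ?_
    exact Real.rpow_le_rpow_of_exponent_le (by exact_mod_cast hp) (by linarith)
  have hsmall : ∀ z, 1 ≤ z → z ≤ L ^ 2 →
      ‖∑ p ∈ primesUpTo z, u p * ((p : ℝ) ^ (-σ') : ℝ)‖ ≤ ε / 2 * L + C₁ := by
    intro z hz hzL
    calc _ ≤ ∑ p ∈ primesUpTo z, (p : ℝ) ^ (-σ) := norm_sum_le_of_le _ fun p hp ↦
          hnorm p (mem_primesUpTo.1 hp).1.one_le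
      _ ≤ z ^ (1 - σ) / (1 - σ) := sum_primesUpTo_rpow_neg_le (by linarith) hσ hz
      _ ≤ (L ^ 2) ^ (1 - σ) / (1 - σ) := by
          gcongr
      _ = 1 / (1 - σ) * L ^ (2 * (1 - σ)) := by
          rw [← Real.rpow_natCast, ← Real.rpow_mul (by linarith)]
          push_cast; ring
      _ ≤ _ := H₁ L (by linarith)
  have hmain : ‖∑ p ∈ primesUpTo y, u p * ((p : ℝ) ^ (-σ') : ℝ)‖ ≤ ε * L + (C₁ + C₂) := by
    rcases le_total y (L ^ 2) with h | h
    · refine (hsmall y hy h).trans ?_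
      nlinarith
    have hL2 : 4 ≤ L ^ 2 := by nlinarith
    have hlog1 : ∀ v : ℝ, 4 ≤ v → 1 ≤ Real.log v := by
      intro v hv
      rw [Real.le_log_iff_exp_le (by linarith)]
      have := Real.exp_one_lt_d9
      linarith
    have key := norm_sum_mul_sub_integral_mul_le (a := L ^ 2) (b := y) (σ := σ) (θ := θ)
      (K := K * L) (D := 2) (c := fun k ↦ if k.Prime then u k * Real.log k else 0)
      (G := 0) (g := 0) (f := fun v ↦ v ^ (-σ') / Real.log v)
      (f' := fun v ↦ ((-σ' * v ^ (-σ' - 1)) * Real.log v - v ^ (-σ') * v⁻¹) / Real.log v ^ 2)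
      (by linarith) h (by linarith) (by positivity) zero_le_two
      (fun v _ ↦ hasDerivAt_const v 0) continuousOn_const ?_ ?_ ?_ ?_ ?_
    · simp only [Pi.zero_apply, mul_zero, intervalIntegral.integral_zero, sub_zero] at key
      have hsplit : ∑ p ∈ primesUpTo y, u p * ((p : ℝ) ^ (-σ') : ℝ) =
          ∑ p ∈ primesUpTo (L ^ 2), u p * ((p : ℝ) ^ (-σ') : ℝ) +
          ∑ k ∈ Finset.Ioc ⌊L ^ 2⌋₊ ⌊y⌋₊, (((k : ℝ) ^ (-σ') / Real.log k : ℝ) : ℂ) *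
            (if k.Prime then u k * Real.log k else 0) := by
        have e1 : ∀ k : ℕ, (((k : ℝ) ^ (-σ') / Real.log k : ℝ) : ℂ) *
            (if k.Prime then u k * Real.log k else 0) =
            if k.Prime then u k * ((k : ℝ) ^ (-σ') : ℝ) else 0 := by
          intro k
          split_ifs with hk
          · have : (Real.log k : ℂ) ≠ 0 := by
              exact_mod_cast (Real.log_pos (by exact_mod_cast hk.one_lt)).ne'
            rw [ofReal_div]
            field_simp
          · simp
        simp only [e1]
        rw [primesUpTo, primesUpTo, Finset.sum_filter, Finset.sum_filter,
          Finset.sum_Ioc_consecutive _ (Nat.zero_le _) (Nat.floor_le_floor h)]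
      have e2 : K * L * 2 * (L ^ 2) ^ (θ - σ) * (2 + 1 / (σ - θ)) ≤ ε / 2 * L + C₂ := by
        refine le_trans (le_of_eq ?_) (H₂ L (by linarith))
        rw [Real.rpow_add (by linarith), Real.rpow_one, ← Real.rpow_natCast,
          ← Real.rpow_mul (by linarith)]
        push_cast; ring
      rw [hsplit]
      have := norm_add_le_of_le (hsmall (L ^ 2) (by linarith) le_rfl) (key.trans e2)
      linarith
    · intro v hv
      have hv4 : 4 ≤ v := hL2.trans hv.1
      have h1 := hlog1 v hv4
      exact (Real.hasDerivAt_rpow_const (Or.inl (by linarith))).div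
        (Real.hasDerivAt_log (by linarith)) (by linarith)
    · intro v hv
      have hv4 : 4 ≤ v := hL2.trans hv.1
      have h1 := hlog1 v hv4
      refine ContinuousAt.continuousWithinAt ?_
      have c1 : ∀ r : ℝ, ContinuousAt (fun v : ℝ ↦ v ^ r) v := fun r ↦
        Real.continuousAt_rpow_const _ _ (Or.inl (by linarith))
      have c2 : ContinuousAt Real.log v := Real.continuousAt_log (by linarith)
      exact (((continuousAt_const.mul (c1 _)).mul c2).sub
        ((c1 _).mul (continuousAt_inv₀ (by linarith)))).div (c2.pow 2) (by positivity)
    · intro v hv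
      have hv4 : 4 ≤ v := hL2.trans hv.1
      rw [sum_Icc_ite_prime (fun k ↦ u k * Real.log k)]
      simpa using H v (by linarith) hv.2
    · intro v hv
      have hv4 : 4 ≤ v := hL2.trans hv.1
      have h1 := hlog1 v hv4
      have hv0 : 0 < v := by linarith
      rw [abs_of_nonneg (by positivity), div_le_iff₀ (by linarith)]
      have : 0 < v ^ (-σ) := by positivity
      have h2 : v ^ (-σ') ≤ v ^ (-σ) :=
        Real.rpow_le_rpow_of_exponent_le (by linarith) (by linarith)
      nlinarith
    · intro v hv
      have hv4 : 4 ≤ v := hL2.trans hv.1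
      have h1 := hlog1 v hv4
      have hv0 : 0 < v := by linarith
      have e3 : v ^ (-σ') * v⁻¹ = v ^ (-σ' - 1) := by
        rw [Real.rpow_sub_one hv0.ne', div_eq_mul_inv]
      have e4 : 0 < v ^ (-σ' - 1) := by positivity
      have e8 : v ^ (-σ' - 1) ≤ v ^ (-σ - 1) :=
        Real.rpow_le_rpow_of_exponent_le (by linarith) (by linarith)
      rw [e3, abs_div, abs_of_nonneg (by positivity : 0 ≤ Real.log v ^ 2),
        div_le_iff₀ (by positivity)]
      have e5 : (-σ' * v ^ (-σ' - 1)) * Real.log v - v ^ (-σ' - 1) =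
        -(v ^ (-σ' - 1) * (σ' * Real.log v + 1)) := by ring
      have e7 : 0 ≤ σ' * Real.log v := mul_nonneg (by linarith) (by linarith)
      rw [e5, abs_neg, abs_of_nonneg (mul_nonneg e4.le (by linarith))]
      have e6 : σ' * Real.log v + 1 ≤ 2 * Real.log v ^ 2 := by nlinarith
      calc _ ≤ v ^ (-σ - 1) * (2 * Real.log v ^ 2) := by gcongr
        _ = _ := by ring
  rw [norm_prod]
  calc _ ≤ ∏ p ∈ primesUpTo y, Real.exp ((u p * ((p : ℝ) ^ (-σ') : ℝ)).re +
        2 * (p : ℝ) ^ (-(2 * σ))) := by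
        refine Finset.prod_le_prod (fun _ _ ↦ norm_nonneg _) fun p hp ↦ ?_
        have hp2 : (2 : ℝ) ≤ p := by exact_mod_cast (mem_primesUpTo.1 hp).1.two_le
        have h34 : (p : ℝ) ^ (-σ) ≤ 3 / 4 := by
          calc (p : ℝ) ^ (-σ) ≤ (2 : ℝ) ^ (-σ) :=
                Real.rpow_le_rpow_of_nonpos two_pos hp2 (by linarith)
            _ ≤ (2 : ℝ) ^ (-(1 / 2) : ℝ) :=
                Real.rpow_le_rpow_of_exponent_le one_le_two (by linarith)
            _ ≤ 3 / 4 := by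
                rw [Real.rpow_neg two_pos.le, ← Real.sqrt_eq_rpow, inv_le_comm₀ (by positivity)
                  (by norm_num)]
                exact Real.le_sqrt_of_sq_le (by norm_num)
        refine (norm_one_sub_inv_le_exp ((hnorm p (by exact_mod_cast (one_le_two.trans hp2))).trans h34)).trans (Real.exp_le_exp.2 ?_)
        have : ‖u p * ((p : ℝ) ^ (-σ') : ℝ)‖ ^ 2 ≤ (p : ℝ) ^ (-(2 * σ)) := by
          calc _ ≤ ((p : ℝ) ^ (-σ)) ^ 2 := by gcongr; exact hnorm p (by exact_mod_cast (one_le_two.trans hp2))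
            _ = _ := by
              rw [← Real.rpow_natCast, ← Real.rpow_mul (by positivity)]; congr 1; push_cast; ring
        linarith
    _ = Real.exp ((∑ p ∈ primesUpTo y, u p * ((p : ℝ) ^ (-σ') : ℝ)).re +
        2 * ∑ p ∈ primesUpTo y, (p : ℝ) ^ (-(2 * σ))) := by
        rw [← Real.exp_sum, Finset.sum_add_distrib, ← Finset.mul_sum, re_sum]
    _ ≤ _ := by
        rw [← Real.exp_add]
        refine Real.exp_le_exp.2 ?_
        have h1 := (re_le_norm _).trans hmain
        have h2 : ∑ p ∈ primesUpTo y, (p : ℝ) ^ (-(2 * σ)) ≤ ∑' n : ℕ, (n : ℝ) ^ (-(2 * σ)) :=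
          hsumm.sum_le_tsum _ fun _ _ ↦ by positivity
        linarith

theorem exp_mul_two_add_log {Q ε : ℝ} (hQ : 0 < Q) :
    Real.exp (ε * (2 + Real.log Q)) = Real.exp (2 * ε) * Q ^ ε := by
  rw [Real.rpow_def_of_pos hQ, ← Real.exp_add]
  congr 1; ring

theorem natCast_cpow_neg_add_mul_I {p : ℕ} (hp : p ≠ 0) (σ t : ℝ) :
    (p : ℂ) ^ (-(σ + t * I)) = (p : ℂ) ^ (-(t * I)) * ((p : ℝ) ^ (-σ) : ℝ) := by
  have : (p : ℂ) ≠ 0 := by exact_mod_cast hp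
  rw [neg_add, cpow_add _ _ this, ofReal_cpow (by positivity), mul_comm]
  push_cast
  rfl

theorem norm_natCast_cpow_neg_mul_I_le (n : ℕ) (t : ℝ) : ‖(n : ℂ) ^ (-(t * I))‖ ≤ 1 := by
  rcases Nat.eq_zero_or_pos n with rfl | hn
  · rw [Nat.cast_zero]
    by_cases h : -(t * I) = 0
    · simp [h]
    · rw [zero_cpow h]; simp
  · rw [norm_natCast_cpow_of_pos hn]
    simp

theorem exists_norm_prod_char_le (hGRH : GRH) {σ ε : ℝ} (hσ : 1 / 2 < σ) (hσ1 : σ < 1)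
    (hε : 0 < ε) :
    ∃ C > 0, ∀ (q : ℕ) [NeZero q] (χ : DirichletCharacter ℂ q), χ ≠ 1 → ∀ t y : ℝ, 1 ≤ y →
      ‖∏ p ∈ primesUpTo y, (1 - χ p * (p : ℂ) ^ (-(σ + t * I)))⁻¹‖ ≤
        C * (q * (|t| + 2)) ^ ε := by
  obtain ⟨K, hK, H⟩ := exists_norm_sum_char_primes_le hGRH (θ := (1 / 2 + σ) / 2)
    (by linarith) (by linarith)
  obtain ⟨C, hC, H'⟩ := exists_norm_prod_primes_le (θ := (1 / 2 + σ) / 2) (σ := σ)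
    (by linarith) (by linarith) hσ1 hK hε
  refine ⟨C * Real.exp (2 * ε), by positivity, ?_⟩
  intro q _ χ hχ t y hy
  have hq : (1 : ℝ) ≤ q := by exact_mod_cast NeZero.one_le
  have hQ : 1 ≤ q * (|t| + 2) := by nlinarith [abs_nonneg t]
  have hlog : 0 ≤ Real.log (q * (|t| + 2)) := Real.log_nonneg hQ
  have := H' (fun p ↦ χ p * (p : ℂ) ^ (-(t * I))) (2 + Real.log (q * (|t| + 2))) y σ
    (by linarith) hy le_rfl hσ1.le (fun n ↦ by
      rw [norm_mul]
      exact mul_le_one₀ (χ.norm_le_one _) (norm_nonneg _) (norm_natCast_cpow_neg_mul_I_le n t))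
    (fun z hz _ ↦ by
      refine (H q χ hχ t z hz).trans ?_
      gcongr
      linarith)
  rw [exp_mul_two_add_log (by linarith), ← mul_assoc] at this
  refine le_trans (le_of_eq ?_) this
  congr 1
  refine Finset.prod_congr rfl fun p hp ↦ ?_
  rw [natCast_cpow_neg_add_mul_I (mem_primesUpTo.1 hp).1.ne_zero, mul_assoc]

theorem norm_integral_cpow_le {t z : ℝ} (hz : 1 ≤ z) (hzt : z ≤ |t|) :
    ‖∫ v : ℝ in 1..z, (v : ℂ) ^ (-(t * I))‖ ≤ 2 := by
  have h0 : -(t * I) + 1 ≠ (0 : ℂ) := by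
    intro h
    have := congrArg re h
    simp at this
  rw [integral_cpow (Or.inl (by simp)), norm_div, ofReal_one, one_cpow]
  have h1 : ‖(z : ℂ) ^ (-(t * I) + 1) - 1‖ ≤ z + 1 := by
    refine (norm_sub_le _ _).trans ?_
    rw [norm_cpow_eq_rpow_re_of_pos (by linarith)]
    simp
  have h2 : |t| ≤ ‖-(t * I) + 1‖ := by
    have := abs_im_le_norm (-(t * I) + 1)
    simpa using this
  rw [div_le_iff₀ (norm_pos_iff.2 h0)]
  linarith

theorem exists_norm_prod_primes_cpow_le (hGRH : GRH) {σ ε : ℝ} (hσ : 1 / 2 < σ) (hσ1 : σ < 1)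
    (hε : 0 < ε) :
    ∃ C > 0, ∀ σ' t y : ℝ, σ ≤ σ' → σ' ≤ 1 → 1 ≤ y → y ≤ |t| →
      ‖∏ p ∈ primesUpTo y, (1 - (p : ℂ) ^ (-(σ' + t * I)))⁻¹‖ ≤ C * (|t| + 2) ^ ε := by
  obtain ⟨K, hK, H⟩ := exists_norm_sum_primes_cpow_sub_integral_le hGRH (θ := (1 / 2 + σ) / 2)
    (by linarith) (by linarith)
  obtain ⟨C, hC, H'⟩ := exists_norm_prod_primes_le (θ := (1 / 2 + σ) / 2) (σ := σ) (K := K + 2)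
    (by linarith) (by linarith) hσ1 (by linarith) hε
  refine ⟨C * Real.exp (2 * ε), by positivity, ?_⟩
  intro σ' t y hσσ' hσ' hy hyt
  have hlog : 0 ≤ Real.log (|t| + 2) := Real.log_nonneg (by linarith)
  have := H' (fun p ↦ (p : ℂ) ^ (-(t * I))) (2 + Real.log (|t| + 2)) y σ'
    (by linarith) hy hσσ' hσ' (fun n ↦ norm_natCast_cpow_neg_mul_I_le n t)
    (fun z hz hzy ↦ by
      have h1 := norm_sub_norm_le (∑ p ∈ primesUpTo z, (p : ℂ) ^ (-(t * I)) * Real.log p)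
        (∫ v : ℝ in 1..z, (v : ℂ) ^ (-(t * I)))
      have h2 := norm_integral_cpow_le (t := t) hz (hzy.trans hyt)
      have h3 := H t z hz
      have h4 : 1 ≤ z ^ ((1 / 2 + σ) / 2) := Real.one_le_rpow hz (by linarith)
      have h5 : K * Real.log (|t| + 2) * z ^ ((1 / 2 + σ) / 2) + 2 ≤
          (K + 2) * (2 + Real.log (|t| + 2)) * z ^ ((1 / 2 + σ) / 2) := by
        have : 0 ≤ Real.log (|t| + 2) * z ^ ((1 / 2 + σ) / 2) := by positivity
        have : 0 ≤ K * z ^ ((1 / 2 + σ) / 2) := by positivity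
        nlinarith
      linarith)
  rw [exp_mul_two_add_log (by linarith), ← mul_assoc] at this
  refine le_trans (le_of_eq ?_) this
  congr 1
  refine Finset.prod_congr rfl fun p hp ↦ ?_
  rw [natCast_cpow_neg_add_mul_I (mem_primesUpTo.1 hp).1.ne_zero]

end SmoothSum

namespace SmoothSum

open Complex Set Filter Topology MeasureTheory Metric

theorem norm_exp_mul_I_sub_one_sub_le (u : ℝ) : ‖cexp (u * I) - 1 - u * I‖ ≤ u ^ 2 / 2 := by
  have h1 : ∀ s ∈ uIcc (0 : ℝ) 1, HasDerivAt (fun s : ℝ ↦ cexp (u * I * s) - u * I * s)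
      (u * I * (cexp (u * I * s) - 1)) s := by
    intro s _
    have e1 : HasDerivAt (fun s : ℂ ↦ u * I * s) (u * I) s := by
      simpa using (hasDerivAt_id (s : ℂ)).const_mul (u * I)
    exact HasDerivAt.congr_deriv (e1.cexp.sub e1).comp_ofReal (by ring)
  have h2 := intervalIntegral.integral_eq_sub_of_hasDerivAt h1
    (Continuous.intervalIntegrable (by fun_prop) _ _)
  have h3 : cexp (u * I) - 1 - u * I = ∫ s : ℝ in 0..1, u * I * (cexp (u * I * s) - 1) := by
    rw [h2]
    simp
    ring
  have h4 : ∫ s : ℝ in 0..1, u ^ 2 * s = u ^ 2 / 2 := by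
    rw [intervalIntegral.integral_const_mul, integral_id]
    ring
  rw [h3, ← h4]
  refine intervalIntegral.norm_integral_le_of_norm_le zero_le_one (ae_of_all _ fun s hs ↦ ?_)
    (Continuous.intervalIntegrable (by fun_prop) _ _)
  have h5 := Real.norm_exp_I_mul_ofReal_sub_one_le (x := u * s)
  have h6 : I * ((u * s : ℝ) : ℂ) = u * I * s := by push_cast; ring
  rw [h6, Real.norm_eq_abs, abs_mul, abs_of_pos hs.1] at h5
  rw [norm_mul, norm_mul, norm_I, mul_one, norm_real, Real.norm_eq_abs]
  calc _ ≤ |u| * (|u| * s) := by gcongr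
    _ = _ := by rw [← sq_abs u]; ring

theorem one_sub_cos_ge {θ : ℝ} (hθ : |θ| ≤ 1) : 43 / 96 * θ ^ 2 ≤ 1 - Real.cos θ := by
  have h := cos_bound (x := (θ : ℂ)) (by simpa using hθ)
  rw [← ofReal_cos, norm_real, Real.norm_eq_abs] at h
  have h2 : (Real.cos θ : ℂ) - (1 - (θ : ℂ) ^ 2 / 2) = ((Real.cos θ - (1 - θ ^ 2 / 2) : ℝ) : ℂ) := by
    push_cast; ring
  rw [h2, norm_real, Real.norm_eq_abs] at h
  have h3 := (abs_le.1 h).2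
  have h4 : |θ| ^ 4 ≤ θ ^ 2 := by
    rw [← sq_abs θ]
    exact pow_le_pow_of_le_one (abs_nonneg _) hθ (by norm_num)
  linarith

theorem norm_one_sub_mul_exp_sq (w θ : ℝ) :
    ‖1 - (w : ℂ) * cexp (-(θ * I))‖ ^ 2 = (1 - w) ^ 2 + 2 * w * (1 - Real.cos θ) := by
  have h1 : -((θ : ℂ) * I) = ((-θ : ℝ) : ℂ) * I := by push_cast; ring
  have h2 : 1 - (w : ℂ) * cexp (-(θ * I)) =
      ((1 - w * Real.cos θ : ℝ) : ℂ) + ((w * Real.sin θ : ℝ) : ℂ) * I := by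
    rw [h1, exp_mul_I, ← ofReal_cos, ← ofReal_sin, Real.cos_neg, Real.sin_neg]
    push_cast; ring
  rw [h2, ← normSq_eq_norm_sq, normSq_add_mul_I]
  linear_combination w ^ 2 * Real.sin_sq_add_cos_sq θ

theorem norm_ratio_sq {w θ : ℝ} (hw : w < 1) :
    ‖(1 - (w : ℂ)) / (1 - w * cexp (-(θ * I)))‖ ^ 2 =
      (1 + 2 * (w / (1 - w) ^ 2) * (1 - Real.cos θ))⁻¹ := by
  have h0 : 0 < 1 - w := by linarith
  rw [norm_div, div_pow, norm_one_sub_mul_exp_sq]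
  have : ‖1 - (w : ℂ)‖ ^ 2 = (1 - w) ^ 2 := by
    rw [← ofReal_one, ← ofReal_sub, norm_real, Real.norm_of_nonneg h0.le]
  rw [this]
  have e : 1 + 2 * (w / (1 - w) ^ 2) * (1 - Real.cos θ) =
    ((1 - w) ^ 2 + 2 * w * (1 - Real.cos θ)) / (1 - w) ^ 2 := by
    field_simp
  rw [e, inv_div]

theorem inv_one_add_le_exp {u c : ℝ} (hu : 0 ≤ u) (hc : u ≤ c) :
    (1 + u)⁻¹ ≤ Real.exp (-(u / (1 + c))) := by
  rw [Real.exp_neg]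
  refine inv_anti₀ (Real.exp_pos _) ?_
  rw [← Real.exp_log (by linarith : 0 < 1 + u)]
  refine Real.exp_le_exp.2 ?_
  have h1 := Real.one_sub_inv_le_log_of_pos (by linarith : 0 < 1 + u)
  have h2 : u / (1 + c) ≤ u / (1 + u) := by gcongr
  have h3 : 1 - (1 + u)⁻¹ = u / (1 + u) := by field_simp; ring
  linarith

theorem norm_log_ratio_add_le {w θ : ℝ} (hw : 0 ≤ w) (hw1 : w < 1) :
    ‖log (1 - (w : ℂ)) - log (1 - w * cexp (-(θ * I))) + θ * (w / (1 - w)) * I‖ ≤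
      θ ^ 2 / 2 * (w / (1 - w) ^ 2) := by
  have hn1 : ‖(w : ℂ)‖ < 1 := by rwa [norm_real, Real.norm_of_nonneg hw]
  have hne : ‖cexp (-(θ * I))‖ = 1 := by
    rw [norm_exp]; simp
  have hn2 : ‖(w : ℂ) * cexp (-(θ * I))‖ < 1 := by rwa [norm_mul, hne, mul_one]
  have s1 := hasSum_taylorSeries_neg_log hn1
  have s2 := hasSum_taylorSeries_neg_log hn2
  have s3 := ((hasSum_geometric_of_norm_lt_one hn1).mul_left (θ * I))
  have s4 : HasSum (fun k : ℕ ↦ if k = 0 then (θ * I : ℂ) else 0) (θ * I) :=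
    hasSum_ite_eq 0 _
  have s5 := (s2.sub s1).add (s3.sub s4)
  have hn3 : ‖w‖ < 1 := by rwa [Real.norm_of_nonneg hw]
  have s6' : HasSum (fun k : ℕ ↦ (k : ℝ) * w ^ k) (w / (1 - w) ^ 2) :=
    hasSum_coe_mul_geometric_of_norm_lt_one hn3
  have s6 : HasSum (fun k : ℕ ↦ θ ^ 2 / 2 * (k * w ^ k)) (θ ^ 2 / 2 * (w / (1 - w) ^ 2)) :=
    HasSum.mul_left _ s6'
  have h1w : 1 - (w : ℂ) ≠ 0 := by
    rw [← ofReal_one, ← ofReal_sub]; exact_mod_cast (by linarith : (1 - w) ≠ 0)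
  have hval : -log (1 - (w : ℂ) * cexp (-(θ * I))) - -log (1 - (w : ℂ)) +
      (θ * I * (1 - (w : ℂ))⁻¹ - θ * I) =
      log (1 - (w : ℂ)) - log (1 - w * cexp (-(θ * I))) + θ * (w / (1 - w)) * I := by
    field_simp
    ring
  rw [hval] at s5
  rw [← s5.tsum_eq]
  refine tsum_of_norm_bounded s6 fun k ↦ ?_
  rcases Nat.eq_zero_or_pos k with rfl | hk
  · simp
  have hk0 : (k : ℂ) ≠ 0 := by exact_mod_cast hk.ne'
  have hkr : (0 : ℝ) < k := by exact_mod_cast hk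
  have h7 := norm_exp_mul_I_sub_one_sub_le (-(k * θ))
  have h8 : ((w : ℂ) * cexp (-(θ * I))) ^ k / k - (w : ℂ) ^ k / k +
      (θ * I * (w : ℂ) ^ k - if k = 0 then (θ * I : ℂ) else 0) =
      (w : ℂ) ^ k / k * (cexp (((-(k * θ) : ℝ) : ℂ) * I) - 1 - ((-(k * θ) : ℝ) : ℂ) * I) := by
    rw [if_neg hk.ne', mul_pow, ← Complex.exp_nat_mul]
    have : (k : ℂ) * -(θ * I) = ((-(k * θ) : ℝ) : ℂ) * I := by push_cast; ring
    rw [this]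
    field_simp
    push_cast
    ring
  rw [h8, norm_mul, norm_div, norm_pow, norm_real, Real.norm_of_nonneg hw, norm_natCast]
  calc _ ≤ w ^ k / k * ((-(k * θ)) ^ 2 / 2) := by gcongr
    _ = _ := by field_simp

end SmoothSum

namespace SmoothSum

open Complex Set Filter Topology MeasureTheory Metric

/-- The Euler product over primes up to `y`. -/
noncomputable def eulerProd (y : ℝ) (s : ℂ) : ℂ := ∏ p ∈ primesUpTo y, (1 - (p : ℂ) ^ (-s))⁻¹

/-- The normalised Euler product `x ^ (it) ζ(α + it; y) / ζ(α; y)` on the line `Re s = α`. -/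
noncomputable def tilt (x y α t : ℝ) : ℂ :=
  (x : ℂ) ^ (t * I) * (eulerProd y (α + t * I) / eulerProd y α)

/-- Minus the logarithmic derivative of the Euler product. -/
noncomputable def saddleMean (y α : ℝ) : ℝ :=
  ∑ p ∈ primesUpTo y, Real.log p * ((p : ℝ) ^ (-α) / (1 - (p : ℝ) ^ (-α)))

/-- The second logarithmic derivative of the Euler product. -/
noncomputable def saddleVar (y α : ℝ) : ℝ :=
  ∑ p ∈ primesUpTo y, Real.log p ^ 2 * ((p : ℝ) ^ (-α) / (1 - (p : ℝ) ^ (-α)) ^ 2)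

theorem two_le_of_mem {y : ℝ} {p : ℕ} (hp : p ∈ primesUpTo y) : (2 : ℝ) ≤ p := by
  exact_mod_cast (mem_primesUpTo.1 hp).1.two_le

theorem log_nonneg_of_mem {y : ℝ} {p : ℕ} (hp : p ∈ primesUpTo y) : 0 ≤ Real.log p :=
  Real.log_nonneg (by linarith [two_le_of_mem hp])

theorem log_le_of_mem {y : ℝ} {p : ℕ} (hp : p ∈ primesUpTo y) : Real.log p ≤ Real.log y :=
  Real.log_le_log (by linarith [two_le_of_mem hp]) (mem_primesUpTo.1 hp).2

theorem rpow_neg_lt_one_of_mem {y α : ℝ} (hα : 0 < α) {p : ℕ} (hp : p ∈ primesUpTo y) :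
    (p : ℝ) ^ (-α) < 1 :=
  Real.rpow_lt_one_of_one_lt_of_neg (by linarith [two_le_of_mem hp]) (by linarith)

theorem rpow_neg_le_of_mem {y α : ℝ} (hα : 1 / 2 ≤ α) {p : ℕ} (hp : p ∈ primesUpTo y) :
    (p : ℝ) ^ (-α) ≤ 17 / 24 := by
  calc (p : ℝ) ^ (-α) ≤ (2 : ℝ) ^ (-α) :=
        Real.rpow_le_rpow_of_nonpos two_pos (two_le_of_mem hp) (by linarith)
    _ ≤ (2 : ℝ) ^ (-(1 / 2) : ℝ) :=
        Real.rpow_le_rpow_of_exponent_le one_le_two (by linarith)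
    _ ≤ 17 / 24 := by
        rw [Real.rpow_neg two_pos.le, ← Real.sqrt_eq_rpow, inv_le_comm₀ (by positivity)
          (by norm_num)]
        exact Real.le_sqrt_of_sq_le (by norm_num)

theorem natCast_cpow_neg_eq_mul_exp {p : ℕ} (hp : p ≠ 0) (α t : ℝ) :
    (p : ℂ) ^ (-(α + t * I)) = ((p : ℝ) ^ (-α) : ℝ) * cexp (-(((t * Real.log p : ℝ) : ℂ) * I)) := by
  have h0 : (p : ℂ) ≠ 0 := by exact_mod_cast hp
  rw [natCast_cpow_neg_add_mul_I hp, mul_comm]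
  congr 1
  rw [cpow_def_of_ne_zero h0]
  congr 1
  push_cast
  rw [← natCast_log]
  ring

theorem one_sub_natCast_cpow_ne_zero {p : ℕ} (hp : p.Prime) {s : ℂ} (hs : 0 < s.re) :
    1 - (p : ℂ) ^ (-s) ≠ 0 := by
  intro h
  have h1 : ‖(p : ℂ) ^ (-s)‖ < 1 := by
    rw [norm_natCast_cpow_of_pos hp.pos]
    exact Real.rpow_lt_one_of_one_lt_of_neg (by exact_mod_cast hp.one_lt) (by simpa using hs)
  rw [← sub_eq_zero.1 h] at h1
  simp at h1

theorem eulerProd_ne_zero {y : ℝ} {s : ℂ} (hs : 0 < s.re) : eulerProd y s ≠ 0 :=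
  Finset.prod_ne_zero_iff.2 fun _ hp ↦
    inv_ne_zero (one_sub_natCast_cpow_ne_zero (mem_primesUpTo.1 hp).1 hs)

theorem eulerProd_ratio_eq (y α t : ℝ) :
    eulerProd y (α + t * I) / eulerProd y α = ∏ p ∈ primesUpTo y,
      (1 - (((p : ℝ) ^ (-α) : ℝ) : ℂ)) /
        (1 - ((p : ℝ) ^ (-α) : ℝ) * cexp (-(((t * Real.log p : ℝ) : ℂ) * I))) := by
  rw [eulerProd, eulerProd, ← Finset.prod_div_distrib]
  refine Finset.prod_congr rfl fun p hp ↦ ?_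
  have hp0 := (mem_primesUpTo.1 hp).1.ne_zero
  have h0 := natCast_cpow_neg_eq_mul_exp hp0 α 0
  simp only [ofReal_zero, zero_mul, add_zero, neg_zero, Complex.exp_zero, mul_one] at h0
  rw [natCast_cpow_neg_eq_mul_exp hp0, h0, inv_div_inv]

theorem norm_tilt_sq {x y α t : ℝ} (hx : 0 < x) (hα : 0 < α) :
    ‖tilt x y α t‖ ^ 2 = ∏ p ∈ primesUpTo y,
      (1 + 2 * ((p : ℝ) ^ (-α) / (1 - (p : ℝ) ^ (-α)) ^ 2) *
        (1 - Real.cos (t * Real.log p)))⁻¹ := by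
  rw [tilt, norm_mul, norm_cpow_eq_rpow_re_of_pos hx]
  simp only [mul_re, ofReal_re, I_re, mul_zero, ofReal_im, I_im, mul_one, sub_self, Real.rpow_zero,
    one_mul]
  rw [eulerProd_ratio_eq, norm_prod, ← Finset.prod_pow]
  exact Finset.prod_congr rfl fun p hp ↦ norm_ratio_sq (rpow_neg_lt_one_of_mem hα hp)

theorem saddleVar_term_le {α : ℝ} {y : ℝ} (hα : 1 / 2 ≤ α) {p : ℕ} (hp : p ∈ primesUpTo y) :
    Real.log p ^ 2 * ((p : ℝ) ^ (-α) / (1 - (p : ℝ) ^ (-α)) ^ 2) ≤ 193 := by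
  have h2 := two_le_of_mem hp
  have h1 := rpow_neg_le_of_mem hα hp
  have hlog : Real.log p ≤ 4 * (p : ℝ) ^ (1 / 4 : ℝ) := by
    have := Real.log_le_rpow_div (x := p) (ε := 1 / 4) (by linarith) (by norm_num)
    linarith
  have hl0 := log_nonneg_of_mem hp
  have hw : (p : ℝ) ^ (-α) ≤ (p : ℝ) ^ (-(1 / 2) : ℝ) :=
    Real.rpow_le_rpow_of_exponent_le (by linarith) (by linarith)
  have h3 : (7 / 24 : ℝ) ^ 2 ≤ (1 - (p : ℝ) ^ (-α)) ^ 2 := by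
    gcongr
    linarith
  have h4 : ((p : ℝ) ^ (1 / 4 : ℝ)) ^ 2 * (p : ℝ) ^ (-(1 / 2) : ℝ) = 1 := by
    rw [← Real.rpow_natCast, ← Real.rpow_mul (by linarith), ← Real.rpow_add (by linarith)]
    norm_num
  calc _ ≤ (4 * (p : ℝ) ^ (1 / 4 : ℝ)) ^ 2 * ((p : ℝ) ^ (-(1 / 2) : ℝ) / (7 / 24) ^ 2) := by
        gcongr
    _ = 16 / (7 / 24) ^ 2 * (((p : ℝ) ^ (1 / 4 : ℝ)) ^ 2 * (p : ℝ) ^ (-(1 / 2) : ℝ)) := by ring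
    _ ≤ 193 := by rw [h4]; norm_num

theorem norm_tilt_le_exp_of_le {x y α t : ℝ} (hx : 0 < x) (hα : 1 / 2 ≤ α)
    (hy : 44 ≤ Real.log y) (ht : |t| * Real.log y ≤ 1) :
    ‖tilt x y α t‖ ≤ Real.exp (-(2 / 5 * saddleVar y α * t ^ 2)) := by
  rw [← pow_le_pow_iff_left₀ (norm_nonneg _) (Real.exp_nonneg _) two_ne_zero,
    norm_tilt_sq hx (by linarith), ← Real.exp_nat_mul]
  have h : ((2 : ℕ) : ℝ) * -(2 / 5 * saddleVar y α * t ^ 2) = ∑ p ∈ primesUpTo y,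
      -(4 / 5 * t ^ 2 *
        (Real.log p ^ 2 * ((p : ℝ) ^ (-α) / (1 - (p : ℝ) ^ (-α)) ^ 2))) := by
    rw [saddleVar, Finset.sum_neg_distrib, ← Finset.mul_sum]; push_cast; ring
  rw [h, Real.exp_sum]
  refine Finset.prod_le_prod (fun p hp ↦ ?_) fun p hp ↦ ?_
  · have := Real.cos_le_one (t * Real.log p)
    have : 0 ≤ 1 - Real.cos (t * Real.log p) := by linarith
    positivity
  have hc1 := Real.cos_le_one (t * Real.log p)
  have hc : 0 ≤ 1 - Real.cos (t * Real.log p) := by linarith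
  set a := (p : ℝ) ^ (-α) / (1 - (p : ℝ) ^ (-α)) ^ 2 with ha
  have ha0 : 0 ≤ a := by positivity
  have hterm := saddleVar_term_le hα hp
  rw [← ha] at hterm
  have hl0 := log_nonneg_of_mem hp
  have hθ : |t * Real.log p| ≤ 1 := by
    rw [abs_mul, abs_of_nonneg hl0]
    exact (mul_le_mul_of_nonneg_left (log_le_of_mem hp) (abs_nonneg t)).trans ht
  have hlow := one_sub_cos_ge hθ
  have hup := Real.one_sub_sq_div_two_le_cos (x := t * Real.log p)
  have ht2 : t ^ 2 ≤ 1 / 44 ^ 2 := by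
    have : |t| ≤ 1 / 44 := by
      rw [le_div_iff₀ (by norm_num)]
      nlinarith [abs_nonneg t]
    rw [← sq_abs]
    calc |t| ^ 2 ≤ (1 / 44) ^ 2 := by gcongr
      _ = _ := by norm_num
  have hu : 2 * a * (1 - Real.cos (t * Real.log p)) ≤ 1 / 10 := by
    calc _ ≤ 2 * a * ((t * Real.log p) ^ 2 / 2) := by gcongr; linarith
      _ = t ^ 2 * (Real.log p ^ 2 * a) := by ring
      _ ≤ 1 / 44 ^ 2 * 193 := by gcongr
      _ ≤ _ := by norm_num
  refine (inv_one_add_le_exp (by positivity) hu).trans (Real.exp_le_exp.2 ?_)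
  rw [neg_le_neg_iff, le_div_iff₀ (by norm_num)]
  have : 2 * a * (43 / 96 * (t * Real.log p) ^ 2) ≤ 2 * a * (1 - Real.cos (t * Real.log p)) := by
    gcongr
  have h9 : 0 ≤ a * (t * Real.log p) ^ 2 := by positivity
  nlinarith

theorem norm_tilt_le_exp_sum {x y α t : ℝ} (hx : 0 < x) (hα : 1 / 2 ≤ α) :
    ‖tilt x y α t‖ ≤ Real.exp (-(1 / 4 * ∑ p ∈ primesUpTo y,
      (p : ℝ) ^ (-α) * (1 - Real.cos (t * Real.log p)))) := by
  rw [← pow_le_pow_iff_left₀ (norm_nonneg _) (Real.exp_nonneg _) two_ne_zero,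
    norm_tilt_sq hx (by linarith), ← Real.exp_nat_mul]
  have h : ((2 : ℕ) : ℝ) * -(1 / 4 * ∑ p ∈ primesUpTo y,
      (p : ℝ) ^ (-α) * (1 - Real.cos (t * Real.log p))) = ∑ p ∈ primesUpTo y,
      -(1 / 2 * ((p : ℝ) ^ (-α) * (1 - Real.cos (t * Real.log p)))) := by
    rw [Finset.sum_neg_distrib, ← Finset.mul_sum]; push_cast; ring
  rw [h, Real.exp_sum]
  have hc : ∀ p : ℕ, 0 ≤ 1 - Real.cos (t * Real.log p) := fun p ↦ by
    linarith [Real.cos_le_one (t * Real.log p)]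
  refine Finset.prod_le_prod (fun p hp ↦ ?_) fun p hp ↦ ?_
  · have := hc p
    positivity
  set w := (p : ℝ) ^ (-α) with hw
  have hw0 : 0 ≤ w := by positivity
  have hw1 : w ≤ 17 / 24 := rpow_neg_le_of_mem hα hp
  have h1 : w ≤ w / (1 - w) ^ 2 := by
    rw [le_div_iff₀ (by nlinarith)]
    have h3 : (1 - w) ^ 2 ≤ 1 := by nlinarith
    exact mul_le_of_le_one_right hw0 h3
  set v := 1 - Real.cos (t * Real.log p) with hv
  have hv0 : 0 ≤ v := hc p
  have hv2 : v ≤ 2 := by linarith [Real.neg_one_le_cos (t * Real.log p)]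
  have h2 : 2 * w * v ≤ 2 * (w / (1 - w) ^ 2) * v := by gcongr
  calc _ ≤ (1 + 2 * w * v)⁻¹ := by gcongr
    _ ≤ Real.exp (-((2 * w * v) / (1 + 3))) :=
        inv_one_add_le_exp (by positivity) (by nlinarith)
    _ = _ := by congr 1; ring

theorem norm_tilt_sub_one_le {x y α t : ℝ} (hx : 0 < x) (hα : 0 < α)
    (hmean : saddleMean y α = Real.log x) (ht : saddleVar y α * t ^ 2 / 2 ≤ 1) :
    ‖tilt x y α t - 1‖ ≤ saddleVar y α * t ^ 2 / 2 + (saddleVar y α * t ^ 2 / 2) ^ 2 := by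
  set f : ℕ → ℂ := fun p ↦ log (1 - (((p : ℝ) ^ (-α) : ℝ) : ℂ)) -
    log (1 - ((p : ℝ) ^ (-α) : ℝ) * cexp (-(((t * Real.log p : ℝ) : ℂ) * I))) +
    ((t * Real.log p : ℝ) : ℂ) *
      ((((p : ℝ) ^ (-α) : ℝ) : ℂ) / (1 - ((p : ℝ) ^ (-α) : ℝ))) * I with hf
  have h1 : tilt x y α t = cexp (∑ p ∈ primesUpTo y, f p) := by
    have e1 : ∑ p ∈ primesUpTo y, f p = Real.log x * (t * I) + ∑ p ∈ primesUpTo y,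
        (log (1 - (((p : ℝ) ^ (-α) : ℝ) : ℂ)) -
    log (1 - ((p : ℝ) ^ (-α) : ℝ) * cexp (-(((t * Real.log p : ℝ) : ℂ) * I)))) := by
      rw [hf, Finset.sum_add_distrib, add_comm, ← hmean, saddleMean, ofReal_sum, Finset.sum_mul]
      congr 1
      refine Finset.sum_congr rfl fun p _ ↦ ?_
      push_cast
      ring
    rw [e1, Complex.exp_add, tilt, cpow_def_of_ne_zero (by exact_mod_cast hx.ne'), ofReal_log hx.le,
      eulerProd_ratio_eq, Complex.exp_sum]
    congr 1
    refine Finset.prod_congr rfl fun p hp ↦ ?_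
    have hw := rpow_neg_lt_one_of_mem hα hp
    have n1 : 1 - (((p : ℝ) ^ (-α) : ℝ) : ℂ) ≠ 0 := by
      rw [← ofReal_one, ← ofReal_sub]; exact_mod_cast (by linarith : 1 - (p : ℝ) ^ (-α) ≠ 0)
    have n2 : 1 - ((p : ℝ) ^ (-α) : ℝ) * cexp (-(((t * Real.log p : ℝ) : ℂ) * I)) ≠ 0 := by
      rw [← natCast_cpow_neg_eq_mul_exp (mem_primesUpTo.1 hp).1.ne_zero]
      exact one_sub_natCast_cpow_ne_zero (mem_primesUpTo.1 hp).1 (by simpa using hα)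
    rw [Complex.exp_sub, exp_log n1, exp_log n2]
  have h2 : ‖∑ p ∈ primesUpTo y, f p‖ ≤ saddleVar y α * t ^ 2 / 2 := by
    calc _ ≤ ∑ p ∈ primesUpTo y, (t * Real.log p) ^ 2 / 2 *
          ((p : ℝ) ^ (-α) / (1 - (p : ℝ) ^ (-α)) ^ 2) :=
          norm_sum_le_of_le _ fun p hp ↦ norm_log_ratio_add_le (by positivity)
            (rpow_neg_lt_one_of_mem hα hp)
      _ = _ := by
          rw [saddleVar, Finset.sum_mul, Finset.sum_div]
          exact Finset.sum_congr rfl fun p _ ↦ by ring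
  rw [h1]
  set h := ∑ p ∈ primesUpTo y, f p
  have h3 := norm_exp_sub_one_sub_id_le (x := h) (h2.trans ht)
  calc ‖cexp h - 1‖ = ‖h + (cexp h - 1 - h)‖ := by congr 1; ring
    _ ≤ ‖h‖ + ‖h‖ ^ 2 := (norm_add_le _ _).trans (by gcongr)
    _ ≤ _ := by gcongr

end SmoothSum

namespace SmoothSum

open Complex Set Filter Topology MeasureTheory Metric

/-- The filter on pairs `(x, y)` for which `x → ∞` while
`(log x) ^ (2 + δ) ≤ y ≤ exp ((log x) ^ (1 / 2 - δ))`. -/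
noncomputable def smoothRange (δ : ℝ) : Filter (ℝ × ℝ) :=
  comap Prod.fst atTop ⊓ 𝓟 {p | Real.log p.1 ^ (2 + δ) ≤ p.2 ∧
    p.2 ≤ Real.exp (Real.log p.1 ^ ((1 : ℝ) / 2 - δ))}

theorem eventually_smoothRange_iff {δ : ℝ} {P : ℝ × ℝ → Prop} :
    (∀ᶠ p in smoothRange δ, P p) ↔ ∃ x₀ : ℝ, ∀ x ≥ x₀, ∀ y : ℝ, Real.log x ^ (2 + δ) ≤ y →
      y ≤ Real.exp (Real.log x ^ ((1 : ℝ) / 2 - δ)) → P (x, y) := by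
  rw [smoothRange, eventually_inf_principal, eventually_comap, eventually_atTop]
  constructor
  · rintro ⟨x₀, h⟩
    exact ⟨x₀, fun x hx y h1 h2 ↦ h x hx (x, y) rfl ⟨h1, h2⟩⟩
  · rintro ⟨x₀, h⟩
    exact ⟨x₀, fun x hx p hp hq ↦ by subst hp; exact h _ hx _ hq.1 hq.2⟩

theorem tendsto_fst_smoothRange (δ : ℝ) : Tendsto Prod.fst (smoothRange δ) atTop :=
  tendsto_comap.mono_left inf_le_left

theorem tendsto_log_fst (δ : ℝ) :
    Tendsto (fun p : ℝ × ℝ ↦ Real.log p.1) (smoothRange δ) atTop :=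
  Real.tendsto_log_atTop.comp (tendsto_fst_smoothRange δ)

theorem tendsto_log_log_fst (δ : ℝ) :
    Tendsto (fun p : ℝ × ℝ ↦ Real.log (Real.log p.1)) (smoothRange δ) atTop :=
  Real.tendsto_log_atTop.comp (tendsto_log_fst δ)

theorem eventually_rpow_le_snd (δ : ℝ) :
    ∀ᶠ p : ℝ × ℝ in smoothRange δ, Real.log p.1 ^ (2 + δ) ≤ p.2 :=
  mem_inf_of_right (mem_principal.2 fun _ h ↦ h.1)

theorem eventually_snd_le_exp (δ : ℝ) :
    ∀ᶠ p : ℝ × ℝ in smoothRange δ, p.2 ≤ Real.exp (Real.log p.1 ^ ((1 : ℝ) / 2 - δ)) :=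
  mem_inf_of_right (mem_principal.2 fun _ h ↦ h.2)

theorem eventually_mul_log_log_le (δ : ℝ) :
    ∀ᶠ p : ℝ × ℝ in smoothRange δ, (2 + δ) * Real.log (Real.log p.1) ≤ Real.log p.2 := by
  filter_upwards [eventually_rpow_le_snd δ, (tendsto_log_fst δ).eventually_ge_atTop 1] with p h h1
  rw [← Real.log_rpow (by linarith)]
  exact Real.log_le_log (by positivity) h

theorem eventually_log_snd_le (δ : ℝ) :
    ∀ᶠ p : ℝ × ℝ in smoothRange δ, Real.log p.2 ≤ Real.log p.1 ^ ((1 : ℝ) / 2 - δ) := by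
  filter_upwards [eventually_rpow_le_snd δ, (tendsto_log_fst δ).eventually_ge_atTop 1,
    eventually_snd_le_exp δ] with p h h1 h2
  have : 0 < Real.log p.1 ^ (2 + δ) := by positivity
  rw [Real.log_le_iff_le_exp (by linarith)]
  exact h2

theorem tendsto_log_snd {δ : ℝ} (hδ : 0 < δ) :
    Tendsto (fun p : ℝ × ℝ ↦ Real.log p.2) (smoothRange δ) atTop :=
  tendsto_atTop_mono' _ (eventually_mul_log_log_le δ)
    ((tendsto_log_log_fst δ).const_mul_atTop (by linarith))

theorem tendsto_log_log_snd {δ : ℝ} (hδ : 0 < δ) :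
    Tendsto (fun p : ℝ × ℝ ↦ Real.log (Real.log p.2)) (smoothRange δ) atTop :=
  Real.tendsto_log_atTop.comp (tendsto_log_snd hδ)

theorem tendsto_snd_smoothRange {δ : ℝ} (hδ : 0 < δ) :
    Tendsto (fun p : ℝ × ℝ ↦ p.2) (smoothRange δ) atTop := by
  refine tendsto_atTop_mono' _ ?_ (tendsto_log_snd hδ)
  filter_upwards [eventually_rpow_le_snd δ, (tendsto_log_fst δ).eventually_ge_atTop 1] with p h h1
  have : 0 < Real.log p.1 ^ (2 + δ) := by positivity
  exact Real.log_le_self (by linarith)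

theorem eventually_mul_log_sq_le {δ : ℝ} (hδ : 0 < δ) (K : ℝ) :
    ∀ᶠ p : ℝ × ℝ in smoothRange δ,
      K * (Real.log p.2 ^ 2 * (1 + Real.log (Real.log p.1)) ^ 3) ≤ Real.log p.1 := by
  have h1 : ∀ᶠ l : ℝ in atTop, |K| * (1 + Real.log l) ^ 3 ≤ l ^ (2 * δ) := by
    have h2 : (fun l : ℝ ↦ 1 + Real.log l) =o[atTop] fun l : ℝ ↦ l ^ (δ / 2) := by
      refine Asymptotics.IsLittleO.add ?_ (isLittleO_log_rpow_atTop (by linarith))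
      exact (Asymptotics.isLittleO_const_left.2 (Or.inr
        (tendsto_norm_atTop_atTop.comp (tendsto_rpow_atTop (by linarith)))))
    have h3 := (h2.def (c := 1) one_pos)
    have h4 : ∀ᶠ l : ℝ in atTop, |K| ≤ l ^ (δ / 2) :=
      (tendsto_rpow_atTop (by linarith)).eventually_ge_atTop _
    filter_upwards [h3, h4, eventually_ge_atTop 1] with l h3 h4 h5
    have hl : 0 ≤ Real.log l := Real.log_nonneg h5
    have h6 : 0 ≤ l ^ (δ / 2) := by positivity
    rw [one_mul, Real.norm_of_nonneg (by linarith), Real.norm_of_nonneg h6] at h3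
    calc |K| * (1 + Real.log l) ^ 3 ≤ l ^ (δ / 2) * (l ^ (δ / 2)) ^ 3 := by gcongr
      _ = l ^ (2 * δ) := by
        rw [← pow_succ', ← Real.rpow_natCast, ← Real.rpow_mul (by linarith)]
        congr 1
        push_cast
        ring
  filter_upwards [(tendsto_log_fst δ).eventually h1, eventually_log_snd_le δ,
    (tendsto_log_fst δ).eventually_ge_atTop 1, (tendsto_log_snd hδ).eventually_ge_atTop 1]
    with p h2 h3 h4 h5
  set l := Real.log p.1
  have hl : 0 ≤ Real.log l := Real.log_nonneg h4
  have h6 : Real.log p.2 ^ 2 ≤ l ^ (1 - 2 * δ) := by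
    calc Real.log p.2 ^ 2 ≤ (l ^ ((1 : ℝ) / 2 - δ)) ^ 2 := by gcongr
      _ = _ := by
        rw [← Real.rpow_natCast, ← Real.rpow_mul (by linarith)]
        congr 1
        push_cast
        ring
  calc K * (Real.log p.2 ^ 2 * (1 + Real.log l) ^ 3)
      ≤ |K| * (Real.log p.2 ^ 2 * (1 + Real.log l) ^ 3) := by
        gcongr
        exact le_abs_self K
    _ = Real.log p.2 ^ 2 * (|K| * (1 + Real.log l) ^ 3) := by ring
    _ ≤ l ^ (1 - 2 * δ) * l ^ (2 * δ) := by gcongr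
    _ = l := by
        rw [← Real.rpow_add (by linarith), sub_add_cancel, Real.rpow_one]

theorem eventually_mul_sq_le {δ : ℝ} (hδ : 0 < δ) (K : ℝ) :
    ∀ᶠ p : ℝ × ℝ in smoothRange δ, K * Real.log p.2 ^ 2 ≤ Real.log p.1 := by
  filter_upwards [eventually_mul_log_sq_le hδ |K|, (tendsto_log_log_fst δ).eventually_ge_atTop 0]
    with p h h1
  refine le_trans ?_ h
  have h2 : 1 ≤ (1 + Real.log (Real.log p.1)) ^ 3 := one_le_pow₀ (by linarith)
  calc K * Real.log p.2 ^ 2 ≤ |K| * (Real.log p.2 ^ 2 * 1) := by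
        rw [mul_one]
        gcongr
        exact le_abs_self K
    _ ≤ _ := by gcongr

end SmoothSum

namespace SmoothSum

open Complex Set Filter Topology MeasureTheory Metric

theorem exists_sum_log_mul_rpow_le {σ₁ : ℝ} (h1 : 1 / 2 < σ₁) :
    ∃ C > 0, ∀ y : ℝ, ∑ p ∈ primesUpTo y, Real.log p * (p : ℝ) ^ (-(2 * σ₁)) ≤ C := by
  set η := σ₁ - 1 / 2 with hη
  have hη0 : 0 < η := by linarith
  have hs : Summable fun n : ℕ ↦ η⁻¹ * (n : ℝ) ^ (-(1 + η)) :=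
    (Real.summable_nat_rpow.2 (by linarith)).mul_left _
  refine ⟨∑' n : ℕ, η⁻¹ * (n : ℝ) ^ (-(1 + η)) + 1, ?_, fun y ↦ ?_⟩
  · have : 0 ≤ ∑' n : ℕ, η⁻¹ * (n : ℝ) ^ (-(1 + η)) := tsum_nonneg fun n ↦ by positivity
    linarith
  calc _ ≤ ∑ p ∈ primesUpTo y, η⁻¹ * (p : ℝ) ^ (-(1 + η)) := by
        refine Finset.sum_le_sum fun p hp ↦ ?_
        have h2 := two_le_of_mem hp
        have h3 := Real.log_le_rpow_div (x := p) (ε := η) (by linarith) hη0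
        calc _ ≤ (p : ℝ) ^ η / η * (p : ℝ) ^ (-(2 * σ₁)) := by gcongr
          _ = η⁻¹ * ((p : ℝ) ^ η * (p : ℝ) ^ (-(2 * σ₁))) := by ring
          _ = _ := by
            rw [← Real.rpow_add (by linarith)]
            congr 2
            rw [hη]; ring
    _ ≤ ∑' n : ℕ, η⁻¹ * (n : ℝ) ^ (-(1 + η)) := hs.sum_le_tsum _ fun n _ ↦ by positivity
    _ ≤ _ := by linarith

theorem exists_abs_saddleMean_sub_le {σ₁ : ℝ} (h1 : 1 / 2 < σ₁) :
    ∃ C > 0, ∀ σ y : ℝ, σ₁ ≤ σ →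
      ∑ p ∈ primesUpTo y, Real.log p * (p : ℝ) ^ (-σ) ≤ saddleMean y σ ∧
      saddleMean y σ ≤ ∑ p ∈ primesUpTo y, Real.log p * (p : ℝ) ^ (-σ) + C := by
  obtain ⟨C, hC, H⟩ := exists_sum_log_mul_rpow_le h1
  refine ⟨24 / 7 * C, by positivity, fun σ y hσ ↦ ⟨?_, ?_⟩⟩
  · refine Finset.sum_le_sum fun p hp ↦ ?_
    have h2 := log_nonneg_of_mem hp
    have h3 := rpow_neg_le_of_mem (α := σ) (by linarith) hp
    have h4 : 0 ≤ (p : ℝ) ^ (-σ) := by positivity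
    gcongr
    rw [le_div_iff₀ (by linarith)]
    nlinarith
  · refine le_trans ?_ (add_le_add_right (mul_le_mul_of_nonneg_left (H y)
      (by norm_num : (0 : ℝ) ≤ 24 / 7)) _)
    rw [Finset.mul_sum, ← Finset.sum_add_distrib]
    refine Finset.sum_le_sum fun p hp ↦ ?_
    have h2 := log_nonneg_of_mem hp
    have h3 := rpow_neg_le_of_mem (α := σ) (by linarith) hp
    have h4 : 0 ≤ (p : ℝ) ^ (-σ) := by positivity
    have h5 : ((p : ℝ) ^ (-σ)) ^ 2 ≤ (p : ℝ) ^ (-(2 * σ₁)) := by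
      rw [← Real.rpow_natCast, ← Real.rpow_mul (by positivity)]
      refine Real.rpow_le_rpow_of_exponent_le (by linarith [two_le_of_mem hp]) ?_
      push_cast; linarith
    have h6 : (p : ℝ) ^ (-σ) / (1 - (p : ℝ) ^ (-σ)) ≤
        (p : ℝ) ^ (-σ) + 24 / 7 * ((p : ℝ) ^ (-σ)) ^ 2 := by
      rw [div_le_iff₀ (by linarith)]
      nlinarith [sq_nonneg ((p : ℝ) ^ (-σ)), mul_nonneg (sq_nonneg ((p : ℝ) ^ (-σ)))
        (sub_nonneg.2 h3)]
    calc _ ≤ Real.log p * ((p : ℝ) ^ (-σ) + 24 / 7 * (p : ℝ) ^ (-(2 * σ₁))) := by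
          gcongr; linarith
      _ = _ := by ring

theorem integral_rpow_neg {σ y : ℝ} (hσ : σ < 1) :
    ∫ v : ℝ in 1..y, v ^ (-σ) = (y ^ (1 - σ) - 1) / (1 - σ) := by
  rw [integral_rpow (Or.inl (by linarith)), Real.one_rpow]
  ring_nf

theorem norm_integral_cpow_neg_le {σ t y : ℝ} (hσ : σ < 1) (hy : 0 < y) :
    ‖∫ v : ℝ in 1..y, (v : ℂ) ^ (-(σ + t * I))‖ ≤
      (y ^ (1 - σ) + 1) / Real.sqrt ((1 - σ) ^ 2 + t ^ 2) := by
  rw [integral_cpow (Or.inl (by simpa using hσ)), norm_div, ofReal_one, one_cpow]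
  have h1 : ‖-((σ : ℂ) + t * I) + 1‖ = Real.sqrt ((1 - σ) ^ 2 + t ^ 2) := by
    have : -((σ : ℂ) + t * I) + 1 = ((1 - σ : ℝ) : ℂ) + ((-t : ℝ) : ℂ) * I := by push_cast; ring
    rw [this, norm_add_mul_I, neg_sq]
  rw [h1]
  gcongr
  refine (norm_sub_le _ _).trans ?_
  rw [norm_cpow_eq_rpow_re_of_pos hy]
  simp [neg_add_eq_sub]

theorem sum_log_mul_rpow_eq (y σ t : ℝ) :
    (∑ p ∈ primesUpTo y, (p : ℂ) ^ (-(σ + t * I)) * Real.log p).re =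
      ∑ p ∈ primesUpTo y, Real.log p * (p : ℝ) ^ (-σ) * Real.cos (t * Real.log p) := by
  rw [re_sum]
  refine Finset.sum_congr rfl fun p hp ↦ ?_
  rw [natCast_cpow_neg_eq_mul_exp (mem_primesUpTo.1 hp).1.ne_zero, ← neg_mul, ← ofReal_neg,
    re_mul_ofReal, re_ofReal_mul, exp_ofReal_mul_I_re, Real.cos_neg]
  ring

theorem exists_abs_sum_log_sub_integral_le (hGRH : GRH) {σ₁ : ℝ} (h0 : 1 / 2 < σ₁)
    (h1 : σ₁ ≤ 1) :
    ∃ C > 0, ∀ σ y : ℝ, σ₁ ≤ σ → σ ≤ 1 → 1 ≤ y →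
      |∑ p ∈ primesUpTo y, Real.log p * (p : ℝ) ^ (-σ) - ∫ v : ℝ in 1..y, v ^ (-σ)| ≤ C := by
  obtain ⟨C, hC, H⟩ := exists_norm_sum_primes_cpow_mul_log_sub_integral_le hGRH h0 h1
  refine ⟨C * Real.log 2, by positivity, fun σ y hσ hσ1 hy ↦ ?_⟩
  have := H σ 0 y hσ hσ1 hy
  rw [abs_zero, zero_add] at this
  refine le_trans (le_of_eq ?_) this
  rw [← Real.norm_eq_abs, ← norm_real]
  congr 1
  have e1 : ∀ v ∈ uIcc 1 y, (((v ^ (-σ) : ℝ)) : ℂ) = (v : ℂ) ^ (-((σ : ℂ) + (0 : ℝ) * I)) := by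
    intro v hv
    rw [uIcc_of_le hy] at hv
    rw [ofReal_cpow (by linarith [hv.1])]
    simp
  push_cast
  rw [← intervalIntegral.integral_ofReal, intervalIntegral.integral_congr e1]
  congr 1
  refine Finset.sum_congr rfl fun p hp ↦ ?_
  rw [ofReal_cpow (by positivity)]
  simp [mul_comm]

theorem continuousOn_saddleMean (y : ℝ) : ContinuousOn (saddleMean y) (Ioi 0) := by
  refine continuousOn_finsetSum _ fun p hp ↦ ?_
  have h2 := two_le_of_mem hp
  have hc : ContinuousOn (fun α : ℝ ↦ (p : ℝ) ^ (-α)) (Ioi 0) :=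
    (continuous_const.rpow continuous_neg fun _ ↦ Or.inl (by positivity)).continuousOn
  refine continuousOn_const.mul (hc.div (continuousOn_const.sub hc) fun α hα ↦ ?_)
  have := rpow_neg_lt_one_of_mem hα hp
  linarith

/-- The exponent `σ₁` on the left of all saddle points. -/
theorem exists_saddle_point (hGRH : GRH) {δ σ₁ : ℝ} (hδ : 0 < δ) (h0 : 1 / 2 < σ₁)
    (h1 : σ₁ < 1) (h2 : 1 < (2 + δ) * (1 - σ₁)) :
    ∀ᶠ p : ℝ × ℝ in smoothRange δ, ∃ α, σ₁ ≤ α ∧ α < 1 ∧ saddleMean p.2 α = Real.log p.1 := by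
  obtain ⟨C, hC, H⟩ := exists_abs_saddleMean_sub_le h0
  obtain ⟨C', hC', H'⟩ := exists_abs_sum_log_sub_integral_le hGRH h0 h1.le
  set K := C + C' + 1
  have h3 : ∀ᶠ l : ℝ in atTop, l + K + 1 ≤ l ^ ((2 + δ) * (1 - σ₁)) := by
    have : ∀ᶠ l : ℝ in atTop, 2 ≤ l ^ ((2 + δ) * (1 - σ₁) - 1) :=
      (tendsto_rpow_atTop (by linarith)).eventually_ge_atTop 2
    filter_upwards [this, eventually_ge_atTop (K + 1), eventually_ge_atTop 1] with l h4 h5 h6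
    have : l ^ ((2 + δ) * (1 - σ₁)) = l ^ ((2 + δ) * (1 - σ₁) - 1) * l := by
      nth_rw 3 [← Real.rpow_one l]
      rw [← Real.rpow_add (by linarith), sub_add_cancel]
    rw [this]
    nlinarith
  filter_upwards [(tendsto_log_fst δ).eventually h3, (tendsto_log_fst δ).eventually_ge_atTop (2 * K),
    (tendsto_log_fst δ).eventually_ge_atTop 1,
    eventually_rpow_le_snd δ, eventually_mul_sq_le hδ 2, (tendsto_log_snd hδ).eventually_ge_atTop 1,
    (tendsto_snd_smoothRange hδ).eventually_ge_atTop 1] with p h3 h4 h4' h5 h6 h7 h8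
  have hlow : Real.log p.1 ≤ saddleMean p.2 σ₁ := by
    have e1 := (H σ₁ p.2 le_rfl).1
    have e2 := (abs_le.1 (H' σ₁ p.2 le_rfl h1.le h8)).1
    rw [integral_rpow_neg h1] at e2
    have e3 : Real.log p.1 ^ ((2 + δ) * (1 - σ₁)) ≤ p.2 ^ (1 - σ₁) := by
      rw [Real.rpow_mul (by linarith)]
      exact Real.rpow_le_rpow (by positivity) h5 (by linarith)
    have e4 : p.2 ^ (1 - σ₁) - 1 ≤ (p.2 ^ (1 - σ₁) - 1) / (1 - σ₁) := by
      rw [le_div_iff₀ (by linarith)]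
      nlinarith [Real.one_le_rpow h8 (by linarith : 0 ≤ 1 - σ₁)]
    linarith
  have hhigh : saddleMean p.2 1 < Real.log p.1 := by
    have e1 := (H 1 p.2 h1.le).2
    have e2 := (abs_le.1 (H' 1 p.2 h1.le le_rfl h8)).2
    have e3 : ∫ v : ℝ in 1..p.2, v ^ (-1 : ℝ) = Real.log p.2 := by
      simp_rw [Real.rpow_neg_one]
      rw [integral_inv_of_pos one_pos (by linarith), div_one]
    rw [e3] at e2
    nlinarith
  have hc : ContinuousOn (saddleMean p.2) (Icc σ₁ 1) :=
    (continuousOn_saddleMean p.2).mono fun z hz ↦ lt_of_lt_of_le (by linarith) hz.1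
  obtain ⟨α, hα, hα'⟩ := intermediate_value_Icc' h1.le hc ⟨hhigh.le, hlow⟩
  refine ⟨α, hα.1, lt_of_le_of_ne hα.2 ?_, hα'⟩
  rintro rfl
  linarith

end SmoothSum

namespace SmoothSum

open Complex Set Filter Topology MeasureTheory Metric

/-- The properties of the saddle point `α` of `x ^ s ζ(s; y)` used below. -/
structure SaddleBounds (σ₁ x y α : ℝ) : Prop where
  one_le_x : 1 ≤ x
  one_le_y : 1 ≤ y
  le_log : 44 ≤ Real.log y
  le_α : σ₁ ≤ α
  α_lt : α < 1
  mean : saddleMean y α = Real.log x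
  c_le : 1 - 1 / (Real.log y / Real.log (Real.log x)) ≤ α
  le_c : α ≤ 1 - 1 / (Real.log y / Real.log (Real.log x)) +
    2 * (Real.log (Real.log y) / Real.log y)
  le_var : 2 * Real.log y ^ 2 ≤ saddleVar y α
  var_le : saddleVar y α ≤ y ^ 2
  norm_tilt_le : ∀ t : ℝ, 1 / Real.log y ≤ |t| → |t| ≤ y → ‖tilt x y α t‖ ≤ (y ^ 5)⁻¹
  le_zeta : y ^ 10 ≤ ‖eulerProd y α‖

theorem exp_sum_le_norm_eulerProd {y α : ℝ} (hα : 0 < α) :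
    Real.exp (∑ p ∈ primesUpTo y, (p : ℝ) ^ (-α)) ≤ ‖eulerProd y α‖ := by
  rw [eulerProd, norm_prod, Real.exp_sum]
  refine Finset.prod_le_prod (fun p _ ↦ Real.exp_nonneg _) fun p hp ↦ ?_
  have h1 := rpow_neg_lt_one_of_mem hα hp
  have h2 : (1 - (p : ℂ) ^ (-(α : ℂ))) = ((1 - (p : ℝ) ^ (-α) : ℝ) : ℂ) := by
    push_cast [ofReal_cpow (Nat.cast_nonneg p)]
    rfl
  rw [norm_inv, h2, norm_real, Real.norm_of_nonneg (by linarith),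
    le_inv_comm₀ (Real.exp_pos _) (by linarith), ← Real.exp_neg]
  linarith [Real.add_one_le_exp (-(p : ℝ) ^ (-α))]

theorem log_two_mul_saddleMean_le {y α : ℝ} (hα : 0 < α) :
    Real.log 2 * saddleMean y α ≤ saddleVar y α := by
  rw [saddleMean, Finset.mul_sum]
  refine Finset.sum_le_sum fun p hp ↦ ?_
  have h1 := rpow_neg_lt_one_of_mem hα hp
  have h2 := log_nonneg_of_mem hp
  have h3 : Real.log 2 ≤ Real.log p := Real.log_le_log two_pos (two_le_of_mem hp)
  have h4 : 0 ≤ (p : ℝ) ^ (-α) := by positivity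
  have h5 : (p : ℝ) ^ (-α) / (1 - (p : ℝ) ^ (-α)) ≤
      (p : ℝ) ^ (-α) / (1 - (p : ℝ) ^ (-α)) ^ 2 := by
    refine div_le_div_of_nonneg_left h4 (by nlinarith) (by nlinarith)
  have h6 : 0 ≤ (p : ℝ) ^ (-α) / (1 - (p : ℝ) ^ (-α)) := div_nonneg h4 (by linarith)
  calc _ ≤ Real.log p * (Real.log p * ((p : ℝ) ^ (-α) / (1 - (p : ℝ) ^ (-α)) ^ 2)) := by gcongr
    _ = _ := by ring

theorem saddleVar_le {y α : ℝ} (hα : 1 / 2 ≤ α) :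
    saddleVar y α ≤ 24 / 7 * Real.log y * saddleMean y α := by
  rw [saddleMean, Finset.mul_sum]
  refine Finset.sum_le_sum fun p hp ↦ ?_
  have h1 := rpow_neg_le_of_mem hα hp
  have h2 := log_nonneg_of_mem hp
  have h3 := log_le_of_mem hp
  have h4 : 0 ≤ (p : ℝ) ^ (-α) := by positivity
  have h7 : 0 ≤ Real.log y := h2.trans h3
  have h6 : 0 ≤ (p : ℝ) ^ (-α) / (1 - (p : ℝ) ^ (-α)) := div_nonneg h4 (by linarith)
  have h5 : (p : ℝ) ^ (-α) / (1 - (p : ℝ) ^ (-α)) ^ 2 ≤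
      24 / 7 * ((p : ℝ) ^ (-α) / (1 - (p : ℝ) ^ (-α))) := by
    have : (p : ℝ) ^ (-α) / (1 - (p : ℝ) ^ (-α)) ^ 2 =
        (1 - (p : ℝ) ^ (-α))⁻¹ * ((p : ℝ) ^ (-α) / (1 - (p : ℝ) ^ (-α))) := by
      field_simp
    rw [this]
    gcongr
    rw [inv_le_comm₀ (by linarith) (by norm_num)]
    linarith
  calc _ = Real.log p * Real.log p * ((p : ℝ) ^ (-α) / (1 - (p : ℝ) ^ (-α)) ^ 2) := by ring
    _ ≤ Real.log y * Real.log p * (24 / 7 * ((p : ℝ) ^ (-α) / (1 - (p : ℝ) ^ (-α)))) := by gcongr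
    _ = _ := by ring

theorem sum_one_sub_cos_ge {y α t C : ℝ} (hy : 1 < y) (hα : α < 1)
    (hJ : (y ^ (1 - α) - 1) / (1 - α) - C ≤ ∑ p ∈ primesUpTo y, Real.log p * (p : ℝ) ^ (-α))
    (H : ‖∑ p ∈ primesUpTo y, (p : ℂ) ^ (-(α + t * I)) * Real.log p -
        ∫ v : ℝ in 1..y, (v : ℂ) ^ (-(α + t * I))‖ ≤ C * Real.log (|t| + 2))
    (hty : 1 / Real.log y ≤ |t|) :
    (y ^ (1 - α) / (2 * (((1 - α) * Real.log y) ^ 2 + 1)) - 2) / (1 - α) - C -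
      C * Real.log (|t| + 2) ≤
      Real.log y * ∑ p ∈ primesUpTo y, (p : ℝ) ^ (-α) * (1 - Real.cos (t * Real.log p)) := by
  have hY : 0 < Real.log y := Real.log_pos hy
  have hβ : 0 < 1 - α := by linarith
  have h1 := (abs_le.1 ((abs_re_le_norm _).trans H)).2
  rw [sub_re, sum_log_mul_rpow_eq] at h1
  have h2 := (le_abs_self _).trans ((abs_re_le_norm _).trans
    (norm_integral_cpow_neg_le (y := y) (t := t) hα (by linarith)))
  set E := y ^ (1 - α) with hE
  have hE0 : 0 < E := by positivity
  set β := 1 - α with hβdef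
  set u := 1 / (2 * ((β * Real.log y) ^ 2 + 1)) with hu
  have hu0 : 0 < u := by positivity
  have hu1 : u ≤ 1 / 2 := by
    rw [hu, div_le_div_iff₀ (by positivity) (by norm_num)]
    nlinarith [sq_nonneg (β * Real.log y)]
  have h3 : (E + 1) / Real.sqrt (β ^ 2 + t ^ 2) ≤ (E + 1) / β * (1 - u) := by
    rw [div_le_iff₀ (Real.sqrt_pos.2 (by positivity)), mul_assoc, div_mul_eq_mul_div,
      le_div_iff₀ hβ]
    gcongr
    have ht2 : (1 / Real.log y) ^ 2 ≤ t ^ 2 := by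
      rw [← sq_abs t]; gcongr
    have h4 : β ≤ (1 - u) * Real.sqrt (β ^ 2 + t ^ 2) := by
      rw [← Real.sqrt_sq (by linarith : 0 ≤ 1 - u), ← Real.sqrt_mul (sq_nonneg _)]
      refine Real.le_sqrt_of_sq_le ?_
      have h5 : 1 - 2 * u ≤ (1 - u) ^ 2 := by nlinarith
      have h6 : β ^ 2 = (1 - 2 * u) * (β ^ 2 + (1 / Real.log y) ^ 2) := by
        rw [hu]; field_simp; ring
      exact h6.le.trans (by gcongr)
    exact h4
  have h7 : Real.log y * ∑ p ∈ primesUpTo y, (p : ℝ) ^ (-α) * (1 - Real.cos (t * Real.log p)) ≥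
      ∑ p ∈ primesUpTo y, Real.log p * (p : ℝ) ^ (-α) * (1 - Real.cos (t * Real.log p)) := by
    rw [Finset.mul_sum]
    refine Finset.sum_le_sum fun p hp ↦ ?_
    have h3 := log_le_of_mem hp
    have h4 : 0 ≤ (p : ℝ) ^ (-α) := by positivity
    have h5 : 0 ≤ 1 - Real.cos (t * Real.log p) := by linarith [Real.cos_le_one (t * Real.log p)]
    rw [mul_assoc]
    gcongr
  have h8 : ∑ p ∈ primesUpTo y, Real.log p * (p : ℝ) ^ (-α) * (1 - Real.cos (t * Real.log p)) =
      ∑ p ∈ primesUpTo y, Real.log p * (p : ℝ) ^ (-α) -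
      ∑ p ∈ primesUpTo y, Real.log p * (p : ℝ) ^ (-α) * Real.cos (t * Real.log p) := by
    rw [← Finset.sum_sub_distrib]
    exact Finset.sum_congr rfl fun p _ ↦ by ring
  have h9 : (E / (2 * ((β * Real.log y) ^ 2 + 1)) - 2) / β ≤
      (E - 1) / β - (E + 1) / β * (1 - u) := by
    have : (E - 1) / β - (E + 1) / β * (1 - u) =
      (E / (2 * ((β * Real.log y) ^ 2 + 1)) - 2) / β + u / β := by
      rw [hu]; field_simp; ring
    have := div_pos hu0 hβ
    linarith
  linarith

theorem twenty_mul_le {l Y l2 β E K S L : ℝ} (hβ : 0 < β) (hl2 : 1 ≤ l2) (hY : 1 ≤ Y)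
    (hK : 0 < K) (b2 : β * Y ≤ l2) (b4 : l / (2 * Y) ≤ E)
    (hcube : 4 * (22 + 3 * K) * (Y ^ 2 * (1 + l2) ^ 3) ≤ l) (hL : L ≤ 2 * Y)
    (h3 : (E / (2 * ((β * Y) ^ 2 + 1)) - 2) / β - K - K * L ≤ Y * S) : 20 * Y ≤ S := by
  have hY0 : 0 < Y := by linarith
  have hE : 0 ≤ E := le_trans (div_nonneg (le_trans (by positivity) hcube) (by linarith)) b4
  have h5 : l / (4 * Y * (1 + l2) ^ 2) ≤ E / (2 * ((β * Y) ^ 2 + 1)) := by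
    have : 2 * ((β * Y) ^ 2 + 1) ≤ 2 * (1 + l2) ^ 2 := by
      have : (β * Y) ^ 2 ≤ l2 ^ 2 := by gcongr
      linarith [add_sq 1 l2]
    calc l / (4 * Y * (1 + l2) ^ 2) = l / (2 * Y) / (2 * (1 + l2) ^ 2) := by
          field_simp; ring
      _ ≤ _ := by gcongr
  have h6 : Y / (1 + l2) ≤ 1 / β := by
    rw [div_le_div_iff₀ (by linarith) hβ]
    linarith
  have h7 : (22 + 3 * K) * Y * (1 + l2) ≤ l / (4 * Y * (1 + l2) ^ 2) := by
    rw [le_div_iff₀ (by positivity)]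
    linarith
  have h8 : ((22 + 3 * K) * Y * (1 + l2) - 2) * (Y / (1 + l2)) ≤
      (E / (2 * ((β * Y) ^ 2 + 1)) - 2) / β := by
    rw [div_eq_mul_one_div _ β]
    have : 0 ≤ (22 + 3 * K) * Y * (1 + l2) - 2 := by
      have h1 : 2 ≤ (22 + 3 * K) * Y := by nlinarith
      have h2 : (22 + 3 * K) * Y * 1 ≤ (22 + 3 * K) * Y * (1 + l2) := by gcongr; linarith
      linarith
    exact mul_le_mul (by linarith) h6 (by positivity) (by linarith)
  have h9 : ((22 + 3 * K) * Y * (1 + l2) - 2) * (Y / (1 + l2)) =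
      (22 + 3 * K) * Y ^ 2 - 2 * (Y / (1 + l2)) := by
    field_simp
  have h10 : Y / (1 + l2) ≤ Y := div_le_self hY0.le (by linarith)
  have h11 : 20 * Y * Y ≤ Y * S := by
    have : K * L ≤ K * (2 * Y) := by gcongr
    have h1 : Y ≤ Y ^ 2 := by nlinarith
    have : K + K * (2 * Y) + 2 * Y ≤ (3 * K + 2) * Y ^ 2 := by nlinarith
    linarith
  have h12 : Y * (20 * Y) ≤ Y * S := by linarith
  exact le_of_mul_le_mul_left h12 hY0

set_option maxHeartbeats 1000000 in
theorem exists_saddleBounds (hGRH : GRH) {δ : ℝ} (hδ : 0 < δ) :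
    ∃ σ₁, 1 / 2 < σ₁ ∧ σ₁ < 1 ∧
      ∀ᶠ p : ℝ × ℝ in smoothRange δ, ∃ α, SaddleBounds σ₁ p.1 p.2 α := by
  have hδ' : 1 / (2 + δ) < 1 / 2 := one_div_lt_one_div_of_lt two_pos (by linarith)
  have hδ0 : 0 < 1 / (2 + δ) := by positivity
  set σ₁ : ℝ := 1 - (1 / 2 + 1 / (2 + δ)) / 2 with hσ₁
  have h0 : 1 / 2 < σ₁ := by linarith
  have h1 : σ₁ < 1 := by linarith
  have h2 : 1 < (2 + δ) * (1 - σ₁) := by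
    have : (2 + δ) * (1 - σ₁) = (2 + δ) * (1 / 2) / 2 + 1 / 2 := by
      rw [hσ₁]; field_simp; ring
    rw [this]; linarith
  refine ⟨σ₁, h0, h1, ?_⟩
  obtain ⟨C₁, hC₁, H₁⟩ := exists_abs_saddleMean_sub_le h0
  obtain ⟨C₂, hC₂, H₂⟩ := exists_abs_sum_log_sub_integral_le hGRH h0 h1.le
  obtain ⟨C₃, hC₃, H₃⟩ := exists_norm_sum_primes_cpow_mul_log_sub_integral_le hGRH h0 h1.le
  set K := C₁ + C₂ + C₃ with hK
  filter_upwards [exists_saddle_point hGRH hδ h0 h1 h2, (tendsto_log_fst δ).eventually_ge_atTop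
    (2 * K + 4), (tendsto_log_log_fst δ).eventually_ge_atTop 1,
    (tendsto_fst_smoothRange δ).eventually_ge_atTop 1,
    eventually_rpow_le_snd δ, eventually_mul_sq_le hδ (20 + K),
    eventually_mul_log_sq_le hδ (4 * (22 + 3 * K)),
    (tendsto_log_snd hδ).eventually_ge_atTop 44, (tendsto_snd_smoothRange hδ).eventually_ge_atTop 2,
    (tendsto_log_log_snd hδ).eventually_ge_atTop 1]
    with p ⟨α, hα₁, hα₂, hα₃⟩ hl hl2 hx hlow hsq hcube hY hy hY2
  obtain ⟨x, y⟩ := p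
  simp only at *
  have hα0 : 1 / 2 ≤ α := by linarith
  have a1 := H₁ α y hα₁
  have a2 := abs_le.1 (H₂ α y hα₁ hα₂.le (by linarith))
  rw [integral_rpow_neg hα₂] at a2
  have a3 := H₃ α
  set P := ∑ p ∈ primesUpTo y, Real.log p * (p : ℝ) ^ (-α) with hP
  have hβ : 0 < 1 - α := by linarith
  have hlogE : Real.log (y ^ (1 - α)) = (1 - α) * Real.log y := Real.log_rpow (by linarith) _
  set E := y ^ (1 - α) with hE
  have hE0 : 0 < E := by positivity
  set Y := Real.log y with hYdef
  set l := Real.log x with hldef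
  set l2 := Real.log l with hl2def
  have hKpos : 0 < K := by positivity
  have hY0 : 0 < Y := by linarith
  have hl0 : 0 < l := by linarith
  have b1 : E ≤ l := by
    have : (E - 1) / (1 - α) ≤ l + K := by linarith
    rw [div_le_iff₀ hβ] at this
    have h3 : (l + K) * (1 - α) ≤ (l + K) * (1 / 2) := by gcongr; linarith
    linarith
  have b2 : (1 - α) * Y ≤ l2 := by
    rw [← hlogE]; exact Real.log_le_log hE0 b1
  have b3 : (E - 1) / (1 - α) ≤ Y * E := by
    have := Real.one_sub_inv_le_log_of_pos hE0
    rw [hlogE] at this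
    rw [div_le_iff₀ hβ]
    have h3 : E * (1 - E⁻¹) ≤ E * ((1 - α) * Y) := by gcongr
    rw [mul_sub, mul_inv_cancel₀ hE0.ne'] at h3
    linarith
  have b4 : l / (2 * Y) ≤ E := by
    rw [div_le_iff₀ (by positivity)]
    linarith
  have b5 : l2 - 2 * Real.log Y ≤ (1 - α) * Y := by
    have h3 := Real.log_le_log (by positivity) b4
    rw [hlogE, Real.log_div (by positivity) (by positivity),
      Real.log_mul (by norm_num) (by positivity)] at h3
    have : Real.log 2 ≤ Real.log Y := Real.log_le_log two_pos (by linarith)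
    linarith
  have hlY : l2 / Y = 1 / (Y / l2) := by rw [one_div_div]
  have hPl : l - K ≤ P := by linarith
  have hexpY : ∀ n : ℕ, y ^ n = Real.exp (n * Y) := fun n ↦ by
    rw [Real.exp_nat_mul, hYdef, Real.exp_log (by linarith)]
  have hyl : 4 * l ≤ y := by
    calc 4 * l ≤ l ^ 2 := by rw [sq]; gcongr; linarith
      _ = l ^ (2 : ℝ) := by norm_cast
      _ ≤ l ^ (2 + δ) := Real.rpow_le_rpow_of_exponent_le (by linarith) (by linarith)
      _ ≤ y := hlow
  refine ⟨α, hx, by linarith, hY, hα₁, hα₂, hα₃, ?_, ?_, ?_, ?_, ?_, ?_⟩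
  · rw [← hlY]
    have := (le_div_iff₀ hY0).2 b2
    linarith
  · rw [← hlY]
    have := (div_le_iff₀ hY0).2 b5
    rw [sub_div, mul_div_assoc] at this
    linarith
  · have h3 := log_two_mul_saddleMean_le (y := y) (α := α) (by linarith)
    rw [hα₃] at h3
    have h4 : 1 / 2 * l ≤ Real.log 2 * l := by
      gcongr
      linarith [Real.log_two_gt_d9]
    have h5 : 0 ≤ K * Y ^ 2 := by positivity
    linarith [sq_nonneg Y]
  · have h3 := saddleVar_le (y := y) hα0
    rw [hα₃] at h3
    have : Y ≤ y := Real.log_le_self (by linarith)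
    have h4 : Y * (4 * l) ≤ y * y := by gcongr
    have h5 : 0 ≤ Y * l := by positivity
    linarith
  · intro t ht hty
    refine (norm_tilt_le_exp_sum (by linarith) hα0).trans ?_
    rw [hexpY, ← Real.exp_neg, Real.exp_le_exp]
    have h3 := sum_one_sub_cos_ge (y := y) (α := α) (t := t) (C := K) (by linarith) hα₂
      (by linarith) ((a3 t y hα₁ hα₂.le (by linarith)).trans (by
        have : 0 ≤ Real.log (|t| + 2) := Real.log_nonneg (by linarith [abs_nonneg t])
        gcongr
        linarith)) ht
    set S := ∑ p ∈ primesUpTo y, (p : ℝ) ^ (-α) * (1 - Real.cos (t * Real.log p))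
    have h4 : Real.log (|t| + 2) ≤ 2 * Y := by
      rw [hYdef, ← Real.log_rpow (by linarith)]
      refine Real.log_le_log (by positivity) ?_
      norm_cast
      have : 2 * y ≤ y * y := by gcongr
      linarith
    have h12 : 20 * Y ≤ S := twenty_mul_le hβ hl2 (by linarith) hKpos b2 b4 hcube h4 h3
    push_cast
    linarith
  · refine le_trans ?_ (exp_sum_le_norm_eulerProd (by linarith))
    rw [hexpY, Real.exp_le_exp]
    have h3 : P ≤ Y * ∑ p ∈ primesUpTo y, (p : ℝ) ^ (-α) := by
      rw [Finset.mul_sum]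
      exact Finset.sum_le_sum fun p hp ↦ by gcongr; exact log_le_of_mem hp
    have h4 : Y * (10 * Y) ≤ Y * ∑ p ∈ primesUpTo y, (p : ℝ) ^ (-α) := by
      have h5 : K * 1 ≤ K * Y ^ 2 := by gcongr; exact one_le_pow₀ (by linarith)
      linarith [sq_nonneg Y]
    push_cast
    exact le_of_mul_le_mul_left h4 hY0

end SmoothSum

namespace SmoothSum

open Complex Set Filter Topology MeasureTheory Metric

theorem differentiableAt_eulerProd {y : ℝ} {s : ℂ} (hs : 0 < s.re) :
    DifferentiableAt ℂ (eulerProd y) s := by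
  unfold eulerProd
  refine DifferentiableAt.fun_finsetProd fun p hp ↦ ?_
  have hp' := (mem_primesUpTo.1 hp).1
  refine DifferentiableAt.inv ?_ (one_sub_natCast_cpow_ne_zero hp' hs)
  exact (differentiableAt_const _).sub (differentiableAt_id.neg.const_cpow
    (Or.inl (by exact_mod_cast hp'.ne_zero)))

theorem continuous_eulerProd_vertical {y α : ℝ} (hα : 0 < α) :
    Continuous fun t : ℝ ↦ eulerProd y (α + t * I) := by
  rw [continuous_iff_continuousAt]
  intro t
  refine ContinuousAt.comp (f := fun t : ℝ ↦ (α + t * I : ℂ))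
    (differentiableAt_eulerProd (by simpa)).continuousAt (by fun_prop)

theorem continuous_ofReal_cpow_vertical {x : ℝ} (hx : 0 < x) (σ : ℂ) :
    Continuous fun t : ℝ ↦ (x : ℂ) ^ (σ + t * I) :=
  Continuous.const_cpow (by fun_prop) (Or.inl (by exact_mod_cast hx.ne'))

theorem continuous_tilt {x y α : ℝ} (hx : 0 < x) (hα : 0 < α) : Continuous (tilt x y α) := by
  have := continuous_ofReal_cpow_vertical hx 0
  simp only [zero_add] at this
  exact this.mul ((continuous_eulerProd_vertical hα).div_const _)

theorem integral_mul_exp_neg_le {V : ℝ} (hV : 0 < V) (a b : ℝ) :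
    ∫ t in a..b, t * Real.exp (-(2 / 5 * V * t ^ 2)) ≤
      Real.exp (-(2 / 5 * V * a ^ 2)) * (5 / (4 * V)) := by
  have hd : ∀ t : ℝ, HasDerivAt (fun t : ℝ ↦ -(5 / (4 * V)) * Real.exp (-(2 / 5 * V * t ^ 2)))
      (t * Real.exp (-(2 / 5 * V * t ^ 2))) t := fun t ↦ by
    have := ((((hasDerivAt_id t).pow 2).const_mul (2 / 5 * V)).neg.exp).const_mul (-(5 / (4 * V)))
    refine this.congr_deriv ?_
    simp
    field_simp
    ring
  rw [intervalIntegral.integral_eq_sub_of_hasDerivAt (fun t _ ↦ hd t)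
    (Continuous.intervalIntegrable (by fun_prop) _ _)]
  have : 0 ≤ (5 / (4 * V)) * Real.exp (-(2 / 5 * V * b ^ 2)) := by positivity
  linarith

theorem integral_ge_of_near_one {g : ℝ → ℝ} (hg : Continuous g) {V b : ℝ} (hV : 0 < V)
    (hb : 11 / 10 / Real.sqrt V ≤ b)
    (h1 : ∀ t, |t| ≤ 11 / 10 / Real.sqrt V → 1 - V * t ^ 2 / 2 - (V * t ^ 2 / 2) ^ 2 ≤ g t)
    (h2 : ∀ t, |t| ≤ b → |g t| ≤ Real.exp (-(2 / 5 * V * t ^ 2))) :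
    19 / 100 / Real.sqrt V ≤ ∫ t in -b..b, g t := by
  have hs : 0 < Real.sqrt V := Real.sqrt_pos.2 hV
  set a := 11 / 10 / Real.sqrt V with ha
  have ha0 : 0 < a := by positivity
  have hsq : Real.sqrt V * Real.sqrt V = V := Real.mul_self_sqrt hV.le
  have haV : V * a ^ 2 = 121 / 100 := by
    rw [ha, div_pow, Real.sq_sqrt hV.le]; field_simp; norm_num
  have hi : ∀ c d : ℝ, IntervalIntegrable g volume c d := fun c d ↦ hg.intervalIntegrable _ _
  have htail : ∀ f : ℝ → ℝ, Continuous f → (∀ t, |t| ≤ b →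
      |f t| ≤ Real.exp (-(2 / 5 * V * t ^ 2))) → -(7015 / 10000 / Real.sqrt V) ≤
      ∫ t in a..b, f t := by
    intro f hf hfb
    have e1 : ∫ t in a..b, -(a⁻¹ * (t * Real.exp (-(2 / 5 * V * t ^ 2)))) ≤ ∫ t in a..b, f t := by
      refine intervalIntegral.integral_mono_on hb
        (Continuous.intervalIntegrable (by fun_prop) _ _) (hf.intervalIntegrable _ _) fun t ht ↦ ?_
      have e2 := (abs_le.1 (hfb t (by rw [abs_of_nonneg (by linarith [ht.1])]; exact ht.2))).1
      refine le_trans (neg_le_neg ?_) e2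
      rw [← mul_assoc]
      refine le_mul_of_one_le_left (Real.exp_nonneg _) ?_
      rw [inv_mul_eq_div, one_le_div ha0]
      exact ht.1
    refine le_trans ?_ e1
    rw [intervalIntegral.integral_neg, intervalIntegral.integral_const_mul]
    refine neg_le_neg ?_
    have e3 := integral_mul_exp_neg_le hV a b
    have e4 : Real.exp (-(2 / 5 * V * a ^ 2)) ≤ 6172 / 10000 := by
      rw [mul_assoc, haV, Real.exp_neg, inv_le_comm₀ (Real.exp_pos _) (by norm_num)]
      have := Real.sum_le_exp_of_nonneg (x := 2 / 5 * (121 / 100)) (by norm_num) 5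
      refine le_trans ?_ this
      simp [Finset.sum_range_succ, Nat.factorial]
      norm_num
    calc _ ≤ a⁻¹ * (6172 / 10000 * (5 / (4 * V))) := by gcongr; exact e3.trans (by gcongr)
      _ ≤ _ := by
        have : a⁻¹ * (6172 / 10000 * (5 / (4 * V))) =
            (6172 / 10000 * 5 / 4 * (10 / 11)) / Real.sqrt V := by
          rw [ha]; nth_rw 2 [← hsq]; field_simp
        rw [this]
        gcongr
        norm_num
  have hmid : 2 * (797 / 1000) / Real.sqrt V ≤ ∫ t in -a..a, g t := by
    have e1 : ∫ t in -a..a, (1 - V * t ^ 2 / 2 - (V * t ^ 2 / 2) ^ 2) ≤ ∫ t in -a..a, g t := by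
      refine intervalIntegral.integral_mono_on (by linarith)
        (Continuous.intervalIntegrable (by fun_prop) _ _) (hi _ _) fun t ht ↦ h1 t (abs_le.2 ht)
    refine le_trans (le_of_le_of_eq (b := 2 * a * (1 - 121 / 600 - (121 / 100) ^ 2 / 20)) ?_ ?_) e1
    · have : 2 * a * (1 - 121 / 600 - (121 / 100) ^ 2 / 20) =
          11 / 5 * (1 - 121 / 600 - (121 / 100) ^ 2 / 20) / Real.sqrt V := by rw [ha]; ring
      rw [this]
      exact div_le_div_of_nonneg_right (by norm_num) hs.le
    · have hd : ∀ t : ℝ, HasDerivAt (fun t : ℝ ↦ t - V / 6 * t ^ 3 - V ^ 2 / 20 * t ^ 5)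
          (1 - V * t ^ 2 / 2 - (V * t ^ 2 / 2) ^ 2) t := fun t ↦ by
        have := ((hasDerivAt_id t).sub (((hasDerivAt_id t).pow 3).const_mul (V / 6))).sub
          (((hasDerivAt_id t).pow 5).const_mul (V ^ 2 / 20))
        refine this.congr_deriv ?_
        simp
        ring
      rw [intervalIntegral.integral_eq_sub_of_hasDerivAt (fun t _ ↦ hd t)
        (Continuous.intervalIntegrable (by fun_prop) _ _)]
      rw [← haV]
      ring_nf
      have : V * a ^ 3 = 121 / 100 * a := by rw [← haV]; ring
      have : V ^ 2 * a ^ 5 = (121 / 100) ^ 2 * a := by rw [← haV]; ring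
      linarith
  have hsplit : ∫ t in -b..b, g t =
      (∫ t in a..b, g (-t)) + (∫ t in -a..a, g t) + ∫ t in a..b, g t := by
    rw [intervalIntegral.integral_comp_neg, intervalIntegral.integral_add_adjacent_intervals
      (hi _ _) (hi _ _), intervalIntegral.integral_add_adjacent_intervals (hi _ _) (hi _ _)]
  have t1 := htail g hg h2
  have t2 := htail (fun t ↦ g (-t)) (by fun_prop) fun t ht ↦ by
    have := h2 (-t) (by rwa [abs_neg])
    rwa [neg_sq] at this
  rw [hsplit]
  have : 19 / 100 / Real.sqrt V ≤ -(7015 / 10000 / Real.sqrt V) + 2 * (797 / 1000) / Real.sqrt V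
      + -(7015 / 10000 / Real.sqrt V) := by
    rw [← neg_div, ← add_div, ← add_div]
    gcongr
    norm_num
  linarith

/-- The contribution of the saddle point to the inversion integral. -/
noncomputable def saddleMass (x y α : ℝ) : ℂ :=
  (1 / (2 * Real.pi) : ℝ) * ∫ t in -(1 / Real.log y)..1 / Real.log y, tilt x y α t

theorem SaddleBounds.var_pos {σ₁ x y α : ℝ} (h : SaddleBounds σ₁ x y α) : 0 < saddleVar y α := by
  have := h.le_var
  have := h.le_log
  nlinarith

theorem SaddleBounds.norm_saddleMass_ge {σ₁ x y α : ℝ} (h : SaddleBounds σ₁ x y α)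
    (hσ : 1 / 2 < σ₁) : 3 / 100 / Real.sqrt (saddleVar y α) ≤ ‖saddleMass x y α‖ := by
  have hV := h.var_pos
  have hs : 0 < Real.sqrt (saddleVar y α) := Real.sqrt_pos.2 hV
  have hx := h.one_le_x
  have hα := h.le_α
  have hY := h.le_log
  have hc : Continuous (tilt x y α) := continuous_tilt (by linarith) (by linarith)
  have key := integral_ge_of_near_one (g := fun t ↦ (tilt x y α t).re)
    (continuous_re.comp hc) hV (b := 1 / Real.log y) (by
      rw [div_le_div_iff₀ hs (by linarith), one_mul]
      refine Real.le_sqrt_of_sq_le ?_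
      have := h.le_var
      nlinarith [sq_nonneg (Real.log y)])
    (fun t ht ↦ by
      have h1 := norm_tilt_sub_one_le (x := x) (y := y) (α := α) (t := t) (by linarith)
        (by linarith) h.mean (by
          have : t ^ 2 ≤ (11 / 10 / Real.sqrt (saddleVar y α)) ^ 2 := by
            rw [← sq_abs t]; gcongr
          rw [div_pow, Real.sq_sqrt hV.le, le_div_iff₀ hV] at this
          linarith)
      have h2 := (abs_le.1 ((abs_re_le_norm _).trans h1)).1
      rw [sub_re, one_re] at h2
      linarith)
    (fun t ht ↦ (abs_re_le_norm _).trans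
      (norm_tilt_le_exp_of_le (by linarith) (by linarith) hY
        (by rwa [le_div_iff₀ (by linarith)] at ht)))
  have hre : (∫ t in -(1 / Real.log y)..1 / Real.log y, tilt x y α t).re =
      ∫ t in -(1 / Real.log y)..1 / Real.log y, (tilt x y α t).re := by
    have := reCLM.intervalIntegral_comp_comm
      (hc.intervalIntegrable (μ := volume) (-(1 / Real.log y)) (1 / Real.log y))
    exact this.symm
  rw [← hre] at key
  rw [saddleMass, norm_mul, norm_real, Real.norm_of_nonneg (by positivity)]
  have hn := key.trans (re_le_norm _)
  calc 3 / 100 / Real.sqrt (saddleVar y α)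
      ≤ 1 / (2 * Real.pi) * (19 / 100 / Real.sqrt (saddleVar y α)) := by
        rw [mul_div_assoc']
        gcongr
        rw [div_mul_eq_mul_div, one_mul, le_div_iff₀ (by positivity)]
        linarith [Real.pi_lt_d2]
    _ ≤ _ := by gcongr

theorem integral_exp_mul_le {V a D D' : ℝ} (hV : 0 < V) (ha : 0 ≤ a) (hD : 0 ≤ D) (hD' : 0 ≤ D') :
    ∫ t in -a..a, Real.exp (-(2 / 5 * V * t ^ 2)) * (D * |t| + D') ≤
      5 / 2 * D / V + 3 * D' / Real.sqrt V := by
  have hc1 : Continuous fun t : ℝ ↦ Real.exp (-(2 / 5 * V * t ^ 2)) * (D * |t|) := by fun_prop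
  have hc2 : Continuous fun t : ℝ ↦ Real.exp (-(2 / 5 * V * t ^ 2)) * D' := by fun_prop
  simp_rw [mul_add]
  rw [intervalIntegral.integral_add (hc1.intervalIntegrable _ _) (hc2.intervalIntegrable _ _)]
  refine add_le_add ?_ ?_
  · rw [← intervalIntegral.integral_add_adjacent_intervals (hc1.intervalIntegrable _ 0)
      (hc1.intervalIntegrable 0 _)]
    have e1 : ∫ t in -a..0, Real.exp (-(2 / 5 * V * t ^ 2)) * (D * |t|) =
        ∫ t in 0..a, Real.exp (-(2 / 5 * V * t ^ 2)) * (D * |t|) := by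
      have := intervalIntegral.integral_comp_neg (a := 0) (b := a)
        (fun t : ℝ ↦ Real.exp (-(2 / 5 * V * t ^ 2)) * (D * |t|))
      simp only [neg_sq, abs_neg, neg_zero] at this
      exact this.symm
    have e2 : ∫ t in 0..a, Real.exp (-(2 / 5 * V * t ^ 2)) * (D * |t|) =
        D * ∫ t in 0..a, t * Real.exp (-(2 / 5 * V * t ^ 2)) := by
      rw [← intervalIntegral.integral_const_mul]
      refine intervalIntegral.integral_congr fun t ht ↦ ?_
      rw [uIcc_of_le ha] at ht
      rw [abs_of_nonneg ht.1]
      ring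
    have e3 := integral_mul_exp_neg_le hV 0 a
    rw [e1, e2]
    have e4 : Real.exp (-(2 / 5 * V * 0 ^ 2)) = 1 := by simp
    rw [e4, one_mul] at e3
    calc _ ≤ D * (5 / (4 * V)) + D * (5 / (4 * V)) := by gcongr
      _ = _ := by field_simp; ring
  · rw [intervalIntegral.integral_mul_const]
    have hintg : Integrable fun t : ℝ ↦ Real.exp (-(2 / 5 * V) * t ^ 2) :=
      integrable_exp_neg_mul_sq (by positivity)
    have e1 : ∫ t in -a..a, Real.exp (-(2 / 5 * V * t ^ 2)) ≤ 3 / Real.sqrt V := by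
      rw [intervalIntegral.integral_of_le (by linarith)]
      simp_rw [← neg_mul (2 / 5 * V)]
      refine (setIntegral_le_integral hintg (ae_of_all _ fun t ↦ (Real.exp_nonneg _))).trans ?_
      rw [integral_gaussian, Real.sqrt_le_left (by positivity), div_pow, Real.sq_sqrt hV.le]
      rw [div_le_div_iff₀ (by positivity) hV]
      nlinarith [Real.pi_lt_d2]
    calc _ ≤ 3 / Real.sqrt V * D' := by gcongr
      _ = _ := by ring

/-- Laplace's method for the integral of `tilt * H`. -/
theorem SaddleBounds.norm_integral_tilt_mul_sub_le {σ₁ x y α : ℝ} (h : SaddleBounds σ₁ x y α)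
    (hσ : 1 / 2 < σ₁) {H : ℝ → ℂ} (hH : Continuous H) {H₀ : ℂ} {D D' B : ℝ} (hD : 0 ≤ D)
    (hD' : 0 ≤ D') (h1 : ∀ t, |t| ≤ 1 / Real.log y → ‖H t - H₀‖ ≤ D * |t| + D')
    (h2 : ∀ t, |t| ≤ y → ‖H t‖ ≤ B) :
    ‖(1 / (2 * Real.pi) : ℝ) * (∫ t in -y..y, tilt x y α t * H t) - saddleMass x y α * H₀‖ ≤
      D / saddleVar y α + D' / Real.sqrt (saddleVar y α) + B / y ^ 4 := by
  have hV := h.var_pos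
  have hs : 0 < Real.sqrt (saddleVar y α) := Real.sqrt_pos.2 hV
  have hx := h.one_le_x
  have hα := h.le_α
  have hY := h.le_log
  have hy := h.one_le_y
  have hc : Continuous (tilt x y α) := continuous_tilt (by linarith) (by linarith)
  have hi : ∀ c d : ℝ, IntervalIntegrable (fun t ↦ tilt x y α t * H t) volume c d :=
    fun c d ↦ (hc.mul hH).intervalIntegrable _ _
  set a := 1 / Real.log y with ha
  have ha0 : 0 < a := by positivity
  have hay : a ≤ y := by
    rw [ha, div_le_iff₀ (by linarith)]
    nlinarith
  have hB : 0 ≤ B := (norm_nonneg _).trans (h2 0 (by simp; linarith))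
  have hsplit : ∫ t in -y..y, tilt x y α t * H t =
      (∫ t in -y..-a, tilt x y α t * H t) + (∫ t in -a..a, tilt x y α t * H t) +
      ∫ t in a..y, tilt x y α t * H t := by
    rw [intervalIntegral.integral_add_adjacent_intervals
      (hi _ _) (hi _ _), intervalIntegral.integral_add_adjacent_intervals (hi _ _) (hi _ _)]
  have hmidb : ∀ t, a ≤ |t| → |t| ≤ y → ‖tilt x y α t * H t‖ ≤ (y ^ 5)⁻¹ * B := fun t ht hty ↦ by
    rw [norm_mul]
    exact mul_le_mul (h.norm_tilt_le t ht hty) (h2 t hty) (norm_nonneg _) (by positivity)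
  have m1 : ‖∫ t in -y..-a, tilt x y α t * H t‖ ≤ B / y ^ 4 := by
    refine (intervalIntegral.norm_integral_le_of_norm_le_const (C := (y ^ 5)⁻¹ * B)
      fun t ht ↦ ?_).trans ?_
    · rw [uIoc_of_le (by linarith)] at ht
      have : t < 0 := by linarith [ht.2]
      exact hmidb t (by rw [abs_of_neg this]; linarith [ht.2])
        (by rw [abs_of_neg this]; linarith [ht.1])
    · calc _ ≤ (y ^ 5)⁻¹ * B * y := by
            gcongr
            rw [abs_of_nonneg (by linarith)]
            linarith
        _ = _ := by field_simp
  have m2 : ‖∫ t in a..y, tilt x y α t * H t‖ ≤ B / y ^ 4 := by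
    refine (intervalIntegral.norm_integral_le_of_norm_le_const (C := (y ^ 5)⁻¹ * B)
      fun t ht ↦ ?_).trans ?_
    · rw [uIoc_of_le (by linarith)] at ht
      have : 0 < t := by linarith [ht.1]
      exact hmidb t (by rw [abs_of_pos this]; exact ht.1.le)
        (by rw [abs_of_pos this]; exact ht.2)
    · calc _ ≤ (y ^ 5)⁻¹ * B * y := by
            gcongr
            rw [abs_of_nonneg (by linarith)]
            linarith
        _ = _ := by field_simp
  have m3 : ‖∫ t in -a..a, tilt x y α t * (H t - H₀)‖ ≤
      5 / 2 * D / saddleVar y α + 3 * D' / Real.sqrt (saddleVar y α) := by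
    refine le_trans ?_ (integral_exp_mul_le hV ha0.le hD hD')
    refine intervalIntegral.norm_integral_le_of_norm_le (by linarith) (ae_of_all _ fun t ht ↦ ?_)
      (Continuous.intervalIntegrable (by fun_prop) _ _)
    have ht' : |t| ≤ a := abs_le.2 ⟨ht.1.le, ht.2⟩
    rw [norm_mul]
    refine mul_le_mul (norm_tilt_le_exp_of_le (by linarith) (by linarith) hY ?_) (h1 t ht')
      (norm_nonneg _) (Real.exp_nonneg _)
    rwa [ha, le_div_iff₀ (by linarith)] at ht'
  have e1 : ∫ t in -a..a, tilt x y α t * (H t - H₀) =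
      (∫ t in -a..a, tilt x y α t * H t) - (∫ t in -a..a, tilt x y α t) * H₀ := by
    simp_rw [mul_sub]
    rw [intervalIntegral.integral_sub (hi _ _)
      (Continuous.intervalIntegrable (by fun_prop) _ _), intervalIntegral.integral_mul_const]
  have e2 : (1 / (2 * Real.pi) : ℝ) * (∫ t in -y..y, tilt x y α t * H t) -
      saddleMass x y α * H₀ = (1 / (2 * Real.pi) : ℝ) *
      ((∫ t in -y..-a, tilt x y α t * H t) + (∫ t in -a..a, tilt x y α t * (H t - H₀)) +
      ∫ t in a..y, tilt x y α t * H t) := by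
    rw [hsplit, e1, saddleMass]
    ring
  have hpi : 1 / (2 * Real.pi) ≤ 1 / 6 := by
    gcongr
    linarith [Real.pi_gt_three]
  rw [e2, norm_mul, norm_real, Real.norm_of_nonneg (by positivity)]
  have hB' : 0 ≤ B / y ^ 4 := by positivity
  have hDV : 0 ≤ D / saddleVar y α := by positivity
  have hDV' : 0 ≤ D' / Real.sqrt (saddleVar y α) := by positivity
  rw [mul_div_assoc, mul_div_assoc] at m3
  calc _ ≤ 1 / 6 * (B / y ^ 4 + (5 / 2 * (D / saddleVar y α) +
        3 * (D' / Real.sqrt (saddleVar y α))) + B / y ^ 4) := by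
        gcongr
        exact (norm_add₃_le).trans (by gcongr)
    _ ≤ _ := by linarith

end SmoothSum

namespace SmoothSum

open Complex Set Filter Topology MeasureTheory Metric

/-- `n` is a positive integer without prime factors exceeding `y`. -/
def IsSmooth (y : ℝ) (n : ℕ) : Prop := 0 < n ∧ ∀ p : ℕ, p.Prime → p ∣ n → (p : ℝ) ≤ y

theorem isSmooth_iff_mem_smoothNumbers {y : ℝ} (hy : 0 ≤ y) {n : ℕ} :
    IsSmooth y n ↔ n ∈ (⌊y⌋₊ + 1).smoothNumbers := by
  rw [IsSmooth, Nat.mem_smoothNumbers', pos_iff_ne_zero]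
  constructor
  · intro h p hp hpn
    exact Nat.lt_succ_of_le (Nat.le_floor (h.2 p hp hpn))
  · intro h
    refine ⟨?_, fun p hp hpn ↦ (Nat.le_floor_iff hy).1 (Nat.le_of_lt_succ (h p hp hpn))⟩
    rintro rfl
    obtain ⟨p, hp, hp'⟩ := Nat.exists_infinite_primes (⌊y⌋₊ + 1)
    exact absurd (h p hp' (dvd_zero p)) (by omega)

theorem IsSmooth.of_dvd {y : ℝ} {m n : ℕ} (hn : IsSmooth y n) (h : m ∣ n) : IsSmooth y m :=
  ⟨Nat.pos_of_dvd_of_pos h hn.1, fun p hp hpm ↦ hn.2 p hp (hpm.trans h)⟩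

theorem IsSmooth.mul {y : ℝ} {m n : ℕ} (hm : IsSmooth y m) (hn : IsSmooth y n) :
    IsSmooth y (m * n) :=
  ⟨Nat.mul_pos hm.1 hn.1, fun p hp h ↦
    ((Nat.Prime.dvd_mul hp).1 h).elim (hm.2 p hp) (hn.2 p hp)⟩

theorem primesBelow_floor_add_one {y : ℝ} (hy : 0 ≤ y) :
    (⌊y⌋₊ + 1).primesBelow = primesUpTo y := by
  ext p
  rw [Nat.mem_primesBelow, mem_primesUpTo, Nat.lt_succ_iff, Nat.le_floor_iff hy, and_comm]

open scoped Classical in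
/-- A Dirichlet character restricted to the `y`-smooth positive integers. -/
noncomputable def smoothChar {q : ℕ} (χ : DirichletCharacter ℂ q) (y : ℝ) (n : ℕ) : ℂ :=
  if IsSmooth y n then χ n else 0

theorem smoothChar_zero {q : ℕ} (χ : DirichletCharacter ℂ q) (y : ℝ) : smoothChar χ y 0 = 0 :=
  if_neg fun h ↦ lt_irrefl 0 h.1

theorem lSeries_smoothChar {q : ℕ} (χ : DirichletCharacter ℂ q) {y : ℝ} (hy : 0 ≤ y) {s : ℂ}
    (hs : 0 < s.re) : LSeriesSummable (smoothChar χ y) s ∧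
      LSeries (smoothChar χ y) s = ∏ p ∈ primesUpTo y, (1 - χ p * (p : ℂ) ^ (-s))⁻¹ := by
  have hs0 : s ≠ 0 := by
    rintro rfl
    simp at hs
  have key := EulerProduct.summable_and_hasSum_smoothNumbers_prod_primesBelow_geometric
    (f := (dirichletSummandHom χ hs0 : ℕ →* ℂ)) (by
      intro p hp
      change ‖χ p * (p : ℂ) ^ (-s)‖ < 1
      rw [norm_mul, norm_natCast_cpow_of_pos hp.pos]
      calc ‖χ p‖ * (p : ℝ) ^ (-s).re ≤ 1 * (p : ℝ) ^ (-s).re := by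
            gcongr
            exact χ.norm_le_one p
        _ < 1 := by
          rw [one_mul]
          exact Real.rpow_lt_one_of_one_lt_of_neg (by exact_mod_cast hp.one_lt)
            (by simpa using hs)) (⌊y⌋₊ + 1)
  have hterm : LSeries.term (smoothChar χ y) s =
      ((⌊y⌋₊ + 1).smoothNumbers).indicator (fun n : ℕ ↦ χ n * (n : ℂ) ^ (-s)) := by
    ext n
    rcases eq_or_ne n 0 with rfl | hn
    · rw [LSeries.term_zero, Set.indicator_apply]
      simp [hs0]
    rw [LSeries.term_of_ne_zero hn, Set.indicator_apply, smoothChar]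
    simp only [isSmooth_iff_mem_smoothNumbers hy]
    split_ifs
    · rw [cpow_neg, div_eq_mul_inv]
    · rw [zero_div]
  have h2 : HasSum (LSeries.term (smoothChar χ y) s)
      (∏ p ∈ primesUpTo y, (1 - χ p * (p : ℂ) ^ (-s))⁻¹) := by
    rw [hterm, ← primesBelow_floor_add_one hy]
    exact hasSum_subtype_iff_indicator.1 key.2
  exact ⟨h2.summable, h2.tsum_eq⟩

/-- The indicator function of the `y`-smooth positive integers. -/
noncomputable def smoothInd (y : ℝ) : ℕ → ℂ := smoothChar (1 : DirichletCharacter ℂ 1) y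

open scoped Classical in
theorem smoothInd_apply (y : ℝ) (n : ℕ) : smoothInd y n = if IsSmooth y n then 1 else 0 := by
  rw [smoothInd, smoothChar]
  congr 1
  exact MulChar.one_apply (isUnit_of_subsingleton _)

theorem lSeries_smoothInd {y : ℝ} (hy : 0 ≤ y) {s : ℂ} (hs : 0 < s.re) :
    LSeriesSummable (smoothInd y) s ∧ LSeries (smoothInd y) s = eulerProd y s := by
  have h := lSeries_smoothChar (1 : DirichletCharacter ℂ 1) hy hs
  refine ⟨h.1, h.2.trans (Finset.prod_congr rfl fun p _ ↦ ?_)⟩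
  rw [MulChar.one_apply (isUnit_of_subsingleton _), one_mul]

end SmoothSum

namespace SmoothSum

open Complex Set Filter Topology MeasureTheory Metric

theorem norm_integral_sub_intervalIntegral_le {g : ℝ → ℂ} {b : ℝ → ℝ} {y : ℝ} (hy : 0 ≤ y)
    (hg : Integrable g) (hb : Integrable b) (hb0 : ∀ t, 0 ≤ b t)
    (h : ∀ t, y ≤ |t| → ‖g t‖ ≤ b t) :
    ‖(∫ t, g t) - ∫ t in -y..y, g t‖ ≤ ∫ t, b t := by
  rw [intervalIntegral.integral_of_le (by linarith),
    ← integral_add_compl (measurableSet_Ioc (a := -y) (b := y)) hg, add_sub_cancel_left]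
  refine (norm_integral_le_of_norm_le hb.integrableOn ?_).trans
    (setIntegral_le_integral hb (ae_of_all _ hb0))
  refine (ae_restrict_iff' measurableSet_Ioc.compl).2 (ae_of_all _ fun t ht ↦ h t ?_)
  by_contra! hlt
  exact ht ⟨(abs_lt.1 hlt).1, (abs_lt.1 hlt).2.le⟩

theorem cpow_mul_eulerProd_eq {x y α : ℝ} (hx : 0 < x) (hα : 0 < α) (t : ℝ) :
    (x : ℂ) ^ (α + t * I) * eulerProd y (α + t * I) =
      (x : ℂ) ^ (α : ℂ) * eulerProd y α * tilt x y α t := by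
  have h0 : eulerProd y α ≠ 0 := eulerProd_ne_zero (by simpa using hα)
  rw [tilt, cpow_add _ _ (by exact_mod_cast hx.ne')]
  field_simp

theorem norm_ofReal_cpow_sub_one_le {c h : ℝ} (hc : c ≤ 1) (hch : 1 - h ≤ c)
    (hh : h ≤ 1 / 6) {s : ℂ} (hs : ‖s‖ ≤ 3) : ‖(c : ℂ) ^ s - 1‖ ≤ 12 * h := by
  have hc0 : 0 < c := by linarith
  have h1 : 1 - c⁻¹ ≤ Real.log c := Real.one_sub_inv_le_log_of_pos hc0
  have h2 : c⁻¹ ≤ 1 + 2 * h := by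
    rw [inv_le_iff_one_le_mul₀ hc0]
    nlinarith
  have h3 : |Real.log c| ≤ 2 * h := by
    rw [abs_le]
    exact ⟨by linarith, by linarith [Real.log_nonpos hc0.le hc]⟩
  rw [cpow_def_of_ne_zero (by exact_mod_cast hc0.ne'), ← ofReal_log hc0.le]
  have h4 : ‖(Real.log c : ℂ) * s‖ ≤ 6 * h := by
    rw [norm_mul, norm_real, Real.norm_eq_abs]
    nlinarith [norm_nonneg s, abs_nonneg (Real.log c)]
  refine (norm_exp_sub_one_le (by linarith)).trans ?_
  linarith

theorem norm_rampMellin_sub_inv_le {h : ℝ} (hh0 : 0 < h) (hh : h ≤ 1 / 6) {s : ℂ}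
    (hs1 : 1 / 2 ≤ s.re) (hs : ‖s‖ ≤ 3) :
    ‖((1 + h : ℂ) ^ (s + 1) - 1) / (h * s * (s + 1)) - 1 / s‖ ≤ 40 * h := by
  have hs0 : 1 / 2 ≤ ‖s‖ := hs1.trans (re_le_norm s)
  have hs3 : 1 ≤ ‖s + 1‖ := by
    refine le_trans ?_ (re_le_norm _)
    simp
    linarith
  have hs4 : ‖s + 1‖ ≤ 4 := (norm_add_le _ _).trans (by rw [norm_one]; linarith)
  have e1 : s ≠ 0 := norm_pos_iff.1 (by linarith)
  have e2 : s + 1 ≠ 0 := norm_pos_iff.1 (by linarith)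
  have e3 : (h : ℂ) ≠ 0 := by exact_mod_cast hh0.ne'
  have hL1 : Real.log (1 + h) ≤ h := by linarith [Real.log_le_sub_one_of_pos (show 0 < 1 + h by linarith)]
  have hL2 : h - h ^ 2 ≤ Real.log (1 + h) := by
    have := Real.one_sub_inv_le_log_of_pos (show 0 < 1 + h by linarith)
    refine le_trans ?_ this
    have e : 1 - (1 + h)⁻¹ = h / (1 + h) := by field_simp; ring
    rw [e, le_div_iff₀ (by linarith)]
    nlinarith [pow_pos hh0 3]
  have hL0 : 0 ≤ Real.log (1 + h) := Real.log_nonneg (by linarith)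
  have hpow : (1 + h : ℂ) ^ (s + 1) = Complex.exp (Real.log (1 + h) * (s + 1)) := by
    rw [cpow_def_of_ne_zero (by exact_mod_cast (show 1 + h ≠ 0 by linarith)),
      ofReal_log (by linarith)]
    push_cast
    rfl
  set L := Real.log (1 + h)
  have hn : ‖(L : ℂ) * (s + 1)‖ ≤ 4 * h := by
    rw [norm_mul, norm_real, Real.norm_of_nonneg hL0]
    nlinarith [norm_nonneg (s + 1)]
  have h1 : ‖(1 + h : ℂ) ^ (s + 1) - 1 - h * (s + 1)‖ ≤ 20 * h ^ 2 := by
    have e : (1 + h : ℂ) ^ (s + 1) - 1 - h * (s + 1) =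
        (Complex.exp (L * (s + 1)) - 1 - L * (s + 1)) + ((L - h : ℝ) : ℂ) * (s + 1) := by
      rw [hpow]
      push_cast
      ring
    rw [e]
    refine (norm_add_le _ _).trans ?_
    have h2 := norm_exp_sub_one_sub_id_le (show ‖(L : ℂ) * (s + 1)‖ ≤ 1 by linarith)
    have h3 : ‖((L - h : ℝ) : ℂ) * (s + 1)‖ ≤ h ^ 2 * 4 := by
      rw [norm_mul, norm_real]
      gcongr
      rw [Real.norm_eq_abs, abs_le]
      exact ⟨by linarith, by nlinarith⟩
    nlinarith [norm_nonneg ((L : ℂ) * (s + 1))]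
  have e : ((1 + h : ℂ) ^ (s + 1) - 1) / (h * s * (s + 1)) - 1 / s =
      ((1 + h : ℂ) ^ (s + 1) - 1 - h * (s + 1)) / (h * s * (s + 1)) := by
    field_simp
  rw [e, norm_div, norm_mul, norm_mul, norm_real, Real.norm_of_nonneg hh0.le]
  rw [div_le_iff₀ (by positivity)]
  refine h1.trans ?_
  have : 1 / 2 ≤ ‖s‖ * ‖s + 1‖ := by nlinarith
  nlinarith [mul_le_mul_of_nonneg_left this (sq_nonneg h)]

theorem norm_inv_add_mul_I_sub_inv_le {α t : ℝ} (hα : 1 / 2 ≤ α) :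
    ‖1 / ((α : ℂ) + t * I) - 1 / α‖ ≤ 4 * |t| := by
  have h1 : 1 / 2 ≤ ‖(α : ℂ) + t * I‖ := by
    refine le_trans ?_ (re_le_norm _)
    simpa using hα
  have e1 : (α : ℂ) + t * I ≠ 0 := norm_pos_iff.1 (by linarith)
  have e2 : (α : ℂ) ≠ 0 := by exact_mod_cast (by linarith : α ≠ 0)
  have e : 1 / ((α : ℂ) + t * I) - 1 / α = -(t * I) / ((α + t * I) * α) := by
    field_simp
    ring
  rw [e, norm_div, norm_neg, norm_mul, norm_mul, norm_I, mul_one, norm_real, norm_real,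
    Real.norm_eq_abs, Real.norm_of_nonneg (by linarith : 0 ≤ α), div_le_iff₀ (by positivity)]
  have : 1 / 4 ≤ ‖(α : ℂ) + t * I‖ * α := by nlinarith
  nlinarith [abs_nonneg t]

theorem SaddleBounds.sqrt_var_ge {σ₁ x y α : ℝ} (h : SaddleBounds σ₁ x y α) :
    Real.log y ≤ Real.sqrt (saddleVar y α) := by
  have := h.le_log
  exact Real.le_sqrt_of_sq_le (by nlinarith [h.le_var])

theorem SaddleBounds.sqrt_var_le {σ₁ x y α : ℝ} (h : SaddleBounds σ₁ x y α) :
    Real.sqrt (saddleVar y α) ≤ y := by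
  have := h.one_le_y
  exact Real.sqrt_le_iff.2 ⟨by linarith, h.var_le⟩

theorem SaddleBounds.log_le {σ₁ x y α : ℝ} (h : SaddleBounds σ₁ x y α) : Real.log y ≤ y := by
  have := h.one_le_y
  exact (Real.log_le_sub_one_of_pos (by linarith)).trans (by linarith)

theorem rampMellin_sub_aux {h : ℝ} (hh0 : 0 < h) (hh : h ≤ 1 / 6) {c : ℝ} (hc : c ≤ 1)
    (hch : 1 - h ≤ c) {α t : ℝ} (hα : 1 / 2 ≤ α) (hα1 : α < 1) (ht : |t| ≤ 1) :
    ‖(c : ℂ) ^ (α + t * I) * (((1 + h : ℂ) ^ ((α + t * I) + 1) - 1) /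
      (h * (α + t * I) * ((α + t * I) + 1))) - 1 / α‖ ≤ 4 * |t| + 148 * h := by
  set s : ℂ := α + t * I with hs
  have hre : s.re = α := by simp [hs]
  have hn : ‖s‖ ≤ 3 := by
    refine (norm_add_le _ _).trans ?_
    rw [norm_mul, norm_I, norm_real, norm_real, Real.norm_of_nonneg (by linarith),
      Real.norm_eq_abs]
    linarith
  have h1 := norm_rampMellin_sub_inv_le hh0 hh (s := s) (by rw [hre]; exact hα) hn
  have h2 := norm_ofReal_cpow_sub_one_le hc hch hh hn
  have h3 := norm_inv_add_mul_I_sub_inv_le (t := t) hα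
  set F := ((1 + h : ℂ) ^ (s + 1) - 1) / (h * s * (s + 1))
  have h4 : ‖1 / s‖ ≤ 2 := by
    rw [norm_div, norm_one, div_le_iff₀]
    · linarith [re_le_norm s]
    · linarith [re_le_norm s]
  have h5 : ‖F‖ ≤ 9 := by
    have : F = (F - 1 / s) + 1 / s := by ring
    rw [this]
    refine (norm_add_le _ _).trans ?_
    linarith
  have e : (c : ℂ) ^ s * F - 1 / α = ((c : ℂ) ^ s - 1) * F + (F - 1 / s) + (1 / s - 1 / α) := by
    ring
  rw [e]
  refine (norm_add_le _ _).trans ?_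
  have h6 := norm_add_le (((c : ℂ) ^ s - 1) * F) (F - 1 / s)
  have h7 : ‖((c : ℂ) ^ s - 1) * F‖ ≤ 12 * h * 9 := by
    rw [norm_mul]
    gcongr
  linarith

theorem SaddleBounds.error_le {σ₁ x y α : ℝ} (h : SaddleBounds σ₁ x y α) {K : ℝ} (hK : 0 ≤ K) :
    4 / saddleVar y α + 148 * (1 / Real.log y) / Real.sqrt (saddleVar y α) +
      81 * Real.log y / y ^ 4 + K * Real.log y / y ^ 10 ≤
      (233 + K) / (Real.sqrt (saddleVar y α) * Real.log y) := by
  have h1 := h.sqrt_var_ge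
  have h2 := h.sqrt_var_le
  have h3 := h.log_le
  have h4 := h.le_log
  have h5 := h.one_le_y
  have h6 : saddleVar y α = Real.sqrt (saddleVar y α) * Real.sqrt (saddleVar y α) :=
    (Real.mul_self_sqrt h.var_pos.le).symm
  set S := Real.sqrt (saddleVar y α)
  set Y := Real.log y
  have hS : 0 < S := by linarith
  have e1 : 4 / saddleVar y α ≤ 4 / (S * Y) := by
    rw [h6]
    gcongr
  have e2 : 148 * (1 / Y) / S = 148 / (S * Y) := by field_simp
  have h7 : S * Y ^ 2 ≤ y ^ 3 := by
    calc S * Y ^ 2 ≤ y * y ^ 2 := by gcongr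
      _ = y ^ 3 := by ring
  have e3 : 81 * Y / y ^ 4 ≤ 81 / (S * Y) := by
    rw [div_le_div_iff₀ (by positivity) (by positivity)]
    have : y ^ 3 ≤ y ^ 4 := pow_le_pow_right₀ h5 (by norm_num)
    nlinarith
  have e4 : K * Y / y ^ 10 ≤ K / (S * Y) := by
    rw [div_le_div_iff₀ (by positivity) (by positivity)]
    have : y ^ 3 ≤ y ^ 10 := pow_le_pow_right₀ h5 (by norm_num)
    nlinarith [mul_le_mul_of_nonneg_left (h7.trans this) hK]
  have e5 : (233 + K) / (S * Y) = 4 / (S * Y) + 148 / (S * Y) + 81 / (S * Y) + K / (S * Y) := by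
    ring
  linarith

theorem ramp_sum_tail_aux {C t : ℝ} (hC : 0 ≤ C) :
    (1 + |t|) ^ (-(1 + 1) : ℝ) * (C * (|t| + 2) ^ (1 / 2 : ℝ)) ≤
      2 * C * (1 + |t|) ^ (-(1 + 1 / 2) : ℝ) := by
  have h1 : (|t| + 2) ^ (1 / 2 : ℝ) ≤ 2 * (1 + |t|) ^ (1 / 2 : ℝ) := by
    calc (|t| + 2) ^ (1 / 2 : ℝ) ≤ (4 * (1 + |t|)) ^ (1 / 2 : ℝ) := by
          gcongr
          linarith [abs_nonneg t]
      _ = 2 * (1 + |t|) ^ (1 / 2 : ℝ) := by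
          rw [Real.mul_rpow (by norm_num) (by positivity), ← Real.sqrt_eq_rpow,
            show (4 : ℝ) = 2 ^ 2 by norm_num, Real.sqrt_sq (by norm_num)]
  have h2 : (1 + |t|) ^ (-(1 + 1 / 2) : ℝ) = (1 + |t|) ^ (-(1 + 1) : ℝ) * (1 + |t|) ^ (1 / 2 : ℝ) := by
    rw [← Real.rpow_add (by positivity)]
    norm_num
  rw [h2]
  have : (0 : ℝ) ≤ (1 + |t|) ^ (-(1 + 1) : ℝ) := by positivity
  nlinarith [mul_le_mul_of_nonneg_left h1 (mul_nonneg this hC)]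

theorem exists_norm_sum_ramp_sub_le (hGRH : GRH) {σ₁ : ℝ} (hσ : 1 / 2 < σ₁) (hσ1 : σ₁ < 1) :
    ∃ C > 0, ∀ x y α c : ℝ, SaddleBounds σ₁ x y α → c ≤ 1 → 1 - 1 / Real.log y ≤ c →
      ‖∑ n ∈ Finset.Icc 1 ⌊2 * x⌋₊, smoothInd y n * ramp (1 / Real.log y) (n / (x * c)) -
        (x : ℂ) ^ (α : ℂ) * eulerProd y α * saddleMass x y α / α‖ ≤
      C * (‖(x : ℂ) ^ (α : ℂ) * eulerProd y α‖ /
        (Real.sqrt (saddleVar y α) * Real.log y)) := by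
  obtain ⟨C, hC, hprod⟩ := exists_norm_prod_primes_cpow_le hGRH hσ hσ1
    (show (0 : ℝ) < 1 / 2 by norm_num)
  set J := ∫ t : ℝ, (1 + |t|) ^ (-(1 + 1 / 2) : ℝ) with hJ
  have hJ0 : 0 ≤ J := integral_nonneg fun t ↦ by positivity
  refine ⟨233 + 162 * C * J, by positivity, ?_⟩
  intro x y α c h hc1 hch
  have hY := h.le_log
  have hy := h.one_le_y
  have hx := h.one_le_x
  have hα := h.le_α
  have hα1 := h.α_lt
  set Y := Real.log y with hYdef
  set r := 1 / Y with hr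
  have hr0 : 0 < r := by positivity
  have hr6 : r ≤ 1 / 6 := by
    rw [hr]
    exact one_div_le_one_div_of_le (by norm_num) (by linarith)
  have hc0 : 0 < c := by linarith
  have hre : ∀ t : ℝ, ((α : ℂ) + t * I).re = α := fun t ↦ by simp
  have him : ∀ t : ℝ, ((α : ℂ) + t * I).im = t := fun t ↦ by simp
  set F : ℂ → ℂ := fun s ↦ ((1 + r : ℂ) ^ (s + 1) - 1) / (r * s * (s + 1)) with hF
  have hFn : ∀ t : ℝ, ‖F (α + t * I)‖ ≤ 81 * Y * (1 + |t|) ^ (-(1 + 1) : ℝ) := by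
    intro t
    have := norm_rampMellin_le hr0 (by linarith) zero_le_one le_rfl (s := α + t * I)
      (by rw [hre]; linarith) (by rw [hre]; linarith)
    rw [him, Real.rpow_neg_one, hr, one_div, inv_inv] at this
    simpa [hF, hr] using this
  set H : ℝ → ℂ := fun t ↦ (c : ℂ) ^ (α + t * I) * F (α + t * I) with hH
  have hcn : ∀ t : ℝ, ‖(c : ℂ) ^ (α + t * I)‖ ≤ 1 := by
    intro t
    rw [norm_cpow_eq_rpow_re_of_pos hc0, hre]
    exact Real.rpow_le_one hc0.le hc1 (by linarith)
  have hHn : ∀ t : ℝ, ‖H t‖ ≤ 81 * Y * (1 + |t|) ^ (-(1 + 1) : ℝ) := by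
    intro t
    rw [hH, norm_mul]
    exact (mul_le_of_le_one_left (norm_nonneg _) (hcn t)).trans (hFn t)
  have hHc : Continuous H := by
    refine (continuous_ofReal_cpow_vertical hc0 _).mul ?_
    refine (differentiableOn_rampMellin hr0).continuousOn.comp_continuous
      (f := fun t : ℝ ↦ (α : ℂ) + t * I) (by fun_prop) fun t ↦ ?_
    rw [Set.mem_ofPred_eq, hre]
    linarith
  set W := (x : ℂ) ^ (α : ℂ) * eulerProd y α with hW
  obtain ⟨hintg, hsum⟩ := sum_mul_comp_div_eq_mellin (a := smoothInd y) (smoothChar_zero _ _)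
    (σ := α) (lSeries_smoothInd (by linarith) (by simp; linarith)).1
    (mellinConvergent_ramp hr0 (by simp; linarith))
    (verticalIntegrable_mellin_ramp hr0 (by linarith) (by linarith) (by linarith))
    (fun t _ ↦ (continuous_ramp r).continuousAt) (z := x * c) (by positivity)
    (N := ⌊2 * x⌋₊) (by
      intro n hn
      have hn' : 2 * x < n := (Nat.floor_lt' (by omega)).1 hn
      rw [ramp_of_ge hr0, mul_zero]
      rw [le_div_iff₀ (by positivity)]
      have : x * c ≤ x := mul_le_of_le_one_right (by linarith) hc1
      nlinarith)
  have hg : ∀ t : ℝ, ((x * c : ℝ) : ℂ) ^ (α + t * I) * mellin (ramp r) (α + t * I) *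
      LSeries (smoothInd y) (α + t * I) = W * (tilt x y α t * H t) := by
    intro t
    rw [mellin_ramp hr0 (by rw [hre]; linarith), (lSeries_smoothInd (by linarith)
      (by rw [hre]; linarith)).2, ofReal_mul, mul_cpow_ofReal_nonneg (by linarith) hc0.le]
    have := cpow_mul_eulerProd_eq (x := x) (y := y) (α := α) (by linarith) (by linarith) t
    simp only [hH, hF]
    linear_combination (c : ℂ) ^ (α + t * I) * (((1 + r : ℂ) ^ ((α + t * I) + 1) - 1) /
      (r * (α + t * I) * ((α + t * I) + 1))) * this
  simp only [hg] at hintg hsum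
  rw [hsum]
  have hEy := h.le_zeta
  have hxα : 0 ≤ x ^ α := by positivity
  have hWn : ‖W‖ = x ^ α * ‖eulerProd y α‖ := by
    rw [hW, norm_mul, norm_cpow_eq_rpow_re_of_pos (by linarith), ofReal_re]
  have htail := norm_integral_sub_intervalIntegral_le (y := y) (by linarith) hintg
    (b := fun t ↦ ‖W‖ / y ^ 10 * (81 * Y) * (2 * C) * (1 + |t|) ^ (-(1 + 1 / 2) : ℝ))
    ((integrable_one_add_abs_rpow (by norm_num)).const_mul _) (fun t ↦ by positivity) (by
      intro t ht
      have e : W * (tilt x y α t * H t) =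
          (x : ℂ) ^ (α + t * I) * eulerProd y (α + t * I) * H t := by
        rw [cpow_mul_eulerProd_eq (by linarith) (by linarith)]
        ring
      rw [e, norm_mul, norm_mul, norm_cpow_eq_rpow_re_of_pos (by linarith), hre]
      have h1 : x ^ α ≤ ‖W‖ / y ^ 10 := by
        rw [le_div_iff₀ (by positivity), hWn]
        gcongr
      have h2 : ‖eulerProd y (α + t * I)‖ ≤ C * (|t| + 2) ^ (1 / 2 : ℝ) :=
        hprod α t y hα hα1.le hy ht
      calc x ^ α * ‖eulerProd y (α + t * I)‖ * ‖H t‖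
          ≤ ‖W‖ / y ^ 10 * (C * (|t| + 2) ^ (1 / 2 : ℝ)) *
            (81 * Y * (1 + |t|) ^ (-(1 + 1) : ℝ)) := by
            gcongr
            exact hHn t
        _ = ‖W‖ / y ^ 10 * (81 * Y) * ((1 + |t|) ^ (-(1 + 1) : ℝ) *
            (C * (|t| + 2) ^ (1 / 2 : ℝ))) := by ring
        _ ≤ ‖W‖ / y ^ 10 * (81 * Y) * (2 * C * (1 + |t|) ^ (-(1 + 1 / 2) : ℝ)) := by
            exact mul_le_mul_of_nonneg_left (ramp_sum_tail_aux hC.le) (by positivity)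
        _ = _ := by ring)
  rw [integral_const_mul (μ := volume) _ fun t : ℝ ↦ (1 + |t|) ^ (-(1 + 1 / 2) : ℝ), ← hJ] at htail
  have hmid := h.norm_integral_tilt_mul_sub_le hσ hHc (H₀ := 1 / α) (D := 4) (D' := 148 * r)
    (B := 81 * Y) (by norm_num) (by positivity) (by
      intro t ht
      exact rampMellin_sub_aux hr0 hr6 hc1 hch (by linarith) hα1 (by linarith)) (by
      intro t _
      refine (hHn t).trans (mul_le_of_le_one_right (by positivity) ?_)
      exact Real.rpow_le_one_of_one_le_of_nonpos (by linarith [abs_nonneg t]) (by norm_num))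
  have h2π : ‖((1 / (2 * Real.pi) : ℝ) : ℂ)‖ ≤ 1 := by
    rw [norm_real, Real.norm_of_nonneg (by positivity), div_le_one (by positivity)]
    linarith [Real.pi_gt_three]
  have e : ((1 / (2 * Real.pi) : ℝ) : ℂ) * (∫ t : ℝ, W * (tilt x y α t * H t)) -
      W * saddleMass x y α / α = ((1 / (2 * Real.pi) : ℝ) : ℂ) *
        ((∫ t : ℝ, W * (tilt x y α t * H t)) - ∫ t in -y..y, W * (tilt x y α t * H t)) +
      W * (((1 / (2 * Real.pi) : ℝ) : ℂ) * (∫ t in -y..y, tilt x y α t * H t) -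
        saddleMass x y α * (1 / α)) := by
    rw [intervalIntegral.integral_const_mul]
    ring
  rw [e]
  refine (norm_add_le _ _).trans ?_
  rw [norm_mul, norm_mul]
  have herr := h.error_le (K := 162 * C * J) (by positivity)
  have hs : 0 < Real.sqrt (saddleVar y α) := Real.sqrt_pos.2 h.var_pos
  calc _ ≤ 1 * (‖W‖ / y ^ 10 * (81 * Y) * (2 * C) * J) + ‖W‖ * (4 / saddleVar y α +
        148 * r / Real.sqrt (saddleVar y α) + 81 * Y / y ^ 4) := by gcongr
    _ = ‖W‖ * (4 / saddleVar y α + 148 * r / Real.sqrt (saddleVar y α) + 81 * Y / y ^ 4 +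
        162 * C * J * Y / y ^ 10) := by ring
    _ ≤ ‖W‖ * ((233 + 162 * C * J) / (Real.sqrt (saddleVar y α) * Y)) := by gcongr
    _ = _ := by ring

open scoped Classical in
theorem psi_eq_card (x y : ℝ) {N : ℕ} (hN : x ≤ N) :
    Psi x y = ((Finset.Icc 1 N).filter fun n ↦ IsSmooth y n ∧ (n : ℝ) ≤ x).card := by
  rw [Psi, Nat.card_coe_set_eq, ← Set.ncard_coe_finset]
  congr 1
  ext n
  rw [Finset.mem_coe, Finset.mem_filter, Finset.mem_Icc, IsSmooth, Set.mem_ofPred_eq]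
  constructor
  · rintro ⟨h1, h2, h3⟩
    exact ⟨⟨h1, by exact_mod_cast h2.trans hN⟩, ⟨h1, h3⟩, h2⟩
  · rintro ⟨-, ⟨h1, h3⟩, h2⟩
    exact ⟨h1, h2, h3⟩

theorem exists_norm_Psi_sub_le (hGRH : GRH) {σ₁ : ℝ} (hσ : 1 / 2 < σ₁) (hσ1 : σ₁ < 1) :
    ∃ C > 0, ∀ x y α : ℝ, SaddleBounds σ₁ x y α →
      ‖(Psi x y : ℂ) - (x : ℂ) ^ (α : ℂ) * eulerProd y α * saddleMass x y α / α‖ ≤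
      C * (‖(x : ℂ) ^ (α : ℂ) * eulerProd y α‖ /
        (Real.sqrt (saddleVar y α) * Real.log y)) := by
  classical
  obtain ⟨C, hC, H⟩ := exists_norm_sum_ramp_sub_le hGRH hσ hσ1
  refine ⟨3 * C, by positivity, ?_⟩
  intro x y α h
  have hY := h.le_log
  have hx := h.one_le_x
  have hr0 : 0 < 1 / Real.log y := by positivity
  have H1 := H x y α 1 h le_rfl (by linarith)
  have hc : (1 + 1 / Real.log y)⁻¹ ≤ 1 := inv_le_one_of_one_le₀ (by linarith)
  have H2 := H x y α (1 + 1 / Real.log y)⁻¹ h hc (by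
    rw [← one_div, le_div_iff₀ (by positivity)]
    nlinarith)
  set r := 1 / Real.log y
  set T := (x : ℂ) ^ (α : ℂ) * eulerProd y α * saddleMass x y α / α
  set E := ‖(x : ℂ) ^ (α : ℂ) * eulerProd y α‖ / (Real.sqrt (saddleVar y α) * Real.log y)
  set A : ℝ → ℝ → ℝ := fun c n ↦ max 0 (min 1 ((1 + r - n / (x * c)) / r)) with hA
  have hreal : ∀ c : ℝ, ∑ n ∈ Finset.Icc 1 ⌊2 * x⌋₊, smoothInd y n * ramp r (n / (x * c)) =
      ((∑ n ∈ (Finset.Icc 1 ⌊2 * x⌋₊).filter (IsSmooth y), A c n : ℝ) : ℂ) := by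
    intro c
    rw [ofReal_sum, Finset.sum_filter]
    refine Finset.sum_congr rfl fun n _ ↦ ?_
    rw [smoothInd_apply]
    split_ifs
    · rw [one_mul, ramp]
    · rw [zero_mul]
  rw [hreal] at H1 H2
  set S₁ := ∑ n ∈ (Finset.Icc 1 ⌊2 * x⌋₊).filter (IsSmooth y), A 1 n with hS₁
  set S₂ := ∑ n ∈ (Finset.Icc 1 ⌊2 * x⌋₊).filter (IsSmooth y), A (1 + r)⁻¹ n with hS₂
  have hfl : x ≤ ⌊2 * x⌋₊ := by
    have := Nat.lt_floor_add_one (2 * x)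
    linarith
  have hΨ : (Psi x y : ℝ) =
      ∑ n ∈ (Finset.Icc 1 ⌊2 * x⌋₊).filter (IsSmooth y), if (n : ℝ) ≤ x then 1 else 0 := by
    rw [psi_eq_card x y hfl, ← Finset.filter_filter, Finset.card_filter]
    push_cast
    rfl
  have hΨ1 : (Psi x y : ℝ) ≤ S₁ := by
    rw [hΨ]
    refine Finset.sum_le_sum fun n _ ↦ ?_
    simp only [hA]
    split_ifs with hn
    · rw [mul_one, min_eq_left]
      · exact le_max_right _ _
      · rw [le_div_iff₀ hr0]
        have : (n : ℝ) / x ≤ 1 := div_le_one_of_le₀ hn (by linarith)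
        linarith
    · exact le_max_left _ _
  have hΨ2 : S₂ ≤ (Psi x y : ℝ) := by
    rw [hΨ]
    refine Finset.sum_le_sum fun n _ ↦ ?_
    simp only [hA]
    split_ifs with hn
    · exact max_le zero_le_one (min_le_left _ _)
    · refine max_le le_rfl ((min_le_right _ _).trans ?_)
      refine div_nonpos_of_nonpos_of_nonneg ?_ hr0.le
      have e : (n : ℝ) / (x * (1 + r)⁻¹) = n / x * (1 + r) := by field_simp
      have : 1 ≤ (n : ℝ) / x := (one_le_div (by linarith)).2 (by linarith)
      rw [e]
      nlinarith
  have h3 : ‖((Psi x y : ℝ) : ℂ) - (S₁ : ℂ)‖ ≤ ‖(S₁ : ℂ) - (S₂ : ℂ)‖ := by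
    rw [← ofReal_sub, ← ofReal_sub, norm_real, norm_real, Real.norm_eq_abs, Real.norm_eq_abs,
      abs_sub_comm, abs_of_nonneg (by linarith), abs_of_nonneg (by linarith)]
    linarith
  have h4 : ‖(S₁ : ℂ) - (S₂ : ℂ)‖ ≤ C * E + C * E := by
    rw [show (S₁ : ℂ) - S₂ = (S₁ - T) - (S₂ - T) by ring]
    exact (norm_sub_le _ _).trans (add_le_add H1 H2)
  have h5 : (Psi x y : ℂ) - T = (((Psi x y : ℝ) : ℂ) - S₁) + (S₁ - T) := by
    push_cast
    ring
  rw [h5]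
  refine (norm_add_le _ _).trans ?_
  linarith

theorem exists_le_Psi (hGRH : GRH) {σ₁ : ℝ} (hσ : 1 / 2 < σ₁) (hσ1 : σ₁ < 1) :
    ∃ K, ∀ x y α : ℝ, SaddleBounds σ₁ x y α → K ≤ Real.log y →
      ‖(x : ℂ) ^ (α : ℂ) * eulerProd y α‖ / Real.sqrt (saddleVar y α) ≤ 50 * Psi x y := by
  obtain ⟨C, hC, H⟩ := exists_norm_Psi_sub_le hGRH hσ hσ1
  refine ⟨100 * C, ?_⟩
  intro x y α h hK
  have H1 := H x y α h
  have hM := h.norm_saddleMass_ge hσ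
  have hV := h.var_pos
  have hs : 0 < Real.sqrt (saddleVar y α) := Real.sqrt_pos.2 hV
  have hα := h.le_α
  have hα1 := h.α_lt
  have hY := h.le_log
  set W := (x : ℂ) ^ (α : ℂ) * eulerProd y α
  set S := Real.sqrt (saddleVar y α)
  have h1 : ‖W‖ / S * (3 / 100) ≤ ‖W * saddleMass x y α / α‖ := by
    rw [norm_div, norm_mul W, norm_real, Real.norm_of_nonneg (by linarith),
      le_div_iff₀ (by linarith)]
    calc ‖W‖ / S * (3 / 100) * α ≤ ‖W‖ / S * (3 / 100) * 1 := by gcongr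
      _ = ‖W‖ * (3 / 100 / S) := by ring
      _ ≤ _ := by gcongr
  have h2 : C * (‖W‖ / (S * Real.log y)) ≤ ‖W‖ / S * (1 / 100) := by
    have e : C * (‖W‖ / (S * Real.log y)) = ‖W‖ / S * (C / Real.log y) := by
      field_simp
    rw [e]
    refine mul_le_mul_of_nonneg_left ?_ (by positivity)
    rw [div_le_iff₀ (by linarith)]
    linarith
  have h3 := norm_sub_norm_le (W * saddleMass x y α / α) (Psi x y : ℂ)
  rw [norm_sub_rev, Complex.norm_natCast] at h3
  linarith

end SmoothSum

namespace SmoothSum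

open Complex Set Filter Topology MeasureTheory Metric

/-- Smooth functions on the line with compact support in the positive half-line. -/
structure TestFun (φ : ℝ → ℂ) : Prop where
  smooth : ContDiff ℝ (⊤ : ℕ∞) φ
  supp : ∃ a b : ℝ, 0 < a ∧ a ≤ b ∧ ∀ w, w ∉ Set.Icc a b → φ w = 0

theorem TestFun.of_tsupport {Φ : ℝ → ℝ} (hsmooth : ContDiff ℝ (⊤ : ℕ∞) Φ)
    (hcompact : HasCompactSupport Φ) (hsupp : tsupport Φ ⊆ Set.Ioi 0) :
    TestFun fun w ↦ (Φ w : ℂ) := by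
  refine ⟨ofRealCLM.contDiff.comp hsmooth, ?_⟩
  rcases (tsupport Φ).eq_empty_or_nonempty with h0 | hne
  · refine ⟨1, 1, one_pos, le_rfl, fun w _ ↦ ?_⟩
    rw [image_eq_zero_of_notMem_tsupport (f := Φ) (by simp [h0]), ofReal_zero]
  · have hK : IsCompact (tsupport Φ) := hcompact
    obtain ⟨a, ha, hamin⟩ := hK.exists_isLeast hne
    obtain ⟨b, hb, hbmax⟩ := hK.exists_isGreatest hne
    refine ⟨a, b, hsupp ha, hamin hb, fun w hw ↦ ?_⟩
    rw [image_eq_zero_of_notMem_tsupport (f := Φ) (fun h ↦ hw ⟨hamin h, hbmax h⟩), ofReal_zero]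

theorem TestFun.deriv {φ : ℝ → ℂ} (hφ : TestFun φ) : TestFun (deriv φ) := by
  refine ⟨(contDiff_infty_iff_deriv.1 hφ.smooth).2, ?_⟩
  obtain ⟨a, b, ha, hab, h⟩ := hφ.supp
  refine ⟨a, b, ha, hab, fun w hw ↦ ?_⟩
  have : φ =ᶠ[𝓝 w] fun _ ↦ 0 := by
    filter_upwards [isClosed_Icc.isOpen_compl.mem_nhds hw] with v hv using h v hv
  rw [this.deriv_eq, deriv_const]

theorem TestFun.mul {φ ψ : ℝ → ℂ} (hφ : TestFun φ)
    (hψ : ∀ w, 0 < w → ContDiffAt ℝ (⊤ : ℕ∞) ψ w) : TestFun fun w ↦ ψ w * φ w := by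
  obtain ⟨a, b, ha, hab, h⟩ := hφ.supp
  refine ⟨contDiff_iff_contDiffAt.2 fun w ↦ ?_, a, b, ha, hab, fun w hw ↦ by rw [h w hw, mul_zero]⟩
  rcases lt_or_ge 0 w with hw | hw
  · exact (hψ w hw).mul hφ.smooth.contDiffAt
  · have : (fun w ↦ ψ w * φ w) =ᶠ[𝓝 w] fun _ ↦ 0 := by
      filter_upwards [isClosed_Icc.isOpen_compl.mem_nhds (show w ∉ Set.Icc a b from
        fun h ↦ by linarith [h.1])] with v hv
      rw [h v hv, mul_zero]
    exact contDiffAt_const.congr_of_eventuallyEq this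

/-- The function `φ` twisted by the additive character of frequency `lam`. -/
noncomputable def twist (φ : ℝ → ℂ) (lam w : ℝ) : ℂ :=
  φ w * Complex.exp (2 * (Real.pi : ℂ) * I * ((lam * w : ℝ) : ℂ))

theorem norm_twist (φ : ℝ → ℂ) (lam w : ℝ) : ‖twist φ lam w‖ = ‖φ w‖ := by
  rw [twist, norm_mul, show 2 * (Real.pi : ℂ) * I * ((lam * w : ℝ) : ℂ) =
    ((2 * Real.pi * (lam * w) : ℝ) : ℂ) * I by push_cast; ring, norm_exp_ofReal_mul_I, mul_one]

theorem TestFun.twist {φ : ℝ → ℂ} (hφ : TestFun φ) (lam : ℝ) : TestFun (twist φ lam) := by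
  have := hφ.mul (ψ := fun w ↦ Complex.exp (2 * (Real.pi : ℂ) * I * ((lam * w : ℝ) : ℂ)))
    fun w _ ↦ by
      have : ContDiff ℝ (⊤ : ℕ∞) fun w : ℝ ↦ ((lam * w : ℝ) : ℂ) :=
        ofRealCLM.contDiff.comp (contDiff_const.mul contDiff_id)
      exact (contDiff_const.mul this).cexp.contDiffAt
  have e : SmoothSum.twist φ lam = fun w ↦
      Complex.exp (2 * (Real.pi : ℂ) * I * ((lam * w : ℝ) : ℂ)) * φ w :=
    funext fun w ↦ mul_comm _ _
  rw [e]
  exact this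

theorem TestFun.mellin_hasDerivAt {φ : ℝ → ℂ} (hφ : TestFun φ) (s : ℂ) :
    MellinConvergent φ s ∧ MellinConvergent (fun t ↦ Real.log t • φ t) s ∧
      HasDerivAt (mellin φ) (mellin (fun t ↦ Real.log t • φ t) s) s := by
  obtain ⟨a, b, ha, hab, h⟩ := hφ.supp
  have h1 : LocallyIntegrableOn φ (Ioi 0) :=
    (hφ.smooth.continuous.locallyIntegrable).locallyIntegrableOn _
  have h2 : φ =O[atTop] (· ^ (-(s.re + 1))) := by
    refine Asymptotics.IsBigO.of_bound 1 ?_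
    filter_upwards [eventually_gt_atTop (max b 0)] with w hw
    rw [h w (fun hh ↦ absurd hh.2 (not_le.2 ((le_max_left _ _).trans_lt hw)))]
    simp
  have h3 : φ =O[𝓝[>] 0] (· ^ (-(s.re - 1))) := by
    refine Asymptotics.IsBigO.of_bound 1 ?_
    filter_upwards [mem_nhdsWithin_of_mem_nhds (Iio_mem_nhds ha)] with w hw
    rw [h w (fun hh ↦ absurd hh.1 (not_le.2 hw))]
    simp
  exact ⟨mellinConvergent_of_isBigO_rpow h1 h2 (by linarith) h3 (by linarith),
    mellin_hasDerivAt_of_isBigO_rpow h1 h2 (by linarith) h3 (by linarith)⟩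

/-- The Mellin transform of a twisted test function. -/
noncomputable def osc (φ : ℝ → ℂ) (lam : ℝ) (s : ℂ) : ℂ := mellin (twist φ lam) s

theorem TestFun.hasDerivAt_osc {φ : ℝ → ℂ} (hφ : TestFun φ) (lam : ℝ) (s : ℂ) :
    HasDerivAt (osc φ lam) (osc (fun w ↦ (Real.log w : ℂ) * φ w) lam s) s := by
  have h := ((hφ.twist lam).mellin_hasDerivAt s).2.2
  convert! h using 1
  rw [osc]
  congr 1
  ext w
  rw [SmoothSum.twist, SmoothSum.twist, real_smul, mul_assoc]

theorem TestFun.log_mul {φ : ℝ → ℂ} (hφ : TestFun φ) : TestFun fun w ↦ (Real.log w : ℂ) * φ w :=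
  hφ.mul fun _ hw ↦ ofRealCLM.contDiff.contDiffAt.comp _ (Real.contDiffAt_log.2 hw.ne')

theorem TestFun.id_mul {φ : ℝ → ℂ} (hφ : TestFun φ) : TestFun fun w ↦ (w : ℂ) * φ w :=
  hφ.mul fun _ _ ↦ ofRealCLM.contDiff.contDiffAt

theorem osc_add_one (φ : ℝ → ℂ) (lam : ℝ) (s : ℂ) :
    osc φ lam (s + 1) = osc (fun w ↦ (w : ℂ) * φ w) lam s := by
  rw [osc, osc, mellin, mellin]
  refine setIntegral_congr_fun measurableSet_Ioi fun w (hw : 0 < w) ↦ ?_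
  have : (w : ℂ) ^ (s + 1 - 1) = (w : ℂ) ^ (s - 1) * w := by
    rw [add_sub_cancel_right, cpow_sub _ _ (by exact_mod_cast hw.ne'), cpow_one,
      div_mul_cancel₀ _ (by exact_mod_cast hw.ne')]
  simp only [this, smul_eq_mul, twist]
  ring

theorem TestFun.osc_by_parts {φ : ℝ → ℂ} (hφ : TestFun φ) (lam : ℝ) (s : ℂ) :
    s * osc φ lam s + osc (_root_.deriv φ) lam (s + 1) +
      2 * Real.pi * I * lam * osc φ lam (s + 1) = 0 := by
  obtain ⟨a, b, ha, hab, h⟩ := hφ.supp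
  have i1 := ((hφ.twist lam).mellin_hasDerivAt s).1
  have i2 := ((hφ.deriv.twist lam).mellin_hasDerivAt (s + 1)).1
  have i3 := ((hφ.twist lam).mellin_hasDerivAt (s + 1)).1
  have hderiv : ∀ w ∈ Ioi (0 : ℝ), HasDerivAt (fun w : ℝ ↦ (w : ℂ) ^ s * SmoothSum.twist φ lam w)
      (s * ((w : ℂ) ^ (s - 1) • SmoothSum.twist φ lam w) +
        (w : ℂ) ^ (s + 1 - 1) • SmoothSum.twist (_root_.deriv φ) lam w +
        2 * Real.pi * I * lam * ((w : ℂ) ^ (s + 1 - 1) • SmoothSum.twist φ lam w)) w := by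
    intro w hw
    have hw0 : 0 < w := hw
    have d1 : HasDerivAt (fun w : ℝ ↦ (w : ℂ) ^ s) (s * (w : ℂ) ^ (s - 1)) w := by
      have := (hasDerivAt_id (w : ℂ)).cpow_const (c := s) (Or.inl (by simpa using hw0))
      simpa using! this.comp_ofReal
    have d2 : HasDerivAt φ (_root_.deriv φ w) w :=
      (hφ.smooth.differentiable (by simp) w).hasDerivAt
    have d3 : HasDerivAt (fun w : ℝ ↦ Complex.exp (2 * (Real.pi : ℂ) * I * ((lam * w : ℝ) : ℂ)))
        (Complex.exp (2 * (Real.pi : ℂ) * I * ((lam * w : ℝ) : ℂ)) *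
          (2 * (Real.pi : ℂ) * I * lam)) w := by
      refine HasDerivAt.cexp ?_
      have := ((hasDerivAt_id w).const_mul lam).ofReal_comp.const_mul (2 * (Real.pi : ℂ) * I)
      simpa using! this
    refine (d1.mul (d2.mul d3)).congr_deriv ?_
    simp only [SmoothSum.twist, smul_eq_mul, add_sub_cancel_right, Pi.mul_apply]
    ring
  have hzero : ∀ w : ℝ, w ∉ Set.Icc a b → (w : ℂ) ^ s * SmoothSum.twist φ lam w = 0 := by
    intro w hw
    rw [SmoothSum.twist, h w hw]
    simp
  have j1 : IntegrableOn (fun w : ℝ ↦ s * ((w : ℂ) ^ (s - 1) • SmoothSum.twist φ lam w)) (Ioi 0) :=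
    Integrable.const_mul i1 s
  have j2 : IntegrableOn (fun w : ℝ ↦ (w : ℂ) ^ (s + 1 - 1) •
    SmoothSum.twist (_root_.deriv φ) lam w) (Ioi 0) := i2
  have j12 : IntegrableOn (fun w : ℝ ↦ s * ((w : ℂ) ^ (s - 1) • SmoothSum.twist φ lam w) +
    (w : ℂ) ^ (s + 1 - 1) • SmoothSum.twist (_root_.deriv φ) lam w) (Ioi 0) := j1.add j2
  have j3 : IntegrableOn (fun w : ℝ ↦ 2 * Real.pi * I * lam *
      ((w : ℂ) ^ (s + 1 - 1) • SmoothSum.twist φ lam w)) (Ioi 0) :=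
    Integrable.const_mul i3 _
  have key := integral_Ioi_of_hasDerivAt_of_tendsto (a := (0 : ℝ)) (m := 0) (by
      refine ContinuousAt.continuousWithinAt ?_
      have : (fun w : ℝ ↦ (w : ℂ) ^ s * SmoothSum.twist φ lam w) =ᶠ[𝓝 0] fun _ ↦ 0 := by
        filter_upwards [Iio_mem_nhds ha] with w hw
        exact hzero w fun hh ↦ absurd hh.1 (not_le.2 hw)
      exact continuousAt_const.congr this.symm) hderiv
    (j12.add j3) (by
      refine tendsto_const_nhds.congr' ?_
      filter_upwards [eventually_gt_atTop b] with w hw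
      exact (hzero w fun hh ↦ absurd hh.2 (not_le.2 hw)).symm)
  rw [integral_add j12 j3, integral_add j1 j2, integral_const_mul,
    integral_const_mul, hzero 0 fun hh ↦ absurd hh.1 (not_le.2 ha), sub_zero] at key
  exact key

theorem TestFun.exists_norm_osc_le_const {φ : ℝ → ℂ} (hφ : TestFun φ) :
    ∃ C ≥ 0, ∀ (lam : ℝ) (s : ℂ), |s.re| ≤ 3 → ‖osc φ lam s‖ ≤ C := by
  have i1 := (hφ.mellin_hasDerivAt 3).1
  have i2 := (hφ.mellin_hasDerivAt (-3)).1
  rw [MellinConvergent] at i1 i2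
  refine ⟨∫ w in Ioi (0 : ℝ), (‖(w : ℂ) ^ ((3 : ℂ) - 1) • φ w‖ +
    ‖(w : ℂ) ^ ((-3 : ℂ) - 1) • φ w‖), integral_nonneg fun w ↦ by positivity, ?_⟩
  intro lam s hs
  rw [osc, mellin]
  refine norm_integral_le_of_norm_le (i1.norm.add i2.norm) ?_
  refine (ae_restrict_iff' measurableSet_Ioi).2 (ae_of_all _ fun w (hw : 0 < w) ↦ ?_)
  rw [norm_smul, norm_smul, norm_smul, norm_twist, norm_cpow_eq_rpow_re_of_pos hw,
    norm_cpow_eq_rpow_re_of_pos hw, norm_cpow_eq_rpow_re_of_pos hw, ← add_mul]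
  refine mul_le_mul_of_nonneg_right ?_ (norm_nonneg _)
  have h := abs_le.1 hs
  have e1 : ((3 : ℂ) - 1).re = 2 := by norm_num
  have e2 : ((-3 : ℂ) - 1).re = -4 := by norm_num
  rw [e1, e2, sub_re, one_re]
  rcases le_total 1 w with h1 | h1
  · have := Real.rpow_le_rpow_of_exponent_le h1 (show s.re - 1 ≤ 2 by linarith [h.2])
    have h0 : (0 : ℝ) ≤ w ^ (-4 : ℝ) := by positivity
    linarith
  · have := Real.rpow_le_rpow_of_exponent_ge hw h1 (show -4 ≤ s.re - 1 by linarith [h.1])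
    have h0 : (0 : ℝ) ≤ w ^ (2 : ℝ) := by positivity
    linarith

theorem TestFun.mul_norm_osc_le {φ : ℝ → ℂ} (hφ : TestFun φ) (lam : ℝ) (s : ℂ) :
    |lam| * ‖osc φ lam s‖ ≤
      ‖s - 1‖ * ‖osc φ lam (s - 1)‖ + ‖osc (_root_.deriv φ) lam s‖ := by
  have h := hφ.osc_by_parts lam (s - 1)
  rw [sub_add_cancel] at h
  have e : 2 * Real.pi * I * lam * osc φ lam s =
      -((s - 1) * osc φ lam (s - 1) + osc (_root_.deriv φ) lam s) := by
    linear_combination h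
  have h1 : ‖2 * Real.pi * I * lam * osc φ lam s‖ = 2 * Real.pi * (|lam| * ‖osc φ lam s‖) := by
    simp only [norm_mul, norm_I, norm_real, Real.norm_eq_abs, one_mul, Complex.norm_ofNat,
      abs_of_pos Real.pi_pos, mul_assoc]
  have h2 := norm_add_le ((s - 1) * osc φ lam (s - 1)) (osc (_root_.deriv φ) lam s)
  rw [norm_mul] at h2
  rw [e, norm_neg] at h1
  have h3 : 0 ≤ |lam| * ‖osc φ lam s‖ := by positivity
  nlinarith [Real.pi_gt_three]

theorem osc_decay_aux {l T C A A1 A2 D D1 E n1 n2 : ℝ} (hl : 0 ≤ l) (hT : 1 ≤ T) (hC : 0 ≤ C)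
    (hA2 : A2 ≤ C) (hD1 : D1 ≤ C) (hE : E ≤ C) (hA : A ≤ C)
    (hA0 : 0 ≤ A1) (hA20 : 0 ≤ A2) (hD10 : 0 ≤ D1) (hn1 : n1 ≤ 2 * T) (hn2 : n2 ≤ 2 * T)
    (h1 : l * A ≤ n1 * A1 + D) (h2 : l * A1 ≤ n2 * A2 + D1) (h3 : l * D ≤ n1 * D1 + E) :
    (1 + l) ^ 2 * A ≤ 20 * C * T ^ 2 := by
  have hT2 : T ≤ T ^ 2 := by nlinarith
  have hCT : C ≤ C * T := by nlinarith
  have hCT2 : C * T ≤ C * T ^ 2 := by nlinarith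
  have k2 : l * A1 ≤ 3 * (C * T) := by
    have : n2 * A2 ≤ 2 * T * C := by
      calc n2 * A2 ≤ 2 * T * A2 := by gcongr
        _ ≤ 2 * T * C := by gcongr
    nlinarith
  have k3 : l * D ≤ 3 * (C * T) := by
    have : n1 * D1 ≤ 2 * T * C := by
      calc n1 * D1 ≤ 2 * T * D1 := by gcongr
        _ ≤ 2 * T * C := by gcongr
    nlinarith
  have k1 : l ^ 2 * A ≤ 9 * (C * T ^ 2) := by
    have e1 : l * (n1 * A1) ≤ 2 * T * (3 * (C * T)) := by
      calc l * (n1 * A1) ≤ l * (2 * T * A1) := by gcongr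
        _ = 2 * T * (l * A1) := by ring
        _ ≤ _ := by gcongr
    nlinarith [mul_le_mul_of_nonneg_left h1 hl]
  have k0 : (1 + l) ^ 2 ≤ 2 + 2 * l ^ 2 := by nlinarith [sq_nonneg (1 - l)]
  rcases le_or_gt 0 A with hA' | hA'
  · nlinarith [mul_le_mul_of_nonneg_right k0 hA']
  · have : (1 + l) ^ 2 * A ≤ 0 := mul_nonpos_of_nonneg_of_nonpos (by positivity) hA'.le
    have : 0 ≤ 20 * C * T ^ 2 := by positivity
    linarith

theorem TestFun.exists_norm_osc_le {φ : ℝ → ℂ} (hφ : TestFun φ) :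
    ∃ C ≥ 0, ∀ (lam : ℝ) (s : ℂ), 0 ≤ s.re → s.re ≤ 1 →
      ‖osc φ lam s‖ ≤ C * ((1 + |s.im|) ^ 2 / (1 + |lam|) ^ 2) := by
  obtain ⟨C₀, hC₀, H₀⟩ := hφ.exists_norm_osc_le_const
  obtain ⟨C₁, hC₁, H₁⟩ := hφ.deriv.exists_norm_osc_le_const
  obtain ⟨C₂, hC₂, H₂⟩ := hφ.deriv.deriv.exists_norm_osc_le_const
  refine ⟨20 * (C₀ + C₁ + C₂), by positivity, ?_⟩
  intro lam s hs0 hs1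
  have hn : ∀ k : ℝ, 1 ≤ k → k ≤ 2 → ‖s - k‖ ≤ 2 * (1 + |s.im|) := by
    intro k hk1 hk2
    refine (norm_le_abs_re_add_abs_im _).trans ?_
    have : |(s - k).re| ≤ 2 := by
      rw [sub_re, ofReal_re, abs_le]
      exact ⟨by linarith, by linarith⟩
    have h2 : (s - k).im = s.im := by simp
    rw [h2]
    linarith [abs_nonneg s.im]
  have hn1 := hn 1 le_rfl (by norm_num)
  have hn2 := hn 2 (by norm_num) le_rfl
  rw [ofReal_one] at hn1
  rw [ofReal_ofNat] at hn2
  have h2 := hφ.mul_norm_osc_le lam (s - 1)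
  rw [sub_sub, one_add_one_eq_two] at h2
  have r0 : |s.re| ≤ 3 := by rw [abs_le]; exact ⟨by linarith, by linarith⟩
  have r1 : |(s - 1).re| ≤ 3 := by
    rw [sub_re, one_re, abs_le]; exact ⟨by linarith, by linarith⟩
  have r2 : |(s - 2).re| ≤ 3 := by
    rw [sub_re, show (2 : ℂ).re = 2 by norm_num, abs_le]; exact ⟨by linarith, by linarith⟩
  have key := osc_decay_aux (C := C₀ + C₁ + C₂) (abs_nonneg lam)
    (show 1 ≤ 1 + |s.im| by linarith [abs_nonneg s.im]) (by positivity)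
    ((H₀ lam (s - 2) r2).trans (by linarith))
    ((H₁ lam (s - 1) r1).trans (by linarith)) ((H₂ lam s r0).trans (by linarith))
    ((H₀ lam s r0).trans (by linarith)) (norm_nonneg _) (norm_nonneg _) (norm_nonneg _) hn1 hn2
    (hφ.mul_norm_osc_le lam s) h2 (hφ.deriv.mul_norm_osc_le lam s)
  rw [← mul_div_assoc, le_div_iff₀ (by positivity)]
  linarith

end SmoothSum

namespace SmoothSum

open Complex Set Filter Topology MeasureTheory Metric FourierTransform

theorem TestFun.exists_integral_norm_osc_sq {φ : ℝ → ℂ} (hφ : TestFun φ) (σ : ℝ) :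
    ∃ C ≥ 0, ∀ lam : ℝ, Integrable (fun t : ℝ ↦ ‖osc φ lam (σ + t * I)‖ ^ 2) ∧
      ∫ t : ℝ, ‖osc φ lam (σ + t * I)‖ ^ 2 = C := by
  obtain ⟨a, b, ha, hab, hsupp⟩ := hφ.supp
  refine ⟨2 * Real.pi * ∫ u : ℝ, (Real.exp (-σ * u) * ‖φ (Real.exp (-u))‖) ^ 2,
    mul_nonneg (by positivity) (integral_nonneg fun u ↦ by positivity), ?_⟩
  intro lam
  set G : ℝ → ℂ := fun u ↦ Real.exp (-σ * u) • SmoothSum.twist φ lam (Real.exp (-u)) with hG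
  have hGc : HasCompactSupport G := by
    refine HasCompactSupport.intro (K := Set.Icc (-Real.log b) (-Real.log a)) isCompact_Icc ?_
    intro u hu
    have : Real.exp (-u) ∉ Set.Icc a b := by
      intro h
      refine hu ⟨?_, ?_⟩
      · have := Real.log_le_log (Real.exp_pos _) h.2
        rw [Real.log_exp] at this
        linarith
      · have := Real.log_le_log ha h.1
        rw [Real.log_exp] at this
        linarith
    simp only [hG, SmoothSum.twist, hsupp _ this, zero_mul, smul_zero]
  have hGs : ContDiff ℝ (⊤ : ℕ∞) G := by
    have h1 : ContDiff ℝ (⊤ : ℕ∞) fun u : ℝ ↦ Real.exp (-σ * u) :=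
      Real.contDiff_exp.comp (contDiff_const.mul contDiff_id)
    exact h1.smul ((hφ.twist lam).smooth.comp (Real.contDiff_exp.comp contDiff_neg))
  set S := hGc.toSchwartzMap hGs with hS
  have hcoe : (S : ℝ → ℂ) = G := rfl
  have hosc : ∀ t : ℝ, osc φ lam (σ + t * I) = (𝓕 S) (t / (2 * Real.pi)) := by
    intro t
    rw [osc, mellin_eq_fourier, SchwartzMap.fourier_coe, hcoe, hG]
    simp
  have h2 : Integrable fun ξ : ℝ ↦ ‖(𝓕 S) ξ‖ ^ 2 := by
    have := ((𝓕 S).memLp 2 volume).integrable_norm_pow (by norm_num)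
    simpa using this
  simp only [hosc]
  refine ⟨h2.comp_div (by positivity), ?_⟩
  have h3 := Measure.integral_comp_div (fun ξ : ℝ ↦ ‖(𝓕 S) ξ‖ ^ 2) (2 * Real.pi)
  rw [h3, SchwartzMap.integral_norm_sq_fourier, abs_of_pos (by positivity), smul_eq_mul, hcoe]
  simp only [hG, norm_smul, norm_twist, Real.norm_of_nonneg (Real.exp_pos _).le]

theorem TestFun.continuous_osc_vertical {φ : ℝ → ℂ} (hφ : TestFun φ) (lam σ : ℝ) :
    Continuous fun t : ℝ ↦ osc φ lam (σ + t * I) := by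
  have : Continuous (osc φ lam) :=
    continuous_iff_continuousAt.2 fun s ↦ (hφ.hasDerivAt_osc lam s).continuousAt
  exact this.comp (by fun_prop)

theorem TestFun.abs_im_sq_mul_le {φ : ℝ → ℂ} (hφ : TestFun φ) (lam : ℝ) (s : ℂ) :
    s.im ^ 2 * ‖osc φ lam s‖ ^ 2 ≤ (1 + |lam|) ^ 2 *
      (2 * ‖osc (fun w ↦ (w : ℂ) * _root_.deriv φ w) lam s‖ ^ 2 +
        80 * ‖osc (fun w ↦ (w : ℂ) * φ w) lam s‖ ^ 2) := by
  have h := hφ.osc_by_parts lam s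
  rw [osc_add_one, osc_add_one] at h
  set A := osc (fun w ↦ (w : ℂ) * _root_.deriv φ w) lam s
  set B := osc (fun w ↦ (w : ℂ) * φ w) lam s
  have e : s * osc φ lam s = -(A + 2 * Real.pi * I * lam * B) := by
    linear_combination h
  have h1 : ‖s * osc φ lam s‖ ≤ ‖A‖ + 2 * Real.pi * |lam| * ‖B‖ := by
    rw [e, norm_neg]
    refine (norm_add_le _ _).trans (le_of_eq ?_)
    simp only [norm_mul, norm_I, norm_real, Real.norm_eq_abs, mul_one, Complex.norm_ofNat,
      abs_of_pos Real.pi_pos]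
  rw [norm_mul] at h1
  have h2 : |s.im| * ‖osc φ lam s‖ ≤ ‖A‖ + 2 * Real.pi * |lam| * ‖B‖ :=
    (mul_le_mul_of_nonneg_right (abs_im_le_norm s) (norm_nonneg _)).trans h1
  have h3 : (2 * Real.pi) ^ 2 ≤ 40 := by nlinarith [Real.pi_lt_d2, Real.pi_pos]
  have h4 : (|s.im| * ‖osc φ lam s‖) ^ 2 ≤ 2 * ‖A‖ ^ 2 + 80 * (|lam| ^ 2 * ‖B‖ ^ 2) := by
    have k1 : (|s.im| * ‖osc φ lam s‖) ^ 2 ≤ (‖A‖ + 2 * Real.pi * |lam| * ‖B‖) ^ 2 := by gcongr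
    have k2 : (‖A‖ + 2 * Real.pi * |lam| * ‖B‖) ^ 2 ≤
        2 * ‖A‖ ^ 2 + 2 * (2 * Real.pi * |lam| * ‖B‖) ^ 2 := by
      nlinarith [sq_nonneg (‖A‖ - 2 * Real.pi * |lam| * ‖B‖)]
    have k3 : (2 * Real.pi * |lam| * ‖B‖) ^ 2 ≤ 40 * (|lam| ^ 2 * ‖B‖ ^ 2) := by
      rw [show (2 * Real.pi * |lam| * ‖B‖) ^ 2 = (2 * Real.pi) ^ 2 * (|lam| ^ 2 * ‖B‖ ^ 2) by ring]
      exact mul_le_mul_of_nonneg_right h3 (by positivity)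
    linarith
  rw [mul_pow, sq_abs] at h4
  have h5 : (0 : ℝ) ≤ |lam| := abs_nonneg _
  have h6 : |lam| ^ 2 ≤ (1 + |lam|) ^ 2 := by gcongr; linarith
  have h7 : 1 ≤ (1 + |lam|) ^ 2 := one_le_pow₀ (by linarith)
  nlinarith [mul_le_mul_of_nonneg_right h6 (sq_nonneg ‖B‖),
    mul_le_mul_of_nonneg_right h7 (sq_nonneg ‖A‖)]

theorem exists_integral_one_add_abs_le {η : ℝ} (hη : 0 < η) :
    ∃ C ≥ 0, ∀ A : ℝ, 1 ≤ A → Integrable (fun t : ℝ ↦ (A + |t|) ^ (-(1 + η))) ∧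
      ∫ t : ℝ, (A + |t|) ^ (-(1 + η)) = C * A ^ (-η) := by
  refine ⟨∫ t : ℝ, (1 + |t|) ^ (-(1 + η)), integral_nonneg fun t ↦ by positivity, ?_⟩
  intro A hA
  have hA0 : 0 < A := by linarith
  have e : (fun t : ℝ ↦ (A + |t|) ^ (-(1 + η))) =
      fun t : ℝ ↦ A ^ (-(1 + η)) * (1 + |t / A|) ^ (-(1 + η)) := by
    ext t
    rw [← Real.mul_rpow hA0.le (by positivity), abs_div, abs_of_pos hA0]
    congr 1
    field_simp
  rw [e]
  refine ⟨((integrable_one_add_abs_rpow hη).comp_div hA0.ne').const_mul _, ?_⟩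
  rw [integral_const_mul, Measure.integral_comp_div (fun t ↦ (1 + |t|) ^ (-(1 + η))) A,
    abs_of_pos hA0, smul_eq_mul, ← mul_assoc, ← Real.rpow_add_one hA0.ne', mul_comm]
  congr 2
  ring

theorem TestFun.exists_integral_norm_osc_le {φ : ℝ → ℂ} (hφ : TestFun φ) (σ : ℝ) {ε : ℝ}
    (hε : 0 < ε) (hε1 : ε < 1 / 2) :
    ∃ C ≥ 0, ∀ lam : ℝ, Integrable (fun t : ℝ ↦ ‖osc φ lam (σ + t * I)‖ * (1 + |t|) ^ ε) ∧
      ∫ t : ℝ, ‖osc φ lam (σ + t * I)‖ * (1 + |t|) ^ ε ≤ C * (1 + |lam|) ^ (1 / 2 + ε) := by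
  obtain ⟨C₀, hC₀, H₀⟩ := hφ.exists_integral_norm_osc_sq σ
  obtain ⟨C₁, hC₁, H₁⟩ := hφ.deriv.id_mul.exists_integral_norm_osc_sq σ
  obtain ⟨C₂, hC₂, H₂⟩ := hφ.id_mul.exists_integral_norm_osc_sq σ
  obtain ⟨C₃, hC₃, H₃⟩ := exists_integral_one_add_abs_le (show 0 < 1 - 2 * ε by linarith)
  refine ⟨C₀ + 2 * C₁ + 80 * C₂ + 2 * C₃, by positivity, ?_⟩
  intro lam
  set A := 1 + |lam| with hA
  have hA1 : 1 ≤ A := by linarith [abs_nonneg lam]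
  have hA0 : 0 < A := by linarith
  obtain ⟨i0, v0⟩ := H₀ lam
  obtain ⟨i1, v1⟩ := H₁ lam
  obtain ⟨i2, v2⟩ := H₂ lam
  obtain ⟨i3, v3⟩ := H₃ A hA1
  set b : ℝ → ℝ := fun t ↦ A ^ (1 / 2 + ε) * (‖osc φ lam (σ + t * I)‖ ^ 2 +
    2 * ‖osc (fun w ↦ (w : ℂ) * _root_.deriv φ w) lam (σ + t * I)‖ ^ 2 +
    80 * ‖osc (fun w ↦ (w : ℂ) * φ w) lam (σ + t * I)‖ ^ 2) +
    2 * A ^ (3 / 2 - ε) * (A + |t|) ^ (-(1 + (1 - 2 * ε))) with hb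
  have j1 : Integrable fun t : ℝ ↦ ‖osc φ lam (σ + t * I)‖ ^ 2 +
      2 * ‖osc (fun w ↦ (w : ℂ) * _root_.deriv φ w) lam (σ + t * I)‖ ^ 2 :=
    i0.add (i1.const_mul 2)
  have j2 : Integrable fun t : ℝ ↦ ‖osc φ lam (σ + t * I)‖ ^ 2 +
      2 * ‖osc (fun w ↦ (w : ℂ) * _root_.deriv φ w) lam (σ + t * I)‖ ^ 2 +
      80 * ‖osc (fun w ↦ (w : ℂ) * φ w) lam (σ + t * I)‖ ^ 2 := j1.add (i2.const_mul 80)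
  have hbi : Integrable b := (j2.const_mul _).add (i3.const_mul _)
  have hle : ∀ t : ℝ, ‖osc φ lam (σ + t * I)‖ * (1 + |t|) ^ ε ≤ b t := by
    intro t
    have him : ((σ : ℂ) + t * I).im = t := by simp
    have h1 := hφ.abs_im_sq_mul_le lam (σ + t * I)
    rw [him] at h1
    set X := ‖osc φ lam (σ + t * I)‖
    set Z := 2 * ‖osc (fun w ↦ (w : ℂ) * _root_.deriv φ w) lam (σ + t * I)‖ ^ 2 +
      80 * ‖osc (fun w ↦ (w : ℂ) * φ w) lam (σ + t * I)‖ ^ 2 with hZ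
    have hAt : 0 < A + |t| := by positivity
    have h2 : (A + |t|) ^ 2 * X ^ 2 ≤ 2 * A ^ 2 * (X ^ 2 + Z) := by
      have : (A + |t|) ^ 2 ≤ 2 * (A ^ 2 + t ^ 2) := by
        rw [← sq_abs t]
        nlinarith [sq_nonneg (A - |t|)]
      nlinarith [mul_le_mul_of_nonneg_right this (sq_nonneg X)]
    have h3 : (1 + |t|) ^ ε ≤ (A + |t|) ^ ε := by gcongr
    have h4 : X * (A + |t|) ^ ε ≤ (A + |t|) ^ 2 * X ^ 2 / (2 * A ^ (3 / 2 - ε)) +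
        2 * A ^ (3 / 2 - ε) * ((A + |t|) ^ ε / (A + |t|)) ^ 2 := by
      have hk : 0 < A ^ (3 / 2 - ε) := by positivity
      set k := A ^ (3 / 2 - ε)
      set v := (A + |t|) ^ ε / (A + |t|) with hv
      have e1 : X * (A + |t|) ^ ε = ((A + |t|) * X) * v := by
        rw [hv]
        field_simp
      rw [e1, ← mul_pow]
      set u := (A + |t|) * X
      rw [← sub_nonneg]
      have e2 : u ^ 2 / (2 * k) + 2 * k * v ^ 2 - u * v =
          ((u - k * v) ^ 2 + 3 * (k * v) ^ 2) / (2 * k) := by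
        field_simp
        ring
      rw [e2]
      positivity
    have h5 : ((A + |t|) ^ ε / (A + |t|)) ^ 2 = (A + |t|) ^ (-(1 + (1 - 2 * ε))) := by
      rw [← Real.rpow_sub_one hAt.ne', ← Real.rpow_natCast, ← Real.rpow_mul hAt.le]
      congr 1
      push_cast
      ring
    have h6 : (A + |t|) ^ 2 * X ^ 2 / (2 * A ^ (3 / 2 - ε)) ≤ A ^ (1 / 2 + ε) * (X ^ 2 + Z) := by
      rw [div_le_iff₀ (by positivity)]
      have e3 : A ^ (1 / 2 + ε) * A ^ (3 / 2 - ε) = A ^ 2 := by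
        rw [← Real.rpow_add hA0, ← Real.rpow_natCast]
        congr 1
        push_cast
        ring
      refine h2.trans (le_of_eq ?_)
      linear_combination -(2 * (X ^ 2 + Z)) * e3
    have h7 : X * (1 + |t|) ^ ε ≤ X * (A + |t|) ^ ε := by gcongr
    simp only [hb]
    rw [h5] at h4
    rw [add_assoc (X ^ 2), ← hZ]
    linarith
  refine ⟨hbi.mono' ?_ (ae_of_all _ fun t ↦ ?_), ?_⟩
  · refine Continuous.aestronglyMeasurable ((hφ.continuous_osc_vertical lam σ).norm.mul ?_)
    exact Continuous.rpow_const (by fun_prop) fun t ↦ Or.inl (by positivity)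
  · rw [Real.norm_of_nonneg (by positivity)]
    exact hle t
  refine (integral_mono_of_nonneg (ae_of_all _ fun t ↦ by positivity) hbi
    (ae_of_all _ hle)).trans ?_
  simp only [hb]
  rw [integral_add (j2.const_mul _) (i3.const_mul _)]
  have e4 : ∫ t : ℝ, (‖osc φ lam (σ + t * I)‖ ^ 2 +
      2 * ‖osc (fun w ↦ (w : ℂ) * _root_.deriv φ w) lam (σ + t * I)‖ ^ 2 +
      80 * ‖osc (fun w ↦ (w : ℂ) * φ w) lam (σ + t * I)‖ ^ 2) = C₀ + 2 * C₁ + 80 * C₂ := by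
    rw [integral_add j1 (i2.const_mul 80),
      integral_add i0 (i1.const_mul 2), integral_const_mul, integral_const_mul, v0, v1, v2]
  rw [integral_const_mul, e4, integral_const_mul, v3]
  have e5 : A ^ (3 / 2 - ε) * A ^ (-(1 - 2 * ε)) = A ^ (1 / 2 + ε) := by
    rw [← Real.rpow_add hA0]
    congr 1
    ring
  refine le_of_eq ?_
  linear_combination 2 * C₃ * e5

end SmoothSum

namespace SmoothSum

open Complex Set Filter Topology MeasureTheory Metric

theorem TestFun.verticalIntegrable_osc {φ : ℝ → ℂ} (hφ : TestFun φ) (lam σ : ℝ) :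
    VerticalIntegrable (mellin (SmoothSum.twist φ lam)) σ := by
  obtain ⟨C, -, hC⟩ := hφ.exists_integral_norm_osc_le σ (show (0 : ℝ) < 1 / 4 by norm_num)
    (by norm_num)
  refine (hC lam).1.mono' (hφ.continuous_osc_vertical lam σ).aestronglyMeasurable
    (ae_of_all _ fun t ↦ ?_)
  exact le_mul_of_one_le_right (norm_nonneg _)
    (Real.one_le_rpow (by linarith [abs_nonneg t]) (by norm_num))

theorem TestFun.sum_smoothChar_eq {φ : ℝ → ℂ} (hφ : TestFun φ) {r : ℕ}
    (χ : DirichletCharacter ℂ r) {y X σ : ℝ} (hy : 0 ≤ y) (hX : 0 < X) (hσ : 0 < σ) (lam : ℝ)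
    {N : ℕ} (hN : ∀ n : ℕ, N < n → φ (n / X) = 0) :
    Integrable (fun t : ℝ ↦ (X : ℂ) ^ (σ + t * I) * osc φ lam (σ + t * I) *
      ∏ p ∈ primesUpTo y, (1 - χ p * (p : ℂ) ^ (-(σ + t * I)))⁻¹) ∧
    ∑ n ∈ Finset.Icc 1 N, smoothChar χ y n * SmoothSum.twist φ lam (n / X) =
      (1 / (2 * Real.pi) : ℝ) * ∫ t : ℝ, (X : ℂ) ^ (σ + t * I) * osc φ lam (σ + t * I) *
        ∏ p ∈ primesUpTo y, (1 - χ p * (p : ℂ) ^ (-(σ + t * I)))⁻¹ := by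
  have hs : ∀ t : ℝ, 0 < ((σ : ℂ) + t * I).re := by simpa using hσ
  have hL : ∀ t : ℝ, LSeries (smoothChar χ y) (σ + t * I) =
      ∏ p ∈ primesUpTo y, (1 - χ p * (p : ℂ) ^ (-(σ + t * I)))⁻¹ :=
    fun t ↦ (lSeries_smoothChar χ hy (hs t)).2
  have hsum : LSeriesSummable (smoothChar χ y) σ :=
    (lSeries_smoothChar χ hy (by simpa using hσ)).1
  have := sum_mul_comp_div_eq_mellin (smoothChar_zero χ y) hsum
    ((hφ.twist lam).mellin_hasDerivAt σ).1 (hφ.verticalIntegrable_osc lam σ)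
    (fun t _ ↦ (hφ.twist lam).smooth.continuous.continuousAt) hX (N := N)
    (fun n hn ↦ by simp [SmoothSum.twist, hN n hn])
  simp only [hL] at this
  exact this

theorem abs_add_two_rpow_le (t : ℝ) {ε : ℝ} (hε : 0 ≤ ε) (hε1 : ε ≤ 1) :
    (|t| + 2) ^ ε ≤ 2 * (1 + |t|) ^ ε := by
  calc (|t| + 2) ^ ε ≤ (2 * (1 + |t|)) ^ ε := by
        refine Real.rpow_le_rpow (by positivity) ?_ hε
        linarith [abs_nonneg t]
    _ = 2 ^ ε * (1 + |t|) ^ ε := Real.mul_rpow (by norm_num) (by positivity)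
    _ ≤ 2 * (1 + |t|) ^ ε := by
        refine mul_le_mul_of_nonneg_right ?_ (by positivity)
        calc (2 : ℝ) ^ ε ≤ 2 ^ (1 : ℝ) :=
              Real.rpow_le_rpow_of_exponent_le (by norm_num) hε1
          _ = 2 := Real.rpow_one 2

theorem TestFun.exists_norm_sum_smoothChar_le (hGRH : GRH) {φ : ℝ → ℂ} (hφ : TestFun φ)
    {σ ε : ℝ} (hσ : 1 / 2 < σ) (hσ1 : σ < 1) (hε : 0 < ε) (hε1 : ε < 1 / 2) :
    ∃ C ≥ 0, ∀ (r : ℕ) [NeZero r] (χ : DirichletCharacter ℂ r), χ ≠ 1 → ∀ y X lam : ℝ, 1 ≤ y →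
      0 < X → ∀ N : ℕ, (∀ n : ℕ, N < n → φ (n / X) = 0) →
      ‖∑ n ∈ Finset.Icc 1 N, smoothChar χ y n * SmoothSum.twist φ lam (n / X)‖ ≤
        C * (X ^ σ * (r : ℝ) ^ ε * (1 + |lam|) ^ (1 / 2 + ε)) := by
  obtain ⟨C₁, hC₁, H₁⟩ := exists_norm_prod_char_le hGRH hσ hσ1 hε
  obtain ⟨C₂, hC₂, H₂⟩ := hφ.exists_integral_norm_osc_le σ hε hε1
  refine ⟨2 * C₁ * C₂, by positivity, ?_⟩
  intro r _ χ hχ y X lam hy hX N hN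
  obtain ⟨i1, e1⟩ := hφ.sum_smoothChar_eq χ (by linarith : 0 ≤ y) hX (by linarith : 0 < σ) lam hN
  obtain ⟨i2, l2⟩ := H₂ lam
  rw [e1, norm_mul, norm_real, Real.norm_of_nonneg (by positivity)]
  have hr : (0 : ℝ) ≤ r := Nat.cast_nonneg r
  have hle : ∀ t : ℝ, ‖(X : ℂ) ^ (σ + t * I) * osc φ lam (σ + t * I) *
      ∏ p ∈ primesUpTo y, (1 - χ p * (p : ℂ) ^ (-(σ + t * I)))⁻¹‖ ≤
      (2 * C₁ * X ^ σ * (r : ℝ) ^ ε) * (‖osc φ lam (σ + t * I)‖ * (1 + |t|) ^ ε) := by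
    intro t
    have h1 := H₁ r χ hχ t y hy
    have h2 : ((r : ℝ) * (|t| + 2)) ^ ε ≤ (r : ℝ) ^ ε * (2 * (1 + |t|) ^ ε) := by
      rw [Real.mul_rpow hr (by positivity)]
      exact mul_le_mul_of_nonneg_left (abs_add_two_rpow_le t hε.le (by linarith)) (by positivity)
    have h3 := h1.trans (mul_le_mul_of_nonneg_left h2 hC₁.le)
    rw [norm_mul, norm_mul, norm_cpow_eq_rpow_re_of_pos hX]
    have hre : ((σ : ℂ) + t * I).re = σ := by simp
    rw [hre]
    refine (mul_le_mul_of_nonneg_left h3 (by positivity)).trans (le_of_eq ?_)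
    ring
  have h4 := (norm_integral_le_of_norm_le (i2.const_mul (2 * C₁ * X ^ σ * (r : ℝ) ^ ε))
    (ae_of_all _ hle))
  rw [integral_const_mul] at h4
  have hpi : 1 / (2 * Real.pi) ≤ 1 := by
    rw [div_le_one (by positivity)]
    linarith [Real.pi_gt_three]
  refine (mul_le_of_le_one_left (norm_nonneg _) hpi).trans (h4.trans ?_)
  refine (mul_le_mul_of_nonneg_left l2 (by positivity)).trans (le_of_eq ?_)
  ring

theorem TestFun.exists_norm_integral_osc_tail_le (hGRH : GRH) {φ : ℝ → ℂ} (hφ : TestFun φ)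
    {σ ε : ℝ} (hσ : 1 / 2 < σ) (hσ1 : σ < 1) (hε : 0 < ε) (hε1 : ε < 1 / 2) :
    ∃ C ≥ 0, ∀ y X lam : ℝ, 1 ≤ y → 0 < X →
      Integrable (fun t : ℝ ↦ (X : ℂ) ^ (σ + t * I) * osc φ lam (σ + t * I) *
        eulerProd y (σ + t * I)) →
      ‖(∫ t : ℝ, (X : ℂ) ^ (σ + t * I) * osc φ lam (σ + t * I) * eulerProd y (σ + t * I)) -
        ∫ t in -y..y, (X : ℂ) ^ (σ + t * I) * osc φ lam (σ + t * I) *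
          eulerProd y (σ + t * I)‖ ≤ C * (X ^ σ * (1 + |lam|) ^ (1 / 2 + ε)) := by
  obtain ⟨C₁, hC₁, H₁⟩ := exists_norm_prod_primes_cpow_le hGRH hσ hσ1 hε
  obtain ⟨C₂, hC₂, H₂⟩ := hφ.exists_integral_norm_osc_le σ hε hε1
  refine ⟨2 * C₁ * C₂, by positivity, ?_⟩
  intro y X lam hy hX hi
  obtain ⟨i2, l2⟩ := H₂ lam
  refine (norm_integral_sub_intervalIntegral_le (by linarith) hi
    (i2.const_mul (2 * C₁ * X ^ σ)) (fun t ↦ by positivity) ?_).trans ?_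
  · intro t ht
    have h1 : ‖eulerProd y (σ + t * I)‖ ≤ C₁ * (|t| + 2) ^ ε := H₁ σ t y le_rfl hσ1.le hy ht
    have h2 := abs_add_two_rpow_le t hε.le (by linarith)
    have h3 := h1.trans (mul_le_mul_of_nonneg_left h2 hC₁.le)
    rw [norm_mul, norm_mul, norm_cpow_eq_rpow_re_of_pos hX]
    have hre : ((σ : ℂ) + t * I).re = σ := by simp
    rw [hre]
    refine (mul_le_mul_of_nonneg_left h3 (by positivity)).trans (le_of_eq ?_)
    ring
  · rw [integral_const_mul]
    refine (mul_le_mul_of_nonneg_left l2 (by positivity)).trans (le_of_eq ?_)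
    ring

theorem TestFun.exists_norm_integral_osc_shift_le (hGRH : GRH) {φ : ℝ → ℂ} (hφ : TestFun φ)
    {σ : ℝ} (hσ : 1 / 2 < σ) (hσ1 : σ < 1) :
    ∃ C ≥ 0, ∀ y X lam α : ℝ, 1 ≤ y → 1 ≤ X → σ ≤ α → α ≤ 1 →
      ‖(∫ t in -y..y, (X : ℂ) ^ (σ + t * I) * osc φ lam (σ + t * I) * eulerProd y (σ + t * I)) -
        ∫ t in -y..y, (X : ℂ) ^ (α + t * I) * osc φ lam (α + t * I) *
          eulerProd y (α + t * I)‖ ≤ C * (X ^ α * y ^ 3 / (1 + |lam|) ^ 2) := by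
  obtain ⟨C₁, hC₁, H₁⟩ := exists_norm_prod_primes_cpow_le hGRH hσ hσ1 one_pos
  obtain ⟨C₂, hC₂, H₂⟩ := hφ.exists_norm_osc_le
  refine ⟨24 * C₁ * C₂, by positivity, ?_⟩
  intro y X lam α hy hX hσα hα
  have hX0 : 0 < X := by linarith
  set f : ℂ → ℂ := fun s ↦ (X : ℂ) ^ s * osc φ lam s * eulerProd y s with hf
  have hd : DifferentiableOn ℂ f (uIcc ((σ : ℂ) + (-y : ℝ) * I).re ((α : ℂ) + y * I).re ×ℂ
      uIcc ((σ : ℂ) + (-y : ℝ) * I).im ((α : ℂ) + y * I).im) := by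
    intro s hs
    have h1 : s.re ∈ uIcc ((σ : ℂ) + (-y : ℝ) * I).re ((α : ℂ) + y * I).re :=
      (mem_reProdIm.1 hs).1
    have h2 : 0 < s.re := by
      simp only [add_re, ofReal_re, mul_re, I_re, mul_zero, ofReal_im, I_im, mul_one, sub_self,
        add_zero] at h1
      rw [uIcc_of_le hσα] at h1
      linarith [h1.1]
    have h3 : DifferentiableAt ℂ (fun s : ℂ ↦ (X : ℂ) ^ s) s :=
      differentiableAt_id.const_cpow (Or.inl (by exact_mod_cast hX0.ne'))
    exact ((h3.mul (hφ.hasDerivAt_osc lam s).differentiableAt).mul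
      (differentiableAt_eulerProd h2)).differentiableWithinAt
  have key := integral_boundary_rect_eq_zero_of_differentiableOn f _ _ hd
  simp only [add_re, ofReal_re, mul_re, I_re, mul_zero, ofReal_im, I_im, mul_one, sub_self,
    add_zero, add_im, mul_im, zero_add] at key
  have hb : ∀ t : ℝ, |t| = y → ‖∫ u : ℝ in σ..α, f (u + t * I)‖ ≤
      12 * C₁ * C₂ * (X ^ α * y ^ 3 / (1 + |lam|) ^ 2) := by
    intro t ht
    have h0 : ∀ u ∈ uIoc σ α, ‖f (u + t * I)‖ ≤
        12 * C₁ * C₂ * (X ^ α * y ^ 3 / (1 + |lam|) ^ 2) := by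
      intro u hu
      rw [uIoc_of_le hσα] at hu
      have hre : ((u : ℂ) + t * I).re = u := by simp
      have him : ((u : ℂ) + t * I).im = t := by simp
      have h1 : ‖eulerProd y (u + t * I)‖ ≤ C₁ * (|t| + 2) ^ (1 : ℝ) :=
        H₁ u t y hu.1.le (hu.2.trans hα) hy ht.ge
      have h2 := H₂ lam (u + t * I) (by rw [hre]; linarith [hu.1])
        (by rw [hre]; linarith [hu.2])
      rw [him, ht] at h2
      rw [Real.rpow_one, ht] at h1
      have h3 : X ^ u ≤ X ^ α := Real.rpow_le_rpow_of_exponent_le hX hu.2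
      have h4 : ‖osc φ lam (u + t * I)‖ ≤ C₂ * ((2 * y) ^ 2 / (1 + |lam|) ^ 2) := by
        refine h2.trans ?_
        gcongr
        linarith
      have h5 : ‖eulerProd y (u + t * I)‖ ≤ C₁ * (3 * y) := by
        refine h1.trans ?_
        gcongr
        linarith
      simp only [hf]
      rw [norm_mul, norm_mul, norm_cpow_eq_rpow_re_of_pos hX0, hre]
      calc X ^ u * ‖osc φ lam (u + t * I)‖ * ‖eulerProd y (u + t * I)‖
          ≤ X ^ α * (C₂ * ((2 * y) ^ 2 / (1 + |lam|) ^ 2)) * (C₁ * (3 * y)) := by gcongr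
        _ = _ := by ring
    refine (intervalIntegral.norm_integral_le_of_norm_le_const h0).trans ?_
    refine mul_le_of_le_one_right (by positivity) ?_
    rw [abs_of_nonneg (by linarith)]
    linarith
  have h1 := hb (-y) (by rw [abs_neg, abs_of_nonneg (by linarith)])
  have h2 := hb y (abs_of_nonneg (by linarith))
  have e : (∫ t in -y..y, f (σ + t * I)) - ∫ t in -y..y, f (α + t * I) =
      -I * ((∫ u : ℝ in σ..α, f (u + (-y : ℝ) * I)) - ∫ u : ℝ in σ..α, f (u + y * I)) := by
    simp only [smul_eq_mul] at key
    linear_combination I * key + ((∫ t in -y..y, f (σ + t * I)) -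
      ∫ t in -y..y, f (α + t * I)) * I_sq
  have e' : ‖(∫ t in -y..y, f (σ + t * I)) - ∫ t in -y..y, f (α + t * I)‖ ≤
      24 * C₁ * C₂ * (X ^ α * y ^ 3 / (1 + |lam|) ^ 2) := by
    rw [e, norm_mul, norm_neg, norm_I, one_mul]
    refine (norm_sub_le _ _).trans ((add_le_add h1 h2).trans (le_of_eq ?_))
    ring
  exact e'

end SmoothSum

namespace SmoothSum

open Complex Set Filter Topology MeasureTheory Metric

theorem TestFun.exists_norm_cpow_mul_osc_le {φ : ℝ → ℂ} (hφ : TestFun φ) :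
    ∃ C ≥ 0, ∀ lam m a : ℝ, 1 ≤ m → 0 ≤ a →
      (∀ s : ℂ, a ≤ s.re → s.re ≤ 1 → ‖(m : ℂ) ^ (-s) * osc φ lam s‖ ≤
        C * (m ^ (-a) * (1 + Real.log m) / (1 + |lam|) ^ 2) * (1 + |s.im|) ^ 2) ∧
      (∀ z w : ℂ, a ≤ z.re → z.re ≤ 1 → |z.im| ≤ 1 → a ≤ w.re → w.re ≤ 1 → |w.im| ≤ 1 →
        ‖(m : ℂ) ^ (-z) * osc φ lam z - (m : ℂ) ^ (-w) * osc φ lam w‖ ≤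
          C * (m ^ (-a) * (1 + Real.log m) / (1 + |lam|) ^ 2) * ‖z - w‖) := by
  obtain ⟨C₁, hC₁, H₁⟩ := hφ.exists_norm_osc_le
  obtain ⟨C₂, hC₂, H₂⟩ := hφ.log_mul.exists_norm_osc_le
  refine ⟨4 * (C₁ + C₂), by positivity, ?_⟩
  intro lam m a hm ha
  have hm0 : 0 < m := by linarith
  have hl : 0 ≤ Real.log m := Real.log_nonneg hm
  have hpow : ∀ s : ℂ, a ≤ s.re → ‖(m : ℂ) ^ (-s)‖ ≤ m ^ (-a) := by
    intro s hs
    rw [norm_cpow_eq_rpow_re_of_pos hm0]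
    exact Real.rpow_le_rpow_of_exponent_le hm (by simpa using hs)
  constructor
  · intro s h1 h2
    rw [norm_mul]
    calc ‖(m : ℂ) ^ (-s)‖ * ‖osc φ lam s‖
        ≤ m ^ (-a) * (C₁ * ((1 + |s.im|) ^ 2 / (1 + |lam|) ^ 2)) :=
          mul_le_mul (hpow s h1) (H₁ lam s (ha.trans h1) h2) (norm_nonneg _) (by positivity)
      _ = C₁ * (m ^ (-a) * 1 / (1 + |lam|) ^ 2) * (1 + |s.im|) ^ 2 := by ring
      _ ≤ _ := by
          gcongr
          · linarith
          · linarith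
  · set R : Set ℂ := Icc a 1 ×ℂ Icc (-1) 1
    have hR : Convex ℝ R :=
      ((convex_Icc a 1).is_linear_preimage reLm.isLinear).inter
        ((convex_Icc (-1 : ℝ) 1).is_linear_preimage imLm.isLinear)
    have hd : ∀ s ∈ R, HasDerivWithinAt (fun s : ℂ ↦ (m : ℂ) ^ (-s) * osc φ lam s)
        ((m : ℂ) ^ (-s) * Complex.log m * (-1) * osc φ lam s + (m : ℂ) ^ (-s) *
          osc (fun w ↦ (Real.log w : ℂ) * φ w) lam s) R s := by
      intro s _
      have h1 : HasDerivAt (fun s : ℂ ↦ (m : ℂ) ^ (-s)) ((m : ℂ) ^ (-s) * Complex.log m * (-1)) s :=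
        (hasDerivAt_id s).neg.const_cpow (Or.inl (by exact_mod_cast hm0.ne'))
      exact (h1.mul (hφ.hasDerivAt_osc lam s)).hasDerivWithinAt
    have hb : ∀ s ∈ R, ‖(m : ℂ) ^ (-s) * Complex.log m * (-1) * osc φ lam s + (m : ℂ) ^ (-s) *
          osc (fun w ↦ (Real.log w : ℂ) * φ w) lam s‖ ≤
        4 * (C₁ + C₂) * (m ^ (-a) * (1 + Real.log m) / (1 + |lam|) ^ 2) := by
      intro s hs
      obtain ⟨⟨h1, h2⟩, h3⟩ := mem_reProdIm.1 hs
      have h3 : |s.im| ≤ 1 := abs_le.2 h3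
      have k1 := H₁ lam s (ha.trans h1) h2
      have k2 := H₂ lam s (ha.trans h1) h2
      have k3 : (1 + |s.im|) ^ 2 ≤ 4 := by
        calc (1 + |s.im|) ^ 2 ≤ (1 + 1) ^ 2 := by gcongr
          _ = 4 := by norm_num
      have k4 : ‖osc φ lam s‖ ≤ C₁ * (4 / (1 + |lam|) ^ 2) := k1.trans (by gcongr)
      have k5 : ‖osc (fun w ↦ (Real.log w : ℂ) * φ w) lam s‖ ≤ C₂ * (4 / (1 + |lam|) ^ 2) :=
        k2.trans (by gcongr)
      refine (norm_add_le _ _).trans ?_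
      rw [norm_mul, norm_mul, norm_mul, norm_mul ((m : ℂ) ^ (-s)) (osc _ _ _), norm_neg, norm_one,
        mul_one, ← ofReal_log hm0.le, norm_real, Real.norm_of_nonneg hl]
      calc ‖(m : ℂ) ^ (-s)‖ * Real.log m * ‖osc φ lam s‖ + ‖(m : ℂ) ^ (-s)‖ *
            ‖osc (fun w ↦ (Real.log w : ℂ) * φ w) lam s‖
          ≤ m ^ (-a) * Real.log m * (C₁ * (4 / (1 + |lam|) ^ 2)) +
            m ^ (-a) * (C₂ * (4 / (1 + |lam|) ^ 2)) := by
            gcongr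
            · exact hpow s h1
            · exact hpow s h1
        _ ≤ m ^ (-a) * (1 + Real.log m) * (C₁ * (4 / (1 + |lam|) ^ 2)) +
            m ^ (-a) * (1 + Real.log m) * (C₂ * (4 / (1 + |lam|) ^ 2)) := by
            gcongr
            · linarith
            · exact le_mul_of_one_le_right (by positivity) (by linarith)
        _ = _ := by ring
    intro z w hz1 hz2 hz3 hw1 hw2 hw3
    exact hR.norm_image_sub_le_of_norm_hasDerivWithin_le hd hb
      (mem_reProdIm.2 ⟨⟨hw1, hw2⟩, abs_le.1 hw3⟩) (mem_reProdIm.2 ⟨⟨hz1, hz2⟩, abs_le.1 hz3⟩)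

theorem TestFun.exists_norm_integral_osc_sub_le {φ : ℝ → ℂ} (hφ : TestFun φ) {σ₁ : ℝ}
    (hσ : 1 / 2 < σ₁) :
    ∃ C ≥ 0, ∀ x y α m lam : ℝ, SaddleBounds σ₁ x y α → 1 ≤ m →
      ‖(1 / (2 * Real.pi) : ℝ) * (∫ t in -y..y, ((x / m : ℝ) : ℂ) ^ (α + t * I) *
          osc φ lam (α + t * I) * eulerProd y (α + t * I)) -
        (x : ℂ) ^ (α : ℂ) * eulerProd y α * saddleMass x y α *
          ((m : ℂ) ^ (-(α : ℂ)) * osc φ lam α)‖ ≤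
      C * (‖(x : ℂ) ^ (α : ℂ) * eulerProd y α‖ / (Real.sqrt (saddleVar y α) * Real.log y)) *
        (m ^ (-α) * (1 + Real.log m) / (1 + |lam|) ^ 2) := by
  obtain ⟨C, hC, H⟩ := hφ.exists_norm_cpow_mul_osc_le
  refine ⟨5 * C, by positivity, ?_⟩
  intro x y α m lam hS hm
  have hx : 0 < x := by linarith [hS.one_le_x]
  have hm0 : 0 < m := by linarith
  have hα := hS.le_α
  have hα0 : 0 < α := by linarith
  have hα1 := hS.α_lt
  have hY := hS.le_log
  have hy := hS.one_le_y
  have hV := hS.var_pos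
  have hVY := hS.sqrt_var_ge
  have hVy := hS.sqrt_var_le
  have hYy := hS.log_le
  set E := m ^ (-α) * (1 + Real.log m) / (1 + |lam|) ^ 2 with hE
  have hE0 : 0 ≤ E := by
    have := Real.log_nonneg hm
    positivity
  obtain ⟨Ha, Hb⟩ := H lam m α hm hα0.le
  have e : ∀ t : ℝ, ((x / m : ℝ) : ℂ) ^ (α + t * I) * osc φ lam (α + t * I) *
      eulerProd y (α + t * I) = (x : ℂ) ^ (α : ℂ) * eulerProd y α * (tilt x y α t *
        ((m : ℂ) ^ (-(α + t * I)) * osc φ lam (α + t * I))) := by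
    intro t
    rw [← mul_assoc, ← cpow_mul_eulerProd_eq hx hα0 t, div_eq_mul_inv,
      ofReal_mul, mul_cpow_ofReal_nonneg hx.le (by positivity), ofReal_inv,
      inv_cpow _ _ (by rw [arg_ofReal_of_nonneg hm0.le]; exact Real.pi_pos.ne), cpow_neg]
    ring
  simp only [e]
  rw [intervalIntegral.integral_const_mul]
  have hre : ∀ t : ℝ, ((α : ℂ) + t * I).re = α := by simp
  have him : ∀ t : ℝ, ((α : ℂ) + t * I).im = t := by simp
  have key := hS.norm_integral_tilt_mul_sub_le hσ
    (H := fun t : ℝ ↦ (m : ℂ) ^ (-(α + t * I)) * osc φ lam (α + t * I))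
    (H₀ := (m : ℂ) ^ (-(α : ℂ)) * osc φ lam α) (D := C * E) (D' := 0) (B := C * E * (4 * y ^ 2))
    (Continuous.mul (Continuous.const_cpow (by fun_prop) (Or.inl (by exact_mod_cast hm0.ne')))
      (hφ.continuous_osc_vertical lam α)) (by positivity) le_rfl
    (fun t ht ↦ by
      have ht1 : |t| ≤ 1 := ht.trans (by rw [div_le_one (by linarith)]; linarith)
      have := Hb (α + t * I) α (hre t).ge ((hre t).trans_le hα1.le) (by rwa [him])
        (by simp) (by simpa using hα1.le) (by simp)
      simpa using this)
    (fun t ht ↦ by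
      refine (Ha (α + t * I) (hre t).ge ((hre t).trans_le hα1.le)).trans ?_
      rw [him]
      refine mul_le_mul_of_nonneg_left ?_ (by positivity)
      calc (1 + |t|) ^ 2 ≤ (y + y) ^ 2 := by gcongr
        _ = 4 * y ^ 2 := by ring)
  set Wc := (x : ℂ) ^ (α : ℂ) * eulerProd y α
  have e2 : ∀ J M h : ℂ, ((1 / (2 * Real.pi) : ℝ) : ℂ) * (Wc * J) - Wc * M * h =
      Wc * (((1 / (2 * Real.pi) : ℝ) : ℂ) * J - M * h) := by
    intro J M h
    ring
  rw [e2, norm_mul]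
  refine (mul_le_mul_of_nonneg_left key (norm_nonneg _)).trans ?_
  set V := saddleVar y α
  set s := Real.sqrt V with hs
  have hs0 : 0 < s := Real.sqrt_pos.2 hV
  have hVs : V = s ^ 2 := (Real.sq_sqrt hV.le).symm
  set Y := Real.log y
  have hY0 : 0 < Y := by linarith
  have h1 : C * E / V ≤ C * E / (s * Y) := by
    rw [hVs, sq]
    gcongr
  have h2 : C * E * (4 * y ^ 2) / y ^ 4 ≤ 4 * (C * E / (s * Y)) := by
    rw [show C * E * (4 * y ^ 2) / y ^ 4 = 4 * (C * E / (y * y)) by field_simp]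
    gcongr
  calc ‖Wc‖ * (C * E / V + 0 / s + C * E * (4 * y ^ 2) / y ^ 4)
      ≤ ‖Wc‖ * (C * E / (s * Y) + 0 / s + 4 * (C * E / (s * Y))) := by gcongr
    _ = _ := by
      rw [zero_div]
      ring

end SmoothSum

namespace SmoothSum

open Complex Set Filter Topology MeasureTheory Metric

theorem TestFun.exists_norm_sum_smoothInd_sub_le (hGRH : GRH) {φ : ℝ → ℂ} (hφ : TestFun φ)
    {σ₁ σ ε : ℝ} (hσ₁ : 1 / 2 < σ₁) (hσ₁1 : σ₁ < 1) (hσ : 1 / 2 < σ) (hσσ₁ : σ ≤ σ₁)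
    (hε : 0 < ε) (hε1 : ε < 1 / 2) :
    ∃ C ≥ 0, ∃ K, ∀ x y α c m lam : ℝ, SaddleBounds σ₁ x y α → K ≤ Real.log y →
      c = 1 - 1 / (Real.log y / Real.log (Real.log x)) → 0 ≤ c → 1 ≤ m → m ≤ x →
      ∀ N : ℕ, (∀ n : ℕ, N < n → φ (n / (x / m)) = 0) →
      ‖∑ n ∈ Finset.Icc 1 N, smoothInd y n * SmoothSum.twist φ lam (n / (x / m)) -
        c * ((m : ℂ) ^ (-(c : ℂ)) * osc φ lam c) * Psi x y‖ ≤
      C * (x ^ σ * (1 + |lam|) ^ (1 / 2 + ε) + Psi x y *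
        (m ^ (-c) * (1 + Real.log m) / (1 + |lam|) ^ 2) *
        (Real.log (Real.log y) / Real.log y)) := by
  obtain ⟨C₁, hC₁, H₁⟩ := hφ.exists_norm_integral_osc_tail_le hGRH hσ (by linarith) hε hε1
  obtain ⟨C₂, hC₂, H₂⟩ := hφ.exists_norm_integral_osc_shift_le hGRH hσ (by linarith)
  obtain ⟨C₃, hC₃, H₃⟩ := hφ.exists_norm_integral_osc_sub_le hσ₁
  obtain ⟨C₄, hC₄, H₄⟩ := exists_norm_Psi_sub_le hGRH hσ₁ hσ₁1
  obtain ⟨K, HK⟩ := exists_le_Psi hGRH hσ₁ hσ₁1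
  obtain ⟨C₅, hC₅, H₅⟩ := hφ.exists_norm_cpow_mul_osc_le
  refine ⟨C₁ + (50 * C₂ + 50 * C₃ + 50 * C₄ * C₅ + 4 * C₅), by positivity, K, ?_⟩
  intro x y α c m lam hS hK hc hc0 hm hmx N hN
  have hx1 := hS.one_le_x
  have hx : 0 < x := by linarith
  have hm0 : 0 < m := by linarith
  have hα := hS.le_α
  have hα0 : 0 < α := by linarith
  have hα1 := hS.α_lt
  have hY := hS.le_log
  have hy := hS.one_le_y
  have hV := hS.var_pos
  have hVY := hS.sqrt_var_ge
  have hVy := hS.sqrt_var_le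
  have hYy := hS.log_le
  have hle := hS.c_le
  have hle' := hS.le_c
  rw [← hc] at hle hle'
  have hX : 1 ≤ x / m := by rwa [le_div_iff₀ hm0, one_mul]
  have hX0 : 0 < x / m := by linarith
  obtain ⟨hi, hs⟩ := hφ.sum_smoothChar_eq (1 : DirichletCharacter ℂ 1) (by linarith : 0 ≤ y) hX0
    (by linarith : 0 < σ) lam hN
  have hE : ∀ t : ℝ, ∏ p ∈ primesUpTo y, (1 - (1 : DirichletCharacter ℂ 1) p *
      (p : ℂ) ^ (-(σ + t * I)))⁻¹ = eulerProd y (σ + t * I) := fun t ↦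
    Finset.prod_congr rfl fun p _ ↦ by rw [MulChar.one_apply (isUnit_of_subsingleton _), one_mul]
  simp only [hE] at hi hs
  have hl : 0 ≤ Real.log m := Real.log_nonneg hm
  set Y := Real.log y
  have hLY : 1 ≤ Real.log Y := by
    rw [Real.le_log_iff_exp_le (by linarith)]
    linarith [Real.exp_one_lt_d9]
  set L := Real.log Y / Y with hL
  have hLY' : 1 / Y ≤ L := div_le_div_of_nonneg_right hLY (by linarith)
  set E := m ^ (-α) * (1 + Real.log m) / (1 + |lam|) ^ 2 with hEdef
  set E' := m ^ (-c) * (1 + Real.log m) / (1 + |lam|) ^ 2 with hE'def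
  have hE0 : 0 ≤ E := by positivity
  have hEE' : E ≤ E' := by
    simp only [hEdef, hE'def]
    gcongr
  have hL0 : 0 ≤ L := by positivity
  set W := ‖(x : ℂ) ^ (α : ℂ) * eulerProd y α‖ with hW
  set s := Real.sqrt (saddleVar y α) with hsdef
  have hs0 : 0 < s := Real.sqrt_pos.2 hV
  have hWΨ : W / s ≤ 50 * Psi x y := HK x y α hS hK
  have hΨ : (0 : ℝ) ≤ Psi x y := by
    have : 0 ≤ W / s := by positivity
    linarith
  have hWsY : W / (s * Y) ≤ 50 * Psi x y * L := by
    rw [← div_div, div_eq_mul_one_div]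
    exact mul_le_mul hWΨ hLY' (by positivity) (by positivity)
  have hpi : ‖((1 / (2 * Real.pi) : ℝ) : ℂ)‖ ≤ 1 := by
    rw [norm_real, Real.norm_of_nonneg (by positivity), div_le_one (by positivity)]
    linarith [Real.pi_gt_three]
  have p1 := H₁ y (x / m) lam hy hX0 hi
  have p2 := H₂ y (x / m) lam α hy hX (hσσ₁.trans hα) hα1.le
  have p3 := H₃ x y α m lam hS hm
  have p4 := H₄ x y α hS
  obtain ⟨Ha, Hb⟩ := H₅ lam m c hm hc0
  have q1 : C₁ * ((x / m) ^ σ * (1 + |lam|) ^ (1 / 2 + ε)) ≤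
      C₁ * (x ^ σ * (1 + |lam|) ^ (1 / 2 + ε)) := by
    gcongr
    exact div_le_self hx.le hm
  have q2 : C₂ * ((x / m) ^ α * y ^ 3 / (1 + |lam|) ^ 2) ≤ 50 * C₂ * (Psi x y * E' * L) := by
    have h1 : (x / m) ^ α = x ^ α * m ^ (-α) := by
      rw [Real.div_rpow hx.le hm0.le, Real.rpow_neg hm0.le, div_eq_mul_inv]
    have h2 : x ^ α * y ^ 10 ≤ W := by
      rw [hW, norm_mul, norm_cpow_eq_rpow_re_of_pos hx, ofReal_re]
      exact mul_le_mul_of_nonneg_left hS.le_zeta (by positivity)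
    have h3 : x ^ α * y ^ 3 ≤ W / (s * Y) := by
      rw [le_div_iff₀ (by positivity)]
      calc x ^ α * y ^ 3 * (s * Y) ≤ x ^ α * y ^ 3 * (y * y) := by gcongr
        _ = x ^ α * y ^ 5 := by ring
        _ ≤ x ^ α * y ^ 10 := by
            gcongr
            norm_num
        _ ≤ W := h2
    have h4 : m ^ (-α) / (1 + |lam|) ^ 2 ≤ E := by
      simp only [hEdef]
      gcongr
      exact le_mul_of_one_le_right (by positivity) (by linarith)
    calc C₂ * ((x / m) ^ α * y ^ 3 / (1 + |lam|) ^ 2)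
        = C₂ * ((x ^ α * y ^ 3) * (m ^ (-α) / (1 + |lam|) ^ 2)) := by rw [h1]; ring
      _ ≤ C₂ * ((50 * Psi x y * L) * E') := by
          refine mul_le_mul_of_nonneg_left ?_ hC₂
          exact mul_le_mul (h3.trans hWsY) (h4.trans hEE') (by positivity) (by positivity)
      _ = _ := by ring
  have q3 : C₃ * (W / (s * Y)) * E ≤ 50 * C₃ * (Psi x y * E' * L) := by
    calc C₃ * (W / (s * Y)) * E ≤ C₃ * (50 * Psi x y * L) * E' := by gcongr
      _ = _ := by ring
  set h : ℂ → ℂ := fun s ↦ (m : ℂ) ^ (-s) * osc φ lam s with hh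
  have nh : ∀ u : ℝ, c ≤ u → u ≤ 1 → ‖h u‖ ≤ C₅ * E' := by
    intro u h1 h2
    have := Ha u (by simpa using h1) (by simpa using h2)
    rwa [ofReal_im, abs_zero, add_zero, one_pow, mul_one] at this
  have q4 : ‖(x : ℂ) ^ (α : ℂ) * eulerProd y α * saddleMass x y α * h α - α * Psi x y * h α‖ ≤
      50 * C₄ * C₅ * (Psi x y * E' * L) := by
    have hαC : (α : ℂ) ≠ 0 := by exact_mod_cast hα0.ne'
    have e1 : (x : ℂ) ^ (α : ℂ) * eulerProd y α * saddleMass x y α * h α - α * Psi x y * h α =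
        -(α * (Psi x y - (x : ℂ) ^ (α : ℂ) * eulerProd y α * saddleMass x y α / α) * h α) := by
      field_simp
      ring
    rw [e1, norm_neg, norm_mul, norm_mul, norm_real, Real.norm_of_nonneg hα0.le]
    calc α * ‖(Psi x y - (x : ℂ) ^ (α : ℂ) * eulerProd y α * saddleMass x y α / α)‖ * ‖h α‖
        ≤ 1 * (C₄ * (50 * Psi x y * L)) * (C₅ * E') := by
          gcongr
          · exact p4.trans (mul_le_mul_of_nonneg_left hWsY hC₄.le)
          · exact nh α hle hα1.le
      _ = _ := by ring
  have q5 : ‖α * Psi x y * h α - c * h c * Psi x y‖ ≤ 4 * C₅ * (Psi x y * E' * L) := by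
    have e1 : α * Psi x y * h α - c * h c * Psi x y =
        Psi x y * (α * (h α - h c) + ((α - c : ℝ) : ℂ) * h c) := by
      push_cast
      ring
    have h1 : ‖h α - h c‖ ≤ C₅ * E' * (2 * L) := by
      have := Hb α c (by simpa using hle) (by simpa using hα1.le) (by simp) (by simp)
        (by simpa using hle.trans hα1.le) (by simp)
      refine this.trans ?_
      rw [← ofReal_sub, norm_real, Real.norm_of_nonneg (by linarith)]
      refine mul_le_mul_of_nonneg_left (by linarith) (by positivity)
    have h2 : ‖((α - c : ℝ) : ℂ)‖ ≤ 2 * L := by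
      rw [norm_real, Real.norm_of_nonneg (by linarith)]
      linarith
    rw [e1, norm_mul, Complex.norm_natCast]
    calc (Psi x y : ℝ) * ‖α * (h α - h c) + ((α - c : ℝ) : ℂ) * h c‖
        ≤ Psi x y * (1 * (C₅ * E' * (2 * L)) + 2 * L * (C₅ * E')) := by
          refine mul_le_mul_of_nonneg_left ((norm_add_le _ _).trans ?_) hΨ
          rw [norm_mul, norm_mul, norm_real, Real.norm_of_nonneg hα0.le]
          refine add_le_add ?_ ?_
          · exact mul_le_mul hα1.le h1 (norm_nonneg _) zero_le_one
          · exact mul_le_mul h2 (nh c le_rfl (hle.trans hα1.le)) (norm_nonneg _) (by positivity)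
      _ = _ := by ring
  have hs' : ∑ n ∈ Finset.Icc 1 N, smoothInd y n * SmoothSum.twist φ lam (n / (x / m)) = _ := hs
  rw [hs']
  set Z := ((1 / (2 * Real.pi) : ℝ) : ℂ)
  set J₀ := ∫ t : ℝ, ((x / m : ℝ) : ℂ) ^ (σ + t * I) * osc φ lam (σ + t * I) *
    eulerProd y (σ + t * I)
  set J₁ := ∫ t in -y..y, ((x / m : ℝ) : ℂ) ^ (σ + t * I) * osc φ lam (σ + t * I) *
    eulerProd y (σ + t * I)
  set J₂ := ∫ t in -y..y, ((x / m : ℝ) : ℂ) ^ (α + t * I) * osc φ lam (α + t * I) *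
    eulerProd y (α + t * I)
  set P := (x : ℂ) ^ (α : ℂ) * eulerProd y α * saddleMass x y α
  have r1 : ‖Z * (J₀ - J₁)‖ ≤ C₁ * (x ^ σ * (1 + |lam|) ^ (1 / 2 + ε)) := by
    rw [norm_mul]
    exact (mul_le_of_le_one_left (norm_nonneg _) hpi).trans (p1.trans q1)
  have r2 : ‖Z * (J₁ - J₂)‖ ≤ 50 * C₂ * (Psi x y * E' * L) := by
    rw [norm_mul]
    exact (mul_le_of_le_one_left (norm_nonneg _) hpi).trans (p2.trans q2)
  have r3 : ‖Z * J₂ - P * h α‖ ≤ 50 * C₃ * (Psi x y * E' * L) := p3.trans q3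
  have e : Z * J₀ - c * h c * Psi x y = Z * (J₀ - J₁) + Z * (J₁ - J₂) + (Z * J₂ - P * h α) +
      (P * h α - α * Psi x y * h α) + (α * Psi x y * h α - c * h c * Psi x y) := by ring
  have r : ‖Z * J₀ - c * h c * Psi x y‖ ≤ C₁ * (x ^ σ * (1 + |lam|) ^ (1 / 2 + ε)) +
      50 * C₂ * (Psi x y * E' * L) + 50 * C₃ * (Psi x y * E' * L) +
      50 * C₄ * C₅ * (Psi x y * E' * L) + 4 * C₅ * (Psi x y * E' * L) := by
    rw [e]
    exact norm_add_le_of_le (norm_add_le_of_le (norm_add_le_of_le (norm_add_le_of_le r1 r2) r3) q4)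
      q5
  refine r.trans ?_
  set U := x ^ σ * (1 + |lam|) ^ (1 / 2 + ε)
  set T := Psi x y * E' * L
  have hU : 0 ≤ U := by positivity
  have hT : 0 ≤ T := mul_nonneg (mul_nonneg hΨ (hE0.trans hEE')) hL0
  have hk : 0 ≤ (50 * C₂ + 50 * C₃ + 50 * C₄ * C₅ + 4 * C₅) * U := by positivity
  have hk2 : 0 ≤ C₁ * T := by positivity
  linarith [show (C₁ + (50 * C₂ + 50 * C₃ + 50 * C₄ * C₅ + 4 * C₅)) * (U + T) = C₁ * U +
    50 * C₂ * T + 50 * C₃ * T + 50 * C₄ * C₅ * T + 4 * C₅ * T +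
    (50 * C₂ + 50 * C₃ + 50 * C₄ * C₅ + 4 * C₅) * U + C₁ * T by ring]

end SmoothSum

namespace SmoothSum

theorem exists_card_divisors_le {ε : ℝ} (hε : 0 < ε) :
    ∃ C ≥ (1 : ℝ), ∀ n : ℕ, n ≠ 0 → (n.divisors.card : ℝ) ≤ C * (n : ℝ) ^ ε := by
  set u := ε * Real.log 2 with hu
  have hu0 : 0 < u := mul_pos hε (Real.log_pos (by norm_num))
  set K := 1 + 1 / u with hK
  have hK1 : 1 ≤ K := by
    have : 0 < 1 / u := by positivity
    linarith
  set P := ⌈(2 : ℝ) ^ (1 / ε)⌉₊ with hP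
  refine ⟨K ^ P, one_le_pow₀ hK1, ?_⟩
  intro n hn
  have h1 : ∀ p ∈ n.primeFactors, ((n.factorization p : ℝ) + 1) ≤
      (if p < P then K else 1) * ((p : ℝ) ^ n.factorization p) ^ ε := by
    intro p hp
    have hp2 : (2 : ℝ) ≤ p := by exact_mod_cast (Nat.prime_of_mem_primeFactors hp).two_le
    have hp0 : (0 : ℝ) < p := by linarith
    set a := n.factorization p
    have e : ((p : ℝ) ^ a) ^ ε = ((p : ℝ) ^ ε) ^ a := by
      rw [← Real.rpow_natCast, ← Real.rpow_natCast, ← Real.rpow_mul hp0.le, ← Real.rpow_mul hp0.le,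
        mul_comm]
    rw [e]
    split_ifs with hpP
    · have h2 : 1 + u * a ≤ ((p : ℝ) ^ ε) ^ a := by
        calc 1 + u * a ≤ Real.exp (u * a) := by linarith [Real.add_one_le_exp (u * a)]
          _ = ((2 : ℝ) ^ ε) ^ a := by
            rw [Real.rpow_def_of_pos (by norm_num), ← Real.exp_nat_mul]
            congr 1
            rw [hu]
            ring
          _ ≤ _ := by gcongr
      calc (a : ℝ) + 1 ≤ (1 + 1 / u) * (1 + u * a) := by
            have : (1 + 1 / u) * (1 + u * a) = 1 + u * a + 1 / u + a := by
              field_simp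
              ring
            rw [this]
            have : 0 ≤ u * a + 1 / u := by positivity
            linarith
        _ ≤ K * ((p : ℝ) ^ ε) ^ a := mul_le_mul_of_nonneg_left h2 (by positivity)
    · have h2 : (2 : ℝ) ≤ (p : ℝ) ^ ε := by
        have h3 : (2 : ℝ) ^ (1 / ε) ≤ p :=
          (Nat.le_ceil _).trans (by exact_mod_cast not_lt.1 hpP)
        calc (2 : ℝ) = ((2 : ℝ) ^ (1 / ε)) ^ ε := by
              rw [← Real.rpow_mul (by norm_num), one_div_mul_cancel hε.ne', Real.rpow_one]
          _ ≤ (p : ℝ) ^ ε := by gcongr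
      rw [one_mul]
      calc (a : ℝ) + 1 ≤ 2 ^ a := by exact_mod_cast Nat.succ_le_of_lt a.lt_two_pow_self
        _ ≤ _ := by gcongr
  have h2 : ∏ p ∈ n.primeFactors, (if p < P then K else 1) ≤ K ^ P := by
    rw [Finset.prod_ite, Finset.prod_const, Finset.prod_const_one, mul_one]
    refine pow_le_pow_right₀ hK1 ?_
    calc _ ≤ (Finset.range P).card := Finset.card_le_card fun p hp ↦ by
          simp only [Finset.mem_filter] at hp
          exact Finset.mem_range.2 hp.2
      _ = P := Finset.card_range P
  have h3 : ∏ p ∈ n.primeFactors, ((p : ℝ) ^ n.factorization p) ^ ε = (n : ℝ) ^ ε := by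
    rw [Real.finsetProd_rpow _ _ fun p _ ↦ by positivity]
    congr 1
    exact_mod_cast (Nat.prod_factorization_pow_eq_self hn)
  rw [Nat.card_divisors hn]
  push_cast
  calc ∏ p ∈ n.primeFactors, ((n.factorization p : ℝ) + 1)
      ≤ ∏ p ∈ n.primeFactors, (if p < P then K else 1) * ((p : ℝ) ^ n.factorization p) ^ ε :=
        Finset.prod_le_prod (fun p _ ↦ by positivity) h1
    _ = (∏ p ∈ n.primeFactors, (if p < P then K else 1)) * (n : ℝ) ^ ε := by
        rw [Finset.prod_mul_distrib, h3]
    _ ≤ _ := mul_le_mul_of_nonneg_right h2 (by positivity)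

theorem le_totient_mul_card_divisors (n : ℕ) : n ≤ n.totient * n.divisors.card := by
  rcases Nat.eq_zero_or_pos n with rfl | hn
  · simp
  calc n = ∑ d ∈ n.divisors, d.totient := (Nat.sum_totient n).symm
    _ ≤ ∑ d ∈ n.divisors, n.totient := Finset.sum_le_sum fun d hd ↦
        Nat.le_of_dvd (Nat.totient_pos.2 hn) (Nat.totient_dvd_of_dvd (Nat.dvd_of_mem_divisors hd))
    _ = n.totient * n.divisors.card := by rw [Finset.sum_const, smul_eq_mul, mul_comm]

/-- The unnormalised finite Fourier transform of `G` restricted to the units modulo `r`. -/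
noncomputable def charCoeff {r : ℕ} [NeZero r] (G : ZMod r → ℂ) (χ : DirichletCharacter ℂ r) : ℂ :=
  ∑ b : (ZMod r)ˣ, χ (b⁻¹ : (ZMod r)ˣ) * G b

theorem sum_charCoeff_mul {r : ℕ} [NeZero r] (G : ZMod r → ℂ) (u : (ZMod r)ˣ) :
    ∑ χ : DirichletCharacter ℂ r, charCoeff G χ * χ u = r.totient * G u := by
  simp only [charCoeff, Finset.sum_mul]
  rw [Finset.sum_comm]
  have h : ∀ b : (ZMod r)ˣ, ∑ χ : DirichletCharacter ℂ r, χ (b⁻¹ : (ZMod r)ˣ) * G b * χ u =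
      if b = u then r.totient * G u else 0 := by
    intro b
    have h1 := DirichletCharacter.sum_char_inv_mul_char_eq ℂ b.isUnit (u : ZMod r)
    rw [ZMod.inv_coe_unit] at h1
    have h2 : ∑ χ : DirichletCharacter ℂ r, χ (b⁻¹ : (ZMod r)ˣ) * G b * χ u =
        G b * ∑ χ : DirichletCharacter ℂ r, χ (b⁻¹ : (ZMod r)ˣ) * χ u := by
      rw [Finset.mul_sum]
      exact Finset.sum_congr rfl fun χ _ ↦ by ring
    rw [h2, h1]
    by_cases hb : b = u
    · rw [hb]
      simp [mul_comm]
    · simp [hb, Units.val_inj]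
  rw [Finset.sum_congr rfl fun b _ ↦ h b]
  simp

theorem sum_norm_charCoeff_sq {r : ℕ} [NeZero r] (G : ZMod r → ℂ) :
    ∑ χ : DirichletCharacter ℂ r, ‖charCoeff G χ‖ ^ 2 =
      r.totient * ∑ u : (ZMod r)ˣ, ‖G u‖ ^ 2 := by
  have h : ∀ χ : DirichletCharacter ℂ r, ((‖charCoeff G χ‖ ^ 2 : ℝ) : ℂ) =
      ∑ u : (ZMod r)ˣ, starRingEnd ℂ (G u) * (charCoeff G χ * χ u) := by
    intro χ
    have e : starRingEnd ℂ (charCoeff G χ) =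
        ∑ u : (ZMod r)ˣ, starRingEnd ℂ (χ (u⁻¹ : (ZMod r)ˣ) * G u) := by rw [charCoeff, map_sum]
    rw [Complex.ofReal_pow, ← Complex.mul_conj', e, Finset.mul_sum]
    refine Finset.sum_congr rfl fun u _ ↦ ?_
    rw [map_mul]
    have h1 : starRingEnd ℂ (χ (u⁻¹ : (ZMod r)ˣ)) = χ u := by
      rw [← RCLike.star_def, MulChar.star_apply', MulChar.inv_apply]
      simp
    rw [h1]
    ring
  have h2 : ((∑ χ : DirichletCharacter ℂ r, ‖charCoeff G χ‖ ^ 2 : ℝ) : ℂ) =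
      ((r.totient * ∑ u : (ZMod r)ˣ, ‖G u‖ ^ 2 : ℝ) : ℂ) := by
    rw [Complex.ofReal_sum, Finset.sum_congr rfl fun χ _ ↦ h χ, Finset.sum_comm]
    push_cast
    rw [Finset.mul_sum]
    refine Finset.sum_congr rfl fun u _ ↦ ?_
    rw [← Finset.mul_sum, sum_charCoeff_mul, ← Complex.mul_conj']
    ring
  exact_mod_cast h2

theorem sum_norm_charCoeff_le {r : ℕ} [NeZero r] {G : ZMod r → ℂ} (hG : ∀ b, ‖G b‖ ≤ 1) :
    ∑ χ : DirichletCharacter ℂ r, ‖charCoeff G χ‖ ≤ r.totient * Real.sqrt r.totient := by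
  have hcard : ((Finset.univ : Finset (DirichletCharacter ℂ r)).card : ℝ) = r.totient := by
    rw [Finset.card_univ, ← Nat.card_eq_fintype_card,
      DirichletCharacter.card_eq_totient_of_hasEnoughRootsOfUnity]
  have h1 : (∑ χ : DirichletCharacter ℂ r, ‖charCoeff G χ‖) ^ 2 ≤
      r.totient * (r.totient * r.totient) := by
    refine (sq_sum_le_card_mul_sum_sq).trans ?_
    rw [hcard, sum_norm_charCoeff_sq]
    gcongr
    calc ∑ u : (ZMod r)ˣ, ‖G u‖ ^ 2 ≤ ∑ u : (ZMod r)ˣ, 1 :=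
          Finset.sum_le_sum fun u _ ↦ pow_le_one₀ (norm_nonneg _) (hG _)
      _ = r.totient := by
          rw [Finset.sum_const, Finset.card_univ, ZMod.card_units_eq_totient]
          simp
  refine (Real.le_sqrt_of_sq_le h1).trans (le_of_eq ?_)
  rw [show (r.totient : ℝ) * (r.totient * r.totient) = (r.totient : ℝ) ^ 2 * r.totient by ring,
    Real.sqrt_mul (by positivity), Real.sqrt_sq (by positivity)]

end SmoothSum

namespace SmoothSum

theorem sum_nthRootsFinset_one {n : ℕ} (hn : 0 < n) :
    ∑ z ∈ Polynomial.nthRootsFinset n (1 : ℂ), z = if n = 1 then 1 else 0 := by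
  have hζ := Complex.isPrimitiveRoot_exp n hn.ne'
  set ζ := Complex.exp (2 * Real.pi * Complex.I / n)
  split_ifs with h1
  · subst h1
    rw [Finset.sum_congr (s₂ := {1}) _ (fun _ _ ↦ rfl), Finset.sum_singleton]
    ext z
    simp [Polynomial.mem_nthRootsFinset]
  · have h : ζ * ∑ z ∈ Polynomial.nthRootsFinset n (1 : ℂ), z =
        ∑ z ∈ Polynomial.nthRootsFinset n (1 : ℂ), z := by
      rw [Finset.mul_sum]
      refine Finset.sum_nbij (fun z ↦ ζ * z) (fun z hz ↦ ?_) (fun z _ w _ hzw ↦ ?_)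
        (fun z hz ↦ ⟨ζ⁻¹ * z, ?_, ?_⟩) fun _ _ ↦ rfl
      · rw [Polynomial.mem_nthRootsFinset hn] at hz ⊢
        rw [mul_pow, hζ.pow_eq_one, hz, one_mul]
      · exact mul_left_cancel₀ (hζ.ne_zero hn.ne') hzw
      · rw [Finset.mem_coe, Polynomial.mem_nthRootsFinset hn] at hz ⊢
        rw [mul_pow, inv_pow, hζ.pow_eq_one, hz, inv_one, one_mul]
      · exact mul_inv_cancel_left₀ (hζ.ne_zero hn.ne') z
    have h2 : (ζ - 1) * ∑ z ∈ Polynomial.nthRootsFinset n (1 : ℂ), z = 0 := by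
      rw [sub_mul, h, one_mul, sub_self]
    exact (mul_eq_zero.1 h2).resolve_left (sub_ne_zero.2 (hζ.ne_one (by omega)))

theorem sum_primitiveRoots {n : ℕ} (hn : 0 < n) :
    ∑ z ∈ primitiveRoots n ℂ, z = (ArithmeticFunction.moebius n : ℂ) := by
  have h := (ArithmeticFunction.sum_eq_iff_sum_mul_moebius_eq
    (f := fun n ↦ ∑ z ∈ primitiveRoots n ℂ, z) (g := fun n ↦ if n = 1 then (1 : ℂ) else 0)).1
      (fun m hm ↦ by
        rw [← sum_nthRootsFinset_one hm, IsPrimitiveRoot.nthRoots_one_eq_biUnion_primitiveRoots,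
          Finset.sum_biUnion]
        exact fun i _ j _ hij ↦ IsPrimitiveRoot.disjoint hij) n hn
  rw [← h, Nat.sum_divisorsAntidiagonal fun i j ↦
    (ArithmeticFunction.moebius i : ℂ) * if j = 1 then 1 else 0, Finset.sum_eq_single n]
  · simp [Nat.div_self hn]
  · intro d hd hdn
    have : n / d ≠ 1 := fun h ↦ hdn (Nat.eq_of_dvd_of_div_eq_one (Nat.dvd_of_mem_divisors hd) h)
    simp [this]
  · intro h
    exact absurd (Nat.mem_divisors_self n hn.ne') h

theorem sum_units_stdAddChar (r : ℕ) [NeZero r] :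
    ∑ b : (ZMod r)ˣ, ZMod.stdAddChar (b : ZMod r) = (ArithmeticFunction.moebius r : ℂ) := by
  have hr : 0 < r := Nat.pos_of_ne_zero (NeZero.ne r)
  have key (k : ℕ) : ZMod.stdAddChar ((k : ℕ) : ZMod r) =
      Complex.exp (2 * Real.pi * Complex.I / r) ^ k := by
    have := ZMod.stdAddChar_coe (N := r) (k : ℤ)
    rw [Int.cast_natCast] at this
    rw [this, ← Complex.exp_nat_mul]
    congr 1
    push_cast
    ring
  have hζ := Complex.isPrimitiveRoot_exp r hr.ne'
  rw [← sum_primitiveRoots hr]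
  refine Finset.sum_bij (fun b _ ↦ ZMod.stdAddChar (b : ZMod r)) (fun b _ ↦ ?_)
    (fun b _ c _ h ↦ Units.ext (ZMod.injective_stdAddChar h)) (fun z hz ↦ ?_) fun _ _ ↦ rfl
  · rw [mem_primitiveRoots hr, ← ZMod.natCast_zmod_val (b : ZMod r), key]
    exact hζ.pow_of_coprime _ (ZMod.val_coe_unit_coprime b)
  · rw [mem_primitiveRoots hr, hζ.isPrimitiveRoot_iff] at hz
    obtain ⟨i, -, hi, rfl⟩ := hz
    exact ⟨ZMod.unitOfCoprime i hi, Finset.mem_univ _, by rw [ZMod.coe_unitOfCoprime, key]⟩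

theorem charCoeff_stdAddChar_one {r : ℕ} [NeZero r] (a : (ZMod r)ˣ) :
    charCoeff (fun b ↦ ZMod.stdAddChar ((a : ZMod r) * b)) 1 = (ArithmeticFunction.moebius r : ℂ) := by
  rw [charCoeff, ← sum_units_stdAddChar]
  refine Fintype.sum_equiv (Equiv.mulLeft a) _ _ fun b ↦ ?_
  rw [MulChar.one_apply_coe, one_mul, Equiv.coe_mulLeft, Units.val_mul]

end SmoothSum

namespace SmoothSum

theorem sum_filter_dvd {F : ℕ → ℂ} {N k : ℕ} (hF : ∀ n, N < n → F n = 0) (hk : 0 < k) :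
    ∑ n ∈ Finset.Icc 1 N with k ∣ n, F n = ∑ m ∈ Finset.Icc 1 N, F (k * m) := by
  have h : ∑ m ∈ Finset.Icc 1 N with k * m ≤ N, F (k * m) = ∑ m ∈ Finset.Icc 1 N, F (k * m) :=
    Finset.sum_filter_of_ne fun m _ hm ↦ not_lt.1 fun h ↦ hm (hF _ h)
  rw [← h]
  refine Finset.sum_nbij' (fun n ↦ n / k) (fun m ↦ k * m) ?_ ?_ ?_ ?_ ?_
  · intro n hn
    rw [Finset.mem_filter, Finset.mem_Icc] at hn ⊢
    obtain ⟨⟨h1, h2⟩, m, rfl⟩ := hn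
    rw [Nat.mul_div_cancel_left _ hk]
    exact ⟨⟨Nat.pos_of_mul_pos_left h1, (Nat.le_mul_of_pos_left m hk).trans h2⟩, h2⟩
  · intro m hm
    rw [Finset.mem_filter, Finset.mem_Icc] at hm ⊢
    exact ⟨⟨Nat.mul_pos hk hm.1.1, hm.2⟩, dvd_mul_right _ _⟩
  · intro n hn
    exact Nat.mul_div_cancel' (Finset.mem_filter.1 hn).2
  · intro m _
    exact Nat.mul_div_cancel_left _ hk
  · intro n hn
    rw [Nat.mul_div_cancel' (Finset.mem_filter.1 hn).2]

theorem smoothInd_mul {y : ℝ} {d : ℕ} (hd : IsSmooth y d) (m : ℕ) :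
    smoothInd y (d * m) = smoothInd y m := by
  rw [smoothInd_apply, smoothInd_apply]
  classical exact if_congr ⟨fun h ↦ h.of_dvd (dvd_mul_left _ _), fun h ↦ hd.mul h⟩ rfl rfl

theorem smoothInd_of_not {y : ℝ} {n : ℕ} (h : ¬IsSmooth y n) : smoothInd y n = 0 := by
  rw [smoothInd_apply, if_neg h]

theorem IsSmooth.coprime {y : ℝ} {m q : ℕ} (hm : IsSmooth y m)
    (hq : ∀ p : ℕ, p.Prime → p ∣ q → y < (p : ℝ)) : m.Coprime q :=
  Nat.coprime_of_dvd fun p hp h1 h2 ↦ ((hm.2 p hp h1).trans_lt (hq p hp h2)).false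

theorem sum_smoothInd_eq_sum_divisors {y : ℝ} {q₀ q₁ N : ℕ} {W : ℕ → ℂ}
    (hW : ∀ n, N < n → W n = 0) (hq₀ : IsSmooth y q₀) (hq₁ : 0 < q₁)
    (hq₁' : ∀ p : ℕ, p.Prime → p ∣ q₁ → y < (p : ℝ)) :
    ∑ n ∈ Finset.Icc 1 N, smoothInd y n * W n =
      ∑ d ∈ q₀.divisors, ∑ m ∈ Finset.Icc 1 N,
        if m.Coprime (q₀ * q₁ / d) then smoothInd y m * W (d * m) else 0 := by
  have hq : 0 < q₀ * q₁ := Nat.mul_pos hq₀.1 hq₁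
  classical
  have h1 : ∑ n ∈ Finset.Icc 1 N, smoothInd y n * W n =
      ∑ n ∈ Finset.Icc 1 N with IsSmooth y n, smoothInd y n * W n := by
    refine (Finset.sum_filter_of_ne fun n _ hn ↦ ?_).symm
    by_contra h
    exact hn (by rw [smoothInd_of_not h, zero_mul])
  rw [h1, ← Finset.sum_fiberwise_of_maps_to (g := fun n ↦ n.gcd (q₀ * q₁)) (t := q₀.divisors)]
  · refine Finset.sum_congr rfl fun d hd ↦ ?_
    have hdq := Nat.dvd_of_mem_divisors hd
    have hds := hq₀.of_dvd hdq
    have hF : ∀ n, N < n →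
        (if n.gcd (q₀ * q₁) = d then smoothInd y n * W n else 0) = 0 := fun n hn ↦ by
      rw [hW n hn, mul_zero, ite_self]
    calc ∑ n ∈ (Finset.Icc 1 N).filter (IsSmooth y) with n.gcd (q₀ * q₁) = d, smoothInd y n * W n
        = ∑ n ∈ Finset.Icc 1 N with d ∣ n,
            if n.gcd (q₀ * q₁) = d then smoothInd y n * W n else 0 := by
          rw [Finset.sum_filter, Finset.sum_filter, Finset.sum_filter]
          refine Finset.sum_congr rfl fun n _ ↦ ?_
          by_cases h : n.gcd (q₀ * q₁) = d
          · have hdn : d ∣ n := h ▸ Nat.gcd_dvd_left _ _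
            by_cases hs : IsSmooth y n
            · simp [h, hs, hdn]
            · simp [hs, smoothInd_of_not hs]
          · simp [h]
      _ = _ := by
        rw [sum_filter_dvd hF hds.1]
        refine Finset.sum_congr rfl fun m _ ↦ ?_
        rw [smoothInd_mul hds]
        refine if_congr ?_ rfl rfl
        obtain ⟨k, hk⟩ := hdq.mul_right q₁
        rw [hk, Nat.mul_div_cancel_left _ hds.1, Nat.gcd_mul_left]
        exact mul_eq_left₀ hds.1.ne'
  · intro n hn
    rw [Finset.mem_filter] at hn
    refine Nat.mem_divisors.2 ⟨?_, hq₀.1.ne'⟩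
    refine Nat.Coprime.dvd_of_dvd_mul_right (IsSmooth.coprime ?_ hq₁') (Nat.gcd_dvd_right n (q₀ * q₁))
    exact hn.2.of_dvd (Nat.gcd_dvd_left _ _)

theorem sum_moebius_divisors_filter_dvd {D : ℕ} (hD : 0 < D) (m : ℕ) :
    ∑ k ∈ D.divisors, (if k ∣ m then (ArithmeticFunction.moebius k : ℂ) else 0) =
      if m.Coprime D then 1 else 0 := by
  have h1 : D.divisors.filter (· ∣ m) = (m.gcd D).divisors := by
    ext k
    rw [Finset.mem_filter, Nat.mem_divisors, Nat.mem_divisors, Nat.dvd_gcd_iff]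
    have h2 : m.gcd D ≠ 0 := (Nat.gcd_pos_of_pos_right m hD).ne'
    have h3 : D ≠ 0 := hD.ne'
    tauto
  rw [← Finset.sum_filter, h1]
  have h2 : (∑ k ∈ (m.gcd D).divisors, ArithmeticFunction.moebius k : ℤ) =
      if m.gcd D = 1 then 1 else 0 := by
    rw [← ArithmeticFunction.coe_mul_zeta_apply, ArithmeticFunction.moebius_mul_coe_zeta,
      ArithmeticFunction.one_apply]
  rw [← Int.cast_sum, h2]
  by_cases h : m.gcd D = 1
  · rw [if_pos h, if_pos h, Int.cast_one]
  · rw [if_neg h, if_neg h, Int.cast_zero]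

theorem sum_smoothInd_coprime {y : ℝ} {D q₁ N : ℕ} {V : ℕ → ℂ}
    (hV : ∀ n, N < n → V n = 0) (hD : IsSmooth y D)
    (hq₁ : ∀ p : ℕ, p.Prime → p ∣ q₁ → y < (p : ℝ)) :
    ∑ m ∈ Finset.Icc 1 N, (if m.Coprime (D * q₁) then smoothInd y m * V m else 0) =
      ∑ k ∈ D.divisors, (ArithmeticFunction.moebius k : ℂ) *
        ∑ m ∈ Finset.Icc 1 N, smoothInd y m * V (k * m) := by
  have h1 : ∀ m ∈ Finset.Icc 1 N,
      (if m.Coprime (D * q₁) then smoothInd y m * V m else 0) =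
        ∑ k ∈ D.divisors, if k ∣ m then
          (ArithmeticFunction.moebius k : ℂ) * (smoothInd y m * V m) else 0 := by
    intro m _
    by_cases hs : IsSmooth y m
    · have h2 : m.Coprime (D * q₁) ↔ m.Coprime D := by
        rw [Nat.coprime_mul_iff_right, and_iff_left (hs.coprime hq₁)]
      have h3 := congrArg (· * (smoothInd y m * V m)) (sum_moebius_divisors_filter_dvd hD.1 m)
      simp only [Finset.sum_mul, ite_mul, one_mul, zero_mul] at h3
      rw [h3, if_congr h2 rfl rfl]
    · simp [smoothInd_of_not hs]
  rw [Finset.sum_congr rfl h1, Finset.sum_comm]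
  refine Finset.sum_congr rfl fun k hk ↦ ?_
  have hks := hD.of_dvd (Nat.dvd_of_mem_divisors hk)
  rw [← Finset.sum_filter, ← Finset.mul_sum,
    sum_filter_dvd (F := fun m ↦ smoothInd y m * V m) (fun n hn ↦ by rw [hV n hn, mul_zero]) hks.1]
  simp only [smoothInd_mul hks]

theorem sum_smoothInd_stdAddChar {y : ℝ} {r N : ℕ} [NeZero r] (G : ZMod r → ℂ) (V : ℕ → ℂ) :
    ∑ m ∈ Finset.Icc 1 N, (if m.Coprime r then smoothInd y m * (G m * V m) else 0) =
      (r.totient : ℂ)⁻¹ * ∑ χ : DirichletCharacter ℂ r, charCoeff G χ *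
        ∑ m ∈ Finset.Icc 1 N, smoothChar χ y m * V m := by
  have hr : (r.totient : ℂ) ≠ 0 := by
    exact_mod_cast (Nat.totient_pos.2 (Nat.pos_of_ne_zero (NeZero.ne r))).ne'
  simp only [Finset.mul_sum]
  rw [Finset.sum_comm]
  refine Finset.sum_congr rfl fun m _ ↦ ?_
  by_cases hs : IsSmooth y m
  · by_cases hm : m.Coprime r
    · have h := sum_charCoeff_mul G (ZMod.unitOfCoprime m hm)
      rw [ZMod.coe_unitOfCoprime] at h
      simp only [smoothChar, if_pos hs]
      have : ∀ χ : DirichletCharacter ℂ r, (r.totient : ℂ)⁻¹ * (charCoeff G χ * (χ m * V m)) =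
          (charCoeff G χ * χ m) * ((r.totient : ℂ)⁻¹ * V m) := fun χ ↦ by ring
      rw [if_pos hm, Finset.sum_congr rfl fun χ _ ↦ this χ, ← Finset.sum_mul, h, smoothInd_apply,
        if_pos hs]
      field_simp
    · rw [if_neg hm, Finset.sum_eq_zero]
      intro χ _
      have : χ (m : ZMod r) = 0 :=
        MulChar.map_nonunit χ fun h ↦ hm ((ZMod.isUnit_iff_coprime m r).1 h)
      rw [smoothChar, if_pos hs, this]
      ring
  · rw [smoothInd_of_not hs, zero_mul, ite_self, Finset.sum_eq_zero]
    intro χ _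
    rw [smoothChar, if_neg hs]
    ring

theorem sum_smoothChar_one {y : ℝ} {r N : ℕ} (V : ℕ → ℂ) :
    ∑ m ∈ Finset.Icc 1 N, smoothChar (1 : DirichletCharacter ℂ r) y m * V m =
      ∑ m ∈ Finset.Icc 1 N, (if m.Coprime r then smoothInd y m * V m else 0) := by
  refine Finset.sum_congr rfl fun m _ ↦ ?_
  rw [smoothInd_apply, smoothChar]
  by_cases hs : IsSmooth y m
  · by_cases hm : m.Coprime r
    · rw [if_pos hs, if_pos hs, if_pos hm, MulChar.one_apply ((ZMod.isUnit_iff_coprime m r).2 hm)]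
    · rw [if_pos hs, if_neg hm,
        MulChar.map_nonunit _ fun h ↦ hm ((ZMod.isUnit_iff_coprime m r).1 h), zero_mul]
  · simp [hs]

theorem norm_sum_smoothInd_stdAddChar_sub_le {y B : ℝ} {r N : ℕ} [NeZero r] (a : (ZMod r)ˣ)
    (V : ℕ → ℂ) (hB : 0 ≤ B) (h : ∀ χ : DirichletCharacter ℂ r, χ ≠ 1 →
      ‖∑ m ∈ Finset.Icc 1 N, smoothChar χ y m * V m‖ ≤ B) :
    ‖∑ m ∈ Finset.Icc 1 N, (if m.Coprime r then
        smoothInd y m * (ZMod.stdAddChar ((a : ZMod r) * (m : ZMod r)) * V m) else 0) -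
      (ArithmeticFunction.moebius r : ℂ) / r.totient *
        ∑ m ∈ Finset.Icc 1 N, (if m.Coprime r then smoothInd y m * V m else 0)‖ ≤
      Real.sqrt r * B := by
  classical
  have hr : 0 < (r.totient : ℝ) := by
    exact_mod_cast Nat.totient_pos.2 (Nat.pos_of_ne_zero (NeZero.ne r))
  set G : ZMod r → ℂ := fun b ↦ ZMod.stdAddChar ((a : ZMod r) * b) with hG
  have hG1 : ∀ b, ‖G b‖ ≤ 1 := fun b ↦ (AddChar.norm_apply _ _).le
  have e := sum_smoothInd_stdAddChar (y := y) (N := N) G V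
  rw [← Finset.add_sum_erase _ _ (Finset.mem_univ 1), charCoeff_stdAddChar_one,
    sum_smoothChar_one] at e
  rw [e, mul_add, ← mul_assoc, inv_mul_eq_div, add_sub_cancel_left, norm_mul, norm_inv,
    Complex.norm_natCast]
  have h2 : ‖∑ χ ∈ Finset.univ.erase (1 : DirichletCharacter ℂ r), charCoeff G χ *
      ∑ m ∈ Finset.Icc 1 N, smoothChar χ y m * V m‖ ≤
        r.totient * Real.sqrt r.totient * B := by
    calc _ ≤ ∑ χ ∈ Finset.univ.erase (1 : DirichletCharacter ℂ r), ‖charCoeff G χ‖ * B := by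
          refine norm_sum_le_of_le _ fun χ hχ ↦ ?_
          rw [norm_mul]
          exact mul_le_mul_of_nonneg_left (h χ (Finset.ne_of_mem_erase hχ)) (norm_nonneg _)
      _ ≤ ∑ χ : DirichletCharacter ℂ r, ‖charCoeff G χ‖ * B :=
          Finset.sum_le_sum_of_subset_of_nonneg (Finset.erase_subset _ _) fun _ _ _ ↦ by positivity
      _ ≤ _ := by
        rw [← Finset.sum_mul]
        exact mul_le_mul_of_nonneg_right (sum_norm_charCoeff_le hG1) hB
  calc _ ≤ (r.totient : ℝ)⁻¹ * (r.totient * Real.sqrt r.totient * B) := by gcongr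
    _ = Real.sqrt r.totient * B := by field_simp
    _ ≤ _ := by
      gcongr
      exact_mod_cast Nat.totient_le r

end SmoothSum

namespace SmoothSum

theorem exp_eq_stdAddChar {r d : ℕ} [NeZero r] (hd : 0 < d) (a : ℤ) (m : ℕ) :
    Complex.exp (2 * Real.pi * Complex.I * (a * (d * m : ℕ) / (d * r : ℕ))) =
      ZMod.stdAddChar ((a : ZMod r) * (m : ZMod r)) := by
  have hd' : (d : ℂ) ≠ 0 := by exact_mod_cast hd.ne'
  have hr : (r : ℂ) ≠ 0 := by exact_mod_cast NeZero.ne r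
  have := ZMod.stdAddChar_coe (N := r) (a * (m : ℤ))
  rw [Int.cast_mul, Int.cast_natCast] at this
  rw [this]
  congr 1
  push_cast
  field_simp

theorem norm_sum_smoothInd_exp_sub_le {y B : ℝ} {q₀ q₁ N : ℕ} {V : ℕ → ℂ} {a : ℤ}
    (hV : ∀ n, N < n → V n = 0) (hq₀ : IsSmooth y q₀) (hq₁ : 0 < q₁)
    (hq₁' : ∀ p : ℕ, p.Prime → p ∣ q₁ → y < (p : ℝ)) (ha : a.gcd (q₀ * q₁ : ℕ) = 1)
    (hB : 0 ≤ B) (h : ∀ D ∈ q₀.divisors, ∀ χ : DirichletCharacter ℂ (D * q₁), χ ≠ 1 →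
      ‖∑ m ∈ Finset.Icc 1 N, smoothChar χ y m * V (q₀ / D * m)‖ ≤ B) :
    ‖∑ n ∈ Finset.Icc 1 N, smoothInd y n *
        (Complex.exp (2 * Real.pi * Complex.I * (a * n / (q₀ * q₁ : ℕ))) * V n) -
      (ArithmeticFunction.moebius q₁ : ℂ) / q₁.totient * ∑ D ∈ q₀.divisors,
        (ArithmeticFunction.moebius D : ℂ) / D.totient * ∑ k ∈ D.divisors,
          (ArithmeticFunction.moebius k : ℂ) *
            ∑ m ∈ Finset.Icc 1 N, smoothInd y m * V (q₀ / D * (k * m))‖ ≤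
      q₀.divisors.card * (Real.sqrt (q₀ * q₁ : ℕ) * B) := by
  rw [sum_smoothInd_eq_sum_divisors (fun n hn ↦ by rw [hV n hn, mul_zero]) hq₀ hq₁ hq₁',
    ← Nat.sum_div_divisors q₀, Finset.mul_sum, ← Finset.sum_sub_distrib, ← nsmul_eq_mul]
  refine (norm_sum_le _ _).trans (Finset.sum_le_card_nsmul _ _ _ fun D hD ↦ ?_)
  have hDq := Nat.dvd_of_mem_divisors hD
  have hDs := hq₀.of_dvd hDq
  have hds := hq₀.of_dvd (Nat.div_dvd_of_dvd hDq)
  have hr : 0 < D * q₁ := Nat.mul_pos hDs.1 hq₁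
  have : NeZero (D * q₁) := ⟨hr.ne'⟩
  have hqr : q₀ * q₁ = q₀ / D * (D * q₁) := by rw [← mul_assoc, Nat.div_mul_cancel hDq]
  have e1 : q₀ * q₁ / (q₀ / D) = D * q₁ := by rw [hqr, Nat.mul_div_cancel_left _ hds.1]
  have hV' : ∀ n, N < n → V (q₀ / D * n) = 0 := fun n hn ↦
    hV _ (hn.trans_le (Nat.le_mul_of_pos_left n hds.1))
  have hu : IsUnit (a : ZMod (D * q₁)) := by
    rw [ZMod.coe_int_isUnit_iff_isCoprime, Int.isCoprime_iff_gcd_eq_one, Int.gcd_comm]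
    refine Nat.eq_one_of_dvd_one ?_
    rw [← ha]
    refine Int.gcd_dvd_gcd_of_dvd_right _ ?_
    exact_mod_cast Dvd.intro_left (q₀ / D) hqr.symm
  obtain ⟨u, hu⟩ := hu
  have hcop : D.Coprime q₁ := hDs.coprime hq₁'
  have key := norm_sum_smoothInd_stdAddChar_sub_le (y := y) (N := N) u (fun m ↦ V (q₀ / D * m)) hB
    (h D hD)
  rw [sum_smoothInd_coprime hV' hDs hq₁', hu,
    ArithmeticFunction.isMultiplicative_moebius.map_mul_of_coprime hcop,
    Nat.totient_mul hcop] at key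
  rw [e1]
  have hle : Real.sqrt (D * q₁ : ℕ) * B ≤ Real.sqrt (q₀ * q₁ : ℕ) * B := by
    gcongr
    exact Nat.le_of_dvd hq₀.1 hDq
  refine le_trans (le_of_eq ?_) (key.trans hle)
  congr 2
  · refine Finset.sum_congr rfl fun m _ ↦ if_congr Iff.rfl ?_ rfl
    have := exp_eq_stdAddChar (r := D * q₁) hds.1 a m
    rw [← hqr] at this
    rw [this]
  · push_cast
    ring

theorem sum_moebius_mul_prod_primeFactors {n : ℕ} (hn : n ≠ 0) (g : ℕ → ℝ) :
    ∑ D ∈ n.divisors, (ArithmeticFunction.moebius D : ℝ) * ∏ p ∈ D.primeFactors, g p =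
      ∏ p ∈ n.primeFactors, (1 - g p) := by
  simp only [sub_eq_add_neg]
  rw [Finset.prod_one_add]
  have hs : ∑ D ∈ n.divisors with Squarefree D,
      (ArithmeticFunction.moebius D : ℝ) * ∏ p ∈ D.primeFactors, g p =
        ∑ D ∈ n.divisors, (ArithmeticFunction.moebius D : ℝ) * ∏ p ∈ D.primeFactors, g p := by
    refine Finset.sum_filter_of_ne fun D _ hD ↦ ?_
    by_contra h
    rw [ArithmeticFunction.moebius_eq_zero_of_not_squarefree h, Int.cast_zero, zero_mul] at hD
    exact hD rfl
  have hprime : ∀ T ∈ n.primeFactors.powerset, ∀ p ∈ T, p.Prime := fun T hT p hp ↦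
    Nat.prime_of_mem_primeFactors (Finset.mem_powerset.1 hT hp)
  rw [← hs]
  refine Finset.sum_nbij' (fun D ↦ D.primeFactors) (fun T ↦ ∏ p ∈ T, p) ?_ ?_ ?_ ?_ ?_
  · intro D hD
    rw [Finset.mem_filter, Nat.mem_divisors] at hD
    exact Finset.mem_powerset.2 (Nat.primeFactors_mono hD.1.1 hn)
  · intro T hT
    have h1 := Nat.primeFactors_prod (hprime T hT)
    refine Finset.mem_filter.2 ⟨Nat.mem_divisors.2 ⟨?_, hn⟩, ?_⟩
    · exact (Finset.prod_dvd_prod_of_subset _ _ _ (Finset.mem_powerset.1 hT)).trans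
        (Nat.prod_primeFactors_dvd n)
    · refine (Finset.squarefree_prod_of_pairwise_isCoprime ?_ fun p hp ↦
        (Nat.prime_iff.1 (hprime T hT p hp)).squarefree)
      intro p hp q hq hpq
      exact Nat.coprime_iff_isRelPrime.1 
        ((Nat.coprime_primes (hprime T hT p hp) (hprime T hT q hq)).2 hpq)
  · intro D hD
    exact Nat.prod_primeFactors_of_squarefree (Finset.mem_filter.1 hD).2
  · intro T hT
    exact Nat.primeFactors_prod (hprime T hT)
  · intro D hD
    have hD2 := (Finset.mem_filter.1 hD).2
    rw [Finset.prod_neg, ArithmeticFunction.moebius_apply_of_squarefree hD2,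
      ← (ArithmeticFunction.cardDistinctFactors_eq_cardFactors_iff_squarefree hD2.ne_zero).2 hD2]
    push_cast
    rfl

theorem rpow_eq_prod_primeFactors {n : ℕ} (hn : Squarefree n) (s : ℝ) :
    (n : ℝ) ^ s = ∏ p ∈ n.primeFactors, (p : ℝ) ^ s := by
  conv_lhs => rw [← Nat.prod_primeFactors_of_squarefree hn]
  rw [Nat.cast_prod, Real.finsetProd_rpow _ _ fun _ _ ↦ Nat.cast_nonneg _]

theorem totient_eq_prod_primeFactors {n : ℕ} (hn : Squarefree n) :
    (n.totient : ℝ) = ∏ p ∈ n.primeFactors, ((p : ℝ) - 1) := by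
  rw [Nat.totient_eq_div_primeFactors_mul, Nat.prod_primeFactors_of_squarefree hn,
    Nat.div_self (Nat.pos_of_ne_zero hn.ne_zero), one_mul, Nat.cast_prod]
  exact Finset.prod_congr rfl fun p hp ↦ by
    rw [Nat.cast_sub (Nat.pos_of_mem_primeFactors hp), Nat.cast_one]

theorem sum_moebius_div_totient_mul_rpow {q : ℕ} (hq : q ≠ 0) (c : ℝ) :
    ∑ D ∈ q.divisors, (ArithmeticFunction.moebius D : ℝ) / D.totient *
        ∑ k ∈ D.divisors, (ArithmeticFunction.moebius k : ℝ) * ((q / D * k : ℕ) : ℝ) ^ (-c) =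
      (q : ℝ) ^ (-c) * ∏ p ∈ q.primeFactors, (1 - ((p : ℝ) ^ c - 1) / ((p : ℝ) - 1)) := by
  rw [← sum_moebius_mul_prod_primeFactors hq, Finset.mul_sum]
  refine Finset.sum_congr rfl fun D hD ↦ ?_
  by_cases hs : Squarefree D
  swap
  · rw [ArithmeticFunction.moebius_eq_zero_of_not_squarefree hs]
    simp
  have hDq := Nat.dvd_of_mem_divisors hD
  have hD0 : 0 < (D : ℝ) := by exact_mod_cast Nat.pos_of_ne_zero hs.ne_zero
  have h1 : ∑ k ∈ D.divisors, (ArithmeticFunction.moebius k : ℝ) * ((q / D * k : ℕ) : ℝ) ^ (-c) =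
      (q : ℝ) ^ (-c) * (D : ℝ) ^ c * ∏ p ∈ D.primeFactors, (1 - (p : ℝ) ^ (-c)) := by
    rw [← sum_moebius_mul_prod_primeFactors hs.ne_zero, Finset.mul_sum]
    refine Finset.sum_congr rfl fun k hk ↦ ?_
    have hks : Squarefree k := hs.squarefree_of_dvd (Nat.dvd_of_mem_divisors hk)
    rw [← rpow_eq_prod_primeFactors hks, Nat.cast_mul, Nat.cast_div hDq hD0.ne',
      Real.mul_rpow (by positivity) (by positivity), Real.div_rpow (by positivity) hD0.le,
      Real.rpow_neg hD0.le, div_inv_eq_mul]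
    ring
  have h2 : ∏ p ∈ D.primeFactors, ((p : ℝ) ^ c - 1) / ((p : ℝ) - 1) =
      (D : ℝ) ^ c * (∏ p ∈ D.primeFactors, (1 - (p : ℝ) ^ (-c))) / D.totient := by
    rw [Finset.prod_div_distrib, totient_eq_prod_primeFactors hs, rpow_eq_prod_primeFactors hs,
      ← Finset.prod_mul_distrib]
    congr 1
    refine Finset.prod_congr rfl fun p hp ↦ ?_
    have hp0 : 0 < (p : ℝ) := by exact_mod_cast Nat.pos_of_mem_primeFactors hp
    rw [mul_sub, mul_one, ← Real.rpow_add hp0, add_neg_cancel, Real.rpow_zero]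
  rw [h1, h2]
  ring

end SmoothSum

namespace SmoothSum

theorem norm_moebius_le_one (n : ℕ) : ‖(ArithmeticFunction.moebius n : ℂ)‖ ≤ 1 := by
  rw [Complex.norm_intCast]
  exact_mod_cast ArithmeticFunction.abs_moebius_le_one

theorem inv_totient_le {n : ℕ} (hn : 0 < n) :
    (n.totient : ℝ)⁻¹ ≤ n.divisors.card / n := by
  have h0 : 0 < (n.totient : ℝ) := by exact_mod_cast Nat.totient_pos.2 hn
  have h1 : 0 < (n : ℝ) := by exact_mod_cast hn
  rw [inv_le_iff_one_le_mul₀ h0, div_mul_eq_mul_div, one_le_div h1, mul_comm]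
  exact_mod_cast le_totient_mul_card_divisors n

theorem card_divisors_le_of_dvd {d n : ℕ} (hn : 0 < n) (h : d ∣ n) :
    (d.divisors.card : ℝ) ≤ n.divisors.card := by
  exact_mod_cast Finset.card_le_card (Nat.divisors_subset_of_dvd hn.ne' h)

theorem norm_sum_moebius_mul_le {q : ℕ} (hq : 0 < q) {c A B : ℝ} (hc : 0 ≤ c) (hc1 : c ≤ 1)
    (hA : 0 ≤ A) (hB : 0 ≤ B) {E : ℕ → ℂ}
    (hE : ∀ m : ℕ, 1 ≤ m → m ≤ q → ‖E m‖ ≤ A + B * ((m : ℝ) ^ (-c) * (1 + Real.log m))) :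
    ‖∑ D ∈ q.divisors, (ArithmeticFunction.moebius D : ℂ) / D.totient *
      ∑ k ∈ D.divisors, (ArithmeticFunction.moebius k : ℂ) * E (q / D * k)‖ ≤
      (q.divisors.card : ℝ) ^ 2 * A +
        (q.divisors.card : ℝ) ^ 3 * (1 + Real.log q) * (q : ℝ) ^ (-c) * B := by
  set τ : ℝ := (q.divisors.card : ℝ) with hτ
  have hq1 : (1 : ℝ) ≤ q := by exact_mod_cast hq
  have hlog : 0 ≤ Real.log q := Real.log_nonneg hq1
  have hτ0 : 0 ≤ τ := Nat.cast_nonneg _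
  have main : ∀ D ∈ q.divisors, ‖(ArithmeticFunction.moebius D : ℂ) / D.totient *
      ∑ k ∈ D.divisors, (ArithmeticFunction.moebius k : ℂ) * E (q / D * k)‖ ≤
      τ * A + τ ^ 2 * (1 + Real.log q) * (q : ℝ) ^ (-c) * B := by
    intro D hD
    have hDq := Nat.dvd_of_mem_divisors hD
    have hD0 : 0 < D := Nat.pos_of_dvd_of_pos hDq hq
    have hD1 : (1 : ℝ) ≤ D := by exact_mod_cast hD0
    have hqD : 0 < q / D := Nat.div_pos (Nat.le_of_dvd hq hDq) hD0
    have hcard : (D.divisors.card : ℝ) ≤ τ := card_divisors_le_of_dvd hq hDq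
    have hterm : ∀ k ∈ D.divisors, ‖(ArithmeticFunction.moebius k : ℂ) * E (q / D * k)‖ ≤
        A + (1 + Real.log q) * (q : ℝ) ^ (-c) * D * B := by
      intro k hk
      have hkD := Nat.dvd_of_mem_divisors hk
      have hk0 : 0 < k := Nat.pos_of_dvd_of_pos hkD hD0
      have hm0 : 0 < q / D * k := Nat.mul_pos hqD hk0
      have hmq : q / D * k ≤ q :=
        (Nat.mul_le_mul_left _ (Nat.le_of_dvd hD0 hkD)).trans (Nat.div_mul_le_self q D)
      have hm1 : (1 : ℝ) ≤ (q / D * k : ℕ) := by exact_mod_cast hm0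
      have hqm : (q : ℝ) ≤ (q / D * k : ℕ) * D := by
        have : q ≤ q / D * k * D := by
          calc q = q / D * D := (Nat.div_mul_cancel hDq).symm
            _ ≤ _ := Nat.mul_le_mul_right _ (Nat.le_mul_of_pos_right _ hk0)
        exact_mod_cast this
      rw [norm_mul]
      refine (mul_le_of_le_one_left (norm_nonneg _) (norm_moebius_le_one k)).trans
        ((hE _ hm0 hmq).trans ?_)
      generalize q / D * k = m at *
      have hm1' : 0 < (m : ℝ) := by linarith
      have h1 : (m : ℝ) ^ (-c) ≤ (q : ℝ) ^ (-c) * D := by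
        have h2 : (q : ℝ) ^ c ≤ (m : ℝ) ^ c * D :=
          calc (q : ℝ) ^ c ≤ (m * D : ℝ) ^ c := Real.rpow_le_rpow (by linarith) hqm hc
            _ = (m : ℝ) ^ c * (D : ℝ) ^ c := Real.mul_rpow hm1'.le (by linarith)
            _ ≤ (m : ℝ) ^ c * (D : ℝ) ^ (1 : ℝ) := by gcongr
            _ = _ := by rw [Real.rpow_one]
        have h3 : 0 < (q : ℝ) ^ c := Real.rpow_pos_of_pos (by linarith) _
        have h4 : 0 < (m : ℝ) ^ c := Real.rpow_pos_of_pos hm1' _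
        rw [Real.rpow_neg hm1'.le, Real.rpow_neg (by linarith), inv_mul_eq_div,
          le_div_iff₀ h3, inv_mul_le_iff₀ h4]
        exact h2
      have h5 : 1 + Real.log m ≤ 1 + Real.log q := by gcongr
      have h6 : 0 ≤ Real.log m := Real.log_nonneg hm1
      calc A + B * ((m : ℝ) ^ (-c) * (1 + Real.log m))
          ≤ A + B * ((q : ℝ) ^ (-c) * D * (1 + Real.log q)) := by gcongr
        _ = _ := by ring
    have hsum : ‖∑ k ∈ D.divisors, (ArithmeticFunction.moebius k : ℂ) * E (q / D * k)‖ ≤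
        τ * (A + (1 + Real.log q) * (q : ℝ) ^ (-c) * D * B) := by
      refine (norm_sum_le _ _).trans ((Finset.sum_le_card_nsmul _ _ _ hterm).trans ?_)
      rw [nsmul_eq_mul]
      gcongr
    have hφ0 : 0 < (D.totient : ℝ) := by exact_mod_cast Nat.totient_pos.2 hD0
    have hφ1 : (D.totient : ℝ)⁻¹ ≤ 1 := inv_le_one_of_one_le₀ (by
      exact_mod_cast Nat.totient_pos.2 hD0)
    have hφ2 : (D.totient : ℝ)⁻¹ * D ≤ τ := by
      have := inv_totient_le hD0
      calc (D.totient : ℝ)⁻¹ * D ≤ D.divisors.card / D * D := by gcongr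
        _ = D.divisors.card := div_mul_cancel₀ _ (by linarith)
        _ ≤ τ := hcard
    rw [norm_mul, norm_div, Complex.norm_natCast, div_eq_mul_inv]
    calc _ ≤ 1 * (D.totient : ℝ)⁻¹ * (τ * (A + (1 + Real.log q) * (q : ℝ) ^ (-c) * D * B)) := by
          gcongr
          exact norm_moebius_le_one D
      _ = τ * ((D.totient : ℝ)⁻¹ * A) +
          τ * ((1 + Real.log q) * (q : ℝ) ^ (-c) * B) * ((D.totient : ℝ)⁻¹ * D) := by ring
      _ ≤ τ * (1 * A) + τ * ((1 + Real.log q) * (q : ℝ) ^ (-c) * B) * τ := by gcongr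
      _ = _ := by ring
  refine (norm_sum_le _ _).trans ((Finset.sum_le_card_nsmul _ _ _ main).trans (le_of_eq ?_))
  rw [nsmul_eq_mul]
  ring

theorem rpow_mul_rpow_mul_rpow_le {x q lam σ η : ℝ} (hq : 1 ≤ q) (hqx : q ≤ Real.sqrt x)
    (hlam : |lam| ≤ Real.sqrt x / q) (hσ : σ ≤ 1 / 2 + η) (hη : 0 < η) (hη1 : η ≤ 1 / 4) :
    x ^ σ * q ^ (1 / 2 + 2 * η) * (1 + |lam|) ^ (1 / 2 + η) ≤ 2 * x ^ (3 / 4 + 2 * η) := by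
  have hs1 : 1 ≤ Real.sqrt x := hq.trans hqx
  have hx1 : 1 ≤ x := Real.one_le_sqrt.1 hs1
  have hx0 : 0 < x := by linarith
  have hq0 : 0 < q := by linarith
  have h1 : 1 + |lam| ≤ 2 * (Real.sqrt x / q) := by
    have : 1 ≤ Real.sqrt x / q := (one_le_div hq0).2 hqx
    linarith
  have hs : Real.sqrt x = x ^ (1 / 2 : ℝ) := Real.sqrt_eq_rpow x
  have h2 : (1 + |lam|) ^ (1 / 2 + η) ≤ 2 * (x ^ (1 / 4 + η / 2) * q ^ (-(1 / 2 + η))) := by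
    calc (1 + |lam|) ^ (1 / 2 + η) ≤ (2 * (Real.sqrt x / q)) ^ (1 / 2 + η) :=
          Real.rpow_le_rpow (by positivity) h1 (by positivity)
      _ = 2 ^ (1 / 2 + η) * (x ^ (1 / 4 + η / 2) * q ^ (-(1 / 2 + η))) := by
        rw [Real.mul_rpow (by norm_num) (by positivity), Real.div_rpow (by positivity) hq0.le, hs,
          ← Real.rpow_mul hx0.le, Real.rpow_neg hq0.le, div_eq_mul_inv]
        ring_nf
      _ ≤ _ := by
        gcongr
        calc (2 : ℝ) ^ (1 / 2 + η) ≤ 2 ^ (1 : ℝ) :=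
              Real.rpow_le_rpow_of_exponent_le (by norm_num) (by linarith)
          _ = 2 := Real.rpow_one 2
  have h3 : q ^ η ≤ x ^ (η / 2) := by
    calc q ^ η ≤ (x ^ (1 / 2 : ℝ)) ^ η := Real.rpow_le_rpow hq0.le (hs ▸ hqx) hη.le
      _ = x ^ (η / 2) := by
        rw [← Real.rpow_mul hx0.le]
        ring_nf
  calc x ^ σ * q ^ (1 / 2 + 2 * η) * (1 + |lam|) ^ (1 / 2 + η)
      ≤ x ^ (1 / 2 + η) * q ^ (1 / 2 + 2 * η) *
          (2 * (x ^ (1 / 4 + η / 2) * q ^ (-(1 / 2 + η)))) := by gcongr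
    _ = 2 * (x ^ (1 / 2 + η) * x ^ (1 / 4 + η / 2)) * (q ^ (1 / 2 + 2 * η) * q ^ (-(1 / 2 + η))) := by
      ring
    _ = 2 * x ^ (1 / 2 + η + (1 / 4 + η / 2)) * q ^ η := by
      rw [← Real.rpow_add hx0, ← Real.rpow_add hq0]
      ring_nf
    _ ≤ 2 * x ^ (1 / 2 + η + (1 / 4 + η / 2)) * x ^ (η / 2) := by gcongr
    _ = _ := by
      rw [mul_assoc, ← Real.rpow_add hx0]
      ring_nf

end SmoothSum

namespace SmoothSum

theorem TestFun.exists_norm_exp_sum_sub_le (hGRH : GRH) {φ : ℝ → ℂ} (hφ : TestFun φ)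
    {σ₁ η : ℝ} (hσ₁ : 1 / 2 < σ₁) (hσ₁1 : σ₁ < 1) (hη : 0 < η) (hη1 : η ≤ 1 / 4) :
    ∃ C ≥ 0, ∃ K, ∀ (x y α c lam : ℝ) (q₀ q₁ N : ℕ) (a : ℤ), SaddleBounds σ₁ x y α →
      K ≤ Real.log y → c = 1 - 1 / (Real.log y / Real.log (Real.log x)) → 0 ≤ c →
      IsSmooth y q₀ → 0 < q₁ → (∀ p : ℕ, p.Prime → p ∣ q₁ → y < (p : ℝ)) →
      a.gcd (q₀ * q₁ : ℕ) = 1 → ((q₀ * q₁ : ℕ) : ℝ) ≤ Real.sqrt x →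
      |lam| ≤ Real.sqrt x / (q₀ * q₁ : ℕ) → (∀ n : ℕ, N < n → φ (n / x) = 0) →
      ‖∑ n ∈ Finset.Icc 1 N, smoothInd y n *
          (Complex.exp (2 * Real.pi * Complex.I * (a * n / (q₀ * q₁ : ℕ))) *
            SmoothSum.twist φ lam (n / x)) -
        (ArithmeticFunction.moebius q₁ : ℂ) / q₁.totient * (c * ((q₀ : ℝ) ^ (-c) *
          ∏ p ∈ q₀.primeFactors, (1 - ((p : ℝ) ^ c - 1) / ((p : ℝ) - 1)) : ℝ) *
            osc φ lam c * Psi x y)‖ ≤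
      C * (x ^ (3 / 4 + 2 * η) + Psi x y * ((q₀ : ℝ) ^ (-c + 4 * η) * (q₁ : ℝ) ^ (-1 + η)) /
        (1 + |lam|) ^ 2 * (Real.log (Real.log y) / Real.log y)) := by
  set σ := min σ₁ (1 / 2 + η) with hσdef
  have hσ : 1 / 2 < σ := lt_min hσ₁ (by linarith)
  have hσ1 : σ < 1 := (min_le_left _ _).trans_lt hσ₁1
  obtain ⟨C₁, hC₁, char⟩ := hφ.exists_norm_sum_smoothChar_le hGRH hσ hσ1 hη (by linarith)
  obtain ⟨C₂, hC₂, K, princ⟩ := hφ.exists_norm_sum_smoothInd_sub_le hGRH hσ₁ hσ₁1 hσ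
    (min_le_left _ _) hη (by linarith)
  obtain ⟨C₃, hC₃, hdiv⟩ := exists_card_divisors_le hη
  refine ⟨2 * C₁ * C₃ + 2 * C₃ ^ 2 * C₂ + C₃ ^ 4 * (1 + 1 / η) * C₂, by positivity, K, ?_⟩
  intro x y α c lam q₀ q₁ N a hS hK hcdef hc hq₀ hq₁ hq₁' ha hqx hlam hN
  have hc1 : c ≤ 1 := hcdef ▸ (hS.c_le.trans hS.α_lt.le)
  have hx1 := hS.one_le_x
  have hx0 : 0 < x := by linarith
  have hqpos : 0 < q₀ * q₁ := Nat.mul_pos hq₀.1 hq₁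
  have hq1 : (1 : ℝ) ≤ (q₀ * q₁ : ℕ) := by exact_mod_cast hqpos
  have hq01 : (1 : ℝ) ≤ q₀ := by exact_mod_cast hq₀.1
  have hq11 : (1 : ℝ) ≤ q₁ := by exact_mod_cast hq₁
  have hq0q : (q₀ : ℝ) ≤ (q₀ * q₁ : ℕ) := by exact_mod_cast Nat.le_mul_of_pos_right q₀ hq₁
  have hsx : Real.sqrt x ≤ x := 
    Real.sqrt_le_iff.2 ⟨hx0.le, le_self_pow₀ hx1 two_ne_zero⟩
  have hpow := rpow_mul_rpow_mul_rpow_le hq1 hqx hlam (min_le_right σ₁ (1 / 2 + η)) hη hη1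
  rw [← hσdef] at hpow
  set q : ℕ := q₀ * q₁ with hq
  set Λ : ℝ := (1 + |lam|) ^ (1 / 2 + η) with hΛ
  have hΛ0 : 0 ≤ Λ := by positivity
  set L : ℝ := Real.log (Real.log y) / Real.log y with hL
  have hL0 : 0 ≤ L := by
    have := hS.le_log
    exact div_nonneg (Real.log_nonneg (by linarith)) (by linarith)
  have hq0 : 0 ≤ (q : ℝ) := by linarith
  have hdm (d m : ℕ) : ((d * m : ℕ) : ℝ) / x = m / (x / d) := by
    rw [div_div_eq_mul_div, Nat.cast_mul, mul_comm]
  have hN' (d : ℕ) (hd : 1 ≤ d) : ∀ n : ℕ, N < n → φ (n / (x / d)) = 0 := fun n hn ↦ by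
    rw [← hdm]
    exact hN _ (hn.trans_le (Nat.le_mul_of_pos_left n hd))
  set V : ℕ → ℂ := fun n ↦ SmoothSum.twist φ lam (n / x) with hVdef
  have hV : ∀ n, N < n → V n = 0 := fun n hn ↦ by
    simp only [hVdef, SmoothSum.twist, hN n hn, zero_mul]
  have hchar : ∀ D ∈ q₀.divisors, ∀ χ : DirichletCharacter ℂ (D * q₁), χ ≠ 1 →
      ‖∑ m ∈ Finset.Icc 1 N, smoothChar χ y m * V (q₀ / D * m)‖ ≤
        C₁ * (x ^ σ * (q : ℝ) ^ η * Λ) := by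
    intro D hD χ hχ
    have hDq := Nat.dvd_of_mem_divisors hD
    have hD0 : 0 < D := Nat.pos_of_dvd_of_pos hDq hq₀.1
    have hd0 : 1 ≤ q₀ / D := Nat.div_pos (Nat.le_of_dvd hq₀.1 hDq) hD0
    have hd1 : (1 : ℝ) ≤ (q₀ / D : ℕ) := by exact_mod_cast hd0
    have : NeZero (D * q₁) := ⟨(Nat.mul_pos hD0 hq₁).ne'⟩
    have hDq1 : ((D * q₁ : ℕ) : ℝ) ≤ q := by
      exact_mod_cast Nat.mul_le_mul_right q₁ (Nat.le_of_dvd hq₀.1 hDq)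
    have h := char (D * q₁) χ hχ y (x / (q₀ / D : ℕ)) lam hS.one_le_y (by positivity) N (hN' _ hd0)
    simp only [hVdef, hdm]
    refine h.trans ?_
    have h1 : x / (q₀ / D : ℕ) ≤ x := div_le_self hx0.le hd1
    gcongr
  have step1 := norm_sum_smoothInd_exp_sub_le hV hq₀ hq₁ hq₁' ha (by positivity) hchar
  set E : ℕ → ℂ := fun m ↦ ∑ n ∈ Finset.Icc 1 N, smoothInd y n * V (m * n) -
    c * (((m : ℝ) ^ (-c) : ℝ) * osc φ lam c) * Psi x y with hE
  have hEle : ∀ m : ℕ, 1 ≤ m → m ≤ q₀ → ‖E m‖ ≤ C₂ * (x ^ σ * Λ) +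
      C₂ * (Psi x y / (1 + |lam|) ^ 2 * L) * ((m : ℝ) ^ (-c) * (1 + Real.log m)) := by
    intro m hm1 hmq
    have hmx : (m : ℝ) ≤ x := by
      have : (m : ℝ) ≤ q₀ := by exact_mod_cast hmq
      linarith
    have h := princ x y α c m lam hS hK hcdef hc (by exact_mod_cast hm1) hmx N (hN' m hm1)
    have e1 : ((m : ℝ) : ℂ) ^ (-(c : ℂ)) = (((m : ℝ) ^ (-c) : ℝ) : ℂ) := by
      rw [Complex.ofReal_cpow (Nat.cast_nonneg m), Complex.ofReal_neg]
    rw [e1] at h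
    simp only [hE, hVdef, hdm]
    refine h.trans (le_of_eq ?_)
    ring
  have step2 := norm_sum_moebius_mul_le hq₀.1 hc hc1 (by positivity) (by positivity) hEle
  set P : ℝ := ∏ p ∈ q₀.primeFactors, (1 - ((p : ℝ) ^ c - 1) / ((p : ℝ) - 1)) with hP
  set M : ℂ := ∑ D ∈ q₀.divisors, (ArithmeticFunction.moebius D : ℂ) / D.totient *
      ∑ k ∈ D.divisors, (ArithmeticFunction.moebius k : ℂ) * E (q₀ / D * k) with hM
  have hident : ∑ D ∈ q₀.divisors,
        (ArithmeticFunction.moebius D : ℂ) / D.totient * ∑ k ∈ D.divisors,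
          (ArithmeticFunction.moebius k : ℂ) *
            ∑ m ∈ Finset.Icc 1 N, smoothInd y m * V (q₀ / D * (k * m)) =
      M + c * (((q₀ : ℝ) ^ (-c) * P : ℝ) : ℂ) * osc φ lam c * Psi x y := by
    rw [hP, ← sum_moebius_div_totient_mul_rpow hq₀.1.ne' c, hM, Complex.ofReal_sum, Finset.mul_sum,
      Finset.sum_mul, Finset.sum_mul, ← Finset.sum_add_distrib]
    refine Finset.sum_congr rfl fun D _ ↦ ?_
    rw [Complex.ofReal_mul, Complex.ofReal_sum, Finset.mul_sum, Finset.mul_sum, Finset.mul_sum,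
      Finset.mul_sum, Finset.sum_mul, Finset.sum_mul, ← Finset.sum_add_distrib]
    refine Finset.sum_congr rfl fun k _ ↦ ?_
    simp only [hE, mul_assoc (q₀ / D) k]
    push_cast
    ring
  rw [hident] at step1
  have hμ : ‖(ArithmeticFunction.moebius q₁ : ℂ) / q₁.totient‖ ≤ (q₁.totient : ℝ)⁻¹ := by
    rw [norm_div, Complex.norm_natCast, div_eq_mul_inv]
    exact mul_le_of_le_one_left (by positivity) (norm_moebius_le_one q₁)
  have hφ1 : (q₁.totient : ℝ)⁻¹ ≤ 1 := inv_le_one_of_one_le₀ (by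
    exact_mod_cast Nat.totient_pos.2 hq₁)
  have hφ2 : (q₁.totient : ℝ)⁻¹ ≤ C₃ * (q₁ : ℝ) ^ (-1 + η) := by
    have hq1pos : 0 < (q₁ : ℝ) := by linarith
    refine (inv_totient_le hq₁).trans ?_
    rw [div_le_iff₀ hq1pos, mul_assoc, Real.rpow_add hq1pos, Real.rpow_neg_one,
      mul_comm (q₁ : ℝ)⁻¹, mul_assoc, inv_mul_cancel₀ hq1pos.ne', mul_one]
    exact hdiv q₁ hq₁.ne'
  set τ : ℝ := (q₀.divisors.card : ℝ) with hτ
  have hτ0 : 0 ≤ τ := Nat.cast_nonneg _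
  have hτ1 : τ ≤ C₃ * (q₀ : ℝ) ^ η := hdiv q₀ hq₀.1.ne'
  have hτ2 : τ ≤ C₃ * (q : ℝ) ^ η := hτ1.trans (by gcongr)
  have hqpos' : 0 < (q : ℝ) := by linarith
  have hq0pos' : 0 < (q₀ : ℝ) := by linarith
  set X : ℝ := x ^ (3 / 4 + 2 * η) with hX
  have b1 : τ * (Real.sqrt q * (C₁ * (x ^ σ * (q : ℝ) ^ η * Λ))) ≤ 2 * C₁ * C₃ * X := by
    have e : (q : ℝ) ^ (1 / 2 + 2 * η) = (q : ℝ) ^ η * Real.sqrt q * (q : ℝ) ^ η := by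
      rw [Real.sqrt_eq_rpow, ← Real.rpow_add hqpos', ← Real.rpow_add hqpos']
      ring_nf
    calc τ * (Real.sqrt q * (C₁ * (x ^ σ * (q : ℝ) ^ η * Λ)))
        ≤ C₃ * (q : ℝ) ^ η * (Real.sqrt q * (C₁ * (x ^ σ * (q : ℝ) ^ η * Λ))) :=
          mul_le_mul_of_nonneg_right hτ2 (by positivity)
      _ = C₁ * C₃ * (x ^ σ * (q : ℝ) ^ (1 / 2 + 2 * η) * Λ) := by
        rw [e]
        ring
      _ ≤ C₁ * C₃ * (2 * X) := mul_le_mul_of_nonneg_left hpow (by positivity)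
      _ = _ := by ring
  have b2 : τ ^ 2 * (C₂ * (x ^ σ * Λ)) ≤ 2 * C₃ ^ 2 * C₂ * X := by
    have e : ((q : ℝ) ^ η) ^ 2 ≤ (q : ℝ) ^ (1 / 2 + 2 * η) := by
      rw [← Real.rpow_mul_natCast hq0]
      exact Real.rpow_le_rpow_of_exponent_le hq1 (by push_cast; linarith)
    calc τ ^ 2 * (C₂ * (x ^ σ * Λ)) ≤ (C₃ * (q : ℝ) ^ η) ^ 2 * (C₂ * (x ^ σ * Λ)) :=
          mul_le_mul_of_nonneg_right (pow_le_pow_left₀ hτ0 hτ2 2) (by positivity)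
      _ = C₃ ^ 2 * C₂ * (x ^ σ * ((q : ℝ) ^ η) ^ 2 * Λ) := by ring
      _ ≤ C₃ ^ 2 * C₂ * (x ^ σ * (q : ℝ) ^ (1 / 2 + 2 * η) * Λ) := by gcongr
      _ ≤ C₃ ^ 2 * C₂ * (2 * X) := mul_le_mul_of_nonneg_left hpow (by positivity)
      _ = _ := by ring
  have hlogq : 1 + Real.log q₀ ≤ (1 + 1 / η) * (q₀ : ℝ) ^ η := by
    have h1 : Real.log q₀ ≤ (q₀ : ℝ) ^ η / η := Real.log_le_rpow_div hq0pos'.le hη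
    have h2 : 1 ≤ (q₀ : ℝ) ^ η := Real.one_le_rpow hq01 hη.le
    calc 1 + Real.log q₀ ≤ (q₀ : ℝ) ^ η + (q₀ : ℝ) ^ η / η := add_le_add h2 h1
      _ = _ := by ring
  have hlogq0 : 0 ≤ Real.log q₀ := Real.log_nonneg hq01
  have b3 : τ ^ 3 * (1 + Real.log q₀) * (q₀ : ℝ) ^ (-c) ≤
      C₃ ^ 3 * (1 + 1 / η) * (q₀ : ℝ) ^ (-c + 4 * η) := by
    have e : (q₀ : ℝ) ^ (-c + 4 * η) = ((q₀ : ℝ) ^ η) ^ 3 * (q₀ : ℝ) ^ η * (q₀ : ℝ) ^ (-c) := by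
      rw [← Real.rpow_mul_natCast hq0pos'.le, ← Real.rpow_add hq0pos', ← Real.rpow_add hq0pos']
      congr 1
      push_cast
      ring
    calc τ ^ 3 * (1 + Real.log q₀) * (q₀ : ℝ) ^ (-c)
        ≤ (C₃ * (q₀ : ℝ) ^ η) ^ 3 * ((1 + 1 / η) * (q₀ : ℝ) ^ η) * (q₀ : ℝ) ^ (-c) := by
          gcongr
      _ = _ := by
        rw [e]
        ring
  set Y : ℝ := Psi x y / (1 + |lam|) ^ 2 * L with hY
  have hY0 : 0 ≤ Y := by positivity
  have step3 : ‖(ArithmeticFunction.moebius q₁ : ℂ) / q₁.totient * M‖ ≤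
      2 * C₃ ^ 2 * C₂ * X + C₃ ^ 4 * (1 + 1 / η) * C₂ *
        ((q₀ : ℝ) ^ (-c + 4 * η) * (q₁ : ℝ) ^ (-1 + η) * Y) := by
    have h1 : 0 ≤ (q₁.totient : ℝ)⁻¹ := by positivity
    rw [norm_mul]
    calc _ ≤ (q₁.totient : ℝ)⁻¹ * (τ ^ 2 * (C₂ * (x ^ σ * Λ)) +
            τ ^ 3 * (1 + Real.log q₀) * (q₀ : ℝ) ^ (-c) * (C₂ * Y)) :=
          mul_le_mul hμ step2 (norm_nonneg _) h1
      _ = (q₁.totient : ℝ)⁻¹ * (τ ^ 2 * (C₂ * (x ^ σ * Λ))) + (q₁.totient : ℝ)⁻¹ *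
            (τ ^ 3 * (1 + Real.log q₀) * (q₀ : ℝ) ^ (-c) * (C₂ * Y)) := by ring
      _ ≤ 1 * (2 * C₃ ^ 2 * C₂ * X) + C₃ * (q₁ : ℝ) ^ (-1 + η) *
            (C₃ ^ 3 * (1 + 1 / η) * (q₀ : ℝ) ^ (-c + 4 * η) * (C₂ * Y)) := by
        refine add_le_add (mul_le_mul hφ1 b2 (by positivity) zero_le_one)
          (mul_le_mul hφ2 (mul_le_mul_of_nonneg_right b3 (by positivity)) (by positivity)
            (by positivity))
      _ = _ := by ring
  have hX0 : 0 ≤ X := by positivity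
  have hT0 : 0 ≤ (q₀ : ℝ) ^ (-c + 4 * η) * (q₁ : ℝ) ^ (-1 + η) * Y := by positivity
  generalize (q₀ : ℝ) ^ (-c + 4 * η) * (q₁ : ℝ) ^ (-1 + η) = R at *
  have e : Psi x y * R / (1 + |lam|) ^ 2 * L = R * Y := by
    rw [hY]
    ring
  rw [e]
  have k1 : 0 ≤ 2 * C₁ * C₃ * (R * Y) := by positivity
  have k2 : 0 ≤ 2 * C₃ ^ 2 * C₂ * (R * Y) := by positivity
  have k3 : 0 ≤ C₃ ^ 4 * (1 + 1 / η) * C₂ * X := by positivity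
  rw [mul_add, ← hq] at step1
  have cancel : ∀ s t u : ℂ, s - (t + u) + t = s - u := fun s t u ↦ by ring
  have h := norm_add_le_of_le step1 step3
  rw [cancel] at h
  refine h.trans ?_
  linarith [b1]

end SmoothSum

namespace SmoothSum

theorem Esum_eq_sum {x y : ℝ} (hx : 0 < x) {Φ : ℝ → ℝ} {N : ℕ}
    (hN : ∀ n : ℕ, N < n → Φ (n / x) = 0) (a : ℤ) (q : ℕ) (γ : ℝ) :
    Esum x y Φ (a / q + γ) = ∑ n ∈ Finset.Icc 1 N, smoothInd y n *
      (Complex.exp (2 * Real.pi * Complex.I * (a * n / q)) *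
        twist (fun w ↦ (Φ w : ℂ)) (γ * x) (n / x)) := by
  have hx' : (x : ℂ) ≠ 0 := by exact_mod_cast hx.ne'
  let F : ℕ → ℂ := fun n ↦
    Complex.exp (2 * Real.pi * Complex.I * n * (a / q + γ : ℝ)) * (Φ (n / x) : ℂ)
  have h1 : Esum x y Φ (a / q + γ) = ∑' n, {n : ℕ | IsSmooth y n}.indicator F n :=
    tsum_subtype {n : ℕ | IsSmooth y n} F
  rw [h1, tsum_eq_sum (s := Finset.Icc 1 N)]
  · refine Finset.sum_congr rfl fun n _ ↦ ?_
    by_cases hn : IsSmooth y n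
    · rw [Set.indicator_of_mem (by exact hn), smoothInd_apply, if_pos hn, one_mul, twist,
        mul_left_comm, ← Complex.exp_add, mul_comm]
      simp only [F]
      congr 2
      push_cast
      field_simp
    · rw [Set.indicator_of_notMem (by exact hn), smoothInd_of_not hn, zero_mul]
  · intro n hn
    by_cases hs : IsSmooth y n
    · have : N < n := by
        by_contra h
        exact hn (Finset.mem_Icc.2 ⟨hs.1, not_lt.1 h⟩)
      simp only [F, Set.indicator_of_mem (show n ∈ {n : ℕ | IsSmooth y n} from hs), hN n this,
        Complex.ofReal_zero, mul_zero]
    · exact Set.indicator_of_notMem (by exact hs) _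

theorem osc_ofReal_eq_integral (Φ : ℝ → ℝ) (lam c : ℝ) :
    osc (fun w ↦ (Φ w : ℂ)) lam c = ∫ w in Set.Ioi (0 : ℝ), ((Φ w : ℝ) : ℂ) *
      Complex.exp (2 * (Real.pi : ℂ) * Complex.I * ((lam * w : ℝ) : ℂ)) *
      ((w ^ (c - 1) : ℝ) : ℂ) := by
  rw [osc, mellin]
  refine MeasureTheory.setIntegral_congr_fun measurableSet_Ioi fun w hw ↦ ?_
  rw [Complex.ofReal_cpow (le_of_lt hw), smul_eq_mul, twist, mul_comm]
  push_cast
  rfl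

theorem TestFun.exists_eq_zero {φ : ℝ → ℂ} (hφ : TestFun φ) {x : ℝ} (hx : 0 < x) :
    ∃ N : ℕ, ∀ n : ℕ, N < n → φ (n / x) = 0 := by
  obtain ⟨a, b, -, -, h⟩ := hφ.supp
  refine ⟨⌈b * x⌉₊, fun n hn ↦ h _ fun hmem ↦ ?_⟩
  exact (Nat.lt_of_ceil_lt hn).not_ge ((div_le_iff₀ hx).1 hmem.2)

theorem eventually_mainExponent_nonneg {δ : ℝ} (hδ : 0 < δ) :
    ∀ᶠ p in smoothRange δ, 0 ≤ 1 - 1 / (Real.log p.2 / Real.log (Real.log p.1)) := by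
  filter_upwards [eventually_mul_log_log_le δ,
    (tendsto_log_log_fst δ).eventually_ge_atTop 0,
    (tendsto_log_snd hδ).eventually_gt_atTop 0] with p h1 h2 h3
  rw [sub_nonneg, one_div_div, div_le_one h3]
  nlinarith

end SmoothSum

theorem exponential_sum_major_arc_asymptotic (hGRH : GRH)
    (Φ : ℝ → ℝ) (hsmooth : ContDiff ℝ (⊤ : ℕ∞) Φ) (hcompact : HasCompactSupport Φ)
    (hsupp : tsupport Φ ⊆ Set.Ioi 0) (δ ε : ℝ) (hδ : 0 < δ) (hε : 0 < ε) :
    ∃ C > (0 : ℝ), ∃ x₀ : ℝ, ∀ x ≥ x₀, ∀ y : ℝ,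
      (Real.log x) ^ (2 + δ) ≤ y → y ≤ Real.exp ((Real.log x) ^ ((1 : ℝ) / 2 - δ)) →
      ∀ (α γ : ℝ) (a : ℤ) (q q₀ q₁ : ℕ), α ∈ Set.Icc (0 : ℝ) 1 →
        Int.gcd a (q : ℤ) = 1 → 1 ≤ q → (q : ℝ) ≤ Real.sqrt x →
        α = (a : ℝ) / (q : ℝ) + γ →
        |γ| ≤ 1 / ((q : ℝ) * Real.sqrt x) → |γ| ≤ x ^ (δ - 1) →
        q = q₀ * q₁ →
        (∀ p : ℕ, p.Prime → p ∣ q₀ → (p : ℝ) ≤ y) →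
        (∀ p : ℕ, p.Prime → p ∣ q₁ → y < (p : ℝ)) →
        ‖Esum x y Φ α -
          (((ArithmeticFunction.moebius q₁ : ℝ) / (Nat.totient q₁ : ℝ) : ℝ) : ℂ) *
            ((((1 - 1 / (Real.log y / Real.log (Real.log x))) /
              (q₀ : ℝ) ^ (1 - 1 / (Real.log y / Real.log (Real.log x))) : ℝ)) : ℂ) *
            ((∏ p ∈ q₀.primeFactors,
              (1 - ((p : ℝ) ^ (1 - 1 / (Real.log y / Real.log (Real.log x))) - 1) /
                ((p : ℝ) - 1)) : ℝ) : ℂ) *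
            (∫ w in Set.Ioi (0 : ℝ), ((Φ w : ℝ) : ℂ) *
              Complex.exp (2 * (Real.pi : ℂ) * Complex.I * ((γ * x * w : ℝ) : ℂ)) *
              ((w ^ ((1 - 1 / (Real.log y / Real.log (Real.log x))) - 1) : ℝ) : ℂ)) *
            ((Psi x y : ℝ) : ℂ)‖ ≤
          C * (x ^ ((3 : ℝ) / 4 + ε) +
            (Psi x y : ℝ) * (q₀ : ℝ) ^ (-(1 - 1 / (Real.log y / Real.log (Real.log x))) + ε) *
              (q₁ : ℝ) ^ (-1 + ε) / (1 + |γ| * x) ^ 2 *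
              (Real.log (Real.log y) / Real.log y)) := by
  have hφ := SmoothSum.TestFun.of_tsupport hsmooth hcompact hsupp
  obtain ⟨σ₁, hσ₁, hσ₁1, hsaddle⟩ := SmoothSum.exists_saddleBounds hGRH hδ
  obtain ⟨η, hη, hη1, hηε⟩ : ∃ η : ℝ, 0 < η ∧ η ≤ 1 / 4 ∧ 4 * η ≤ ε :=
    ⟨min ε 1 / 4, by positivity, by linarith [min_le_right ε 1], by linarith [min_le_left ε 1]⟩
  obtain ⟨C, hC, K, main⟩ := hφ.exists_norm_exp_sum_sub_le hGRH hσ₁ hσ₁1 hη hη1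
  obtain ⟨x₀, hx₀⟩ := (SmoothSum.eventually_smoothRange_iff).1 (hsaddle.and
    (((SmoothSum.tendsto_log_snd hδ).eventually_ge_atTop K).and
      (SmoothSum.eventually_mainExponent_nonneg hδ)))
  refine ⟨C + 1, by positivity, x₀, ?_⟩
  intro x hx y hy1 hy2 α γ a q q₀ q₁ _ ha hq hqx hα hγ _ hqq hq₀ hq₁
  obtain ⟨⟨s, hs⟩, hK, hc⟩ := hx₀ x hx y hy1 hy2
  subst hqq hα
  dsimp only at hs hK hc
  have hx1 : 1 ≤ x := hs.one_le_x
  have hx0 : 0 < x := by linarith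
  have hy0 := hs.le_log
  have hq₀0 : 0 < q₀ := Nat.pos_of_mul_pos_right hq
  have hq₁0 : 0 < q₁ := Nat.pos_of_mul_pos_left hq
  have hqpos : (0 : ℝ) < (q₀ * q₁ : ℕ) := by exact_mod_cast hq
  obtain ⟨N, hN⟩ := hφ.exists_eq_zero hx0
  have hlam : |γ * x| = |γ| * x := by rw [abs_mul, abs_of_pos hx0]
  have hlam' : |γ * x| ≤ Real.sqrt x / (q₀ * q₁ : ℕ) := by
    rw [hlam]
    calc |γ| * x ≤ 1 / ((q₀ * q₁ : ℕ) * Real.sqrt x) * x := by gcongr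
      _ = Real.sqrt x / (q₀ * q₁ : ℕ) := by
        have : 0 < Real.sqrt x := Real.sqrt_pos.2 hx0
        rw [one_div_mul_eq_div, div_eq_div_iff (by positivity) hqpos.ne']
        nth_rewrite 1 [← Real.mul_self_sqrt hx0.le]
        ring
  have h := main x y s _ (γ * x) q₀ q₁ N a hs hK rfl hc ⟨hq₀0, hq₀⟩ hq₁0 hq₁ ha hqx hlam' hN
  have hN' : ∀ n : ℕ, N < n → Φ (n / x) = 0 := fun n hn ↦ Complex.ofReal_eq_zero.1 (hN n hn)
  rw [← SmoothSum.Esum_eq_sum hx0 hN' a (q₀ * q₁) γ, SmoothSum.osc_ofReal_eq_integral, hlam] at h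
  set c : ℝ := 1 - 1 / (Real.log y / Real.log (Real.log x))
  have hq₀1 : (1 : ℝ) ≤ q₀ := by exact_mod_cast hq₀0
  have hq₁1 : (1 : ℝ) ≤ q₁ := by exact_mod_cast hq₁0
  have hL : 0 ≤ Real.log (Real.log y) / Real.log y :=
    div_nonneg (Real.log_nonneg (by linarith)) (by linarith)
  refine (le_of_eq ?_).trans (h.trans ?_)
  · congr 2
    rw [div_eq_mul_inv c, ← Real.rpow_neg (by positivity)]
    push_cast
    ring
  · rw [mul_assoc (Psi x y : ℝ)]
    gcongr
    · linarith
    · linarith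
    · linarith
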